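/- For every ε > 0 there exists x₀ such that the following holds: for every modulus q ≥ 1 with the property that no Dirichlet L-function L(s, χ) of a character χ mod q has a zero s = σ + it (σ, t real) with 1 − σ < 1/(24·log(q(1+|t|))), for every integer a with gcd(a, q) = 1, and for every real x with x ≥ x₀ and x ≥ q^{160}, one has #{p ≤ x : p prime, p ≡ a (mod q)} ≥ (1 − e^{−2} − ε)·x/(φ(q)·log x). -/

import Mathlib

namespace LinnikAP

open Finset Filter Topology MeasureTheory

section CharacterSums

variable {q : ℕ} [NeZero q]

lemma sum_range_eq_sum_zmod (f : ZMod q → ℂ) : ∑ i ∈ range q, f (i : ZMod q) = ∑ a, f a := by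
  refine sum_bij' (fun i _ => (i : ZMod q)) (fun a _ => a.val) ?_ ?_ ?_ ?_ ?_
  · intro i _; simp
  · intro a _; simpa using ZMod.val_lt a
  · intro i hi; exact ZMod.val_cast_of_lt (by simpa using hi)
  · intro a _; simp
  · intro i _; rfl

lemma sum_range_add_char {χ : DirichletCharacter ℂ q} (hχ : χ ≠ 1) (N : ℕ) :
    ∑ i ∈ range q, χ ((N + i : ℕ) : ZMod q) = 0 := by
  have h := sum_range_eq_sum_zmod (fun a : ZMod q => χ ((N : ZMod q) + a))
  simp only [Nat.cast_add]
  rw [h, ← MulChar.sum_eq_zero_of_ne_one hχ]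
  exact Fintype.sum_equiv (Equiv.addLeft (N : ZMod q)) _ _ (fun _ => rfl)

lemma norm_sum_range_char_le {χ : DirichletCharacter ℂ q} (hχ : χ ≠ 1) (N : ℕ) :
    ‖∑ n ∈ range N, χ (n : ZMod q)‖ ≤ q := by
  induction N using Nat.strong_induction_on with
  | _ N ih =>
    rcases lt_or_ge N q with h | h
    · refine (norm_sum_le _ _).trans ?_
      refine (sum_le_sum (fun n _ => χ.norm_le_one _)).trans ?_
      simp only [sum_const, card_range, nsmul_eq_mul, mul_one]
      exact_mod_cast h.le
    · obtain ⟨k, rfl⟩ := Nat.exists_eq_add_of_le' h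
      rw [sum_range_add, sum_range_add_char hχ, add_zero]
      exact ih k (Nat.lt_add_of_pos_right (NeZero.pos q))

lemma norm_sum_Ioc_char_le {χ : DirichletCharacter ℂ q} (hχ : χ ≠ 1) (M N : ℕ) :
    ‖∑ n ∈ Ioc M N, χ (n : ZMod q)‖ ≤ 2 * q := by
  rcases le_total N M with h | h
  · rw [Ioc_eq_empty_of_le h]; simp
  · have h1 : ∑ n ∈ Ioc M N, χ (n : ZMod q)
        = ∑ n ∈ range (N + 1), χ (n : ZMod q) - ∑ n ∈ range (M + 1), χ (n : ZMod q) := by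
      rw [eq_sub_iff_add_eq, add_comm, ← sum_range_add_sum_Ico _ (Nat.succ_le_succ h)]
      congr 1
      refine sum_congr ?_ (fun _ _ => rfl)
      ext n; simp only [mem_Ioc, mem_Ico]; omega
    rw [h1]
    refine (norm_sub_le _ _).trans ?_
    linarith [norm_sum_range_char_le hχ (N + 1), norm_sum_range_char_le hχ (M + 1)]

/-- The partial sums of `χ` over `n > M`. -/
noncomputable def tailSum (χ : DirichletCharacter ℂ q) (M : ℕ) (t : ℝ) : ℂ :=
  ∑ n ∈ Ioc M ⌊t⌋₊, χ (n : ZMod q)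

omit [NeZero q] in
lemma tailSum_eq_zero (χ : DirichletCharacter ℂ q) {M : ℕ} {t : ℝ} (h : t < M + 1) :
    tailSum χ M t = 0 := by
  unfold tailSum
  rw [Ioc_eq_empty_of_le, sum_empty]
  rcases lt_or_ge t 0 with h0 | h0
  · simp [Nat.floor_of_nonpos h0.le]
  · exact Nat.lt_succ_iff.mp ((Nat.floor_lt h0).mpr (by exact_mod_cast h))

omit [NeZero q] in
lemma measurable_tailSum (χ : DirichletCharacter ℂ q) (M : ℕ) : Measurable (tailSum χ M) := by
  have : tailSum χ M = (fun k : ℕ => ∑ n ∈ Ioc M k, χ (n : ZMod q)) ∘ (fun t : ℝ => ⌊t⌋₊) := rfl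
  rw [this]
  exact (measurable_from_nat).comp Nat.measurable_floor

lemma norm_tailSum_le {χ : DirichletCharacter ℂ q} (hχ : χ ≠ 1) (M : ℕ) (t : ℝ) :
    ‖tailSum χ M t‖ ≤ 2 * q := norm_sum_Ioc_char_le hχ M _

lemma differentiableAt_mellin_tailSum {χ : DirichletCharacter ℂ q} (hχ : χ ≠ 1) (M : ℕ) {s : ℂ}
    (hs : s.re < 0) : DifferentiableAt ℂ (mellin (tailSum χ M)) s := by
  refine mellin_differentiableAt_of_isBigO_rpow (a := 0) (b := s.re - 1) ?_ ?_ hs ?_ (by linarith)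
  · have hb : LocallyIntegrable (tailSum χ M) volume := by
      intro x
      refine ⟨Metric.ball x 1, Metric.ball_mem_nhds x one_pos, ?_⟩
      refine IntegrableOn.of_bound (by simp [Real.volume_ball])
        (measurable_tailSum χ M).aestronglyMeasurable (2 * q) ?_
      exact ae_of_all _ (norm_tailSum_le hχ M)
    exact hb.locallyIntegrableOn _
  · refine Asymptotics.IsBigO.of_bound (2 * q) (Eventually.of_forall fun t => ?_)
    simpa using norm_tailSum_le hχ M t
  · refine Asymptotics.IsBigO.of_bound 1 ?_
    filter_upwards [nhdsWithin_le_nhds (Iio_mem_nhds (zero_lt_one' ℝ))] with t ht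
    rw [tailSum_eq_zero χ (lt_of_lt_of_le ht (by simp)), norm_zero]
    positivity

lemma LFunction_sub_sum_eq_of_one_lt {χ : DirichletCharacter ℂ q} (hχ : χ ≠ 1) (M : ℕ) {s : ℂ}
    (hs : 1 < s.re) :
    χ.LFunction s - ∑ n ∈ Icc 1 M, χ (n : ZMod q) * (n : ℂ) ^ (-s)
      = s * mellin (tailSum χ M) (-s) := by
  set f : ℕ → ℂ := fun n => if M < n then χ (n : ZMod q) else 0 with hf
  have hfle : ∀ n, ‖f n‖ ≤ 1 := by
    intro n; simp only [hf]; split_ifs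
    · exact χ.norm_le_one _
    · simp
  have hsumm : LSeriesSummable f s := LSeriesSummable_of_bounded_of_one_lt_re (fun n _ => hfle n) hs
  have hpart : ∀ t : ℝ, ∑ k ∈ Icc 1 ⌊t⌋₊, f k = tailSum χ M t := by
    intro t
    simp only [hf, tailSum]
    rw [← sum_filter]
    refine sum_congr ?_ (fun _ _ => rfl)
    ext n; simp only [mem_filter, mem_Icc, mem_Ioc]; omega
  have hO : (fun n : ℕ => ∑ k ∈ Icc 1 n, f k) =O[atTop] fun n : ℕ => (n : ℝ) ^ (0 : ℝ) := by
    refine Asymptotics.IsBigO.of_bound (2 * q) (Eventually.of_forall fun n => ?_)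
    have := hpart n
    rw [Nat.floor_natCast] at this
    rw [this]
    simpa using norm_tailSum_le hχ M n
  have h1 := LSeries_eq_mul_integral f le_rfl (by linarith) hsumm hO
  have h2 : mellin (tailSum χ M) (-s)
      = ∫ t in Set.Ioi (1 : ℝ), (∑ k ∈ Icc 1 ⌊t⌋₊, f k) * (t : ℂ) ^ (-(s + 1)) := by
    rw [mellin]
    have h3 : ∫ t in Set.Ioi (0 : ℝ), (t : ℂ) ^ (-s - 1) • tailSum χ M t
        = ∫ t in Set.Ioi (1 : ℝ), (t : ℂ) ^ (-s - 1) • tailSum χ M t := by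
      refine setIntegral_eq_of_subset_of_ae_sdiff_eq_zero measurableSet_Ioi.nullMeasurableSet
        (Set.Ioi_subset_Ioi (zero_le_one' ℝ)) ?_
      have hne : ∀ᵐ t : ℝ, t ≠ 1 := by simp [ae_iff]
      filter_upwards [hne] with t ht1 ht
      have htlt : t < 1 := lt_of_le_of_ne (by simpa using ht.2) ht1
      rw [tailSum_eq_zero χ (by linarith [(Nat.cast_nonneg M : (0:ℝ) ≤ M)]), smul_zero]
    rw [h3]
    refine setIntegral_congr_fun measurableSet_Ioi fun t _ => ?_
    rw [hpart, smul_eq_mul, mul_comm, neg_add']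
  rw [h2, ← h1]
  have hterm : ∀ n, LSeries.term (fun n => χ (n : ZMod q)) s n
      = LSeries.term f s n + (if n ∈ Icc 1 M then χ (n : ZMod q) * (n : ℂ) ^ (-s) else 0) := by
    intro n
    rcases eq_or_ne n 0 with rfl | hn
    · simp
    · rw [LSeries.term_of_ne_zero hn, LSeries.term_of_ne_zero hn]
      have hn1 : 1 ≤ n := Nat.one_le_iff_ne_zero.mpr hn
      by_cases h : M < n
      · simp [hf, h, mem_Icc, not_le.mpr h]
      · simp [hf, h, mem_Icc, hn1, not_lt.mp h, Complex.cpow_neg, div_eq_mul_inv]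
  rw [χ.LFunction_eq_LSeries hs, LSeries, LSeries]
  simp_rw [hterm]
  rw [Summable.tsum_add hsumm (summable_of_hasFiniteSupport
    ((Icc 1 M).finite_toSet.subset (by intro n; simp; tauto)))]
  rw [tsum_eq_sum (s := Icc 1 M) (f := fun n => if n ∈ Icc 1 M then _ else _)
    (fun n hn => if_neg hn)]
  rw [sum_ite_mem, inter_self, add_sub_cancel_right]

lemma LFunction_sub_sum_eq {χ : DirichletCharacter ℂ q} (hχ : χ ≠ 1) (M : ℕ) {s : ℂ}
    (hs : 0 < s.re) :
    χ.LFunction s - ∑ n ∈ Icc 1 M, χ (n : ZMod q) * (n : ℂ) ^ (-s)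
      = s * mellin (tailSum χ M) (-s) := by
  have hopen : IsOpen {s : ℂ | 0 < s.re} := isOpen_lt continuous_const Complex.continuous_re
  have hconv : Convex ℝ {s : ℂ | 0 < s.re} := convex_halfSpace_re_gt 0
  refine AnalyticOnNhd.eqOn_of_preconnected_of_eventuallyEq (𝕜 := ℂ) (z₀ := 2)
    (U := {s : ℂ | 0 < s.re})
    (f := fun s => χ.LFunction s - ∑ n ∈ Icc 1 M, χ (n : ZMod q) * (n : ℂ) ^ (-s))
    (g := fun s => s * mellin (tailSum χ M) (-s)) ?_ ?_ hconv.isPreconnected ?_ ?_ hs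
  · refine DifferentiableOn.analyticOnNhd ?_ hopen
    refine Differentiable.differentiableOn ?_
    refine (χ.differentiable_LFunction hχ).sub ?_
    refine Differentiable.fun_sum fun n hn => ?_
    have hn0 : (n : ℂ) ≠ 0 := by
      have := (mem_Icc.mp hn).1
      exact_mod_cast (by omega : n ≠ 0)
    exact (differentiable_const _).mul (differentiable_neg.const_cpow (Or.inl hn0))
  · refine DifferentiableOn.analyticOnNhd (fun s hs => ?_) hopen
    refine DifferentiableAt.differentiableWithinAt ?_
    refine differentiableAt_id.mul ?_
    have := differentiableAt_mellin_tailSum hχ M (s := -s) (by simpa using hs)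
    exact this.comp s differentiable_neg.differentiableAt
  · simp
  · have : {s : ℂ | 1 < s.re} ∈ 𝓝 (2 : ℂ) :=
      (isOpen_lt continuous_const Complex.continuous_re).mem_nhds (by simp)
    filter_upwards [this] with s hs
    exact LFunction_sub_sum_eq_of_one_lt hχ M hs

/-- Approximation of `L(s, χ)` by its partial sums to the right of the imaginary axis. -/
theorem norm_LFunction_sub_sum_le {χ : DirichletCharacter ℂ q} (hχ : χ ≠ 1) {M : ℕ} (hM : 1 ≤ M)
    {s : ℂ} (hs : 0 < s.re) :
    ‖χ.LFunction s - ∑ n ∈ Icc 1 M, χ (n : ZMod q) * (n : ℂ) ^ (-s)‖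
      ≤ 2 * q * ‖s‖ / s.re * (M : ℝ) ^ (-s.re) := by
  have hM0 : (0 : ℝ) < M := by exact_mod_cast hM
  rw [LFunction_sub_sum_eq hχ M hs, norm_mul]
  have key : ‖mellin (tailSum χ M) (-s)‖ ≤ ∫ t in Set.Ioi (M : ℝ), 2 * q * t ^ (-s.re - 1) := by
    have h1 : mellin (tailSum χ M) (-s)
        = ∫ t in Set.Ioi (M : ℝ), (t : ℂ) ^ (-s - 1) • tailSum χ M t := by
      rw [mellin]
      symm
      refine setIntegral_eq_of_subset_of_ae_sdiff_eq_zero measurableSet_Ioi.nullMeasurableSet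
        (Set.Ioi_subset_Ioi hM0.le) ?_ |>.symm
      refine ae_of_all _ fun t ht => ?_
      have : t ≤ M := by simpa using ht.2
      rw [tailSum_eq_zero χ (by linarith), smul_zero]
    rw [h1]
    refine norm_integral_le_of_norm_le ?_ ?_
    · exact (integrableOn_Ioi_rpow_of_lt (by linarith) hM0).const_mul _
    · refine (ae_restrict_iff' measurableSet_Ioi).mpr (ae_of_all _ fun t ht => ?_)
      have ht0 : 0 < t := hM0.trans ht
      rw [norm_smul, Complex.norm_cpow_eq_rpow_re_of_pos ht0, mul_comm]
      simp only [Complex.sub_re, Complex.neg_re, Complex.one_re]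
      exact mul_le_mul_of_nonneg_right (norm_tailSum_le hχ M t) (by positivity)
  rw [integral_const_mul, integral_Ioi_rpow_of_lt (by linarith) hM0] at key
  have h2 : -(M : ℝ) ^ (-s.re - 1 + 1) / (-s.re - 1 + 1) = (M : ℝ) ^ (-s.re) / s.re := by
    rw [sub_add_cancel, neg_div_neg_eq]
  rw [h2] at key
  calc ‖s‖ * ‖mellin (tailSum χ M) (-s)‖ ≤ ‖s‖ * (2 * q * ((M : ℝ) ^ (-s.re) / s.re)) := by gcongr
    _ = _ := by ring

end CharacterSums

section Growth

lemma sum_Icc_rpow_neg_half_le (M : ℕ) :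
    ∑ n ∈ Icc 1 M, (n : ℝ) ^ (-(1 / 2) : ℝ) ≤ 2 * √M := by
  induction M with
  | zero => simp
  | succ M ih =>
    rw [sum_Icc_succ_top (by omega)]
    have h1 : ((M + 1 : ℕ) : ℝ) ^ (-(1 / 2) : ℝ) = 1 / √(M + 1) := by
      rw [Real.rpow_neg (by positivity), ← Real.sqrt_eq_rpow, one_div]; push_cast; rfl
    have h2 : 1 / √((M : ℝ) + 1) ≤ 2 * √((M : ℝ) + 1) - 2 * √M := by
      have hp : 0 < √((M : ℝ) + 1) := Real.sqrt_pos.mpr (by positivity)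
      rw [div_le_iff₀ hp]
      nlinarith [Real.sq_sqrt (show (0 : ℝ) ≤ M + 1 by positivity),
        Real.sq_sqrt (show (0 : ℝ) ≤ M by positivity), sq_nonneg (√((M : ℝ) + 1) - √M)]
    rw [h1]; push_cast; linarith

variable {q : ℕ} [NeZero q]

omit [NeZero q] in
lemma norm_sum_char_cpow_le (χ : DirichletCharacter ℂ q) (M : ℕ) {s : ℂ} (hs : 1 / 2 ≤ s.re) :
    ‖∑ n ∈ Icc 1 M, χ (n : ZMod q) * (n : ℂ) ^ (-s)‖ ≤ 2 * √M := by
  refine (norm_sum_le _ _).trans (le_trans (sum_le_sum fun n hn => ?_)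
    (sum_Icc_rpow_neg_half_le M))
  have hn1 : 1 ≤ n := (mem_Icc.mp hn).1
  rw [norm_mul, Complex.norm_natCast_cpow_of_pos (by omega)]
  refine (mul_le_of_le_one_left (by positivity) (χ.norm_le_one _)).trans ?_
  exact Real.rpow_le_rpow_of_exponent_le (by exact_mod_cast hn1) (by simp; linarith)

theorem norm_LFunction_le {χ : DirichletCharacter ℂ q} (hχ : χ ≠ 1) {s : ℂ}
    (hs : 1 / 2 ≤ s.re) (hs3 : s.re ≤ 3) :
    ‖χ.LFunction s‖ ≤ 7 * √(q * (|s.im| + 4)) := by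
  set X : ℝ := q * (|s.im| + 4) with hX
  have hq1 : (1 : ℝ) ≤ q := by exact_mod_cast NeZero.one_le
  have hX4 : 4 ≤ X := by rw [hX]; nlinarith [abs_nonneg s.im]
  set M : ℕ := ⌈X⌉₊
  have hMX : X ≤ M := Nat.le_ceil X
  have hMX2 : (M : ℝ) ≤ 2 * X := by linarith [(Nat.ceil_lt_add_one (by linarith : (0:ℝ) ≤ X)).le]
  have hM1 : 1 ≤ M := by
    have : (1 : ℝ) ≤ M := by linarith
    exact_mod_cast this
  have hns : ‖s‖ ≤ |s.im| + 4 := by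
    refine (Complex.norm_le_abs_re_add_abs_im s).trans ?_
    rw [abs_of_nonneg (by linarith : 0 ≤ s.re)]; linarith
  have h1 := norm_LFunction_sub_sum_le hχ hM1 (s := s) (by linarith)
  have h2 := norm_sum_char_cpow_le χ M hs
  have hsM : √(M : ℝ) ≤ 3 / 2 * √X := by
    rw [show (3 : ℝ) / 2 = √(9 / 4) by
      rw [show (9 : ℝ) / 4 = (3 / 2) ^ 2 by norm_num, Real.sqrt_sq (by norm_num)],
      ← Real.sqrt_mul (by norm_num)]
    exact Real.sqrt_le_sqrt (by linarith [(Nat.ceil_lt_add_one (by linarith : (0:ℝ) ≤ X)).le])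
  have h3 : (M : ℝ) ^ (-s.re) ≤ 1 / √X := by
    have : (M : ℝ) ^ (-s.re) ≤ (M : ℝ) ^ (-(1 / 2) : ℝ) :=
      Real.rpow_le_rpow_of_exponent_le (by exact_mod_cast hM1) (by linarith)
    refine this.trans ?_
    rw [Real.rpow_neg (by positivity), ← Real.sqrt_eq_rpow, ← one_div]
    exact one_div_le_one_div_of_le (Real.sqrt_pos.mpr (by linarith)) (Real.sqrt_le_sqrt hMX)
  have h4 : 2 * q * ‖s‖ / s.re * (M : ℝ) ^ (-s.re) ≤ 4 * √X := by
    have h5 : 2 * q * ‖s‖ / s.re ≤ 4 * X := by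
      rw [div_le_iff₀ (by linarith)]
      have : (q : ℝ) * ‖s‖ ≤ X := by rw [hX]; gcongr
      nlinarith
    calc 2 * q * ‖s‖ / s.re * (M : ℝ) ^ (-s.re) ≤ 4 * X * (1 / √X) := by gcongr
      _ = 4 * (X / √X) := by ring
      _ = 4 * √X := by rw [Real.div_sqrt]
  calc ‖χ.LFunction s‖ = ‖(χ.LFunction s - ∑ n ∈ Icc 1 M, χ (n : ZMod q) * (n : ℂ) ^ (-s))
        + ∑ n ∈ Icc 1 M, χ (n : ZMod q) * (n : ℂ) ^ (-s)‖ := by rw [sub_add_cancel]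
    _ ≤ 4 * √X + 2 * √M := (norm_add_le _ _).trans (add_le_add (h1.trans h4) h2)
    _ ≤ 7 * √X := by linarith

lemma summable_rpow_neg {σ : ℝ} (hσ : 1 < σ) : Summable fun n : ℕ => (n : ℝ) ^ (-σ) :=
  Real.summable_nat_rpow.mpr (by linarith)

lemma tsum_rpow_neg_le {σ : ℝ} (hσ : 1 < σ) : ∑' n : ℕ, (n : ℝ) ^ (-σ) ≤ σ / (σ - 1) := by
  have h := ZetaAsymptotics.zeta_limit_aux1 hσ
  have h0 : 0 ≤ ZetaAsymptotics.termTSum σ :=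
    tsum_nonneg fun n => ZetaAsymptotics.term_nonneg _ _
  have h1 : ∑' n : ℕ, (n : ℝ) ^ (-σ) = ∑' n : ℕ, 1 / ((n : ℝ) + 1) ^ σ := by
    rw [(summable_rpow_neg hσ).tsum_eq_zero_add]
    simp only [Nat.cast_zero, Real.zero_rpow (by linarith : -σ ≠ 0), zero_add]
    refine tsum_congr fun n => ?_
    rw [Real.rpow_neg (by positivity), one_div]; push_cast; rfl
  have h2 : 0 ≤ σ * ZetaAsymptotics.termTSum σ := by positivity
  have h3 : σ / (σ - 1) = 1 / (σ - 1) + 1 := by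
    rw [div_add_one (by linarith), add_sub_cancel]
  rw [h1, h3]
  linarith

lemma norm_LSeries_le_of_norm_le_one {f : ℕ → ℂ} (hf : ∀ n, ‖f n‖ ≤ 1) {s : ℂ} (hs : 1 < s.re) :
    ‖LSeries f s‖ ≤ s.re / (s.re - 1) := by
  refine le_trans ?_ (tsum_rpow_neg_le hs)
  refine tsum_of_norm_bounded (summable_rpow_neg hs).hasSum fun n => ?_
  rcases eq_or_ne n 0 with rfl | hn
  · simp; positivity
  · rw [LSeries.norm_term_eq, if_neg hn, Real.rpow_neg (by positivity), div_eq_mul_inv]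
    exact mul_le_of_le_one_left (by positivity) (hf n)

open scoped LSeries.notation in
theorem le_norm_LFunction (χ : DirichletCharacter ℂ q) {s : ℂ} (hs : 1 < s.re) :
    (s.re - 1) / s.re ≤ ‖χ.LFunction s‖ := by
  have h := DirichletCharacter.LSeries.mul_mu_eq_one χ hs
  rw [← χ.LFunction_eq_LSeries hs] at h
  have h2 : ‖LSeries ((fun n : ℕ => χ (n : ZMod q)) * fun n : ℕ =>
      ((ArithmeticFunction.moebius n : ℤ) : ℂ)) s‖ ≤ s.re / (s.re - 1) := by
    refine norm_LSeries_le_of_norm_le_one (fun n => ?_) hs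
    simp only [Pi.mul_apply, norm_mul]
    refine mul_le_one₀ (χ.norm_le_one _) (norm_nonneg _) ?_
    rw [Complex.norm_intCast]
    exact_mod_cast ArithmeticFunction.abs_moebius_le_one
  have h3 : 1 = ‖χ.LFunction s‖ * ‖LSeries ((fun n : ℕ => χ (n : ZMod q)) * fun n : ℕ =>
      ((ArithmeticFunction.moebius n : ℤ) : ℂ)) s‖ := by
    rw [← norm_mul, h, norm_one]
  have hpos : 0 < s.re - 1 := by linarith
  rw [div_le_iff₀ (by linarith)]
  have h4 : 1 ≤ ‖χ.LFunction s‖ * (s.re / (s.re - 1)) := by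
    nth_rw 1 [h3]; gcongr
  rw [← mul_div_assoc, le_div_iff₀ hpos] at h4
  linarith

end Growth

/-- The fractional part, cut off below one. -/
noncomputable def fractCut (t : ℝ) : ℂ := if 1 ≤ t then ((t - ⌊t⌋₊ : ℝ) : ℂ) else 0

lemma norm_fractCut_le (t : ℝ) : ‖fractCut t‖ ≤ 1 := by
  unfold fractCut
  split_ifs with h
  · rw [Complex.norm_real, Real.norm_eq_abs, abs_le]
    have := Nat.lt_floor_add_one t
    have := Nat.floor_le (by linarith : 0 ≤ t)
    constructor <;> linarith
  · simp

lemma measurable_fractCut : Measurable fractCut := by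
  unfold fractCut
  refine Measurable.ite measurableSet_Ici ?_ measurable_const
  refine Complex.measurable_ofReal.comp (measurable_id.sub ?_)
  exact measurable_from_nat.comp Nat.measurable_floor

lemma differentiableAt_mellin_fractCut {s : ℂ} (hs : s.re < 0) :
    DifferentiableAt ℂ (mellin fractCut) s := by
  refine mellin_differentiableAt_of_isBigO_rpow (a := 0) (b := s.re - 1) ?_ ?_ hs ?_ (by linarith)
  · have hb : LocallyIntegrable fractCut volume := by
      intro x
      refine ⟨Metric.ball x 1, Metric.ball_mem_nhds x one_pos, ?_⟩
      refine IntegrableOn.of_bound (by simp [Real.volume_ball])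
        measurable_fractCut.aestronglyMeasurable 1 ?_
      exact ae_of_all _ norm_fractCut_le
    exact hb.locallyIntegrableOn _
  · refine Asymptotics.IsBigO.of_bound 1 (Eventually.of_forall fun t => ?_)
    simpa using norm_fractCut_le t
  · refine Asymptotics.IsBigO.of_bound 1 ?_
    filter_upwards [nhdsWithin_le_nhds (Iio_mem_nhds (zero_lt_one' ℝ))] with t ht
    rw [fractCut, if_neg (not_le.mpr ht), norm_zero]
    positivity

lemma mellin_fractCut_eq (s : ℂ) :
    mellin fractCut s = ∫ t in Set.Ioi (1 : ℝ), (t : ℂ) ^ (s - 1) * fractCut t := by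
  rw [mellin]
  refine setIntegral_eq_of_subset_of_ae_sdiff_eq_zero measurableSet_Ioi.nullMeasurableSet
    (Set.Ioi_subset_Ioi (zero_le_one' ℝ)) ?_
  have hne : ∀ᵐ t : ℝ, t ≠ 1 := by simp [ae_iff]
  filter_upwards [hne] with t ht1 ht
  have htlt : t < 1 := lt_of_le_of_ne (by simpa using ht.2) ht1
  rw [fractCut, if_neg (not_le.mpr htlt), smul_zero]

lemma integrableOn_cpow_mul_fractCut {s : ℂ} (hs : 0 < s.re) :
    IntegrableOn (fun t : ℝ => (t : ℂ) ^ (-s - 1) * fractCut t) (Set.Ioi 1) := by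
  refine Integrable.mono' (integrableOn_Ioi_rpow_of_lt (a := -s.re - 1) (by linarith) one_pos)
    ?_ ?_
  · refine AEStronglyMeasurable.mul ?_ measurable_fractCut.aestronglyMeasurable
    refine ContinuousOn.aestronglyMeasurable (fun t ht => ?_) measurableSet_Ioi
    refine ContinuousAt.continuousWithinAt ?_
    exact Complex.continuousAt_ofReal_cpow_const _ _ (Or.inr (by
      have : (1 : ℝ) < t := ht
      linarith))
  · refine (ae_restrict_iff' measurableSet_Ioi).mpr (ae_of_all _ fun t ht => ?_)
    have ht0 : 0 < t := one_pos.trans ht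
    rw [norm_mul, Complex.norm_cpow_eq_rpow_re_of_pos ht0]
    simp only [Complex.sub_re, Complex.neg_re, Complex.one_re]
    exact mul_le_of_le_one_right (by positivity) (norm_fractCut_le t)

lemma riemannZeta₁_eq_of_one_lt {s : ℂ} (hs : 1 < s.re) :
    riemannZeta₁ s = s - s * (s - 1) * mellin fractCut (-s) := by
  have hs1 : s ≠ 1 := by rintro rfl; simp at hs
  have hs1' : s - 1 ≠ 0 := sub_ne_zero.mpr hs1
  have h1 := LSeries_eq_mul_integral (fun _ => (1 : ℂ)) zero_le_one hs
    (LSeriesSummable_of_bounded_of_one_lt_re (m := 1) (by simp) hs)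
    (Asymptotics.IsBigO.of_bound 1 (Eventually.of_forall fun n => by simp))
  have h0 : riemannZeta s = LSeries (fun _ => (1 : ℂ)) s := (LSeries_one_eq_riemannZeta hs).symm
  have h2 : ∫ t in Set.Ioi (1 : ℝ), (∑ k ∈ Icc 1 ⌊t⌋₊, (1 : ℂ)) * (t : ℂ) ^ (-(s + 1))
      = (∫ t in Set.Ioi (1 : ℝ), (t : ℂ) ^ (-s)) - mellin fractCut (-s) := by
    rw [mellin_fractCut_eq, ← integral_sub
      (integrableOn_Ioi_cpow_of_lt (by simpa using hs) one_pos)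
      (integrableOn_cpow_mul_fractCut (by linarith))]
    refine setIntegral_congr_fun measurableSet_Ioi fun t ht => ?_
    have ht1 : (1 : ℝ) < t := ht
    have ht0 : (t : ℂ) ≠ 0 := by exact_mod_cast (by linarith : t ≠ 0)
    simp only [sum_const, Nat.card_Icc, fractCut, if_pos ht1.le, nsmul_eq_mul, mul_one]
    rw [show (-s : ℂ) = (-s - 1) + 1 by ring, Complex.cpow_add _ _ ht0, Complex.cpow_one,
      show -(s + 1) = -s - 1 by ring]
    push_cast
    simp
    ring
  rw [h2, integral_Ioi_cpow_of_lt (by simpa using hs) one_pos] at h1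
  have h3 := riemannZeta_eq_inv_sub_mul hs1
  have h4 : riemannZeta₁ s = (s - 1) * riemannZeta s := by
    rw [h3]; field_simp
  rw [h4, h0, h1]
  have h5 : -s + 1 ≠ 0 := by intro h; apply hs1'; linear_combination -h
  simp only [Complex.ofReal_one, Complex.one_cpow]
  field_simp
  ring

lemma riemannZeta₁_eq {s : ℂ} (hs : 0 < s.re) :
    riemannZeta₁ s = s - s * (s - 1) * mellin fractCut (-s) := by
  have hopen : IsOpen {s : ℂ | 0 < s.re} := isOpen_lt continuous_const Complex.continuous_re
  refine AnalyticOnNhd.eqOn_of_preconnected_of_eventuallyEq (𝕜 := ℂ) (z₀ := 2)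
    (U := {s : ℂ | 0 < s.re}) (g := fun s => s - s * (s - 1) * mellin fractCut (-s))
    (differentiable_riemannZeta₁.differentiableOn.analyticOnNhd hopen) ?_
    (convex_halfSpace_re_gt 0).isPreconnected (by simp) ?_ hs
  · refine DifferentiableOn.analyticOnNhd (fun s hs => ?_) hopen
    refine DifferentiableAt.differentiableWithinAt ?_
    have := differentiableAt_mellin_fractCut (s := -s) (by simpa using hs)
    have h2 := this.comp s differentiable_neg.differentiableAt
    have h3 : DifferentiableAt ℂ (fun s : ℂ => s * (s - 1)) s := by fun_prop
    exact differentiableAt_id.sub (h3.mul h2)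
  · have : {s : ℂ | 1 < s.re} ∈ 𝓝 (2 : ℂ) :=
      (isOpen_lt continuous_const Complex.continuous_re).mem_nhds (by simp)
    filter_upwards [this] with s hs
    exact riemannZeta₁_eq_of_one_lt hs

theorem norm_riemannZeta₁_le {s : ℂ} (hs : 1 / 2 ≤ s.re) (hs3 : s.re ≤ 3) :
    ‖riemannZeta₁ s‖ ≤ 3 * (|s.im| + 4) ^ 2 := by
  rw [riemannZeta₁_eq (by linarith)]
  have hns : ‖s‖ ≤ |s.im| + 3 := by
    refine (Complex.norm_le_abs_re_add_abs_im s).trans ?_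
    rw [abs_of_nonneg (by linarith : 0 ≤ s.re)]; linarith
  have hns1 : ‖s - 1‖ ≤ |s.im| + 4 := by
    refine (norm_sub_le _ _).trans ?_
    rw [norm_one]; linarith
  have key : ‖mellin fractCut (-s)‖ ≤ 1 / s.re := by
    have h1 : ∫ t in Set.Ioi (1 : ℝ), t ^ (-s.re - 1) = 1 / s.re := by
      rw [integral_Ioi_rpow_of_lt (by linarith) one_pos, sub_add_cancel, Real.one_rpow,
        neg_div_neg_eq]
    rw [mellin_fractCut_eq, ← h1]
    refine norm_integral_le_of_norm_le
      (integrableOn_Ioi_rpow_of_lt (by linarith) one_pos) ?_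
    refine (ae_restrict_iff' measurableSet_Ioi).mpr (ae_of_all _ fun t ht => ?_)
    have ht0 : 0 < t := one_pos.trans ht
    rw [norm_mul, Complex.norm_cpow_eq_rpow_re_of_pos ht0]
    simp only [Complex.sub_re, Complex.neg_re, Complex.one_re]
    exact mul_le_of_le_one_right (by positivity) (norm_fractCut_le t)
  have h2 : 1 / s.re ≤ 2 := by rw [div_le_iff₀ (by linarith)]; linarith
  calc ‖s - s * (s - 1) * mellin fractCut (-s)‖
      ≤ ‖s‖ + ‖s‖ * ‖s - 1‖ * ‖mellin fractCut (-s)‖ := by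
        refine (norm_sub_le _ _).trans ?_
        rw [norm_mul, norm_mul]
    _ ≤ (|s.im| + 3) + (|s.im| + 3) * (|s.im| + 4) * 2 := by
        gcongr; exact key.trans h2
    _ ≤ _ := by nlinarith [abs_nonneg s.im]

end LinnikAP

namespace LinnikAP

open Finset Filter Topology Metric

lemma exists_entire_factor {f : ℂ → ℂ} (hf : Differentiable ℂ f) {z : ℂ} (hz : f z ≠ 0) (ρ : ℂ) :
    ∃ g : ℂ → ℂ, Differentiable ℂ g ∧ g ρ ≠ 0 ∧
      ∀ s, f s = (s - ρ) ^ analyticOrderNatAt f ρ * g s := by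
  have han : AnalyticAt ℂ f ρ := hf.analyticAt ρ
  have htop : analyticOrderAt f ρ ≠ ⊤ := by
    intro h
    have := (AnalyticOnNhd.analyticOrderAt_eq_top_iff_eq_zero (𝕜 := ℂ) (f := f) ρ
      (fun z => hf.analyticAt z)).mp h
    exact hz (congrFun this z)
  obtain ⟨h, hh, hh0, hev⟩ := (han.analyticOrderNatAt_eq_iff htop).mp rfl
  set n := analyticOrderNatAt f ρ
  refine ⟨fun s => if s = ρ then h ρ else f s / (s - ρ) ^ n, fun s => ?_, by simpa using hh0,
    fun s => ?_⟩
  · by_cases hs : s = ρ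
    · subst hs
      refine (hh.differentiableAt).congr_of_eventuallyEq ?_
      filter_upwards [hev] with w hw
      split_ifs with hws
      · rw [hws]
      · rw [hw, smul_eq_mul, mul_div_cancel_left₀ _ (pow_ne_zero _ (sub_ne_zero.mpr hws))]
    · have h1 : DifferentiableAt ℂ (fun s => f s / (s - ρ) ^ n) s :=
        (hf s).div (by fun_prop) (pow_ne_zero _ (sub_ne_zero.mpr hs))
      refine h1.congr_of_eventuallyEq ?_
      filter_upwards [isOpen_ne.mem_nhds hs] with w hw
      rw [if_neg hw]
  · simp only
    by_cases hs : s = ρ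
    · subst hs
      simp only [sub_self, if_true]
      have := hev.self_of_nhds
      simpa using this
    · rw [if_neg hs, mul_div_cancel₀ _ (pow_ne_zero _ (sub_ne_zero.mpr hs))]

lemma exists_entire_factor_finset {f : ℂ → ℂ} (hf : Differentiable ℂ f) {z : ℂ} (hz : f z ≠ 0)
    (Z : Finset ℂ) :
    ∃ g : ℂ → ℂ, Differentiable ℂ g ∧ (∀ ρ ∈ Z, g ρ ≠ 0) ∧
      ∀ s, f s = (∏ ρ ∈ Z, (s - ρ) ^ analyticOrderNatAt f ρ) * g s := by
  induction Z using Finset.induction_on with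
  | empty => exact ⟨f, hf, by simp, by simp⟩
  | insert ρ Z hρ ih =>
    obtain ⟨g, hg, hg0, hfg⟩ := ih
    have hgz : g z ≠ 0 := by
      intro h; apply hz; rw [hfg, h, mul_zero]
    obtain ⟨k, hk, hk0, hgk⟩ := exists_entire_factor hg hgz ρ
    have hord : analyticOrderNatAt g ρ = analyticOrderNatAt f ρ := by
      have hP : Differentiable ℂ (fun s => ∏ ρ ∈ Z, (s - ρ) ^ analyticOrderNatAt f ρ) := by fun_prop
      have hPρ : (∏ ρ' ∈ Z, (ρ - ρ') ^ analyticOrderNatAt f ρ') ≠ 0 :=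
        prod_ne_zero_iff.mpr fun ρ' hρ' => pow_ne_zero _ (sub_ne_zero.mpr (by
          rintro rfl; exact hρ hρ'))
      have hfe : f = (fun s => ∏ ρ ∈ Z, (s - ρ) ^ analyticOrderNatAt f ρ) * g := by
        funext s; exact hfg s
      have h1 : analyticOrderAt f ρ = analyticOrderAt g ρ := by
        nth_rw 1 [hfe]
        rw [analyticOrderAt_mul (hP.analyticAt ρ) (hg.analyticAt ρ),
          (hP.analyticAt ρ).analyticOrderAt_eq_zero.mpr hPρ, zero_add]
      unfold analyticOrderNatAt; rw [h1]
    rw [hord] at hgk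
    refine ⟨k, hk, ?_, fun s => ?_⟩
    · intro ρ' hρ'
      rcases mem_insert.mp hρ' with rfl | h
      · exact hk0
      · intro h0; apply hg0 ρ' h; rw [hgk, h0, mul_zero]
    · rw [prod_insert hρ, hfg s, hgk s]; ring

lemma finite_zeros_of_isCompact {f : ℂ → ℂ} (hf : Differentiable ℂ f) {z : ℂ} (hz : f z ≠ 0)
    {K : Set ℂ} (hK : IsCompact K) : (K ∩ f ⁻¹' {0}).Finite := by
  have h1 := AnalyticOnNhd.preimage_zero_mem_codiscrete (𝕜 := ℂ) (f := f)
    (fun z _ => hf.analyticAt z) hz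
  have h2 : IsClosed (f ⁻¹' {0}) := isClosed_singleton.preimage hf.continuous
  have h3 : IsDiscrete (f ⁻¹' {0}) := by
    have := mem_codiscrete'.mp h1
    simpa using this.2
  exact (hK.inter_right h2).finite (h3.mono Set.inter_subset_right)

lemma one_le_analyticOrderNatAt {f : ℂ → ℂ} (hf : Differentiable ℂ f) {z : ℂ} (hz : f z ≠ 0)
    {ρ : ℂ} (hρ : f ρ = 0) : 1 ≤ analyticOrderNatAt f ρ := by
  by_contra! h
  obtain ⟨g, -, hg0, hfg⟩ := exists_entire_factor hf hz ρ
  rw [Nat.lt_one_iff] at h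
  have := hfg ρ
  rw [h, hρ] at this
  simp at this
  exact hg0 this.symm

lemma exists_log_on_ball {F : ℂ → ℂ} {c : ℂ} {R : ℝ} (hR : 0 < R)
    (hF : DifferentiableOn ℂ F (ball c R)) (h0 : ∀ z ∈ ball c R, F z ≠ 0) :
    ∃ H : ℂ → ℂ, H c = 0 ∧ ∀ z ∈ ball c R, HasDerivAt H (logDeriv F z) z ∧
      F z = F c * Complex.exp (H z) := by
  have hd : DifferentiableOn ℂ (logDeriv F) (ball c R) :=
    (hF.deriv isOpen_ball).div hF h0
  obtain ⟨H, hHc, hH⟩ := (hd.isExactOn_ball).with_val_at c 0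
  refine ⟨H, hHc, fun z hz => ⟨hH z hz, ?_⟩⟩
  have hconst : ∀ w ∈ ball c R, HasDerivAt (fun s => F s * Complex.exp (-H s)) 0 w := by
    intro w hw
    have hFw := (hF.differentiableAt (isOpen_ball.mem_nhds hw)).hasDerivAt
    have := hFw.mul (hH w hw).neg.cexp
    have h3 : deriv F w * Complex.exp ((-H) w) + F w * (Complex.exp ((-H) w) * -logDeriv F w)
        = 0 := by
      rw [logDeriv_apply]
      have := h0 w hw
      field_simp
      simp
    rw [h3] at this
    exact this
  have h2 := (convex_ball c R).is_const_of_fderivWithin_eq_zero (𝕜 := ℂ)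
    (f := fun s => F s * Complex.exp (-H s)) (x := z) (y := c)
    (fun w hw => (hconst w hw).differentiableAt.differentiableWithinAt)
    (fun w hw => by
      rw [fderivWithin_of_isOpen isOpen_ball hw]
      ext
      simp [(hconst w hw).deriv])
    hz (mem_ball_self hR)
  simp only [hHc, neg_zero, Complex.exp_zero, mul_one] at h2
  rw [← h2, mul_assoc, ← Complex.exp_add]; simp

lemma norm_deriv_zero_le_of_re_le {H : ℂ → ℂ} {c H' : ℂ} {R A : ℝ} (hR : 0 < R) (hA : 0 < A)
    (hH : DifferentiableOn ℂ H (ball c R)) (hc : H c = 0) (hre : ∀ z ∈ ball c R, (H z).re ≤ A)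
    (hd : HasDerivAt H H' c) : ‖H'‖ ≤ 2 * A / R := by
  have hb : ∀ z ∈ ball c R, ‖H z‖ ≤ 2 * A * ‖z - c‖ / (R - ‖z - c‖) := by
    intro z hz
    have hz' : z - c ∈ ball (0 : ℂ) R := by simpa [dist_eq_norm] using hz
    have h := Complex.borelCaratheodory_zero (f := fun w => H (w + c)) hA
      (hH.comp (by fun_prop) (fun w hw => by simpa [dist_eq_norm] using hw))
      (fun w hw => hre _ (by simpa [dist_eq_norm] using hw)) hR hz' (by simpa using hc)
    simpa using h
  have h1 : Tendsto (fun t : ℝ => ‖(t : ℂ)⁻¹ • (H (c + t) - H c)‖) (𝓝[>] 0) (𝓝 ‖H'‖) := by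
    have := (hasDerivAt_iff_tendsto_slope_zero.mp hd).norm
    refine this.comp ?_
    refine tendsto_nhdsWithin_iff.mpr ⟨?_, ?_⟩
    · exact (Complex.continuous_ofReal.tendsto' 0 0 (by simp)).mono_left nhdsWithin_le_nhds
    · filter_upwards [self_mem_nhdsWithin] with t ht
      have : (0 : ℝ) < t := ht
      simpa using this.ne'
  have h2 : Tendsto (fun t : ℝ => 2 * A / (R - t)) (𝓝[>] 0) (𝓝 (2 * A / R)) := by
    have : ContinuousAt (fun t : ℝ => 2 * A / (R - t)) 0 :=
      continuousAt_const.div (by fun_prop) (by simpa using hR.ne')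
    have := this.tendsto
    rw [sub_zero] at this
    exact this.mono_left nhdsWithin_le_nhds
  refine le_of_tendsto_of_tendsto h1 h2 ?_
  filter_upwards [Ioo_mem_nhdsGT hR] with t ht
  have htn : ‖(t : ℂ)‖ = t := by rw [Complex.norm_real, Real.norm_of_nonneg ht.1.le]
  have := hb (c + t) (by simpa [dist_eq_norm, abs_of_pos ht.1] using ht.2)
  rw [add_sub_cancel_left, htn] at this
  rw [hc, sub_zero, norm_smul, norm_inv, htn]
  have htp := ht.1
  calc t⁻¹ * ‖H (c + t)‖ ≤ t⁻¹ * (2 * A * t / (R - t)) := by gcongr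
    _ = _ := by field_simp

/-- Removing the zeros of an entire function in a closed ball by Blaschke factors. -/
lemma exists_blaschke_factor {f : ℂ → ℂ} (hf : Differentiable ℂ f) {c : ℂ} {R M : ℝ} (hR : 0 < R)
    (hc : f c ≠ 0) (hM : ∀ s, dist s c = R → ‖f s‖ ≤ M * ‖f c‖) {Z : Finset ℂ}
    (hZ : ∀ ρ, ρ ∈ Z ↔ f ρ = 0 ∧ dist ρ c ≤ R) :
    ∃ F : ℂ → ℂ, Differentiable ℂ F ∧ (∀ s, dist s c < R → F s ≠ 0) ∧
      (∀ s, dist s c ≤ R → ‖F s‖ ≤ M * ‖f c‖) ∧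
      ‖F c‖ = ‖f c‖ * ∏ ρ ∈ Z, (R / dist c ρ) ^ analyticOrderNatAt f ρ ∧
      ∀ s, dist s c < R → f s ≠ 0 → logDeriv F s = logDeriv f s
        - ∑ ρ ∈ Z, (analyticOrderNatAt f ρ : ℂ) * (1 / (s - ρ)
          + starRingEnd ℂ (ρ - c) / (R ^ 2 - starRingEnd ℂ (ρ - c) * (s - c))) := by
  obtain ⟨g, hg, hg0, hfg⟩ := exists_entire_factor_finset hf hc Z
  set m := analyticOrderNatAt f
  set b : ℂ → ℂ → ℂ := fun ρ s => (R ^ 2 - starRingEnd ℂ (ρ - c) * (s - c)) / R with hb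
  have hRC : (R : ℂ) ≠ 0 := by exact_mod_cast hR.ne'
  have hbd : ∀ ρ, Differentiable ℂ (b ρ) := by intro ρ; simp only [hb]; fun_prop
  have hnum : ∀ ρ ∈ Z, ∀ s, dist s c < R →
      (R : ℂ) ^ 2 - starRingEnd ℂ (ρ - c) * (s - c) ≠ 0 := by
    intro ρ hρ s hs h
    have h1 : ‖(R : ℂ) ^ 2‖ = ‖starRingEnd ℂ (ρ - c) * (s - c)‖ := by rw [sub_eq_zero.mp h]
    rw [norm_mul, RCLike.norm_conj, norm_pow, Complex.norm_real, Real.norm_of_nonneg hR.le] at h1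
    have h2 : ‖ρ - c‖ ≤ R := by simpa [dist_eq_norm] using ((hZ ρ).mp hρ).2
    have h3 : ‖s - c‖ < R := by simpa [dist_eq_norm] using hs
    nlinarith [norm_nonneg (ρ - c), norm_nonneg (s - c)]
  have hb0 : ∀ ρ ∈ Z, ∀ s, dist s c < R → b ρ s ≠ 0 := fun ρ hρ s hs =>
    div_ne_zero (hnum ρ hρ s hs) hRC
  have hFd : Differentiable ℂ (fun s => g s * ∏ ρ ∈ Z, b ρ s ^ m ρ) := by
    refine hg.mul ?_
    refine Differentiable.fun_finsetProd fun ρ _ => (hbd ρ).pow _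
  have hgne : ∀ s, dist s c ≤ R → g s ≠ 0 := by
    intro s hs h
    have hfs : f s = 0 := by rw [hfg, h, mul_zero]
    exact hg0 s ((hZ s).mpr ⟨hfs, hs⟩) h
  refine ⟨fun s => g s * ∏ ρ ∈ Z, b ρ s ^ m ρ, hFd, ?_, ?_, ?_, ?_⟩
  · intro s hs
    exact mul_ne_zero (hgne s hs.le) (prod_ne_zero_iff.mpr fun ρ hρ =>
      pow_ne_zero _ (hb0 ρ hρ s hs))
  · intro s hs
    have hsphere : ∀ s, dist s c = R → ‖g s * ∏ ρ ∈ Z, b ρ s ^ m ρ‖ ≤ M * ‖f c‖ := by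
      intro s hs
      have hs' : ‖s - c‖ = R := by simpa [dist_eq_norm] using hs
      have hbn : ∀ ρ, ‖b ρ s‖ = ‖s - ρ‖ := by
        intro ρ
        have h1 : (R : ℂ) ^ 2 - starRingEnd ℂ (ρ - c) * (s - c)
            = starRingEnd ℂ (s - ρ) * (s - c) := by
          have : (R : ℂ) ^ 2 = starRingEnd ℂ (s - c) * (s - c) := by
            rw [← Complex.normSq_eq_conj_mul_self, Complex.normSq_eq_norm_sq, hs']; push_cast; rfl
          rw [this]; simp only [map_sub]; ring
        simp only [hb]
        rw [norm_div, h1, norm_mul, RCLike.norm_conj, hs', Complex.norm_real,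
          Real.norm_of_nonneg hR.le]
        field_simp
      refine le_trans (le_of_eq ?_) (hM s hs)
      rw [hfg s, norm_mul, norm_mul, norm_prod, norm_prod, mul_comm]
      congr 1
      exact prod_congr rfl fun ρ _ => by rw [norm_pow, norm_pow, hbn]
    have := Complex.norm_le_of_forall_mem_frontier_norm_le (U := ball c R) isBounded_ball
      (f := fun s => g s * ∏ ρ ∈ Z, b ρ s ^ m ρ) (C := M * ‖f c‖) hFd.diffContOnCl
      (fun z hz => hsphere z (by
        rw [frontier_ball c hR.ne'] at hz; exact hz)) (z := s) (by
        rw [closure_ball c hR.ne']; exact hs)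
    exact this
  · simp only
    rw [norm_mul, norm_prod, hfg c, norm_mul, norm_prod, mul_comm _ ‖g c‖, mul_assoc,
      ← prod_mul_distrib]
    congr 1
    refine prod_congr rfl fun ρ hρ => ?_
    have hρc : c - ρ ≠ 0 := by
      rw [sub_ne_zero]; rintro rfl
      exact hc ((hZ _).mp hρ).1
    have h1 : ‖b ρ c‖ = R := by
      simp only [hb, sub_self, mul_zero, sub_zero]
      rw [norm_div, norm_pow, Complex.norm_real, Real.norm_of_nonneg hR.le]
      field_simp
    rw [norm_pow, norm_pow, h1, ← mul_pow, dist_eq_norm,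
      mul_div_cancel₀ _ (norm_ne_zero_iff.mpr hρc)]
  · intro s hs hfs
    have hsρ : ∀ ρ ∈ Z, s - ρ ≠ 0 := by
      intro ρ hρ; rw [sub_ne_zero]; rintro rfl
      exact hfs ((hZ _).mp hρ).1
    have hgs := hgne s hs.le
    have hP : ∏ ρ ∈ Z, (s - ρ) ^ m ρ ≠ 0 :=
      prod_ne_zero_iff.mpr fun ρ hρ => pow_ne_zero _ (hsρ ρ hρ)
    have hPd : DifferentiableAt ℂ (fun s => ∏ ρ ∈ Z, (s - ρ) ^ m ρ) s := by fun_prop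
    have hB : ∏ ρ ∈ Z, b ρ s ^ m ρ ≠ 0 :=
      prod_ne_zero_iff.mpr fun ρ hρ => pow_ne_zero _ (hb0 ρ hρ s hs)
    have hBd : DifferentiableAt ℂ (fun s => ∏ ρ ∈ Z, b ρ s ^ m ρ) s :=
      DifferentiableAt.fun_finsetProd fun ρ _ => ((hbd ρ).pow _).differentiableAt
    have e1 : logDeriv f s = ∑ ρ ∈ Z, (m ρ : ℂ) * (1 / (s - ρ)) + logDeriv g s := by
      have : f = fun s => (∏ ρ ∈ Z, (s - ρ) ^ m ρ) * g s := funext hfg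
      nth_rw 1 [this]
      rw [logDeriv_mul s hP hgs hPd (hg s)]
      congr 1
      rw [logDeriv_prod (f := fun ρ s => (s - ρ) ^ m ρ)
        (fun ρ hρ => pow_ne_zero _ (hsρ ρ hρ)) (fun ρ hρ => by fun_prop)]
      refine sum_congr rfl fun ρ hρ => ?_
      rw [logDeriv_fun_pow (by fun_prop), logDeriv_apply]
      simp
    have e2 : logDeriv (fun s => g s * ∏ ρ ∈ Z, b ρ s ^ m ρ) s = logDeriv g s
        - ∑ ρ ∈ Z, (m ρ : ℂ) *
          (starRingEnd ℂ (ρ - c) / (R ^ 2 - starRingEnd ℂ (ρ - c) * (s - c))) := by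
      rw [logDeriv_mul s hgs hB (hg s) hBd,
        logDeriv_prod (f := fun ρ s => b ρ s ^ m ρ) (fun ρ hρ => pow_ne_zero _ (hb0 ρ hρ s hs))
          (fun ρ hρ => ((hbd ρ).pow _).differentiableAt), sub_eq_add_neg, ← sum_neg_distrib]
      congr 1
      refine sum_congr rfl fun ρ hρ => ?_
      rw [logDeriv_fun_pow ((hbd ρ) s), logDeriv_apply]
      have hder : deriv (b ρ) s = - starRingEnd ℂ (ρ - c) / R := by
        have : HasDerivAt (b ρ) ((0 - starRingEnd ℂ (ρ - c) * (1 - 0)) / R) s := by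
          exact (((hasDerivAt_const s _).sub (((hasDerivAt_id s).sub
            (hasDerivAt_const s c)).const_mul _)).div_const _)
        rw [this.deriv]; ring
      rw [hder]
      have := hnum ρ hρ s hs
      simp only [hb]
      field_simp
    rw [e2, e1]
    simp only [mul_add, sum_add_distrib]
    ring

section LandauBounds

variable {f : ℂ → ℂ} {c : ℂ} {R M : ℝ}

lemma exists_zeros_finset (hf : Differentiable ℂ f) (hc : f c ≠ 0) (z : ℂ) (R : ℝ) :
    ∃ Z : Finset ℂ, ∀ ρ, ρ ∈ Z ↔ f ρ = 0 ∧ dist ρ z ≤ R := by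
  refine ⟨(finite_zeros_of_isCompact hf hc (isCompact_closedBall z R)).toFinset, fun ρ => ?_⟩
  simp [and_comm]

lemma one_le_blaschke {Z : Finset ℂ} (hc : f c ≠ 0) (hZ : ∀ ρ ∈ Z, f ρ = 0 ∧ dist ρ c ≤ R) :
    ∀ ρ ∈ Z, 1 ≤ (R / dist c ρ) ^ analyticOrderNatAt f ρ := by
  intro ρ hρ
  have hpos : 0 < dist c ρ := dist_pos.mpr (by rintro rfl; exact hc (hZ _ hρ).1)
  refine one_le_pow₀ ?_
  rw [one_le_div hpos, dist_comm]
  exact (hZ ρ hρ).2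

/-- Jensen's bound for the number of zeros. -/
theorem sum_order_le (hf : Differentiable ℂ f) {R₁ : ℝ} (hR₁ : 0 < R₁) (hR : R₁ < R)
    (hc : f c ≠ 0) (hM : ∀ s, dist s c ≤ R → ‖f s‖ ≤ M * ‖f c‖) {S : Finset ℂ}
    (hS : ∀ ρ ∈ S, f ρ = 0 ∧ dist ρ c ≤ R₁) :
    ∑ ρ ∈ S, (analyticOrderNatAt f ρ : ℝ) ≤ Real.log M / Real.log (R / R₁) := by
  have hR0 : 0 < R := hR₁.trans hR
  obtain ⟨Z, hZ⟩ := exists_zeros_finset hf hc c R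
  obtain ⟨F, -, -, hFle, hFc, -⟩ := exists_blaschke_factor hf hR0 hc
    (fun s hs => hM s hs.le) hZ
  have hfc : 0 < ‖f c‖ := norm_pos_iff.mpr hc
  have h1 : ∏ ρ ∈ Z, (R / dist c ρ) ^ analyticOrderNatAt f ρ ≤ M := by
    have := hFle c (by simpa using hR0.le)
    rw [hFc, mul_comm] at this
    exact le_of_mul_le_mul_right this hfc
  have hSZ : S ⊆ Z := fun ρ hρ => (hZ ρ).mpr ⟨(hS ρ hρ).1, (hS ρ hρ).2.trans hR.le⟩
  have h2 : ∏ ρ ∈ S, (R / R₁) ^ analyticOrderNatAt f ρ ≤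
      ∏ ρ ∈ Z, (R / dist c ρ) ^ analyticOrderNatAt f ρ := by
    calc _ ≤ ∏ ρ ∈ S, (R / dist c ρ) ^ analyticOrderNatAt f ρ := by
          refine prod_le_prod (fun ρ _ => by positivity) fun ρ hρ => ?_
          have hpos : 0 < dist c ρ := dist_pos.mpr (by rintro rfl; exact hc (hS _ hρ).1)
          gcongr
          rw [dist_comm]; exact (hS ρ hρ).2
      _ ≤ _ := prod_le_prod_of_subset_of_one_le hSZ (fun ρ _ => by positivity)
          fun ρ hρ _ => one_le_blaschke hc (fun ρ hρ => (hZ ρ).mp hρ) ρ hρ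
  have hlog : 0 < Real.log (R / R₁) := Real.log_pos (by rwa [one_lt_div hR₁])
  rw [le_div_iff₀ hlog, sum_mul]
  have h3 := Real.log_le_log (prod_pos fun ρ _ => by positivity) (h2.trans h1)
  rw [Real.log_prod (fun ρ _ => by positivity)] at h3
  simpa [Real.log_pow] using h3

lemma exists_blaschke_log (hf : Differentiable ℂ f) (hR : 0 < R) (hc : f c ≠ 0) (hM1 : 1 ≤ M)
    (hM : ∀ s, dist s c ≤ R → ‖f s‖ ≤ M * ‖f c‖) {Z : Finset ℂ}
    (hZ : ∀ ρ, ρ ∈ Z ↔ f ρ = 0 ∧ dist ρ c ≤ R) :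
    ∃ H : ℂ → ℂ, H c = 0 ∧ ∀ s ∈ ball c R, (H s).re ≤ Real.log M ∧
      ∃ H' : ℂ, HasDerivAt H H' s ∧ (f s ≠ 0 → H' = logDeriv f s
        - ∑ ρ ∈ Z, (analyticOrderNatAt f ρ : ℂ) * (1 / (s - ρ)
          + starRingEnd ℂ (ρ - c) / (R ^ 2 - starRingEnd ℂ (ρ - c) * (s - c)))) := by
  obtain ⟨F, hFd, hF0, hFle, hFc, hFl⟩ := exists_blaschke_factor hf hR hc
    (fun s hs => hM s hs.le) hZ
  obtain ⟨H, hHc, hH⟩ := exists_log_on_ball hR hFd.differentiableOn (c := c)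
    (fun z hz => hF0 z hz)
  have hfc : 0 < ‖f c‖ := norm_pos_iff.mpr hc
  have hFc1 : ‖f c‖ ≤ ‖F c‖ := by
    rw [hFc]
    refine le_mul_of_one_le_right hfc.le ?_
    exact one_le_prod (one_le_blaschke hc (fun ρ hρ => (hZ ρ).mp hρ))
  refine ⟨H, hHc, fun s hs => ⟨?_, logDeriv F s, (hH s hs).1, fun h => hFl s hs h⟩⟩
  have h1 := hFle s (le_of_lt hs)
  rw [(hH s hs).2, norm_mul, Complex.norm_exp] at h1
  have h2 : Real.exp (H s).re ≤ M := by
    have h3 : ‖f c‖ * Real.exp (H s).re ≤ ‖f c‖ * M := by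
      calc _ ≤ ‖F c‖ * Real.exp (H s).re := by gcongr
        _ ≤ _ := by rw [mul_comm ‖f c‖]; exact h1
    exact le_of_mul_le_mul_left h3 hfc
  rw [Real.le_log_iff_exp_le (by linarith)]
  exact h2

/-- A form of Landau's lemma: an upper bound for a sum over zeros by the logarithmic derivative. -/
theorem sum_zeros_le (hf : Differentiable ℂ f) (hR : 0 < R) (hc : f c ≠ 0) (hM1 : 1 < M)
    (hM : ∀ s, dist s c ≤ R → ‖f s‖ ≤ M * ‖f c‖) {S : Finset ℂ}
    (hre : ∀ ρ, f ρ = 0 → dist ρ c ≤ R → ρ.re ≤ c.re)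
    (hS : ∀ ρ ∈ S, f ρ = 0 ∧ dist ρ c ≤ R) :
    ∑ ρ ∈ S, (analyticOrderNatAt f ρ : ℝ) *
        ((c.re - ρ.re) / dist c ρ ^ 2 - (c.re - ρ.re) / R ^ 2)
      ≤ (logDeriv f c).re + 2 * Real.log M / R := by
  obtain ⟨Z, hZ⟩ := exists_zeros_finset hf hc c R
  obtain ⟨H, hHc, hH⟩ := exists_blaschke_log hf hR hc hM1.le hM hZ
  obtain ⟨-, H', hd, hH'⟩ := hH c (mem_ball_self hR)
  have hb := norm_deriv_zero_le_of_re_le hR (Real.log_pos hM1)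
    (fun s hs => ((hH s hs).2.choose_spec.1).differentiableAt.differentiableWithinAt) hHc
    (fun s hs => (hH s hs).1) hd
  have hterm : ∀ ρ, ((analyticOrderNatAt f ρ : ℂ) * (1 / (c - ρ)
      + starRingEnd ℂ (ρ - c) / (R ^ 2 - starRingEnd ℂ (ρ - c) * (c - c)))).re
      = (analyticOrderNatAt f ρ : ℝ) *
        ((c.re - ρ.re) / dist c ρ ^ 2 - (c.re - ρ.re) / R ^ 2) := by
    intro ρ
    rw [← Complex.ofReal_natCast, Complex.re_ofReal_mul, sub_self, mul_zero, sub_zero,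
      Complex.add_re, one_div, Complex.inv_re, ← Complex.ofReal_pow, Complex.div_ofReal_re,
      Complex.conj_re, Complex.sub_re, Complex.sub_re, Complex.normSq_eq_norm_sq, dist_eq_norm]
    ring
  have h1 := congrArg Complex.re (hH' hc)
  rw [Complex.sub_re, Complex.re_sum] at h1
  simp_rw [hterm] at h1
  have h2 : -(2 * Real.log M / R) ≤ H'.re :=
    (neg_le_neg hb).trans ((abs_le.mp (Complex.abs_re_le_norm H')).1)
  have hSZ : S ⊆ Z := fun ρ hρ => (hZ ρ).mpr (hS ρ hρ)
  refine (sum_le_sum_of_subset_of_nonneg hSZ fun ρ hρ _ => ?_).trans (by linarith)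
  have hρ' := (hZ ρ).mp hρ
  have hpos : 0 < dist c ρ := dist_pos.mpr (by rintro rfl; exact hc hρ'.1)
  refine mul_nonneg (Nat.cast_nonneg _) (sub_nonneg.mpr ?_)
  have := hre ρ hρ'.1 hρ'.2
  have h3 : dist c ρ ≤ R := by rw [dist_comm]; exact hρ'.2
  gcongr

/-- A bound for the logarithmic derivative away from the zeros. -/
theorem norm_logDeriv_sub_sum_le (hf : Differentiable ℂ f) (hR : 0 < R) (hc : f c ≠ 0) (hM1 : 1 < M)
    (hM : ∀ s, dist s c ≤ R → ‖f s‖ ≤ M * ‖f c‖) {Z : Finset ℂ}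
    (hZ : ∀ ρ, ρ ∈ Z ↔ f ρ = 0 ∧ dist ρ c ≤ R) {s : ℂ} (hs : dist s c ≤ R / 2) (hfs : f s ≠ 0) :
    ‖logDeriv f s - ∑ ρ ∈ Z, (analyticOrderNatAt f ρ : ℂ) * (1 / (s - ρ))‖
      ≤ 24 * Real.log M / R + ∑ ρ ∈ Z, (analyticOrderNatAt f ρ : ℝ) * (2 / R) := by
  obtain ⟨H, hHc, hH⟩ := exists_blaschke_log hf hR hc hM1.le hM hZ
  have hsR : s ∈ ball c R := mem_ball.mpr (by linarith)
  obtain ⟨-, H', hd, hH'⟩ := hH s hsR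
  have hlog := Real.log_pos hM1
  have hHd : DifferentiableOn ℂ H (ball c R) := fun s hs =>
    ((hH s hs).2.choose_spec.1).differentiableAt.differentiableWithinAt
  have hsub : ∀ z, dist z s ≤ R / 4 → dist z c ≤ 3 * R / 4 := by
    intro z hz
    linarith [dist_triangle z s c]
  have hHb : ∀ z ∈ sphere s (R / 4), ‖H z‖ ≤ 6 * Real.log M := by
    intro z hz
    have hz3 : dist z c ≤ 3 * R / 4 := hsub z (le_of_eq hz)
    have hz' : z - c ∈ ball (0 : ℂ) R := by
      rw [mem_ball_zero_iff, ← dist_eq_norm]; linarith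
    have h := Complex.borelCaratheodory_zero (f := fun w => H (w + c)) hlog
      (hHd.comp (by fun_prop) (fun w hw => by simpa [dist_eq_norm] using hw))
      (fun w hw => (hH _ (by simpa [dist_eq_norm] using hw)).1) hR hz' (by simpa using hHc)
    simp only [sub_add_cancel] at h
    refine h.trans ?_
    rw [dist_eq_norm] at hz3
    rw [div_le_iff₀ (by linarith)]
    nlinarith
  have hderiv : ‖deriv H s‖ ≤ 6 * Real.log M / (R / 4) := by
    refine Complex.norm_deriv_le_of_forall_mem_sphere_norm_le (by linarith) ?_ hHb
    refine DifferentiableOn.diffContOnCl ?_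
    refine hHd.mono ?_
    rw [closure_ball s (by linarith)]
    intro z hz
    exact mem_ball.mpr (by linarith [hsub z hz])
  rw [hd.deriv] at hderiv
  have h1 : logDeriv f s - ∑ ρ ∈ Z, (analyticOrderNatAt f ρ : ℂ) * (1 / (s - ρ))
      = H' + ∑ ρ ∈ Z, (analyticOrderNatAt f ρ : ℂ) *
          (starRingEnd ℂ (ρ - c) / (R ^ 2 - starRingEnd ℂ (ρ - c) * (s - c))) := by
    rw [hH' hfs]
    simp_rw [mul_add, sum_add_distrib]
    ring
  rw [h1]
  refine (norm_add_le _ _).trans (add_le_add (hderiv.trans (le_of_eq (by ring))) ?_)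
  refine (norm_sum_le _ _).trans (sum_le_sum fun ρ hρ => ?_)
  rw [norm_mul, Complex.norm_natCast]
  gcongr
  have hρ' : ‖ρ - c‖ ≤ R := by rw [← dist_eq_norm]; exact ((hZ ρ).mp hρ).2
  have hs' : ‖s - c‖ ≤ R / 2 := by rw [← dist_eq_norm]; exact hs
  have h2 : R ^ 2 / 2 ≤ ‖(R : ℂ) ^ 2 - starRingEnd ℂ (ρ - c) * (s - c)‖ := by
    refine le_trans ?_ (norm_sub_norm_le _ _)
    rw [norm_mul, RCLike.norm_conj, norm_pow, Complex.norm_real, Real.norm_of_nonneg hR.le]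
    nlinarith [norm_nonneg (ρ - c), norm_nonneg (s - c)]
  rw [norm_div, RCLike.norm_conj]
  calc ‖ρ - c‖ / ‖(R : ℂ) ^ 2 - starRingEnd ℂ (ρ - c) * (s - c)‖ ≤ R / (R ^ 2 / 2) := by gcongr
    _ = 2 / R := by field_simp

end LandauBounds

end LinnikAP

namespace LinnikAP

open Finset ArithmeticFunction

section Sieve

lemma sum_divisors_moebius (n : ℕ) :
    ∑ d ∈ n.divisors, (moebius d : ℝ) = if n = 1 then 1 else 0 := by
  have h := congrArg (fun f : ArithmeticFunction ℤ => f n) coe_zeta_mul_moebius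
  simp only [coe_zeta_mul_apply, one_apply] at h
  exact_mod_cast h

lemma sum_inv_le_div_totient {m : ℕ} (hm : m ≠ 0) {T : Finset ℕ}
    (hT : ∀ k ∈ T, k ≠ 0 ∧ k.primeFactors ⊆ m.primeFactors) :
    ∑ k ∈ T, (k : ℝ)⁻¹ ≤ m / m.totient := by
  let f : ℕ →* ℝ :=
    { toFun := fun n => (n : ℝ)⁻¹
      map_one' := by simp
      map_mul' := fun a b => by push_cast; rw [mul_inv] }
  have hf : ∀ n : ℕ, f n = (n : ℝ)⁻¹ := fun n => rfl
  obtain ⟨-, hs⟩ := EulerProduct.summable_and_hasSum_factoredNumbers_prod_filter_prime_geometric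
    (f := f) (fun {p} hp => by
      rw [hf, norm_inv, Real.norm_natCast]
      exact inv_lt_one_of_one_lt₀ (by exact_mod_cast hp.one_lt)) m.primeFactors
  have hm0 : (m : ℝ) ≠ 0 := by exact_mod_cast hm
  have htot : (m.totient : ℝ) = m * ∏ p ∈ m.primeFactors, (1 - (p : ℝ)⁻¹) := by
    have := congrArg (fun x : ℚ => (x : ℝ)) (Nat.totient_eq_mul_prod_factors m)
    push_cast at this
    exact this
  have hprod : ∏ p ∈ m.primeFactors with p.Prime, (1 - f p)⁻¹ = m / m.totient := by
    rw [filter_true_of_mem (fun p hp => Nat.prime_of_mem_primeFactors hp), htot,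
      prod_inv_distrib, div_mul_eq_div_div, div_self hm0, one_div]
    simp [hf]
  rw [hprod] at hs
  have hmem : ∀ k ∈ T, k ∈ Nat.factoredNumbers m.primeFactors := fun k hk =>
    Nat.mem_factoredNumbers_of_primeFactors_subset (hT k hk).1 (hT k hk).2
  classical
  have hle := sum_le_hasSum (T.subtype (· ∈ Nat.factoredNumbers m.primeFactors))
    (fun i _ => by rw [hf]; positivity) hs
  have h2 := sum_subtype_of_mem (fun k : ℕ => f k) hmem
  exact h2 ▸ hle

/-- The squarefree integers up to `R` coprime to `q`. -/
def sieveSupport (q R : ℕ) : Finset ℕ := {n ∈ Icc 1 R | Squarefree n ∧ n.Coprime q}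

/-- The normalising sum of the Selberg sieve. -/
noncomputable def sieveSum (q R : ℕ) : ℝ := ∑ n ∈ sieveSupport q R, (n.totient : ℝ)⁻¹

/-- The optimal Selberg weights. -/
noncomputable def sieveWeight (q R d : ℕ) : ℝ :=
  moebius d * d / sieveSum q R * ∑ n ∈ sieveSupport q R with d ∣ n, (n.totient : ℝ)⁻¹

variable {q R : ℕ}

lemma mem_sieveSupport {n : ℕ} :
    n ∈ sieveSupport q R ↔ (1 ≤ n ∧ n ≤ R) ∧ Squarefree n ∧ n.Coprime q := by
  simp [sieveSupport]

lemma mem_sieveSupport_of_dvd {n d : ℕ} (hn : n ∈ sieveSupport q R) (hd : d ∣ n) :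
    d ∈ sieveSupport q R := by
  rw [mem_sieveSupport] at *
  have hd1 := Nat.pos_of_dvd_of_pos hd hn.1.1
  exact ⟨⟨hd1, (Nat.le_of_dvd hn.1.1 hd).trans hn.1.2⟩, hn.2.1.squarefree_of_dvd hd,
    hn.2.2.coprime_dvd_left hd⟩

lemma one_mem_sieveSupport (hR : 1 ≤ R) : 1 ∈ sieveSupport q R := by
  simp [mem_sieveSupport, hR]

lemma sieveSum_pos (hR : 1 ≤ R) : 0 < sieveSum q R := by
  refine sum_pos (fun n hn => ?_) ⟨1, one_mem_sieveSupport hR⟩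
  have := Nat.totient_pos.mpr (mem_sieveSupport.mp hn).1.1
  positivity

lemma log_le_sieveSum (hq : q ≠ 0) (R : ℕ) :
    Real.log R ≤ q / q.totient * sieveSum q R := by
  have hharm : Real.log R ≤ ∑ m ∈ Icc 1 R, (m : ℝ)⁻¹ := by
    rcases Nat.eq_zero_or_pos R with rfl | hR
    · simp
    have h := log_add_one_le_harmonic R
    rw [harmonic_eq_sum_Icc] at h
    push_cast at h
    refine le_trans (Real.log_le_log (by positivity) ?_) h
    linarith
  refine hharm.trans ?_
  let r : ℕ → ℕ := fun m => ∏ p ∈ m.primeFactors with ¬ p ∣ q, p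
  have hrp : ∀ m, (r m).primeFactors = m.primeFactors.filter (fun p => ¬ p ∣ q) := fun m =>
    Nat.primeFactors_prod fun p hp => Nat.prime_of_mem_primeFactors (mem_filter.mp hp).1
  have hrd : ∀ m, r m ∣ m := fun m =>
    (prod_dvd_prod_of_subset _ _ _ (filter_subset _ _)).trans (Nat.prod_primeFactors_dvd m)
  have hrs : ∀ m ∈ Icc 1 R, r m ∈ sieveSupport q R := by
    intro m hm
    rw [mem_Icc] at hm
    have h1 := Nat.pos_of_dvd_of_pos (hrd m) hm.1
    refine mem_sieveSupport.mpr ⟨⟨h1, (Nat.le_of_dvd hm.1 (hrd m)).trans hm.2⟩, ?_, ?_⟩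
    · refine squarefree_prod_of_pairwise_isCoprime (fun a ha b hb hab => ?_) fun p hp =>
        (Nat.prime_of_mem_primeFactors (mem_filter.mp hp).1).squarefree
      rw [Function.onFun, ← Nat.coprime_iff_isRelPrime]
      exact (Nat.coprime_primes (Nat.prime_of_mem_primeFactors (mem_filter.mp ha).1)
        (Nat.prime_of_mem_primeFactors (mem_filter.mp hb).1)).mpr hab
    · refine Nat.Coprime.prod_left fun p hp => ?_
      exact ((Nat.prime_of_mem_primeFactors (mem_filter.mp hp).1).coprime_iff_not_dvd).mpr
        (mem_filter.mp hp).2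
  rw [sieveSum, mul_sum, ← sum_fiberwise_of_maps_to hrs]
  refine sum_le_sum fun n hn => ?_
  have hn' := mem_sieveSupport.mp hn
  have hn0 : n ≠ 0 := by omega
  have h1 : (∑ k ∈ ({m ∈ Icc 1 R | r m = n}).image (· / n), (k : ℝ)⁻¹)
      ≤ ((q * n : ℕ) : ℝ) / (q * n).totient := by
    refine sum_inv_le_div_totient (by positivity) fun k hk => ?_
    obtain ⟨m, hm, rfl⟩ := mem_image.mp hk
    obtain ⟨hm1, hm2⟩ := mem_filter.mp hm
    have hd : n ∣ m := hm2 ▸ hrd m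
    have hm0 : m ≠ 0 := by have := (mem_Icc.mp hm1).1; omega
    have hk0 : m / n ≠ 0 := by
      have := Nat.div_pos (Nat.le_of_dvd (by omega) hd) (by omega); omega
    refine ⟨hk0, fun p hp => ?_⟩
    have hpp := Nat.prime_of_mem_primeFactors hp
    have hpm : p ∣ m := (Nat.dvd_of_mem_primeFactors hp).trans (Nat.div_dvd_of_dvd hd)
    rw [Nat.mem_primeFactors]
    refine ⟨hpp, ?_, by positivity⟩
    by_cases hpq : p ∣ q
    · exact hpq.mul_right n
    · refine Dvd.dvd.mul_left ?_ q
      have : p ∈ (r m).primeFactors := by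
        rw [hrp, mem_filter]
        exact ⟨Nat.mem_primeFactors.mpr ⟨hpp, hpm, hm0⟩, hpq⟩
      rw [hm2] at this
      exact Nat.dvd_of_mem_primeFactors this
  rw [sum_image (fun a ha b hb hab => by
    have ha' : n ∣ a := (mem_filter.mp ha).2 ▸ hrd a
    have hb' : n ∣ b := (mem_filter.mp hb).2 ▸ hrd b
    rw [← Nat.div_mul_cancel ha', ← Nat.div_mul_cancel hb']
    rw [hab])] at h1
  have h2 : ∑ m ∈ Icc 1 R with r m = n, (m : ℝ)⁻¹
      = (n : ℝ)⁻¹ * ∑ m ∈ Icc 1 R with r m = n, ((m / n : ℕ) : ℝ)⁻¹ := by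
    rw [mul_sum]
    refine sum_congr rfl fun m hm => ?_
    have ha' : n ∣ m := (mem_filter.mp hm).2 ▸ hrd m
    rw [Nat.cast_div ha' (by exact_mod_cast hn0), inv_div]
    have : (n : ℝ) ≠ 0 := by exact_mod_cast hn0
    field_simp
  rw [h2]
  refine (mul_le_mul_of_nonneg_left h1 (by positivity)).trans (le_of_eq ?_)
  rw [Nat.totient_mul hn'.2.2.symm]
  push_cast
  have : (0 : ℝ) < q.totient := by exact_mod_cast Nat.totient_pos.mpr (by omega)
  have : (0 : ℝ) < n.totient := by exact_mod_cast Nat.totient_pos.mpr (by omega)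
  field_simp

lemma sieveWeight_one (hR : 1 ≤ R) : sieveWeight q R 1 = 1 := by
  have := (sieveSum_pos (q := q) hR).ne'
  simp only [sieveWeight, one_dvd, filter_true, moebius_apply_one, Int.cast_one, Nat.cast_one, one_mul]
  change 1 / sieveSum q R * sieveSum q R = 1
  field_simp

lemma sieveWeight_eq_zero {d : ℕ} (hd : d ∉ sieveSupport q R) : sieveWeight q R d = 0 := by
  rw [sieveWeight, sum_eq_zero, mul_zero]
  intro n hn
  obtain ⟨h1, h2⟩ := mem_filter.mp hn
  exact absurd (mem_sieveSupport_of_dvd h1 h2) hd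

lemma abs_sieveWeight_le (hR : 1 ≤ R) (d : ℕ) : |sieveWeight q R d| ≤ 1 := by
  by_cases hd : d ∈ sieveSupport q R
  swap
  · simp [sieveWeight_eq_zero hd]
  have hG := sieveSum_pos (q := q) hR
  have hd' := mem_sieveSupport.mp hd
  have key : (d : ℝ) * ∑ n ∈ sieveSupport q R with d ∣ n, (n.totient : ℝ)⁻¹ ≤ sieveSum q R := by
    have h1 : (d : ℝ) * ∑ n ∈ sieveSupport q R with d ∣ n, (n.totient : ℝ)⁻¹
        = ∑ z ∈ ({n ∈ sieveSupport q R | d ∣ n}) ×ˢ d.divisors,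
          ((z.2 * (z.1 / d)).totient : ℝ)⁻¹ := by
      rw [sum_product, mul_sum]
      refine sum_congr rfl fun n hn => ?_
      obtain ⟨hn1, hn2⟩ := mem_filter.mp hn
      have hn' := mem_sieveSupport.mp hn1
      obtain ⟨e, rfl⟩ := hn2
      have hcop : d.Coprime e := Nat.coprime_of_squarefree_mul hn'.2.1
      simp only [Nat.mul_div_cancel_left _ (show 0 < d by omega)]
      rw [Nat.totient_mul hcop]
      have hde : (d : ℝ) = ∑ l ∈ d.divisors, ((d / l).totient : ℝ) := by
        conv_lhs => rw [← Nat.sum_totient d]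
        push_cast
        exact (Nat.sum_div_divisors d (fun l => (l.totient : ℝ))).symm
      conv_lhs => rw [hde]
      rw [sum_mul]
      refine sum_congr rfl fun l hl => ?_
      obtain ⟨⟨k, rfl⟩, -⟩ := Nat.mem_divisors.mp hl
      have hlk : l.Coprime k := Nat.coprime_of_squarefree_mul hd'.2.1
      have hl0 : 0 < l := Nat.pos_of_mul_pos_right (by omega : 0 < l * k)
      rw [Nat.mul_div_cancel_left _ hl0, Nat.totient_mul hlk,
        Nat.totient_mul (hcop.coprime_dvd_left (Dvd.intro _ rfl))]
      push_cast
      have : (0 : ℝ) < k.totient := by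
        exact_mod_cast Nat.totient_pos.mpr (Nat.pos_of_mul_pos_left (by omega : 0 < l * k))
      rw [mul_inv, mul_inv, mul_inv]
      field_simp
    rw [h1, sieveSum]
    have hinj : Set.InjOn (fun z : ℕ × ℕ => z.2 * (z.1 / d))
        (({n ∈ sieveSupport q R | d ∣ n}) ×ˢ d.divisors : Finset (ℕ × ℕ)) := by
      rintro ⟨n, l⟩ h ⟨n', l'⟩ h' heq
      simp only [coe_product, Set.mem_prod, mem_coe, mem_filter, Nat.mem_divisors] at h h'
      obtain ⟨⟨hn, e, rfl⟩, hl, -⟩ := h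
      obtain ⟨⟨hn', e', rfl⟩, hl', -⟩ := h'
      have hd0 : 0 < d := by omega
      simp only [Nat.mul_div_cancel_left _ hd0] at heq
      have hc : d.Coprime e := Nat.coprime_of_squarefree_mul (mem_sieveSupport.mp hn).2.1
      have hc' : d.Coprime e' := Nat.coprime_of_squarefree_mul (mem_sieveSupport.mp hn').2.1
      have e1 : Nat.gcd d (l * e) = l := by
        rw [Nat.Coprime.gcd_mul_right_cancel_right _ hc.symm, Nat.gcd_eq_right hl]
      have e2 : Nat.gcd d (l' * e') = l' := by
        rw [Nat.Coprime.gcd_mul_right_cancel_right _ hc'.symm, Nat.gcd_eq_right hl']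
      have hll : l = l' := by rw [← e1, ← e2, heq]
      subst hll
      have hl0 : 0 < l := Nat.pos_of_dvd_of_pos hl hd0
      rw [Nat.eq_of_mul_eq_mul_left hl0 heq]
    rw [← sum_image (f := fun n => (n.totient : ℝ)⁻¹) hinj]
    refine sum_le_sum_of_subset_of_nonneg (fun n hn => ?_) fun _ _ _ => by positivity
    obtain ⟨⟨n, l⟩, hz, rfl⟩ := mem_image.mp hn
    simp only [mem_product, mem_filter, Nat.mem_divisors] at hz
    obtain ⟨⟨hn, e, rfl⟩, hl, -⟩ := hz
    refine mem_sieveSupport_of_dvd hn ?_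
    rw [Nat.mul_div_cancel_left _ (by omega : 0 < d)]
    exact Nat.mul_dvd_mul_right hl e
  have hmu : |(moebius d : ℝ)| ≤ 1 := by exact_mod_cast abs_moebius_le_one
  rw [sieveWeight, mul_div_assoc, mul_assoc, abs_mul]
  refine mul_le_one₀ hmu (abs_nonneg _) ?_
  rw [abs_of_nonneg (by positivity), div_mul_eq_mul_div, div_le_one hG]
  exact key

lemma sum_sieveWeight_div (k : ℕ) (hk : k ∈ sieveSupport q R) :
    ∑ d ∈ sieveSupport q R with k ∣ d, sieveWeight q R d / d
      = moebius k / (k.totient * sieveSum q R) := by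
  have h1 : ∀ d ∈ ({d ∈ sieveSupport q R | k ∣ d}), sieveWeight q R d / d =
      ∑ n ∈ sieveSupport q R, (sieveSum q R)⁻¹ * (n.totient : ℝ)⁻¹ *
        (if d ∣ n then (moebius d : ℝ) else 0) := by
    intro d hd
    have hd0 : (d : ℝ) ≠ 0 := by
      have := (mem_sieveSupport.mp (mem_filter.mp hd).1).1.1
      exact_mod_cast (by omega : d ≠ 0)
    rw [sieveWeight, sum_filter, mul_sum, sum_div]
    refine sum_congr rfl fun n _ => ?_
    split_ifs
    · field_simp
    · simp
  rw [sum_congr rfl h1, sum_comm]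
  simp_rw [← mul_sum]
  have h2 : ∀ n ∈ sieveSupport q R, (∑ d ∈ sieveSupport q R with k ∣ d,
      if d ∣ n then (moebius d : ℝ) else 0) = if n = k then (moebius k : ℝ) else 0 := by
    intro n hn
    have hn' := mem_sieveSupport.mp hn
    rw [← sum_filter, filter_filter]
    by_cases hkn : k ∣ n
    · obtain ⟨e, rfl⟩ := hkn
      have hc : k.Coprime e := Nat.coprime_of_squarefree_mul hn'.2.1
      have hk0 : 0 < k := (mem_sieveSupport.mp hk).1.1
      have he0 : e ≠ 0 := by rintro rfl; simp at hn'
      have hset : ({d ∈ sieveSupport q R | k ∣ d ∧ d ∣ k * e})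
          = e.divisors.image (k * ·) := by
        ext d
        simp only [mem_filter, mem_image, Nat.mem_divisors]
        constructor
        · rintro ⟨-, ⟨f, rfl⟩, h⟩
          exact ⟨f, ⟨Nat.dvd_of_mul_dvd_mul_left hk0 h, he0⟩, rfl⟩
        · rintro ⟨f, ⟨hf, -⟩, rfl⟩
          exact ⟨mem_sieveSupport_of_dvd hn (Nat.mul_dvd_mul_left k hf), Dvd.intro _ rfl,
            Nat.mul_dvd_mul_left k hf⟩
      rw [hset, sum_image fun a _ b _ h => Nat.eq_of_mul_eq_mul_left hk0 h]
      have : ∀ f ∈ e.divisors, (moebius (k * f) : ℝ) = moebius k * moebius f := by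
        intro f hf
        rw [isMultiplicative_moebius.map_mul_of_coprime
          (hc.coprime_dvd_right (Nat.dvd_of_mem_divisors hf))]
        push_cast; rfl
      rw [sum_congr rfl this, ← mul_sum, sum_divisors_moebius e]
      by_cases he : e = 1
      · simp [he]
      · rw [if_neg he, if_neg, mul_zero]
        intro h
        exact he (Nat.eq_of_mul_eq_mul_left hk0 (by rw [h, mul_one]))
    · rw [if_neg (by rintro rfl; exact hkn dvd_rfl)]
      refine sum_eq_zero fun d hd => absurd ?_ hkn
      exact (mem_filter.mp hd).2.1.trans (mem_filter.mp hd).2.2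
  rw [sum_congr rfl fun n hn => by rw [h2 n hn]]
  simp only [mul_ite, mul_zero, sum_ite_eq', hk, if_true]
  rw [div_eq_mul_inv, mul_inv]
  ring

/-- The minimum of the Selberg quadratic form. -/
lemma sum_sieveWeight_mul (hR : 1 ≤ R) :
    ∑ d ∈ sieveSupport q R, ∑ e ∈ sieveSupport q R,
      sieveWeight q R d * sieveWeight q R e / (d.lcm e : ℝ) = (sieveSum q R)⁻¹ := by
  have hG := sieveSum_pos (q := q) hR
  have h1 : ∀ d ∈ sieveSupport q R, ∀ e ∈ sieveSupport q R,
      sieveWeight q R d * sieveWeight q R e / (d.lcm e : ℝ)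
        = ∑ k ∈ sieveSupport q R, (k.totient : ℝ) *
          ((if k ∣ d then sieveWeight q R d / d else 0) *
            (if k ∣ e then sieveWeight q R e / e else 0)) := by
    intro d hd e he
    have hd' := mem_sieveSupport.mp hd
    have he' := mem_sieveSupport.mp he
    have hg : (d.gcd e : ℝ) = ∑ k ∈ sieveSupport q R,
        if k ∣ d ∧ k ∣ e then (k.totient : ℝ) else 0 := by
      conv_lhs => rw [← Nat.sum_totient (d.gcd e)]
      push_cast
      rw [← sum_filter]
      refine sum_congr ?_ fun _ _ => rfl
      ext k
      simp only [Nat.mem_divisors, mem_filter, Nat.dvd_gcd_iff]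
      constructor
      · rintro ⟨h, -⟩
        exact ⟨mem_sieveSupport_of_dvd hd h.1, h⟩
      · rintro ⟨-, h⟩
        exact ⟨h, (Nat.gcd_pos_of_pos_left _ hd'.1.1).ne'⟩
    have hd0 : (0 : ℝ) < d := by exact_mod_cast hd'.1.1
    have he0 : (0 : ℝ) < e := by exact_mod_cast he'.1.1
    have hl0 : (0 : ℝ) < d.lcm e := by
      exact_mod_cast Nat.lcm_pos hd'.1.1 he'.1.1
    have hgl : (d.gcd e : ℝ) * d.lcm e = d * e := by exact_mod_cast Nat.gcd_mul_lcm d e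
    have : sieveWeight q R d * sieveWeight q R e / (d.lcm e : ℝ)
        = (d.gcd e : ℝ) * (sieveWeight q R d / d * (sieveWeight q R e / e)) := by
      field_simp
      linear_combination (-(sieveWeight q R d * sieveWeight q R e)) * hgl
    rw [this, hg, sum_mul]
    refine sum_congr rfl fun k _ => ?_
    by_cases ha : k ∣ d <;> by_cases hb : k ∣ e <;> simp [ha, hb]
  rw [sum_congr rfl fun d hd => sum_congr rfl fun e he => h1 d hd e he]
  have h2 : ∑ d ∈ sieveSupport q R, ∑ e ∈ sieveSupport q R, ∑ k ∈ sieveSupport q R,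
      (k.totient : ℝ) * ((if k ∣ d then sieveWeight q R d / d else 0) *
            (if k ∣ e then sieveWeight q R e / e else 0))
      = ∑ k ∈ sieveSupport q R, (k.totient : ℝ) *
        (∑ d ∈ sieveSupport q R with k ∣ d, sieveWeight q R d / d) ^ 2 := by
    rw [sum_congr rfl fun d _ => sum_comm, sum_comm]
    refine sum_congr rfl fun k _ => ?_
    rw [sq, sum_filter, sum_mul_sum, mul_sum]
    simp_rw [mul_sum]
  rw [h2]
  have h3 : ∀ k ∈ sieveSupport q R, (k.totient : ℝ) *
        (∑ d ∈ sieveSupport q R with k ∣ d, sieveWeight q R d / d) ^ 2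
        = ((sieveSum q R) ^ 2)⁻¹ * (k.totient : ℝ)⁻¹ := by
    intro k hk
    have hk' := mem_sieveSupport.mp hk
    have : (0 : ℝ) < k.totient := by exact_mod_cast Nat.totient_pos.mpr hk'.1.1
    have hmu : (moebius k : ℝ) ^ 2 = 1 := by
      exact_mod_cast moebius_sq_eq_one_of_squarefree hk'.2.1
    rw [sum_sieveWeight_div k hk, div_pow, hmu]
    field_simp
  rw [sum_congr rfl h3, ← mul_sum]
  change ((sieveSum q R) ^ 2)⁻¹ * sieveSum q R = _
  field_simp

lemma abs_card_modEq_sub_le {A B r : ℕ} (hAB : A ≤ B) (hr : 0 < r) (v : ℕ) :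
    |(#{x ∈ Ioc A B | x ≡ v [MOD r]} : ℝ) - ((B : ℝ) - A) / r| ≤ 1 := by
  have h := Nat.Ioc_filter_modEq_card A B hr v
  have hle : ((A : ℚ) - v) / r ≤ ((B : ℚ) - v) / r := by
    have : (A : ℚ) ≤ B := by exact_mod_cast hAB
    gcongr
  rw [max_eq_left (sub_nonneg.mpr (Int.floor_mono hle))] at h
  have h' : (#{x ∈ Ioc A B | x ≡ v [MOD r]} : ℚ)
      = (⌊((B : ℚ) - v) / r⌋ : ℚ) - ⌊((A : ℚ) - v) / r⌋ := by exact_mod_cast h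
  have hq : |(#{x ∈ Ioc A B | x ≡ v [MOD r]} : ℚ) - ((B : ℚ) - A) / r| ≤ 1 := by
    have e : ((B : ℚ) - A) / r = ((B : ℚ) - v) / r - ((A : ℚ) - v) / r := by ring
    rw [h', e, abs_le]
    have := Int.floor_le (((B : ℚ) - v) / r)
    have := Int.lt_floor_add_one (((B : ℚ) - v) / r)
    have := Int.floor_le (((A : ℚ) - v) / r)
    have := Int.lt_floor_add_one (((A : ℚ) - v) / r)
    constructor <;> linarith
  have h3 := (Rat.cast_le (K := ℝ)).mpr hq
  push_cast at h3
  exact h3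

/-- Selberg's upper bound sieve in an arithmetic progression. -/
theorem sum_sq_sieveWeight_le (hq : q ≠ 0) (hR : 2 ≤ R) {A B : ℕ} (hAB : A ≤ B) (b : ℕ) :
    ∑ n ∈ Ioc A B with n ≡ b [MOD q], (∑ d ∈ n.divisors, sieveWeight q R d) ^ 2
      ≤ ((B : ℝ) - A) / (q.totient * Real.log R) + (R : ℝ) ^ 2 := by
  have hR1 : 1 ≤ R := by omega
  have hlog : 0 < Real.log R := Real.log_pos (by exact_mod_cast hR)
  have hG := sieveSum_pos (q := q) hR1
  have hAB' : (0 : ℝ) ≤ (B : ℝ) - A := sub_nonneg.mpr (by exact_mod_cast hAB)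
  set θ := sieveWeight q R with hθ
  have h1 : ∀ n ∈ ({n ∈ Ioc A B | n ≡ b [MOD q]}), (∑ d ∈ n.divisors, θ d) ^ 2
      = ∑ d ∈ sieveSupport q R, ∑ e ∈ sieveSupport q R,
        if d.lcm e ∣ n then θ d * θ e else 0 := by
    intro n hn
    have hn0 : n ≠ 0 := by have := mem_Ioc.mp (mem_filter.mp hn).1; omega
    have : ∑ d ∈ n.divisors, θ d = ∑ d ∈ sieveSupport q R, if d ∣ n then θ d else 0 := by
      rw [← sum_filter]
      refine (sum_subset_zero_on_sdiff (fun d hd => ?_) (fun d hd => ?_)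
        fun _ _ => rfl).symm
      · exact Nat.mem_divisors.mpr ⟨(mem_filter.mp hd).2, hn0⟩
      · rw [mem_sdiff, mem_filter, Nat.mem_divisors] at hd
        exact sieveWeight_eq_zero fun h => hd.2 ⟨h, hd.1.1⟩
    rw [this, sq, sum_mul_sum]
    refine sum_congr rfl fun d _ => sum_congr rfl fun e _ => ?_
    simp only [Nat.lcm_dvd_iff]
    by_cases ha : d ∣ n <;> by_cases hb : e ∣ n <;> simp [ha, hb]
  rw [sum_congr rfl h1, sum_comm]
  rw [sum_congr rfl fun d _ => sum_comm]
  have h2 : ∀ d ∈ sieveSupport q R, ∀ e ∈ sieveSupport q R,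
      (∑ n ∈ Ioc A B with n ≡ b [MOD q], if d.lcm e ∣ n then θ d * θ e else 0)
        ≤ ((B : ℝ) - A) / q * (θ d * θ e / d.lcm e) + 1 := by
    intro d hd e he
    have hd' := mem_sieveSupport.mp hd
    have he' := mem_sieveSupport.mp he
    have hl0 : 0 < d.lcm e := Nat.lcm_pos hd'.1.1 he'.1.1
    have hcop : Nat.Coprime (d.lcm e) q := (hd'.2.2.mul_left he'.2.2).coprime_dvd_left (Nat.lcm_dvd_mul d e)
    rw [← sum_filter, filter_filter, sum_const, nsmul_eq_mul]
    obtain ⟨v, hv1, hv2⟩ := Nat.chineseRemainder hcop 0 b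
    have hset : ({n ∈ Ioc A B | n ≡ b [MOD q] ∧ d.lcm e ∣ n})
        = {n ∈ Ioc A B | n ≡ v [MOD d.lcm e * q]} := by
      ext n
      simp only [mem_filter, and_congr_right_iff]
      intro _
      rw [← Nat.modEq_and_modEq_iff_modEq_mul hcop, ← Nat.modEq_zero_iff_dvd]
      constructor
      · rintro ⟨h, h'⟩
        exact ⟨h'.trans hv1.symm, h.trans hv2.symm⟩
      · rintro ⟨h, h'⟩
        exact ⟨h'.trans hv2, h.trans hv1⟩
    rw [hset]
    have hc := abs_card_modEq_sub_le hAB (Nat.mul_pos hl0 (Nat.pos_of_ne_zero hq)) v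
    have hθθ : |θ d * θ e| ≤ 1 := by
      rw [abs_mul]
      exact mul_le_one₀ (abs_sieveWeight_le hR1 d) (abs_nonneg _) (abs_sieveWeight_le hR1 e)
    have h3 := (le_abs_self _).trans ((abs_mul _ _).trans_le
      (mul_le_one₀ hc (abs_nonneg _) hθθ))
    rw [sub_mul] at h3
    have h4 : ((B : ℝ) - A) / ((d.lcm e * q : ℕ) : ℝ) * (θ d * θ e)
        = ((B : ℝ) - A) / q * (θ d * θ e / d.lcm e) := by
      push_cast
      have : (0 : ℝ) < d.lcm e := by exact_mod_cast hl0
      have : (q : ℝ) ≠ 0 := by exact_mod_cast hq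
      field_simp
    linarith
  refine (sum_le_sum fun d hd => sum_le_sum fun e he => h2 d hd e he).trans ?_
  simp_rw [sum_add_distrib, ← mul_sum]
  rw [hθ, sum_sieveWeight_mul hR1]
  have hcard : (#(sieveSupport q R) : ℝ) ≤ R := by
    have := card_filter_le (Icc 1 R) (fun n => Squarefree n ∧ n.Coprime q)
    rw [Nat.card_Icc, Nat.add_sub_cancel] at this
    exact_mod_cast this
  refine add_le_add ?_ ?_
  · have hφ : (0 : ℝ) < q.totient := by
      exact_mod_cast Nat.totient_pos.mpr (Nat.pos_of_ne_zero hq)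
    have hl := log_le_sieveSum hq R
    have : (sieveSum q R)⁻¹ ≤ q / (q.totient * Real.log R) := by
      rw [inv_le_iff_one_le_mul₀ hG, div_mul_eq_mul_div, one_le_div (by positivity)]
      rw [div_mul_eq_mul_div, le_div_iff₀ hφ] at hl
      linarith
    calc _ ≤ ((B : ℝ) - A) / q * (q / (q.totient * Real.log R)) := by gcongr
      _ = _ := by field_simp
  · simp only [sum_const, nsmul_eq_mul, mul_one]
    rw [sq]
    gcongr

end Sieve

end LinnikAP

namespace LinnikAP

open MeasureTheory Complex Finset
open scoped Real

lemma integral_gaussian_mul_cexp {κ : ℝ} (hκ : 0 < κ) (u : ℝ) :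
    ∫ t : ℝ, ((Real.exp (-κ * t ^ 2) : ℝ) : ℂ) * cexp (-(I * t * u))
      = ((√(π / κ) * Real.exp (-(4 * κ)⁻¹ * u ^ 2) : ℝ) : ℂ) := by
  have h := fourierIntegral_gaussian (b := (κ : ℂ)) (by simpa using hκ) (-(u : ℂ))
  have e : ∀ t : ℝ, ((Real.exp (-κ * t ^ 2) : ℝ) : ℂ) * cexp (-(I * t * u))
      = cexp (I * -(u : ℂ) * t) * cexp (-(κ : ℂ) * t ^ 2) := by
    intro t
    rw [mul_comm]
    push_cast
    congr 2
    ring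
  simp_rw [e]
  rw [h]
  push_cast
  congr 1
  · rw [show (1 / 2 : ℂ) = ((1 / 2 : ℝ) : ℂ) by push_cast; rfl, ← ofReal_div,
      ← ofReal_cpow (by positivity), Real.sqrt_eq_rpow]
  · congr 1
    have : (κ : ℂ) ≠ 0 := by exact_mod_cast hκ.ne'
    field_simp

lemma integrable_gaussian_kernel {κ : ℝ} (hκ : 0 < κ) :
    Integrable (fun u : ℝ => √(π / κ) * Real.exp (-(4 * κ)⁻¹ * u ^ 2)) :=
  (integrable_exp_neg_mul_sq (by positivity)).const_mul _

lemma integral_gaussian_kernel {κ : ℝ} (hκ : 0 < κ) :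
    ∫ u : ℝ, √(π / κ) * Real.exp (-(4 * κ)⁻¹ * u ^ 2) = 2 * π := by
  rw [integral_const_mul, integral_gaussian, ← Real.sqrt_mul (by positivity)]
  rw [show π / κ * (π / (4 * κ)⁻¹) = (2 * π) ^ 2 by field_simp; ring]
  exact Real.sqrt_sq (by positivity)

/-- Bessel's inequality for the Fourier transform, with a Gaussian weight. -/
theorem integral_gaussian_mul_sq_fourier_le {F : ℝ → ℂ} (hF : Integrable F)
    (hF2 : Integrable fun y => ‖F y‖ ^ 2) {κ : ℝ} (hκ : 0 < κ) :
    Integrable (fun t : ℝ => Real.exp (-κ * t ^ 2) * ‖∫ y, F y * cexp (-(I * t * y))‖ ^ 2) ∧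
    ∫ t : ℝ, Real.exp (-κ * t ^ 2) * ‖∫ y, F y * cexp (-(I * t * y))‖ ^ 2
      ≤ 2 * π * ∫ y, ‖F y‖ ^ 2 := by
  set k : ℝ → ℝ := fun u => √(π / κ) * Real.exp (-(4 * κ)⁻¹ * u ^ 2) with hk
  have hk0 : ∀ u, 0 ≤ k u := fun u => by positivity
  have hkint : Integrable k := integrable_gaussian_kernel hκ
  let H : ℝ → ℝ × ℝ → ℂ := fun t p =>
    cexp (-(I * t * (p.1 - p.2))) *
      (((Real.exp (-κ * t ^ 2) : ℝ) : ℂ) * (F p.1 * starRingEnd ℂ (F p.2)))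
  have hconj : Integrable (fun y => starRingEnd ℂ (F y)) :=
    (conjLIE.integrable_comp_iff (φ := F)).mpr hF
  have hFF : Integrable (fun p : ℝ × ℝ => F p.1 * starRingEnd ℂ (F p.2)) := hF.mul_prod hconj
  have hH : Integrable (Function.uncurry H) := by
    refine Integrable.bdd_mul (c := 1) (((integrable_exp_neg_mul_sq hκ).ofReal (𝕜 := ℂ)).mul_prod
      hFF) ?_ (Filter.Eventually.of_forall fun z => ?_)
    · exact (by fun_prop : Continuous fun z : ℝ × ℝ × ℝ =>
        cexp (-(I * z.1 * (z.2.1 - z.2.2)))).aestronglyMeasurable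
    · rw [norm_exp]
      simp
  have h1 : ∀ t : ℝ, ((Real.exp (-κ * t ^ 2) * ‖∫ y, F y * cexp (-(I * t * y))‖ ^ 2 : ℝ) : ℂ)
      = ∫ p, H t p := by
    intro t
    have e1 : ∀ p : ℝ × ℝ, H t p = ((Real.exp (-κ * t ^ 2) : ℝ) : ℂ) *
        ((F p.1 * cexp (-(I * t * p.1))) * starRingEnd ℂ (F p.2 * cexp (-(I * t * p.2)))) := by
      intro p
      have : cexp (-(I * t * (p.1 - p.2)))
          = cexp (-(I * t * p.1)) * starRingEnd ℂ (cexp (-(I * t * p.2))) := by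
        rw [← exp_conj, ← exp_add]
        congr 1
        simp only [map_neg, map_mul, conj_I, conj_ofReal]
        ring
      simp only [H, this, map_mul]
      ring
    simp_rw [e1]
    rw [integral_const_mul, Measure.volume_eq_prod, integral_prod_mul
      (f := fun y : ℝ => F y * cexp (-(I * t * y)))
      (g := fun y : ℝ => starRingEnd ℂ (F y * cexp (-(I * t * y)))), integral_conj,
      mul_conj, normSq_eq_norm_sq]
    push_cast
    rfl
  have hint : Integrable (fun t : ℝ => ∫ p, H t p) := hH.integral_prod_left
  refine ⟨?_, ?_⟩
  · have := hint.re
    refine this.congr (Filter.Eventually.of_forall fun t => ?_)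
    simp only [← h1]
    exact ofReal_re _
  have h2 : ((∫ t : ℝ, Real.exp (-κ * t ^ 2) * ‖∫ y, F y * cexp (-(I * t * y))‖ ^ 2 : ℝ) : ℂ)
      = ∫ p : ℝ × ℝ, ((k (p.2 - p.1) : ℝ) : ℂ) * (F p.1 * starRingEnd ℂ (F p.2)) := by
    rw [← integral_complex_ofReal]
    simp_rw [h1]
    rw [integral_integral_swap hH]
    refine integral_congr_ae (Filter.Eventually.of_forall fun p => ?_)
    simp only [H]
    have : ∀ t : ℝ, cexp (-(I * t * (p.1 - p.2))) *
      (((Real.exp (-κ * t ^ 2) : ℝ) : ℂ) * (F p.1 * starRingEnd ℂ (F p.2)))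
        = (((Real.exp (-κ * t ^ 2) : ℝ) : ℂ) * cexp (-(I * t * ((p.1 - p.2 : ℝ) : ℂ)))) *
          (F p.1 * starRingEnd ℂ (F p.2)) := by
      intro t; push_cast; ring
    simp_rw [this]
    rw [integral_mul_const, integral_gaussian_mul_cexp hκ]
    simp only [hk]
    rw [show (p.1 - p.2) ^ 2 = (p.2 - p.1) ^ 2 by ring]
  have hc1 := hF2.convolution_integrand (ContinuousLinearMap.mul ℝ ℝ) hkint
  have hc2 : Integrable (fun p : ℝ × ℝ => k (p.2 - p.1) * ‖F p.1‖ ^ 2) := by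
    refine hc1.swap.congr (Filter.Eventually.of_forall fun p => ?_)
    simp [mul_comm]
  have hkneg : ∀ u, k (-u) = k u := fun u => by simp [hk]
  have hc3 : Integrable (fun p : ℝ × ℝ => k (p.2 - p.1) * ‖F p.2‖ ^ 2) := by
    refine hc1.congr (Filter.Eventually.of_forall fun p => ?_)
    simp only [ContinuousLinearMap.mul_apply']
    rw [← hkneg, neg_sub, mul_comm]
  have hI2 : ∫ p : ℝ × ℝ, k (p.2 - p.1) * ‖F p.1‖ ^ 2 = 2 * π * ∫ y, ‖F y‖ ^ 2 := by
    rw [Measure.volume_eq_prod, integral_prod _ hc2]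
    simp_rw [integral_mul_const]
    have : ∀ x : ℝ, ∫ a : ℝ, k (a - x) = 2 * π := fun x => by
      rw [integral_sub_right_eq_self k x, integral_gaussian_kernel hκ]
    simp_rw [this]
    rw [integral_const_mul]
  have hI3 : ∫ p : ℝ × ℝ, k (p.2 - p.1) * ‖F p.2‖ ^ 2 = 2 * π * ∫ y, ‖F y‖ ^ 2 := by
    rw [Measure.volume_eq_prod, integral_prod_symm _ hc3]
    simp_rw [integral_mul_const]
    have : ∀ x : ℝ, ∫ a : ℝ, k (x - a) = 2 * π := fun x => by
      rw [integral_sub_left_eq_self k volume x, integral_gaussian_kernel hκ]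
    simp_rw [this]
    rw [integral_const_mul]
  have h3 : ‖∫ p : ℝ × ℝ, ((k (p.2 - p.1) : ℝ) : ℂ) * (F p.1 * starRingEnd ℂ (F p.2))‖
      ≤ ∫ p : ℝ × ℝ, (1 / 2) * (k (p.2 - p.1) * ‖F p.1‖ ^ 2 + k (p.2 - p.1) * ‖F p.2‖ ^ 2) := by
    refine norm_integral_le_of_norm_le ((hc2.add hc3).const_mul _)
      (Filter.Eventually.of_forall fun p => ?_)
    rw [norm_mul, norm_mul, RCLike.norm_conj, norm_real, Real.norm_of_nonneg (hk0 _)]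
    nlinarith [mul_nonneg (hk0 (p.2 - p.1)) (sq_nonneg (‖F p.1‖ - ‖F p.2‖))]
  rw [← h2, integral_const_mul, integral_add hc2 hc3, hI2, hI3, norm_real] at h3
  exact (le_abs_self _).trans (h3.trans (le_of_eq (by ring)))

/-- The part of a finite sum over `n` with `y < log n ≤ y + δ`. -/
noncomputable def windowSum {α : Type*} [AddCommMonoid α] (S : Finset ℕ) (δ : ℝ) (c : ℕ → α)
    (y : ℝ) : α :=
  ∑ n ∈ S.filter (fun n : ℕ => y < Real.log n ∧ Real.log n ≤ y + δ), c n

lemma windowSum_eq {α : Type*} [AddCommMonoid α] (S : Finset ℕ) (δ : ℝ) (c : ℕ → α) :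
    windowSum S δ c = fun y => ∑ n ∈ S,
      (Set.Ico (Real.log n - δ) (Real.log n)).indicator (fun _ => c n) y := by
  classical
  funext y
  rw [windowSum, sum_filter]
  refine sum_congr rfl fun n _ => ?_
  rw [Set.indicator_apply]
  refine if_congr ?_ rfl rfl
  rw [Set.mem_Ico]
  constructor <;> rintro ⟨h1, h2⟩ <;> constructor <;> linarith

lemma integrable_windowSum {E : Type*} [NormedAddCommGroup E] (S : Finset ℕ) (δ : ℝ)
    (c : ℕ → E) : Integrable (windowSum S δ c) := by
  rw [windowSum_eq]
  refine integrable_finsetSum _ fun n _ => ?_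
  rw [integrable_indicator_iff measurableSet_Ico]
  exact integrableOn_const (by simp)

lemma integral_windowSum (S : Finset ℕ) {δ : ℝ} (hδ : 0 ≤ δ) (w : ℕ → ℝ) :
    ∫ y, windowSum S δ w y = δ * ∑ n ∈ S, w n := by
  rw [windowSum_eq, integral_finsetSum _ fun n _ => by
    rw [integrable_indicator_iff measurableSet_Ico]
    exact integrableOn_const (by simp), mul_sum]
  refine sum_congr rfl fun n _ => ?_
  rw [integral_indicator measurableSet_Ico, setIntegral_const]
  simp [hδ]

lemma norm_windowSum_le {E : Type*} [NormedAddCommGroup E] (S : Finset ℕ) (δ : ℝ) (c : ℕ → E)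
    (y : ℝ) : ‖windowSum S δ c y‖ ≤ ∑ n ∈ S, ‖c n‖ :=
  (norm_sum_le _ _).trans
    (sum_le_sum_of_subset_of_nonneg (filter_subset _ _) fun _ _ _ => norm_nonneg _)

lemma integrable_norm_sq_windowSum {E : Type*} [NormedAddCommGroup E] (S : Finset ℕ) (δ : ℝ)
    (c : ℕ → E) : Integrable fun y => ‖windowSum S δ c y‖ ^ 2 := by
  simp_rw [sq]
  exact (integrable_windowSum S δ c).norm.bdd_mul
    (integrable_windowSum S δ c).norm.aestronglyMeasurable
    (Filter.Eventually.of_forall fun y => by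
      rw [norm_norm]; exact norm_windowSum_le S δ c y)

lemma fourier_windowSum (S : Finset ℕ) {δ : ℝ} (hδ : 0 ≤ δ) (c : ℕ → ℂ) (t : ℝ) :
    ∫ y, windowSum S δ c y * cexp (-(I * t * y))
      = (∑ n ∈ S, c n * cexp (-(I * t * Real.log n))) * ∫ u in -δ..0, cexp (-(I * t * u)) := by
  have e : ∀ y : ℝ, windowSum S δ c y * cexp (-(I * t * y)) = ∑ n ∈ S,
      (Set.Ico (Real.log n - δ) (Real.log n)).indicator
        (fun y : ℝ => c n * cexp (-(I * t * y))) y := by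
    intro y
    rw [windowSum_eq, sum_mul]
    refine sum_congr rfl fun n _ => ?_
    by_cases h : y ∈ Set.Ico (Real.log n - δ) (Real.log n) <;> simp [h]
  simp_rw [e]
  rw [integral_finsetSum _ fun n _ => by
    rw [integrable_indicator_iff measurableSet_Ico]
    refine ((by fun_prop : Continuous fun y : ℝ => c n * cexp (-(I * t * y))).integrableOn_Icc
      (a := Real.log n - δ) (b := Real.log n)).mono_set Set.Ico_subset_Icc_self, sum_mul]
  refine sum_congr rfl fun n _ => ?_
  rw [integral_indicator measurableSet_Ico, integral_Ico_eq_integral_Ioc,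
    ← intervalIntegral.integral_of_le (by linarith), intervalIntegral.integral_const_mul, mul_assoc]
  congr 1
  have h1 := intervalIntegral.integral_comp_add_right (a := -δ) (b := 0)
    (fun y : ℝ => cexp (-(I * t * y))) (Real.log n)
  rw [zero_add, neg_add_eq_sub] at h1
  rw [← h1, ← intervalIntegral.integral_const_mul]
  refine intervalIntegral.integral_congr fun u _ => ?_
  rw [← exp_add]
  congr 1
  push_cast
  ring

lemma le_norm_integral_cexp {δ T t : ℝ} (hδ : 0 ≤ δ) (ht : |t| ≤ T) :
    δ * (1 - (δ * T) ^ 2 / 2) ≤ ‖∫ u in -δ..0, cexp (-(I * t * u))‖ := by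
  refine le_trans ?_ (re_le_norm _)
  have h1 : (∫ u in -δ..0, cexp (-(I * t * u))).re = ∫ u in -δ..0, Real.cos (t * u) := by
    have := reCLM.intervalIntegral_comp_comm (a := -δ) (b := 0) (μ := volume)
      (f := fun u : ℝ => cexp (-(I * t * u)))
      ((by fun_prop : Continuous fun u : ℝ => cexp (-(I * t * u))).intervalIntegrable _ _)
    rw [reCLM_apply] at this
    rw [← this]
    refine intervalIntegral.integral_congr fun u _ => ?_
    simp only [reCLM_apply]
    rw [show -(I * t * u) = ((-(t * u) : ℝ) : ℂ) * I by push_cast; ring, exp_ofReal_mul_I_re,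
      Real.cos_neg]
  rw [h1]
  have h2 : ∫ _u in -δ..0, (1 - (δ * T) ^ 2 / 2) = δ * (1 - (δ * T) ^ 2 / 2) := by
    rw [intervalIntegral.integral_const]; simp
  rw [← h2]
  refine intervalIntegral.integral_mono_on (by linarith) (by simp)
    ((by fun_prop : Continuous fun u : ℝ => Real.cos (t * u)).intervalIntegrable _ _)
    fun u hu => ?_
  have h3 := Real.one_sub_sq_div_two_le_cos (x := t * u)
  have h4 : (t * u) ^ 2 ≤ (δ * T) ^ 2 := by
    rw [← sq_abs, abs_mul, mul_comm]
    have : |u| ≤ δ := abs_le.mpr ⟨hu.1, hu.2.trans hδ⟩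
    gcongr
  linarith

/-- Gallagher's inequality for finite Dirichlet polynomials. -/
theorem gallagher (S : Finset ℕ) (c : ℕ → ℂ) {δ T : ℝ} (hδ : 0 < δ) (hT : 0 ≤ T)
    (hδT : δ * T ≤ 1) :
    ∫ t in -T..T, ‖∑ n ∈ S, c n * cexp (-(I * t * Real.log n))‖ ^ 2
      ≤ 2 * π / (δ * (1 - (δ * T) ^ 2 / 2)) ^ 2 * ∫ y, ‖windowSum S δ c y‖ ^ 2 := by
  have hpos : 0 < δ * (1 - (δ * T) ^ 2 / 2) := by
    have : (δ * T) ^ 2 ≤ 1 := pow_le_one₀ (by positivity) hδT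
    refine mul_pos hδ (by linarith)
  rw [div_mul_eq_mul_div, le_div_iff₀ (by positivity)]
  set X := ∫ t in -T..T, ‖∑ n ∈ S, c n * cexp (-(I * t * Real.log n))‖ ^ 2 with hX
  set D := δ * (1 - (δ * T) ^ 2 / 2)
  have key : ∀ κ : ℝ, 0 < κ → X * D ^ 2 * Real.exp (-κ * T ^ 2)
      ≤ 2 * π * ∫ y, ‖windowSum S δ c y‖ ^ 2 := by
    intro κ hκ
    obtain ⟨hi, hle⟩ := integral_gaussian_mul_sq_fourier_le (integrable_windowSum S δ c)
      (integrable_norm_sq_windowSum S δ c) hκ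
    refine le_trans ?_ hle
    rw [hX, mul_assoc, ← intervalIntegral.integral_mul_const,
      intervalIntegral.integral_of_le (by linarith)]
    refine le_trans ?_ (setIntegral_le_integral (s := Set.Ioc (-T) T) hi
      (Filter.Eventually.of_forall fun t => by positivity))
    refine setIntegral_mono_on ?_ hi.integrableOn measurableSet_Ioc fun t ht => ?_
    · exact ((by fun_prop : Continuous fun t : ℝ =>
        ‖∑ n ∈ S, c n * cexp (-(I * t * Real.log n))‖ ^ 2 *
          (D ^ 2 * Real.exp (-κ * T ^ 2))).integrableOn_Icc).mono_set Set.Ioc_subset_Icc_self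
    · have ht' : |t| ≤ T := abs_le.mpr ⟨ht.1.le, ht.2⟩
      have h1 := le_norm_integral_cexp hδ.le ht'
      have h2 : Real.exp (-κ * T ^ 2) ≤ Real.exp (-κ * t ^ 2) := by
        have : t ^ 2 ≤ T ^ 2 := by rw [← sq_abs]; gcongr
        rw [Real.exp_le_exp]; nlinarith
      rw [fourier_windowSum S hδ.le, norm_mul, mul_pow ‖_‖ ‖_‖]
      calc _ = Real.exp (-κ * T ^ 2) *
            (‖∑ n ∈ S, c n * cexp (-(I * t * Real.log n))‖ ^ 2 * D ^ 2) := by ring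
        _ ≤ _ := by gcongr
  have hlim : Filter.Tendsto (fun κ : ℝ => X * D ^ 2 * Real.exp (-κ * T ^ 2))
      (nhdsWithin 0 (Set.Ioi 0)) (nhds (X * D ^ 2)) := by
    have : Continuous fun κ : ℝ => X * D ^ 2 * Real.exp (-κ * T ^ 2) := by fun_prop
    have h := (this.tendsto 0).mono_left (nhdsWithin_le_nhds (s := Set.Ioi 0))
    simpa using h
  exact le_of_tendsto hlim (Filter.eventually_of_mem self_mem_nhdsWithin fun κ hκ => key κ hκ)

/-- Orthogonality of characters, in mean square. -/
lemma sum_norm_sq_char_sum {q : ℕ} [NeZero q] (S : Finset ℕ) (a : ℕ → ℂ) :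
    ∑ χ : DirichletCharacter ℂ q, ‖∑ n ∈ S, a n * χ (n : ZMod q)‖ ^ 2
      = q.totient * ∑ b : (ZMod q)ˣ, ‖∑ n ∈ S.filter (fun n : ℕ => (n : ZMod q) = b), a n‖ ^ 2 := by
  classical
  have h1 : ∀ χ : DirichletCharacter ℂ q, ∑ n ∈ S, a n * χ (n : ZMod q)
      = ∑ b : (ZMod q)ˣ, (∑ n ∈ S.filter (fun n : ℕ => (n : ZMod q) = b), a n) * χ b := by
    intro χ
    simp_rw [sum_mul, sum_filter]
    rw [sum_comm]
    refine sum_congr rfl fun n _ => ?_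
    by_cases hn : IsUnit (n : ZMod q)
    · obtain ⟨u, hu⟩ := hn
      rw [sum_eq_single u]
      · simp [hu]
      · intro b _ hb
        rw [if_neg]
        rw [← hu]
        exact fun h => hb (Units.ext h.symm)
      · simp
    · rw [χ.map_nonunit hn, mul_zero, sum_eq_zero]
      intro b _
      rw [if_neg]
      rintro h
      exact hn (h ▸ b.isUnit)
  have h2 : ∀ χ : DirichletCharacter ℂ q, ∀ b : (ZMod q)ˣ,
      starRingEnd ℂ (χ b) = χ ((b : ZMod q)⁻¹) := by
    intro χ b
    rw [ZMod.inv_coe_unit, starRingEnd_apply, MulChar.star_apply', MulChar.inv_apply,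
      Ring.inverse_unit]
  set A : (ZMod q)ˣ → ℂ := fun b => ∑ n ∈ S.filter (fun n : ℕ => (n : ZMod q) = b), a n
  have h3 : ((∑ χ : DirichletCharacter ℂ q, ‖∑ n ∈ S, a n * χ (n : ZMod q)‖ ^ 2 : ℝ) : ℂ)
      = ((q.totient * ∑ b : (ZMod q)ˣ, ‖A b‖ ^ 2 : ℝ) : ℂ) := by
    push_cast
    calc ∑ χ : DirichletCharacter ℂ q, (‖∑ n ∈ S, a n * χ (n : ZMod q)‖ : ℂ) ^ 2
        = ∑ χ : DirichletCharacter ℂ q, ∑ b : (ZMod q)ˣ, ∑ b' : (ZMod q)ˣ,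
            A b * starRingEnd ℂ (A b') * (χ ((b' : ZMod q)⁻¹) * χ b) := by
          refine sum_congr rfl fun χ _ => ?_
          rw [← ofReal_pow, ← normSq_eq_norm_sq, ← mul_conj, h1 χ, map_sum,
            sum_mul_sum]
          refine sum_congr rfl fun b _ => sum_congr rfl fun b' _ => ?_
          rw [map_mul, h2]
          ring
      _ = ∑ b : (ZMod q)ˣ, ∑ b' : (ZMod q)ˣ, A b * starRingEnd ℂ (A b') *
            (if (b' : ZMod q) = b then (q.totient : ℂ) else 0) := by
          rw [sum_comm]
          refine sum_congr rfl fun b _ => ?_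
          rw [sum_comm]
          refine sum_congr rfl fun b' _ => ?_
          rw [← mul_sum, DirichletCharacter.sum_char_inv_mul_char_eq ℂ b'.isUnit]
      _ = _ := by
          rw [mul_sum]
          refine sum_congr rfl fun b _ => ?_
          simp only [Units.val_inj, mul_ite, mul_zero, sum_ite_eq', mem_univ,
            if_true]
          rw [mul_conj, normSq_eq_norm_sq]
          push_cast
          ring
  exact_mod_cast h3

/-- A mean value theorem for Dirichlet polynomials twisted by all characters modulo `q`. -/
theorem sum_char_mean_square_le {q : ℕ} [NeZero q] (S : Finset ℕ) (a : ℕ → ℂ) (w : ℕ → ℝ)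
    (hw : ∀ n, 0 ≤ w n) {δ T : ℝ} (hδ : 0 < δ) (hT : 0 ≤ T) (hδT : δ * T ≤ 1)
    (h : ∀ y : ℝ, ∀ b : (ZMod q)ˣ,
      q.totient * ‖∑ n ∈ S.filter (fun n : ℕ => (y < Real.log n ∧ Real.log n ≤ y + δ) ∧ (n : ZMod q) = b), a n‖ ^ 2
        ≤ δ * ∑ n ∈ S.filter (fun n : ℕ => (y < Real.log n ∧ Real.log n ≤ y + δ) ∧ (n : ZMod q) = b), w n) :
    ∑ χ : DirichletCharacter ℂ q, ∫ t in -T..T,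
        ‖∑ n ∈ S, a n * χ (n : ZMod q) * cexp (-(I * t * Real.log n))‖ ^ 2
      ≤ 2 * π / (1 - (δ * T) ^ 2 / 2) ^ 2 * ∑ n ∈ S, w n := by
  classical
  have hpos : 0 < 1 - (δ * T) ^ 2 / 2 := by
    have : (δ * T) ^ 2 ≤ 1 := pow_le_one₀ (by positivity) hδT
    linarith
  refine (sum_le_sum fun χ _ => gallagher S (fun n => a n * χ (n : ZMod q)) hδ hT
    hδT).trans ?_
  rw [← mul_sum, ← integral_finsetSum _ fun χ _ => integrable_norm_sq_windowSum _ _ _]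
  have key : ∀ y, ∑ χ : DirichletCharacter ℂ q,
      ‖windowSum S δ (fun n => a n * χ (n : ZMod q)) y‖ ^ 2 ≤ δ * windowSum S δ w y := by
    intro y
    simp only [windowSum]
    rw [sum_norm_sq_char_sum, mul_sum]
    simp_rw [filter_filter]
    refine (sum_le_sum fun b _ => h y b).trans ?_
    rw [← mul_sum]
    gcongr
    have : ∀ b : (ZMod q)ˣ, ∑ n ∈ S.filter (fun n : ℕ => (y < Real.log n ∧
        Real.log n ≤ y + δ) ∧ (n : ZMod q) = b), w n =
        ∑ n ∈ S.filter (fun n : ℕ => y < Real.log n ∧ Real.log n ≤ y + δ),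
          if (n : ZMod q) = b then w n else 0 := by
      intro b
      rw [← filter_filter, sum_filter]
    simp_rw [this]
    rw [sum_comm]
    refine sum_le_sum fun n _ => ?_
    by_cases hn : IsUnit (n : ZMod q)
    · obtain ⟨u, hu⟩ := hn
      rw [sum_eq_single u]
      · simp [hu]
      · intro b _ hb
        rw [if_neg]
        rw [← hu]
        exact fun h => hb (Units.ext h.symm)
      · simp
    · rw [sum_eq_zero]
      · exact hw n
      intro b _
      rw [if_neg]
      rintro h
      exact hn (h ▸ b.isUnit)
  have hint : ∫ y, ∑ χ : DirichletCharacter ℂ q,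
      ‖windowSum S δ (fun n => a n * χ (n : ZMod q)) y‖ ^ 2 ≤ δ * (δ * ∑ n ∈ S, w n) := by
    rw [← integral_windowSum S hδ.le, ← integral_const_mul]
    exact integral_mono (integrable_finsetSum _ fun χ _ => integrable_norm_sq_windowSum _ _ _)
      ((integrable_windowSum S δ w).const_mul _) key
  calc _ ≤ 2 * π / (δ * (1 - (δ * T) ^ 2 / 2)) ^ 2 * (δ * (δ * ∑ n ∈ S, w n)) := by gcongr
    _ = _ := by field_simp

/-- The Gaussian weight `exp (sℓ + η²s²/2)`. -/
noncomputable def gaussWeight (η ℓ : ℝ) (s : ℂ) : ℂ := cexp (s * ℓ + η ^ 2 * s ^ 2 / 2)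

lemma norm_gaussWeight (η ℓ : ℝ) (s : ℂ) :
    ‖gaussWeight η ℓ s‖ = Real.exp (s.re * ℓ + η ^ 2 * (s.re ^ 2 - s.im ^ 2) / 2) := by
  rw [gaussWeight, norm_exp]
  congr 1
  simp [sq]

lemma differentiable_gaussWeight (η ℓ : ℝ) : Differentiable ℂ (gaussWeight η ℓ) := by
  unfold gaussWeight; fun_prop

lemma norm_gaussWeight_line (η ℓ c t : ℝ) :
    ‖gaussWeight η ℓ (c + t * I)‖
      = Real.exp (c * ℓ + η ^ 2 * c ^ 2 / 2) * Real.exp (-(η ^ 2 / 2) * t ^ 2) := by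
  rw [norm_gaussWeight, ← Real.exp_add]
  congr 1
  simp
  ring

lemma continuous_gaussWeight_line (η ℓ c : ℝ) :
    Continuous fun t : ℝ => gaussWeight η ℓ (c + t * I) :=
  (differentiable_gaussWeight η ℓ).continuous.comp (by fun_prop)

lemma integrable_gaussWeight_line {η : ℝ} (hη : 0 < η) (ℓ c : ℝ) :
    Integrable fun t : ℝ => gaussWeight η ℓ (c + t * I) := by
  refine Integrable.mono'
    ((integrable_exp_neg_mul_sq (b := η ^ 2 / 2) (by positivity)).const_mul
      (Real.exp (c * ℓ + η ^ 2 * c ^ 2 / 2)))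
    (continuous_gaussWeight_line η ℓ c).aestronglyMeasurable
    (Filter.Eventually.of_forall fun t => ?_)
  rw [norm_gaussWeight_line]

lemma integral_gaussWeight_line {η : ℝ} (hη : 0 < η) (ℓ c : ℝ) :
    ∫ t : ℝ, gaussWeight η ℓ (c + t * I)
      = ((√(2 * π) / η * Real.exp (-ℓ ^ 2 / (2 * η ^ 2)) : ℝ) : ℂ) := by
  have hb : (-(η ^ 2 / 2 : ℝ) : ℂ).re < 0 := by
    rw [neg_re, ofReal_re]
    have : 0 < η ^ 2 / 2 := by positivity
    linarith
  have h := integral_cexp_quadratic hb (I * (ℓ + η ^ 2 * c)) (c * ℓ + η ^ 2 * c ^ 2 / 2)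
  have e : ∀ t : ℝ, gaussWeight η ℓ (c + t * I) = cexp (-((η ^ 2 / 2 : ℝ) : ℂ) * t ^ 2
      + I * (ℓ + η ^ 2 * c) * t + (c * ℓ + η ^ 2 * c ^ 2 / 2)) := by
    intro t
    rw [gaussWeight]
    congr 1
    push_cast
    linear_combination (η ^ 2 * t ^ 2 / 2 : ℂ) * I_sq
  simp_rw [e]
  rw [h]
  have hη' : (η : ℂ) ≠ 0 := by exact_mod_cast hη.ne'
  push_cast
  congr 1
  · rw [neg_neg, show (π : ℂ) / (η ^ 2 / 2) = ((2 * π / η ^ 2 : ℝ) : ℂ) by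
      push_cast; field_simp, show (1 / 2 : ℂ) = ((1 / 2 : ℝ) : ℂ) by push_cast; rfl,
      ← ofReal_cpow (by positivity), ← Real.sqrt_eq_rpow, Real.sqrt_div' _ (by positivity),
      Real.sqrt_sq hη.le]
    push_cast
    rfl
  · congr 1
    field_simp
    linear_combination ((ℓ + η ^ 2 * c : ℂ) ^ 2 * 4) * I_sq

lemma gaussWeight_mul_cexp (η ℓ v : ℝ) (s : ℂ) :
    gaussWeight η ℓ s * cexp (-(s * v)) = gaussWeight η (ℓ - v) s := by
  rw [gaussWeight, gaussWeight, ← exp_add]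
  congr 1
  push_cast
  ring

lemma integrable_exp_mul_gaussian {η : ℝ} (hη : 0 < η) (ℓ β : ℝ) :
    Integrable fun v : ℝ => Real.exp (β * v) * Real.exp (-(ℓ - v) ^ 2 / (2 * η ^ 2)) := by
  have h := ((integrable_exp_neg_mul_sq (b := (2 * η ^ 2)⁻¹) (by positivity)).comp_sub_right
    (ℓ + η ^ 2 * β)).const_mul (Real.exp (β * ℓ + η ^ 2 * β ^ 2 / 2))
  refine h.congr (Filter.Eventually.of_forall fun v => ?_)
  simp only
  rw [← Real.exp_add, ← Real.exp_add]
  congr 1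
  field_simp
  ring

lemma integral_exp_mul_gaussian {η : ℝ} (hη : 0 < η) (ℓ β : ℝ) :
    ∫ v : ℝ, Real.exp (β * v) * Real.exp (-(ℓ - v) ^ 2 / (2 * η ^ 2))
      = √(2 * π) * η * Real.exp (β * ℓ + η ^ 2 * β ^ 2 / 2) := by
  have h : ∀ v : ℝ, Real.exp (β * v) * Real.exp (-(ℓ - v) ^ 2 / (2 * η ^ 2))
      = Real.exp (-(2 * η ^ 2)⁻¹ * (v - (ℓ + η ^ 2 * β)) ^ 2) *
        Real.exp (β * ℓ + η ^ 2 * β ^ 2 / 2) := by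
    intro v
    rw [← Real.exp_add, ← Real.exp_add]
    congr 1
    field_simp
    ring
  simp_rw [h]
  rw [integral_mul_const, integral_sub_right_eq_self (fun v => Real.exp (-(2 * η ^ 2)⁻¹ * v ^ 2)),
    integral_gaussian, show π / (2 * η ^ 2)⁻¹ = 2 * π * η ^ 2 by field_simp,
    Real.sqrt_mul' _ (by positivity), Real.sqrt_sq hη.le]

/-- The contribution of a simple pole at `ρ` to the Gaussian-weighted integral. -/
lemma integral_gaussWeight_div {η c : ℝ} (hη : 0 < η) (ℓ : ℝ) {ρ : ℂ} (hρ : ρ.re < c) :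
    ∫ t : ℝ, (1 / (c + t * I - ρ)) * gaussWeight η ℓ (c + t * I)
      = ((√(2 * π) / η : ℝ) : ℂ) *
        ∫ v in Set.Ioi (0 : ℝ), cexp (ρ * v) * ((Real.exp (-(ℓ - v) ^ 2 / (2 * η ^ 2)) : ℝ) : ℂ) := by
  have h1 : ∀ t : ℝ, (1 / (c + t * I - ρ)) * gaussWeight η ℓ (c + t * I)
      = ∫ v in Set.Ioi (0 : ℝ), cexp (-(c + t * I - ρ) * v) * gaussWeight η ℓ (c + t * I) := by
    intro t
    rw [integral_mul_const]
    congr 1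
    have := integral_exp_mul_complex_Ioi (a := -(c + t * I - ρ)) (by simp; linarith) 0
    rw [this]
    simp
    rw [← neg_sub, inv_neg, neg_div, one_div]
  simp_rw [h1]
  have hint : Integrable (Function.uncurry fun (t v : ℝ) =>
      cexp (-(c + t * I - ρ) * v) * gaussWeight η ℓ (c + t * I))
      (volume.prod (volume.restrict (Set.Ioi 0))) := by
    have hv : Integrable (fun v : ℝ => Real.exp (-(c - ρ.re) * v)) (volume.restrict (Set.Ioi 0)) :=
      integrableOn_exp_mul_Ioi (by linarith) 0
    refine Integrable.mono' ((integrable_gaussWeight_line hη ℓ c).norm.mul_prod hv) ?_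
      (Filter.Eventually.of_forall fun p => ?_)
    · refine Continuous.aestronglyMeasurable ?_
      refine Continuous.mul (by fun_prop) ((continuous_gaussWeight_line η ℓ c).comp continuous_fst)
    · simp only [Function.uncurry]
      rw [norm_mul, mul_comm, norm_exp]
      simp
  rw [integral_integral_swap hint, ← integral_const_mul]
  refine setIntegral_congr_fun measurableSet_Ioi fun v _ => ?_
  have h2 : ∀ t : ℝ, cexp (-(c + t * I - ρ) * v) * gaussWeight η ℓ (c + t * I)
      = cexp (ρ * v) * gaussWeight η (ℓ - v) (c + t * I) := by
    intro t
    rw [← gaussWeight_mul_cexp, mul_left_comm, ← exp_add, mul_comm]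
    congr 2
    ring
  simp_rw [h2]
  rw [integral_const_mul, integral_gaussWeight_line hη]
  push_cast
  ring

lemma norm_integral_gaussWeight_div_le {η c : ℝ} (hη : 0 < η) (ℓ : ℝ) {ρ : ℂ} (hρ : ρ.re < c) :
    ‖∫ t : ℝ, (1 / (c + t * I - ρ)) * gaussWeight η ℓ (c + t * I)‖
      ≤ 2 * π * Real.exp (ρ.re * ℓ + η ^ 2 * ρ.re ^ 2 / 2) := by
  rw [integral_gaussWeight_div hη ℓ hρ, norm_mul, norm_real, Real.norm_of_nonneg
    (by positivity)]
  have h : ‖∫ v in Set.Ioi (0 : ℝ), cexp (ρ * v) *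
      ((Real.exp (-(ℓ - v) ^ 2 / (2 * η ^ 2)) : ℝ) : ℂ)‖
      ≤ √(2 * π) * η * Real.exp (ρ.re * ℓ + η ^ 2 * ρ.re ^ 2 / 2) := by
    rw [← integral_exp_mul_gaussian hη]
    have hi := integrable_exp_mul_gaussian hη ℓ ρ.re
    refine le_trans ?_ (setIntegral_le_integral (s := Set.Ioi 0) hi
      (Filter.Eventually.of_forall fun v => by positivity))
    refine norm_integral_le_of_norm_le hi.integrableOn (Filter.Eventually.of_forall fun v => ?_)
    rw [norm_mul, norm_exp, norm_real, Real.norm_of_nonneg (by positivity)]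
    simp
  refine (mul_le_mul_of_nonneg_left h (by positivity)).trans (le_of_eq ?_)
  have : √(2 * π) * √(2 * π) = 2 * π := Real.mul_self_sqrt (by positivity)
  field_simp
  linear_combination this

section ZeroCounts

variable {f : ℂ → ℂ} {M T : ℝ}

/-- Growth of `f` around the line `Re s = 21/20`, up to height `T`. -/
def LocalGrowth (f : ℂ → ℂ) (M T : ℝ) : Prop :=
  ∀ t : ℝ, |t| ≤ T → f ((21 / 20 : ℝ) + t * I) ≠ 0 ∧ ∀ s : ℂ, dist s ((21 / 20 : ℝ) + t * I) ≤ 1 / 2 →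
    ‖f s‖ ≤ M * ‖f ((21 / 20 : ℝ) + t * I)‖

lemma sum_order_le_of_localGrowth (hf : Differentiable ℂ f) (hM : 1 ≤ M) (hg : LocalGrowth f M T)
    {t : ℝ} (ht : |t| ≤ T) {S : Finset ℂ}
    (hS : ∀ ρ ∈ S, f ρ = 0 ∧ dist ρ ((21 / 20 : ℝ) + t * I) ≤ 2 / 5) :
    ∑ ρ ∈ S, (analyticOrderNatAt f ρ : ℝ) ≤ 5 * Real.log M := by
  obtain ⟨h0, h1⟩ := hg t ht
  have h := sum_order_le hf (by norm_num) (by norm_num : (2 / 5 : ℝ) < 1 / 2) h0 h1 hS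
  refine h.trans ?_
  have h2 : (1 / 5 : ℝ) ≤ Real.log (1 / 2 / (2 / 5)) := by
    have := Real.one_sub_inv_le_log_of_pos (by norm_num : (0 : ℝ) < 1 / 2 / (2 / 5))
    norm_num at this ⊢
    exact this
  rw [div_le_iff₀ (by linarith)]
  nlinarith [Real.log_nonneg hM]

lemma dist_line_le {ρ : ℂ} {t a : ℝ} (h1 : |ρ.re - 21 / 20| ≤ a) {b : ℝ} (h2 : |ρ.im - t| ≤ b) :
    dist ρ ((21 / 20 : ℝ) + t * I) ^ 2 ≤ a ^ 2 + b ^ 2 := by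
  rw [dist_eq_norm, ← normSq_eq_norm_sq, normSq_apply]
  have e1 : (ρ - ((21 / 20 : ℝ) + t * I)).re = ρ.re - 21 / 20 := by simp
  have e2 : (ρ - ((21 / 20 : ℝ) + t * I)).im = ρ.im - t := by simp
  rw [e1, e2, ← sq, ← sq, ← sq_abs, ← sq_abs (ρ.im - t)]
  gcongr

lemma sum_order_strip_le (hf : Differentiable ℂ f) (hM : 1 ≤ M) (hT : 0 ≤ T)
    (hg : LocalGrowth f M (T + 1)) {S : Finset ℂ}
    (hS : ∀ ρ ∈ S, f ρ = 0 ∧ 9 / 10 ≤ ρ.re ∧ ρ.re ≤ 1 ∧ |ρ.im| ≤ T) :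
    ∑ ρ ∈ S, (analyticOrderNatAt f ρ : ℝ) ≤ (4 * T + 3) * (5 * Real.log M) := by
  set K : ℤ := ⌈2 * T⌉
  have hmaps : ∀ ρ ∈ S, round (2 * ρ.im) ∈ Icc (-K) K := by
    intro ρ hρ
    obtain ⟨-, -, -, h⟩ := hS ρ hρ
    rw [abs_le] at h
    rw [mem_Icc, round_eq]
    have hc : 2 * T ≤ K := Int.le_ceil _
    constructor
    · rw [Int.le_floor]; push_cast; linarith
    · rw [← Int.lt_add_one_iff, Int.floor_lt]
      push_cast; linarith
  rw [← sum_fiberwise_of_maps_to hmaps]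
  have hj : ∀ j ∈ Icc (-K) K,
      ∑ ρ ∈ S with round (2 * ρ.im) = j, (analyticOrderNatAt f ρ : ℝ) ≤ 5 * Real.log M := by
    intro j hj
    rw [mem_Icc] at hj
    refine sum_order_le_of_localGrowth hf hM hg (t := j / 2) ?_ ?_
    · have hc : (K : ℝ) < 2 * T + 1 := Int.ceil_lt_add_one _
      have h1 : (j : ℝ) ≤ K := by exact_mod_cast hj.2
      have h2 : -(K : ℝ) ≤ j := by exact_mod_cast hj.1
      rw [abs_le]; constructor <;> linarith
    · intro ρ hρ
      rw [mem_filter] at hρ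
      obtain ⟨h0, h1, h2, -⟩ := hS ρ hρ.1
      refine ⟨h0, ?_⟩
      have h3 : |ρ.im - (j / 2 : ℝ)| ≤ 1 / 4 := by
        have := abs_sub_round (2 * ρ.im)
        rw [hρ.2, abs_le] at this
        rw [abs_le]; constructor <;> linarith
      have h4 := dist_line_le (ρ := ρ) (a := 3 / 20) (by rw [abs_le]; constructor <;> linarith) h3
      push_cast at h4 ⊢
      refine abs_le_of_sq_le_sq' (h4.trans (by norm_num)) (by norm_num) |>.2
  refine (sum_le_sum hj).trans ?_
  rw [sum_const, nsmul_eq_mul]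
  have hlog := Real.log_nonneg hM
  gcongr
  have hc : (K : ℝ) < 2 * T + 1 := Int.ceil_lt_add_one _
  have hK0 : 0 ≤ K := Int.ceil_nonneg (by linarith)
  have : ((Icc (-K) K).card : ℝ) = 2 * K + 1 := by
    rw [Int.card_Icc]
    have : ((K + 1 - -K).toNat : ℤ) = 2 * K + 1 := by rw [Int.toNat_of_nonneg (by linarith)]; ring
    exact_mod_cast this
  rw [this]; linarith

lemma logDeriv_eq_sum_add {g : ℂ → ℂ} {Z : Finset ℂ} {m : ℂ → ℕ} (hg : Differentiable ℂ g)
    (hfg : ∀ s, f s = (∏ ρ ∈ Z, (s - ρ) ^ m ρ) * g s) {s : ℂ} (hs : ∀ ρ ∈ Z, s ≠ ρ)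
    (hgs : g s ≠ 0) :
    logDeriv f s = ∑ ρ ∈ Z, (m ρ : ℂ) * (1 / (s - ρ)) + logDeriv g s := by
  have hsρ : ∀ ρ ∈ Z, s - ρ ≠ 0 := fun ρ hρ => sub_ne_zero.mpr (hs ρ hρ)
  have hP : ∏ ρ ∈ Z, (s - ρ) ^ m ρ ≠ 0 :=
    prod_ne_zero_iff.mpr fun ρ hρ => pow_ne_zero _ (hsρ ρ hρ)
  have hPd : DifferentiableAt ℂ (fun s => ∏ ρ ∈ Z, (s - ρ) ^ m ρ) s := by fun_prop
  have : f = fun s => (∏ ρ ∈ Z, (s - ρ) ^ m ρ) * g s := funext hfg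
  nth_rw 1 [this]
  rw [logDeriv_mul s hP hgs hPd (hg s)]
  congr 1
  rw [logDeriv_prod (f := fun ρ s => (s - ρ) ^ m ρ)
    (fun ρ hρ => pow_ne_zero _ (hsρ ρ hρ)) (fun ρ hρ => by fun_prop)]
  refine sum_congr rfl fun ρ hρ => ?_
  rw [logDeriv_fun_pow (by fun_prop), logDeriv_apply]
  simp

/-- If `Z` holds all zeros of `f` in a box, then the zero-free cofactor has small logarithmic
derivative. -/
theorem norm_logDeriv_cofactor_le (hf : Differentiable ℂ f) (hM : 1 < M) (hT : 0 ≤ T)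
    (hg : LocalGrowth f M (T + 2)) {Z : Finset ℂ}
    (hZ : ∀ ρ, ρ ∈ Z ↔ f ρ = 0 ∧ 9 / 10 ≤ ρ.re ∧ |ρ.im| ≤ T + 1) (hre : ∀ ρ ∈ Z, ρ.re ≤ 1)
    {g : ℂ → ℂ} (hgd : Differentiable ℂ g)
    (hfg : ∀ s, f s = (∏ ρ ∈ Z, (s - ρ) ^ analyticOrderNatAt f ρ) * g s)
    (hgZ : ∀ ρ ∈ Z, g ρ ≠ 0) {s : ℂ} (h1 : 47 / 50 ≤ s.re) (h2 : s.re ≤ 11 / 10)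
    (h3 : |s.im| ≤ T) :
    g s ≠ 0 ∧ ‖logDeriv g s‖ ≤ (80 * T + 400) * Real.log M := by
  have hlog := Real.log_pos hM
  have hne : ∀ s : ℂ, 9 / 10 ≤ s.re → |s.im| ≤ T + 1 → g s ≠ 0 := by
    intro s h1 h2 h0
    by_cases hs : s ∈ Z
    · exact hgZ s hs h0
    · refine hs ((hZ s).mpr ⟨?_, h1, h2⟩)
      rw [hfg, h0, mul_zero]
  have hN : ∑ ρ ∈ Z, (analyticOrderNatAt f ρ : ℝ) ≤ (4 * (T + 1) + 3) * (5 * Real.log M) :=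
    sum_order_strip_le hf hM.le (by linarith) (by convert hg using 1; ring) fun ρ hρ =>
      ⟨((hZ ρ).mp hρ).1, ((hZ ρ).mp hρ).2.1, hre ρ hρ, ((hZ ρ).mp hρ).2.2⟩
  have hgs := hne s (by linarith) (by linarith)
  refine ⟨hgs, ?_⟩
  have key : ∀ s : ℂ, 93 / 100 < s.re → s.re < 111 / 100 → |s.im| < T + 1 / 2 → f s ≠ 0 →
      ‖logDeriv g s‖ ≤ (80 * T + 400) * Real.log M := by
    intro s h1 h2 h3 hfs
    have ht : |s.im| ≤ T + 2 := by linarith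
    obtain ⟨hc, hMc⟩ := hg s.im ht
    set c : ℂ := (21 / 20 : ℝ) + s.im * I with hcdef
    obtain ⟨Y, hY⟩ := exists_zeros_finset hf hc c (2 / 5)
    have hsc : dist s c ≤ 12 / 100 := by
      have := dist_line_le (ρ := s) (t := s.im) (a := 12 / 100)
        (by rw [abs_le]; constructor <;> linarith) (b := 0) (by simp)
      exact abs_le_of_sq_le_sq' (this.trans (by norm_num)) (by norm_num) |>.2
    have hb := norm_logDeriv_sub_sum_le hf (by norm_num : (0 : ℝ) < 2 / 5) hc hM
      (fun s hs => hMc s (by linarith)) hY (s := s) (by linarith) hfs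
    have hYc : ∑ ρ ∈ Y, (analyticOrderNatAt f ρ : ℝ) ≤ 5 * Real.log M :=
      sum_order_le_of_localGrowth hf hM.le hg ht fun ρ hρ => (hY ρ).mp hρ
    have hgs := hne s (by linarith) (by linarith)
    have e := logDeriv_eq_sum_add hgd hfg (s := s) (fun ρ hρ h => by
      rw [h] at hfs; exact hfs ((hZ ρ).mp hρ).1) hgs
    have e2 : logDeriv g s = (logDeriv f s - ∑ ρ ∈ Y, (analyticOrderNatAt f ρ : ℂ) * (1 / (s - ρ)))
        + (∑ ρ ∈ Y \ Z, (analyticOrderNatAt f ρ : ℂ) * (1 / (s - ρ))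
          - ∑ ρ ∈ Z \ Y, (analyticOrderNatAt f ρ : ℂ) * (1 / (s - ρ))) := by
      rw [sum_sdiff_sub_sum_sdiff, e]
      ring
    rw [e2]
    have b1 : ‖∑ ρ ∈ Y \ Z, (analyticOrderNatAt f ρ : ℂ) * (1 / (s - ρ))‖
        ≤ 34 * (5 * Real.log M) := by
      refine (norm_sum_le _ _).trans ?_
      refine le_trans ?_ (mul_le_mul_of_nonneg_left hYc (by norm_num))
      rw [mul_sum]
      refine (sum_le_sum fun ρ hρ => ?_).trans (sum_le_sum_of_subset_of_nonneg
        sdiff_subset fun _ _ _ => by positivity)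
      rw [mem_sdiff, hY, hZ] at hρ
      obtain ⟨⟨h0, hd⟩, hn⟩ := hρ
      have him : |ρ.im - s.im| ≤ 2 / 5 := by
        refine le_trans ?_ hd
        rw [dist_eq_norm]
        refine le_trans (le_of_eq ?_) (abs_im_le_norm _)
        simp [hcdef]
      have him2 : |ρ.im| ≤ T + 1 := by
        have := abs_sub_abs_le_abs_sub ρ.im s.im
        linarith
      have hre : ρ.re < 9 / 10 := by
        by_contra! h
        exact hn ⟨h0, h, him2⟩
      have hd3 : 3 / 100 ≤ ‖s - ρ‖ := by
        refine le_trans ?_ (re_le_norm _)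
        rw [sub_re]; linarith
      rw [norm_mul, norm_natCast, norm_div, norm_one, mul_comm]
      gcongr
      rw [div_le_iff₀ (by linarith)]
      linarith
    have b2 : ‖∑ ρ ∈ Z \ Y, (analyticOrderNatAt f ρ : ℂ) * (1 / (s - ρ))‖
        ≤ 4 * ((4 * (T + 1) + 3) * (5 * Real.log M)) := by
      refine (norm_sum_le _ _).trans ?_
      refine le_trans ?_ (mul_le_mul_of_nonneg_left hN (by norm_num))
      rw [mul_sum]
      refine (sum_le_sum fun ρ hρ => ?_).trans (sum_le_sum_of_subset_of_nonneg
        sdiff_subset fun _ _ _ => by positivity)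
      rw [mem_sdiff, hY, hZ] at hρ
      obtain ⟨⟨h0, -⟩, hn⟩ := hρ
      have hd : 2 / 5 < dist ρ c := by
        by_contra! h
        exact hn ⟨h0, h⟩
      have hd3 : 1 / 4 ≤ ‖s - ρ‖ := by
        rw [← dist_eq_norm, dist_comm]
        linarith [dist_triangle ρ s c]
      rw [norm_mul, norm_natCast, norm_div, norm_one, mul_comm]
      gcongr
      rw [div_le_iff₀ (by linarith)]
      linarith
    rw [← sum_mul] at hb
    refine (norm_add_le _ _).trans ((add_le_add hb (norm_sub_le _ _)).trans ?_)
    have : (∑ ρ ∈ Y, (analyticOrderNatAt f ρ : ℝ)) * (2 / (2 / 5)) ≤ 5 * Real.log M * 5 := by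
      norm_num; linarith
    linarith
  have hf0 : f ((21 / 20 : ℝ) + (0 : ℝ) * I) ≠ 0 := (hg 0 (by simp; linarith)).1
  have hev : ∀ᶠ z in nhdsWithin s {s}ᶜ, f z ≠ 0 := by
    rcases (hf.analyticAt s).eventually_eq_zero_or_eventually_ne_zero with h | h
    · have := (AnalyticOnNhd.eqOn_zero_of_preconnected_of_eventuallyEq_zero
        (fun z _ => hf.analyticAt z) isPreconnected_univ (Set.mem_univ s) h)
        (Set.mem_univ ((21 / 20 : ℝ) + (0 : ℝ) * I))
      exact absurd this hf0
    · exact h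
  have hopen : ∀ᶠ z in nhdsWithin s {s}ᶜ, 93 / 100 < z.re ∧ z.re < 111 / 100 ∧
      |z.im| < T + 1 / 2 := by
    refine nhdsWithin_le_nhds ?_
    have a1 := continuous_re.continuousAt (x := s) |>.eventually
      (lt_mem_nhds (by linarith : 93 / 100 < s.re))
    have a2 := continuous_re.continuousAt (x := s) |>.eventually
      (gt_mem_nhds (by linarith : s.re < 111 / 100))
    have a3 := (continuous_abs.comp continuous_im).continuousAt (x := s) |>.eventually
      (gt_mem_nhds (by simp only [Function.comp]; linarith : (abs ∘ im) s < T + 1 / 2))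
    filter_upwards [a1, a2, a3] with z h1 h2 h3 using ⟨h1, h2, h3⟩
  have hcont : ContinuousAt (fun z => ‖logDeriv g z‖) s := by
    have hd : ContinuousAt (deriv g) s :=
      (hgd.analyticAt s).deriv.continuousAt
    exact (hd.div hgd.continuous.continuousAt hgs).norm
  have hl : Filter.Tendsto (fun z => ‖logDeriv g z‖) (nhdsWithin s {s}ᶜ) (nhds ‖logDeriv g s‖) :=
    hcont.tendsto.mono_left nhdsWithin_le_nhds
  refine le_of_tendsto hl ?_
  filter_upwards [hev, hopen] with z hz hz2 using key z hz2.1 hz2.2.1 hz2.2.2 hz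

end ZeroCounts

lemma norm_integral_tail_le {G : ℝ → ℂ} {η T D A : ℝ} (hη : 0 < η) (hT : 0 ≤ T) (hD : 0 ≤ D)
    (hG : ∀ t, ‖G t‖ ≤ D * (Real.exp A * Real.exp (-(η ^ 2 / 2) * t ^ 2))) :
    ‖∫ t in (Set.Ioc (-T) T)ᶜ, G t‖
      ≤ D * Real.exp A * Real.exp (-(η ^ 2 / 4) * T ^ 2) * (4 / η) := by
  have hi : Integrable fun t : ℝ => D * Real.exp A * Real.exp (-(η ^ 2 / 4) * T ^ 2) *
      Real.exp (-(η ^ 2 / 4) * t ^ 2) :=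
    (integrable_exp_neg_mul_sq (by positivity)).const_mul _
  have h1 : ‖∫ t in (Set.Ioc (-T) T)ᶜ, G t‖ ≤ ∫ t in (Set.Ioc (-T) T)ᶜ,
      D * Real.exp A * Real.exp (-(η ^ 2 / 4) * T ^ 2) * Real.exp (-(η ^ 2 / 4) * t ^ 2) := by
    refine norm_integral_le_of_norm_le hi.integrableOn ?_
    refine (ae_restrict_iff' measurableSet_Ioc.compl).mpr (Filter.Eventually.of_forall fun t ht => ?_)
    refine (hG t).trans ?_
    have hT2 : T ^ 2 ≤ t ^ 2 := by
      rw [Set.mem_compl_iff, Set.mem_Ioc, not_and_or, not_lt, not_le] at ht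
      rcases ht with h | h <;> nlinarith
    rw [← mul_assoc, mul_assoc _ (Real.exp (-(η ^ 2 / 4) * T ^ 2)), ← Real.exp_add]
    gcongr
    nlinarith [sq_nonneg η]
  refine h1.trans ((setIntegral_le_integral hi (Filter.Eventually.of_forall fun t => by
    positivity)).trans ?_)
  rw [integral_const_mul, integral_gaussian]
  gcongr
  rw [Real.sqrt_le_left (by positivity), div_pow, div_div_eq_mul_div]
  gcongr
  nlinarith [Real.pi_lt_four]

theorem explicit_formula {f : ℂ → ℂ} (hf : Differentiable ℂ f) {M T : ℝ} (hM : 1 < M) (hT : 0 ≤ T)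
    (hgr : LocalGrowth f M (T + 2)) {Z : Finset ℂ}
    (hZ : ∀ ρ, ρ ∈ Z ↔ f ρ = 0 ∧ 9 / 10 ≤ ρ.re ∧ |ρ.im| ≤ T + 1) (hre : ∀ ρ ∈ Z, ρ.re ≤ 1)
    {c : ℝ} (hc : 1 < c) (hc' : c ≤ 11 / 10) {B' : ℝ} (hfc : ∀ t : ℝ, f (c + t * I) ≠ 0)
    (hB' : ∀ t : ℝ, ‖logDeriv f (c + t * I)‖ ≤ B') {η ℓ : ℝ} (hη : 0 < η)
    (hℓ : 0 ≤ ℓ) {B : ℝ} (hB : (80 * T + 400) * Real.log M ≤ B) :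
    ‖∫ t : ℝ, logDeriv f (c + t * I) * gaussWeight η ℓ (c + t * I)‖
      ≤ 2 * Real.pi * ∑ ρ ∈ Z, (analyticOrderNatAt f ρ : ℝ) *
          Real.exp (ρ.re * ℓ + η ^ 2 * ρ.re ^ 2 / 2)
        + (2 * T * B * Real.exp (47 / 50 * ℓ + η ^ 2)
          + B * Real.exp (c * ℓ + η ^ 2 - η ^ 2 / 4 * T ^ 2)
          + (B' + B / (c - 1)) * Real.exp (c * ℓ + η ^ 2 - η ^ 2 / 4 * T ^ 2) * (4 / η)) := by
  obtain ⟨g, hgd, hgZ, hfg⟩ := exists_entire_factor_finset hf (hfc 0) Z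
  set m : ℂ → ℕ := analyticOrderNatAt f
  have hlog := Real.log_pos hM
  have hB0 : 0 ≤ B := le_trans (by positivity) hB
  have hB'0 : 0 ≤ B' := (norm_nonneg _).trans (hB' 0)
  have hcof : ∀ s : ℂ, 47 / 50 ≤ s.re → s.re ≤ 11 / 10 → |s.im| ≤ T →
      g s ≠ 0 ∧ ‖logDeriv g s‖ ≤ B := fun s h1 h2 h3 => by
    have := norm_logDeriv_cofactor_le hf hM hT hgr hZ hre hgd hfg hgZ h1 h2 h3
    exact ⟨this.1, this.2.trans hB⟩
  have hN : ∑ ρ ∈ Z, (m ρ : ℝ) ≤ B := by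
    refine (sum_order_strip_le hf hM.le (T := T + 1) (by linarith) (by convert hgr using 1; ring)
      fun ρ hρ => ⟨((hZ ρ).mp hρ).1, ((hZ ρ).mp hρ).2.1, hre ρ hρ, ((hZ ρ).mp hρ).2.2⟩).trans
      (le_trans ?_ hB)
    nlinarith
  have hgc : ∀ t : ℝ, g (c + t * I) ≠ 0 := fun t h => hfc t (by rw [hfg, h, mul_zero])
  have hcρ : ∀ ρ ∈ Z, ∀ t : ℝ, (c + t * I : ℂ) ≠ ρ := fun ρ hρ t h => by
    have := hfc t
    rw [h] at this
    exact this ((hZ ρ).mp hρ).1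
  have hline : Continuous fun t : ℝ => (c + t * I : ℂ) := by fun_prop
  have hdec : ∀ t : ℝ, logDeriv f (c + t * I) * gaussWeight η ℓ (c + t * I)
      = ∑ ρ ∈ Z, (m ρ : ℂ) * (1 / (c + t * I - ρ) * gaussWeight η ℓ (c + t * I))
        + logDeriv g (c + t * I) * gaussWeight η ℓ (c + t * I) := by
    intro t
    rw [logDeriv_eq_sum_add hgd hfg (fun ρ hρ => hcρ ρ hρ t) (hgc t), add_mul, sum_mul]
    simp_rw [mul_assoc]
  have hpole : ∀ ρ ∈ Z, ∀ t : ℝ, ‖1 / (c + t * I - ρ)‖ ≤ 1 / (c - 1) := by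
    intro ρ hρ t
    rw [norm_div, norm_one]
    have : c - 1 ≤ ‖(c + t * I - ρ : ℂ)‖ := by
      refine le_trans ?_ (re_le_norm _)
      have := hre ρ hρ
      simp; linarith
    have hc1 : 0 < c - 1 := by linarith
    gcongr
  have hipole : ∀ ρ ∈ Z, Integrable fun t : ℝ =>
      1 / (c + t * I - ρ) * gaussWeight η ℓ (c + t * I) := by
    intro ρ hρ
    refine (integrable_gaussWeight_line hη ℓ c).bdd_mul (c := 1 / (c - 1)) ?_
      (Filter.Eventually.of_forall fun t => hpole ρ hρ t)
    refine Continuous.aestronglyMeasurable ?_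
    exact continuous_const.div (hline.sub continuous_const)
      fun t => sub_ne_zero.mpr (hcρ ρ hρ t)
  have hgb : ∀ t : ℝ, ‖logDeriv g (c + t * I)‖ ≤ B' + B / (c - 1) := by
    intro t
    have e := logDeriv_eq_sum_add hgd hfg (fun ρ hρ => hcρ ρ hρ t) (hgc t)
    rw [eq_sub_of_add_eq' e.symm]
    refine (norm_sub_le _ _).trans (add_le_add (hB' t) ?_)
    refine (norm_sum_le _ _).trans ?_
    rw [div_eq_mul_one_div]
    have hc1 : 0 ≤ 1 / (c - 1) := by have : 0 < c - 1 := by linarith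
                                     positivity
    refine le_trans ?_ (mul_le_mul_of_nonneg_right hN hc1)
    rw [sum_mul]
    refine sum_le_sum fun ρ hρ => ?_
    rw [norm_mul, norm_natCast]
    gcongr
    exact hpole ρ hρ t
  have hgcont : Continuous fun t : ℝ => logDeriv g (c + t * I) := by
    refine Continuous.div ?_ (hgd.continuous.comp hline) hgc
    exact (hgd.deriv.continuous).comp hline
  have hig : Integrable fun t : ℝ => logDeriv g (c + t * I) * gaussWeight η ℓ (c + t * I) :=
    (integrable_gaussWeight_line hη ℓ c).bdd_mul (c := B' + B / (c - 1))
      hgcont.aestronglyMeasurable (Filter.Eventually.of_forall hgb)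
  simp_rw [hdec]
  rw [integral_add (integrable_finsetSum _ fun ρ hρ => (hipole ρ hρ).const_mul _) hig,
    integral_finsetSum _ fun ρ hρ => (hipole ρ hρ).const_mul _]
  refine (norm_add_le _ _).trans (add_le_add ?_ ?_)
  · rw [mul_sum]
    refine (norm_sum_le _ _).trans (sum_le_sum fun ρ hρ => ?_)
    rw [integral_const_mul, norm_mul, norm_natCast, mul_left_comm]
    gcongr
    exact norm_integral_gaussWeight_div_le hη ℓ (lt_of_le_of_lt (hre ρ hρ) hc)
  have hc1 : 0 < c - 1 := by linarith
  rw [← integral_add_compl (measurableSet_Ioc (a := -T) (b := T)) hig]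
  refine (norm_add_le _ _).trans (add_le_add ?_ ?_)
  swap
  · refine (norm_integral_tail_le hη hT (by positivity : 0 ≤ B' + B / (c - 1))
      (A := c * ℓ + η ^ 2 * c ^ 2 / 2) fun t => ?_).trans ?_
    · rw [norm_mul, norm_gaussWeight_line]
      gcongr
      exact hgb t
    · rw [mul_assoc (B' + B / (c - 1)), ← Real.exp_add]
      gcongr
      have hc2 : c ^ 2 ≤ 2 := by nlinarith
      nlinarith [mul_nonneg (sq_nonneg η) (sub_nonneg.mpr hc2)]
  · rw [← intervalIntegral.integral_of_le (by linarith)]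
    set F : ℂ → ℂ := fun s => logDeriv g s * gaussWeight η ℓ s with hF
    have hFd : DifferentiableOn ℂ F (Set.uIcc (47 / 50 : ℝ) c ×ℂ Set.uIcc (-T) T) := by
      intro s hs
      rw [mem_reProdIm, Set.uIcc_of_le (by linarith), Set.uIcc_of_le (by linarith)] at hs
      have := (hcof s hs.1.1 (hs.1.2.trans hc') (abs_le.mpr hs.2)).1
      refine DifferentiableAt.differentiableWithinAt ?_
      exact ((hgd.deriv s).div (hgd s) this).mul (differentiable_gaussWeight η ℓ s)
    have hrect := integral_boundary_rect_eq_zero_of_differentiableOn F ⟨47 / 50, -T⟩ ⟨c, T⟩ hFd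
    simp only at hrect
    have e : ∫ t in -T..T, F (c + t * I) = (∫ t in -T..T, F ((47 / 50 : ℝ) + t * I))
        + I * ((∫ x in (47 / 50 : ℝ)..c, F (x + ((-T : ℝ) : ℂ) * I))
          - ∫ x in (47 / 50 : ℝ)..c, F (x + (T : ℂ) * I)) := by
      rw [smul_eq_mul, smul_eq_mul] at hrect
      linear_combination (-I) * hrect + ((∫ t in -T..T, F (c + t * I))
        - ∫ t in -T..T, F ((47 / 50 : ℝ) + t * I)) * I_sq
    have hv : ‖∫ t in -T..T, F ((47 / 50 : ℝ) + t * I)‖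
        ≤ 2 * T * B * Real.exp (47 / 50 * ℓ + η ^ 2) := by
      have := intervalIntegral.norm_integral_le_of_norm_le_const (a := -T) (b := T)
        (f := fun t : ℝ => F ((47 / 50 : ℝ) + t * I)) (C := B * Real.exp (47 / 50 * ℓ + η ^ 2)) ?_
      · rw [show T - -T = 2 * T by ring, abs_of_nonneg (by linarith)] at this
        linarith
      · intro t ht
        rw [Set.uIoc_of_le (by linarith)] at ht
        have hb := (hcof ((47 / 50 : ℝ) + t * I) (by simp) (by simp; norm_num)
          (by simpa using abs_le.mpr ⟨ht.1.le, ht.2⟩)).2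
        simp only [hF]
        have e1 : (((47 / 50 : ℝ) : ℂ) + t * I).re = 47 / 50 := by simp
        have e2 : (((47 / 50 : ℝ) : ℂ) + t * I).im = t := by simp
        rw [norm_mul, norm_gaussWeight, e1, e2]
        refine mul_le_mul hb (Real.exp_le_exp.mpr ?_) (Real.exp_pos _).le hB0
        nlinarith [sq_nonneg η, mul_nonneg (sq_nonneg η) (sq_nonneg t)]
    have hh : ∀ τ : ℝ, |τ| = T → ‖∫ x in (47 / 50 : ℝ)..c, F (x + (τ : ℂ) * I)‖
        ≤ 1 / 2 * (B * Real.exp (c * ℓ + η ^ 2 - η ^ 2 / 4 * T ^ 2)) := by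
      intro τ hτ
      have := intervalIntegral.norm_integral_le_of_norm_le_const (a := 47 / 50) (b := c)
        (f := fun x : ℝ => F (x + (τ : ℂ) * I))
        (C := B * Real.exp (c * ℓ + η ^ 2 - η ^ 2 / 4 * T ^ 2)) ?_
      · rw [abs_of_nonneg (by linarith)] at this
        refine this.trans ?_
        rw [mul_comm]
        gcongr
        linarith
      · intro x hx
        rw [Set.uIoc_of_le (by linarith)] at hx
        have hb := (hcof (x + τ * I) (by simpa using hx.1.le) (by simpa using hx.2.trans hc')
          (by simpa using hτ.le)).2
        simp only [hF]
        have e1 : ((x : ℂ) + τ * I).re = x := by simp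
        have e2 : ((x : ℂ) + τ * I).im = τ := by simp
        rw [norm_mul, norm_gaussWeight, e1, e2]
        refine mul_le_mul hb (Real.exp_le_exp.mpr ?_) (Real.exp_pos _).le hB0
        have h2 : τ ^ 2 = T ^ 2 := by rw [← sq_abs, hτ]
        rw [h2]
        have h3 : x ^ 2 ≤ 2 := by nlinarith [hx.1, hx.2]
        nlinarith [sq_nonneg η, mul_nonneg (sq_nonneg η) (sq_nonneg T), hx.1, hx.2,
          mul_nonneg (sq_nonneg η) (by linarith : 0 ≤ 2 - x ^ 2),
          mul_nonneg (by linarith [hx.2] : 0 ≤ c - x) hℓ]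
    rw [show (∫ t in -T..T, logDeriv g (c + t * I) * gaussWeight η ℓ (c + t * I))
      = ∫ t in -T..T, F (c + t * I) from rfl, e]
    refine (norm_add_le _ _).trans (add_le_add hv ?_)
    rw [norm_mul, norm_I, one_mul]
    refine (norm_sub_le _ _).trans ((add_le_add (hh (-T) (by rw [abs_neg, abs_of_nonneg hT]))
      (hh T (abs_of_nonneg hT))).trans (le_of_eq (by ring)))

end LinnikAP

namespace LinnikAP

open MeasureTheory Finset
open Real (exp log)
open ArithmeticFunction (vonMangoldt vonMangoldt_nonneg)

lemma sum_vonMangoldt_mul_div (N : ℕ) :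
    ∑ n ∈ Ioc 0 N, vonMangoldt n * ((N / n : ℕ) : ℝ) = log (N.factorial : ℝ) := by
  rw [← ArithmeticFunction.sum_Ioc_mul_zeta_eq_sum, ArithmeticFunction.vonMangoldt_mul_zeta]
  simp only [ArithmeticFunction.log_apply]
  induction N with
  | zero => simp
  | succ n ih =>
    rw [Nat.factorial_succ, Nat.cast_mul, Real.log_mul (by positivity) (by positivity),
      sum_Ioc_succ_top (by omega), ih, add_comm]

lemma sum_vonMangoldt_div_le {N : ℕ} (hN : 1 ≤ N) :
    ∑ n ∈ Ioc 0 N, vonMangoldt n / n ≤ log N + 6 := by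
  have hN0 : (0 : ℝ) < N := by exact_mod_cast hN
  have h1 := sum_vonMangoldt_mul_div N
  have h2 : log (N.factorial : ℝ) ≤ N * log N := by
    rw [← Real.log_pow]
    exact Real.log_le_log (by positivity) (by exact_mod_cast Nat.factorial_le_pow N)
  have h3 := Chebyshev.psi_le_const_mul_self hN0.le
  rw [Chebyshev.psi, Nat.floor_natCast] at h3
  have h4 : N * ∑ n ∈ Ioc 0 N, vonMangoldt n / n
      ≤ ∑ n ∈ Ioc 0 N, vonMangoldt n * ((N / n : ℕ) : ℝ) + ∑ n ∈ Ioc 0 N, vonMangoldt n := by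
    rw [mul_sum, ← sum_add_distrib]
    refine sum_le_sum fun n hn => ?_
    have : (N : ℝ) / n ≤ ((N / n : ℕ) : ℝ) + 1 := by
      rw [← Nat.floor_div_eq_div (K := ℝ)]
      exact (Nat.lt_floor_add_one _).le
    have := mul_le_mul_of_nonneg_left this (vonMangoldt_nonneg (n := n))
    calc _ = vonMangoldt n * ((N : ℝ) / n) := by ring
      _ ≤ _ := by linarith
  have h5 : log 4 ≤ 2 := by
    rw [show (4 : ℝ) = 2 ^ 2 by norm_num, Real.log_pow]
    have := Real.log_two_lt_d9
    push_cast; linarith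
  have h6 : N * ∑ n ∈ Ioc 0 N, vonMangoldt n / n ≤ N * (log N + 6) := by nlinarith
  exact le_of_mul_le_mul_left h6 hN0

lemma le_sum_vonMangoldt_div {N : ℕ} (hN : 1 ≤ N) :
    log N - 1 ≤ ∑ n ∈ Ioc 0 N, vonMangoldt n / n := by
  have hN0 : (0 : ℝ) < N := by exact_mod_cast hN
  have h1 := sum_vonMangoldt_mul_div N
  have h2 := Stirling.le_log_factorial_stirling (n := N) (by omega)
  have h3 : 0 ≤ log N := Real.log_nonneg (by exact_mod_cast hN)
  have h3' : 0 ≤ log (2 * Real.pi) := Real.log_nonneg (by linarith [Real.pi_gt_three])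
  have h4 : ∑ n ∈ Ioc 0 N, vonMangoldt n * ((N / n : ℕ) : ℝ)
      ≤ N * ∑ n ∈ Ioc 0 N, vonMangoldt n / n := by
    rw [mul_sum]
    refine sum_le_sum fun n hn => ?_
    have : ((N / n : ℕ) : ℝ) ≤ (N : ℝ) / n := Nat.cast_div_le
    have := mul_le_mul_of_nonneg_left this (vonMangoldt_nonneg (n := n))
    calc _ ≤ vonMangoldt n * ((N : ℝ) / n) := this
      _ = _ := by ring
  have h6 : N * (log N - 1) ≤ N * ∑ n ∈ Ioc 0 N, vonMangoldt n / n := by nlinarith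
  exact le_of_mul_le_mul_left h6 hN0

lemma sum_vonMangoldt_div_log_le (S : Finset ℕ) {X v : ℝ} (hX : 0 ≤ X) (hv : X ≤ v) :
    ∑ n ∈ S.filter (fun n : ℕ => X < log n ∧ log n ≤ v), vonMangoldt n / n
      ≤ (v - X) + 8 := by
  have hX1 : 1 ≤ exp X := Real.one_le_exp hX
  have hv1 : 1 ≤ exp v := Real.one_le_exp (hX.trans hv)
  have hfX : 1 ≤ ⌊exp X⌋₊ := (Nat.one_le_floor_iff _).mpr hX1
  have hfv : 1 ≤ ⌊exp v⌋₊ := (Nat.one_le_floor_iff _).mpr hv1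
  have hle : ⌊exp X⌋₊ ≤ ⌊exp v⌋₊ := Nat.floor_mono (Real.exp_le_exp.mpr hv)
  have hsub : S.filter (fun n : ℕ => X < log n ∧ log n ≤ v)
      ⊆ Ioc ⌊exp X⌋₊ ⌊exp v⌋₊ := by
    intro n hn
    obtain ⟨-, h1, h2⟩ := mem_filter.mp hn
    have hn0 : (0 : ℝ) < n := by
      rcases Nat.eq_zero_or_pos n with h | h
      · simp [h] at h1; linarith
      · exact_mod_cast h
    rw [mem_Ioc]
    refine ⟨?_, ?_⟩
    · rw [Nat.floor_lt (Real.exp_pos _).le]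
      exact (Real.lt_log_iff_exp_lt hn0).mp h1
    · exact Nat.le_floor ((Real.log_le_iff_le_exp hn0).mp h2)
  refine (sum_le_sum_of_subset_of_nonneg hsub fun n _ _ =>
    div_nonneg vonMangoldt_nonneg (Nat.cast_nonneg n)).trans ?_
  have hsplit := sum_Ioc_consecutive (fun n : ℕ => vonMangoldt n / n) (Nat.zero_le _) hle
  have hup := sum_vonMangoldt_div_le hfv
  have hlo := le_sum_vonMangoldt_div hfX
  have h1 : log ⌊exp v⌋₊ ≤ v := by
    rw [Real.log_le_iff_le_exp (by exact_mod_cast hfv)]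
    exact Nat.floor_le (Real.exp_pos _).le
  have h2 : X - 1 ≤ log ⌊exp X⌋₊ := by
    rw [Real.le_log_iff_exp_le (by exact_mod_cast hfX), Real.exp_sub, div_le_iff₀ (Real.exp_pos _)]
    have := (Nat.lt_floor_add_one (exp X)).le
    have h3 : (1 : ℝ) ≤ ⌊exp X⌋₊ := by exact_mod_cast hfX
    nlinarith [Real.exp_one_gt_d9]
  linarith

lemma integral_Ioi_exp_neg_mul_linear {δ X C : ℝ} (hδ : 0 < δ) (hC : 0 ≤ C) :
    IntegrableOn (fun v => δ * exp (-δ * v) * ((v - X) + C)) (Set.Ioi X) ∧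
      ∫ v in Set.Ioi X, δ * exp (-δ * v) * ((v - X) + C) = exp (-δ * X) * (1 / δ + C) := by
  have hd : ∀ v ∈ Set.Ici X, HasDerivAt (fun v => -(exp (-δ * v) * ((v - X) + C + 1 / δ)))
      (δ * exp (-δ * v) * ((v - X) + C)) v := by
    intro v _
    have h1 : HasDerivAt (fun v : ℝ => exp (-δ * v)) (exp (-δ * v) * (-δ * 1)) v :=
      ((hasDerivAt_id v).const_mul (-δ)).exp
    have h2 : HasDerivAt (fun v : ℝ => (v - X) + C + 1 / δ) 1 v :=
      (((hasDerivAt_id v).sub_const X).add_const C).add_const (1 / δ)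
    refine (h1.mul h2).neg.congr_deriv ?_
    field_simp
    ring
  have hlim : Filter.Tendsto (fun v => -(exp (-δ * v) * ((v - X) + C + 1 / δ)))
      Filter.atTop (nhds 0) := by
    have h1 : Filter.Tendsto (fun v : ℝ => v * exp (-δ * v)) Filter.atTop (nhds 0) := by
      have := Real.tendsto_pow_mul_exp_neg_atTop_nhds_zero 1
      have h2 := (this.comp (Filter.tendsto_id.const_mul_atTop hδ)).const_mul (1 / δ)
      rw [mul_zero] at h2
      refine h2.congr fun v => ?_
      simp only [Function.comp, id, pow_one]
      field_simp
    have h3 : Filter.Tendsto (fun v : ℝ => exp (-δ * v)) Filter.atTop (nhds 0) := by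
      refine Real.tendsto_exp_atBot.comp ?_
      exact Filter.tendsto_id.const_mul_atTop_of_neg (by linarith)
    have := (h1.add (h3.const_mul (-X + C + 1 / δ))).neg
    rw [mul_zero, add_zero, neg_zero] at this
    refine this.congr fun v => by ring
  have hint := integrableOn_Ioi_deriv_of_nonneg' hd (fun v hv => by
    have : X < v := hv
    have : 0 ≤ v - X + C := by linarith
    positivity) hlim
  refine ⟨hint, ?_⟩
  rw [integral_Ioi_of_hasDerivAt_of_tendsto' hd hint hlim]
  ring

/-- Partial summation against an exponential, in logarithmic scale. -/
lemma sum_mul_exp_neg_le (S : Finset ℕ) (a u : ℕ → ℝ) {δ X C : ℝ} (hδ : 0 < δ) (hC : 0 ≤ C)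
    (hu : ∀ n ∈ S, X < u n) (h : ∀ v, X ≤ v → ∑ n ∈ S with u n ≤ v, a n ≤ (v - X) + C) :
    ∑ n ∈ S, a n * exp (-δ * u n) ≤ exp (-δ * X) * (1 / δ + C) := by
  obtain ⟨hint, hval⟩ := integral_Ioi_exp_neg_mul_linear (X := X) hδ hC
  have hexp : ∀ n ∈ S, exp (-δ * u n)
      = ∫ v in Set.Ioi X, (Set.Ici (u n)).indicator (fun v => δ * exp (-δ * v)) v := by
    intro n hn
    rw [setIntegral_indicator measurableSet_Ici,
      Set.inter_eq_right.mpr (Set.Ici_subset_Ioi.mpr (hu n hn)),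
      integral_Ici_eq_integral_Ioi, integral_const_mul, integral_exp_mul_Ioi (by linarith)]
    field_simp
  have hi : ∀ n, IntegrableOn ((Set.Ici (u n)).indicator fun v => δ * exp (-δ * v))
      (Set.Ioi X) := fun n =>
    ((integrableOn_exp_mul_Ioi (by linarith : -δ < 0) X).const_mul δ).indicator measurableSet_Ici
  calc ∑ n ∈ S, a n * exp (-δ * u n)
      = ∫ v in Set.Ioi X, ∑ n ∈ S, a n *
          (Set.Ici (u n)).indicator (fun v => δ * exp (-δ * v)) v := by
        rw [integral_finsetSum _ fun n _ => (hi n).const_mul _]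
        refine sum_congr rfl fun n hn => ?_
        rw [integral_const_mul, hexp n hn]
    _ ≤ ∫ v in Set.Ioi X, δ * exp (-δ * v) * ((v - X) + C) := by
        refine setIntegral_mono_on (integrable_finsetSum _ fun n _ => (hi n).const_mul _) hint
          measurableSet_Ioi fun v hv => ?_
        have := mul_le_mul_of_nonneg_left (h v (le_of_lt hv))
          (by positivity : 0 ≤ δ * exp (-δ * v))
        refine le_trans (le_of_eq ?_) this
        rw [sum_filter, mul_sum]
        refine sum_congr rfl fun n _ => ?_
        by_cases hn : u n ≤ v
        · rw [Set.indicator_of_mem (show v ∈ Set.Ici (u n) from hn), if_pos hn]; ring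
        · rw [Set.indicator_of_notMem (show v ∉ Set.Ici (u n) from hn), if_neg hn]; ring
    _ = _ := hval

lemma sum_vonMangoldt_exp_le (S : Finset ℕ) {δ X : ℝ} (hδ : 0 < δ) (hX : 0 ≤ X)
    (hS : ∀ n ∈ S, X < log n) :
    ∑ n ∈ S, vonMangoldt n / n * exp (-δ * log n) ≤ exp (-δ * X) * (1 / δ + 8) := by
  refine sum_mul_exp_neg_le S (fun n => vonMangoldt n / n) (fun n => log n) hδ (by norm_num)
    hS fun v hv => ?_
  refine le_trans (le_of_eq ?_) (sum_vonMangoldt_div_log_le S hX hv)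
  refine sum_congr (filter_congr (q := fun n : ℕ =>
    X < log n ∧ log n ≤ v) fun n hn => ?_) fun _ _ => rfl
  exact ⟨fun h => ⟨hS n hn, h⟩, fun h => h.2⟩

lemma rpow_neg_one_sub_eq {n : ℕ} (hn : n ≠ 0) (δ : ℝ) :
    (n : ℝ) ^ (-(1 + δ)) = 1 / n * exp (-δ * log n) := by
  have hn0 : (0 : ℝ) < n := by exact_mod_cast Nat.pos_of_ne_zero hn
  rw [neg_add, Real.rpow_add hn0, Real.rpow_neg_one, Real.rpow_def_of_pos hn0, one_div]
  ring_nf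

lemma summable_vonMangoldt_rpow {δ : ℝ} (hδ : 0 < δ) :
    Summable fun n : ℕ => vonMangoldt n * (n : ℝ) ^ (-(1 + δ)) := by
  refine summable_of_sum_le (c := 1 / δ + 8) (fun n => mul_nonneg
    vonMangoldt_nonneg (Real.rpow_nonneg (Nat.cast_nonneg n) _)) fun S => ?_
  have := sum_vonMangoldt_exp_le (S.filter fun n : ℕ => 0 < log n) hδ le_rfl fun n hn =>
    (mem_filter.mp hn).2
  rw [mul_zero, Real.exp_zero, one_mul] at this
  refine le_trans (le_of_eq ?_) this
  rw [sum_filter]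
  refine sum_congr rfl fun n _ => ?_
  split_ifs with h
  · have hn : n ≠ 0 := by rintro rfl; simp at h
    rw [rpow_neg_one_sub_eq hn]; ring
  · have : n = 0 ∨ n = 1 := by
      by_contra! hc
      exact h (Real.log_pos (by exact_mod_cast (by omega : 1 < n)))
    rcases this with rfl | rfl <;> simp

lemma tsum_vonMangoldt_rpow_le {δ X : ℝ} (hδ : 0 < δ) (hX : 0 ≤ X) (p : ℕ → Prop)
    [DecidablePred p] (hp : ∀ n, p n → vonMangoldt n = 0 ∨ X < log n) :
    ∑' n : ℕ, (if p n then vonMangoldt n * (n : ℝ) ^ (-(1 + δ)) else 0)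
      ≤ exp (-δ * X) * (1 / δ + 8) := by
  refine Real.tsum_le_of_sum_le (fun n => ?_) fun S => ?_
  · split_ifs
    · exact mul_nonneg
        vonMangoldt_nonneg (Real.rpow_nonneg (Nat.cast_nonneg n) _)
    · exact le_rfl
  have := sum_vonMangoldt_exp_le (S.filter fun n : ℕ => p n ∧ X < log n) hδ hX fun n hn =>
    (mem_filter.mp hn).2.2
  refine le_trans (le_of_eq ?_) this
  rw [sum_filter]
  refine sum_congr rfl fun n _ => ?_
  by_cases h : p n
  · rcases hp n h with h0 | h1
    · simp [h0]
    · have hn : n ≠ 0 := by rintro rfl; simp at h1; linarith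
      rw [if_pos h, if_pos ⟨h, h1⟩, rpow_neg_one_sub_eq hn]; ring
  · simp [h]

lemma exists_sum_nonprime_le : ∃ C : ℝ, 0 ≤ C ∧ ∀ S : Finset ℕ,
    ∑ n ∈ S with ¬ n.Prime, vonMangoldt n / n ≤ C := by
  have hs := ArithmeticFunction.vonMangoldt.summable_residueClass_non_primes_div (0 : ZMod 1)
  have h0 : ∀ n : ℕ, 0 ≤ (if n.Prime then 0 else
      ArithmeticFunction.vonMangoldt.residueClass (0 : ZMod 1) n) / n := fun n => by
    have := ArithmeticFunction.vonMangoldt.residueClass_nonneg (0 : ZMod 1) n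
    split_ifs <;> positivity
  refine ⟨_, tsum_nonneg h0, fun S => le_trans (le_of_eq ?_) (hs.sum_le_tsum S fun n _ => h0 n)⟩
  rw [sum_filter]
  refine sum_congr rfl fun n _ => ?_
  have : ArithmeticFunction.vonMangoldt.residueClass (0 : ZMod 1) n = vonMangoldt n :=
    Set.indicator_of_mem
    (show n ∈ {n : ℕ | (n : ZMod 1) = 0} from Subsingleton.elim (α := ZMod 1) _ _) _
  rw [this]
  split_ifs <;> simp_all

end LinnikAP

namespace LinnikAP

open MeasureTheory Complex Finset
open ArithmeticFunction (vonMangoldt vonMangoldt_nonneg)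

section PrimePolynomial

variable {q : ℕ} [NeZero q]

omit [NeZero q] in
lemma norm_term_vonMangoldt_le (χ : DirichletCharacter ℂ q) (s : ℂ) (n : ℕ) :
    ‖LSeries.term ((fun n : ℕ => χ (n : ZMod q)) * fun n : ℕ => ((vonMangoldt n : ℝ) : ℂ)) s n‖
      ≤ vonMangoldt n * (n : ℝ) ^ (-s.re) := by
  rcases Nat.eq_zero_or_pos n with rfl | hn
  · simp
  rw [LSeries.norm_term_eq, if_neg hn.ne', Real.rpow_neg (Nat.cast_nonneg n), ← div_eq_mul_inv]
  gcongr
  rw [Pi.mul_apply, norm_mul, norm_real,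
    Real.norm_of_nonneg vonMangoldt_nonneg]
  exact mul_le_of_le_one_left vonMangoldt_nonneg (χ.norm_le_one _)

lemma logDeriv_LFunction_eq (χ : DirichletCharacter ℂ q) {s : ℂ} (hs : 1 < s.re) :
    logDeriv χ.LFunction s
      = -LSeries ((fun n : ℕ => χ (n : ZMod q)) * fun n : ℕ => ((vonMangoldt n : ℝ) : ℂ)) s := by
  rw [DirichletCharacter.LSeries_twist_vonMangoldt_eq χ hs, logDeriv_apply,
    DirichletCharacter.deriv_LFunction_eq_deriv_LSeries χ hs,
    DirichletCharacter.LFunction_eq_LSeries χ hs]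
  ring

omit [NeZero q] in
lemma summable_term_vonMangoldt (χ : DirichletCharacter ℂ q) {s : ℂ} (hs : 1 < s.re) :
    Summable (LSeries.term ((fun n : ℕ => χ (n : ZMod q)) *
      fun n : ℕ => ((vonMangoldt n : ℝ) : ℂ)) s) := by
  refine Summable.of_norm_bounded (summable_vonMangoldt_rpow (δ := s.re - 1) (by linarith))
    fun n => ?_
  have := norm_term_vonMangoldt_le χ s n
  rwa [show -(1 + (s.re - 1)) = -s.re by ring]

lemma norm_logDeriv_LFunction_le (χ : DirichletCharacter ℂ q) {δ : ℝ} (hδ : 0 < δ) {s : ℂ}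
    (hs : s.re = 1 + δ) : ‖logDeriv χ.LFunction s‖ ≤ 1 / δ + 8 := by
  rw [logDeriv_LFunction_eq χ (by linarith), norm_neg, LSeries]
  have h1 := tsum_vonMangoldt_rpow_le hδ le_rfl (fun _ => True) (fun n _ => by
    by_cases h : 1 < n
    · right; exact Real.log_pos (by exact_mod_cast h)
    · left
      have : n = 0 ∨ n = 1 := by omega
      rcases this with rfl | rfl <;> simp)
  simp only [if_true, mul_zero, Real.exp_zero, one_mul] at h1
  refine (tsum_of_norm_bounded (summable_vonMangoldt_rpow hδ).hasSum fun n => ?_).trans h1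
  rw [← hs]
  exact norm_term_vonMangoldt_le χ s n

/-- The primes `p` with `2 * L < log p ≤ K * L`, in terms of integer parts. -/
noncomputable def primeRange (L K : ℝ) : Finset ℕ :=
  {n ∈ Ioc ⌊Real.exp (2 * L)⌋₊ ⌊Real.exp (K * L)⌋₊ | n.Prime}

noncomputable def primePoly (χ : DirichletCharacter ℂ q) (L K : ℝ) (s : ℂ) : ℂ :=
  ∑ n ∈ primeRange L K, LSeries.term ((fun n : ℕ => χ (n : ZMod q)) *
    fun n : ℕ => ((vonMangoldt n : ℝ) : ℂ)) s n

lemma exists_norm_logDeriv_add_primePoly_le : ∃ C : ℝ, 0 ≤ C ∧ ∀ (q : ℕ) [NeZero q]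
    (χ : DirichletCharacter ℂ q) (L K δ : ℝ) (s : ℂ), 0 ≤ L → 0 ≤ K → 0 < δ → s.re = 1 + δ →
    ‖logDeriv χ.LFunction s + primePoly χ L K s‖
      ≤ 2 * L + C + Real.exp (-δ * (K * L)) * (1 / δ + 8) := by
  obtain ⟨C, hC, hCS⟩ := exists_sum_nonprime_le
  refine ⟨6 + C, by linarith, fun q _ χ L K δ s hL hK hδ hs => ?_⟩
  have hs1 : 1 < s.re := by linarith
  set f := LSeries.term ((fun n : ℕ => χ (n : ZMod q)) *
    fun n : ℕ => ((vonMangoldt n : ℝ) : ℂ)) s with hf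
  have hsum : Summable f := summable_term_vonMangoldt χ hs1
  have hrest : logDeriv χ.LFunction s + primePoly χ L K s
      = -∑' n, (if n ∈ primeRange L K then 0 else f n) := by
    rw [logDeriv_LFunction_eq χ hs1, LSeries, primePoly, ← hf]
    have h1 : ∑' n, (if n ∈ primeRange L K then f n else 0) = ∑ n ∈ primeRange L K, f n := by
      rw [tsum_eq_sum (s := primeRange L K) fun n hn => if_neg hn]
      exact sum_congr rfl fun n hn => if_pos hn
    have hs2 : Summable fun n => if n ∈ primeRange L K then f n else 0 :=
      summable_of_ne_finset_zero (s := primeRange L K) fun n hn => if_neg hn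
    rw [← h1, neg_add_eq_sub, ← Summable.tsum_sub hs2 hsum, ← tsum_neg]
    refine tsum_congr fun n => ?_
    split_ifs <;> ring
  rw [hrest, norm_neg]
  set g : ℕ → ℝ := fun n => if n ∈ primeRange L K then 0 else vonMangoldt n * (n : ℝ) ^ (-(1 + δ))
    with hg
  have hfac : ∀ n : ℕ, 0 ≤ vonMangoldt n * (n : ℝ) ^ (-(1 + δ)) := fun n => mul_nonneg
    vonMangoldt_nonneg (Real.rpow_nonneg (Nat.cast_nonneg n) _)
  have hg0 : ∀ n, 0 ≤ g n := fun n => by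
    simp only [hg]; split_ifs
    · exact le_rfl
    · exact hfac n
  have hgs : Summable g := Summable.of_nonneg_of_le hg0 (fun n => by
    simp only [hg]; split_ifs
    · exact hfac n
    · exact le_rfl) (summable_vonMangoldt_rpow hδ)
  refine (tsum_of_norm_bounded hgs.hasSum fun n => ?_).trans ?_
  · simp only [hg]
    split_ifs
    · simp
    · rw [← hs]
      exact norm_term_vonMangoldt_le χ s n
  refine Real.tsum_le_of_sum_le hg0 fun S => ?_
  have hterm : ∀ n : ℕ, vonMangoldt n * (n : ℝ) ^ (-(1 + δ)) ≤ vonMangoldt n / n := by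
    intro n
    rcases Nat.eq_zero_or_pos n with rfl | hn
    · simp
    rw [div_eq_mul_inv, ← Real.rpow_neg_one]
    refine mul_le_mul_of_nonneg_left ?_ vonMangoldt_nonneg
    exact Real.rpow_le_rpow_of_exponent_le (by exact_mod_cast hn) (by linarith)
  have hdiv : ∀ n : ℕ, 0 ≤ vonMangoldt n / n := fun n =>
    div_nonneg vonMangoldt_nonneg (Nat.cast_nonneg n)
  set N := ⌊Real.exp (2 * L)⌋₊
  have hN1 : 1 ≤ N := (Nat.one_le_floor_iff _).mpr (Real.one_le_exp (by linarith))
  have h1 : ∑ n ∈ Ioc 0 N, vonMangoldt n / n ≤ 2 * L + 6 := by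
    refine (sum_vonMangoldt_div_le hN1).trans ?_
    gcongr
    rw [Real.log_le_iff_le_exp (by exact_mod_cast hN1)]
    exact Nat.floor_le (Real.exp_pos _).le
  have h2 := hCS S
  have h3 := sum_vonMangoldt_exp_le (S.filter fun n : ℕ => K * L < Real.log n) hδ (X := K * L)
    (by positivity) fun n hn => (mem_filter.mp hn).2
  have h4 : ∑ n ∈ S, g n ≤ ∑ n ∈ Ioc 0 N, vonMangoldt n / n
      + ∑ n ∈ S with ¬ n.Prime, vonMangoldt n / n
      + ∑ n ∈ S.filter (fun n : ℕ => K * L < Real.log n),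
          vonMangoldt n / n * Real.exp (-δ * Real.log n) := by
    have e1 : ∑ n ∈ S.filter (fun n => n ∈ Ioc 0 N), vonMangoldt n / n
        ≤ ∑ n ∈ Ioc 0 N, vonMangoldt n / n :=
      sum_le_sum_of_subset_of_nonneg (fun n hn => (mem_filter.mp hn).2)
        fun n _ _ => hdiv n
    refine le_trans ?_ (add_le_add (add_le_add e1 le_rfl) le_rfl)
    rw [sum_filter, sum_filter, sum_filter, ← sum_add_distrib,
      ← sum_add_distrib]
    refine sum_le_sum fun n _ => ?_
    have a1 : 0 ≤ (if n ∈ Ioc 0 N then vonMangoldt n / (n : ℝ) else 0) := by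
      split_ifs; exacts [hdiv n, le_rfl]
    have a2 : 0 ≤ (if ¬ n.Prime then vonMangoldt n / (n : ℝ) else 0) := by
      split_ifs; exacts [le_rfl, hdiv n]
    have a3 : 0 ≤ (if K * L < Real.log n then vonMangoldt n / (n : ℝ) *
        Real.exp (-δ * Real.log n) else 0) := by
      split_ifs; exacts [mul_nonneg (hdiv n) (Real.exp_pos _).le, le_rfl]
    simp only [hg]
    by_cases hm : n ∈ primeRange L K
    · rw [if_pos hm]; linarith
    rw [if_neg hm]
    rcases Nat.eq_zero_or_pos n with rfl | hn
    · exact le_trans (le_of_eq (by simp)) (add_nonneg (add_nonneg a1 a2) a3)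
    by_cases hnN : n ≤ N
    · have : n ∈ Ioc 0 N := mem_Ioc.mpr ⟨hn, hnN⟩
      rw [if_pos this]
      linarith [hterm n]
    by_cases hp : n.Prime
    · have : K * L < Real.log n := by
        rw [Real.lt_log_iff_exp_lt (by exact_mod_cast hn), ← Nat.floor_lt (Real.exp_pos _).le]
        by_contra hcon
        exact hm (mem_filter.mpr ⟨mem_Ioc.mpr ⟨by omega, by omega⟩, hp⟩)
      rw [if_pos this, rpow_neg_one_sub_eq hn.ne']
      have e : vonMangoldt n * (1 / n * Real.exp (-δ * Real.log n))
        = vonMangoldt n / n * Real.exp (-δ * Real.log n) := by ring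
      rw [e]
      linarith
    · have : (if ¬ n.Prime then vonMangoldt n / (n : ℝ) else 0) = vonMangoldt n / n := if_pos hp
      linarith [hterm n]
  linarith

lemma sum_zeros_LFunction_le {χ : DirichletCharacter ℂ q} (hχ : χ ≠ 1) {L δ : ℝ}
    (hq : (q : ℝ) ≤ Real.exp L) (hδ : 0 < δ) (hδ1 : δ ≤ 1) {c : ℂ} (hc : c.re = 1 + δ)
    {S : Finset ℂ} (hS : ∀ ρ ∈ S, χ.LFunction ρ = 0 ∧ dist ρ c ≤ 1 / 2) :
    ∑ ρ ∈ S, (analyticOrderNatAt χ.LFunction ρ : ℝ) *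
        ((c.re - ρ.re) / dist c ρ ^ 2 - 4 * (c.re - ρ.re))
      ≤ (logDeriv χ.LFunction c).re + (2 * L + 2 * Real.log (|c.im| + 5) + 4 * Real.log (14 / δ)) := by
  have hq0 : (0 : ℝ) < q := by exact_mod_cast Nat.pos_of_ne_zero (NeZero.ne q)
  have hq1 : (1 : ℝ) ≤ q := by exact_mod_cast Nat.one_le_iff_ne_zero.mpr (NeZero.ne q)
  have hc1 : 1 < c.re := by linarith
  have hlow := le_norm_LFunction χ hc1
  have hfc : χ.LFunction c ≠ 0 := DirichletCharacter.LFunction_ne_zero_of_one_le_re χ (Or.inl hχ) hc1.le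
  set M : ℝ := 7 * √(q * (|c.im| + 5)) * (2 / δ) with hM
  have habs := abs_nonneg c.im
  have hsq : 1 ≤ √(q * (|c.im| + 5)) := by
    rw [Real.one_le_sqrt]; nlinarith
  have hδ2 : 2 ≤ 2 / δ := by rw [le_div_iff₀ hδ]; linarith
  have hM1 : 1 < M := by rw [hM]; nlinarith
  have hbound : ∀ s, dist s c ≤ 1 / 2 → ‖χ.LFunction s‖ ≤ M * ‖χ.LFunction c‖ := by
    intro s hs
    have hre := (abs_re_le_norm (s - c)).trans
      ((dist_eq s c).symm.le.trans hs)
    have him := (abs_im_le_norm (s - c)).trans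
      ((dist_eq s c).symm.le.trans hs)
    rw [sub_re, abs_le] at hre
    rw [sub_im] at him
    have h1 := norm_LFunction_le hχ (s := s) (by linarith) (by linarith)
    have h2 : |s.im| ≤ |c.im| + 1 / 2 := by
      have := abs_add_le (s.im - c.im) c.im
      rw [sub_add_cancel] at this; linarith
    have h3 : 7 * √(q * (|s.im| + 4)) ≤ 7 * √(q * (|c.im| + 5)) :=
      mul_le_mul_of_nonneg_left (Real.sqrt_le_sqrt
        (mul_le_mul_of_nonneg_left (by linarith) hq0.le)) (by norm_num)
    have h4 : 1 ≤ (2 / δ) * ‖χ.LFunction c‖ := by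
      have : δ / 2 ≤ ‖χ.LFunction c‖ := by
        refine le_trans ?_ hlow
        rw [hc]
        rw [show 1 + δ - 1 = δ by ring]
        gcongr
        linarith
      calc (1 : ℝ) = (2 / δ) * (δ / 2) := by field_simp
        _ ≤ _ := by gcongr
    rw [hM, mul_assoc]
    refine h1.trans (h3.trans (le_mul_of_one_le_right (by positivity) h4))
  have hre : ∀ ρ, χ.LFunction ρ = 0 → dist ρ c ≤ 1 / 2 → ρ.re ≤ c.re := by
    intro ρ h _
    by_contra! hcon
    exact DirichletCharacter.LFunction_ne_zero_of_one_le_re χ (Or.inl hχ) (by linarith) h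
  have main := sum_zeros_le (DirichletCharacter.differentiable_LFunction hχ)
    (by norm_num : (0 : ℝ) < 1 / 2) hfc hM1 hbound hre hS
  have e : ∀ ρ : ℂ, (c.re - ρ.re) / dist c ρ ^ 2 - (c.re - ρ.re) / (1 / 2) ^ 2
      = (c.re - ρ.re) / dist c ρ ^ 2 - 4 * (c.re - ρ.re) := fun ρ => by ring
  simp_rw [e] at main
  refine main.trans (by
    have hlogq : Real.log q ≤ L := (Real.log_le_iff_le_exp hq0).mpr hq
    have hlogM : Real.log M = (Real.log q + Real.log (|c.im| + 5)) / 2 + Real.log (14 / δ) := by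
      rw [hM, show 7 * √(q * (|c.im| + 5)) * (2 / δ) = √(q * (|c.im| + 5)) * (14 / δ) by ring,
        Real.log_mul (by positivity) (by positivity), Real.log_sqrt (by positivity),
        Real.log_mul (by positivity) (by positivity)]
    rw [hlogM]
    linarith)

end PrimePolynomial

end LinnikAP

namespace LinnikAP

open MeasureTheory Complex Finset
open ArithmeticFunction (vonMangoldt)

lemma sum_mul_sq_le_sq_sum {ι : Type*} (S : Finset ι) (m v : ι → ℝ) (hm : ∀ i ∈ S, 1 ≤ m i)
    (hv : ∀ i ∈ S, 0 ≤ v i) : ∑ i ∈ S, m i * v i ^ 2 ≤ (∑ i ∈ S, m i * v i) ^ 2 := by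
  have h1 : ∑ i ∈ S, m i * v i ^ 2 ≤ ∑ i ∈ S, (m i * v i) ^ 2 := by
    refine sum_le_sum fun i hi => ?_
    have := hm i hi
    have h2 : m i ≤ m i ^ 2 := by nlinarith
    rw [mul_pow]
    exact mul_le_mul_of_nonneg_right h2 (sq_nonneg _)
  refine h1.trans (sum_sq_le_sq_sum_of_nonneg fun i hi => ?_)
  exact mul_nonneg (by linarith [hm i hi]) (hv i hi)

lemma sum_mul_sq_le_integral {Z : Finset ℂ} {m v h : ℂ → ℝ} {P : ℝ → ℝ} (hP : Continuous P)
    {T : ℝ} (hT : 0 ≤ T) (hm : ∀ ρ ∈ Z, 1 ≤ m ρ) (hv : ∀ ρ ∈ Z, 0 ≤ v ρ) (hh : ∀ ρ ∈ Z, 0 ≤ h ρ)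
    (hZ : ∀ ρ ∈ Z, |ρ.im| + h ρ ≤ T)
    (H : ∀ t, |t| ≤ T → ∀ S ⊆ Z, S.Nonempty → (∀ ρ ∈ S, |t - ρ.im| ≤ h ρ) →
      ∑ ρ ∈ S, m ρ * v ρ ≤ P t) :
    ∑ ρ ∈ Z, m ρ * v ρ ^ 2 * (2 * h ρ) ≤ ∫ t in -T..T, P t ^ 2 := by
  classical
  rw [intervalIntegral.integral_of_le (by linarith), ← integral_Icc_eq_integral_Ioc]
  have hsub : ∀ ρ ∈ Z, Set.Icc (ρ.im - h ρ) (ρ.im + h ρ) ⊆ Set.Icc (-T) T := by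
    intro ρ hρ
    have := hZ ρ hρ
    have h2 := abs_le.mp (le_refl |ρ.im|)
    exact Set.Icc_subset_Icc (by linarith) (by linarith)
  have hint : ∀ ρ ∈ Z, IntegrableOn (Set.indicator (Set.Icc (ρ.im - h ρ) (ρ.im + h ρ))
      fun _ => m ρ * v ρ ^ 2) (Set.Icc (-T) T) := fun ρ _ =>
    (integrableOn_const (by simp)).indicator measurableSet_Icc
  have e : ∑ ρ ∈ Z, m ρ * v ρ ^ 2 * (2 * h ρ) = ∫ t in Set.Icc (-T) T,
      ∑ ρ ∈ Z, Set.indicator (Set.Icc (ρ.im - h ρ) (ρ.im + h ρ)) (fun _ => m ρ * v ρ ^ 2) t := by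
    rw [integral_finsetSum _ hint]
    refine sum_congr rfl fun ρ hρ => ?_
    rw [setIntegral_indicator measurableSet_Icc, Set.inter_eq_right.mpr (hsub ρ hρ),
      setIntegral_const, smul_eq_mul, Real.volume_real_Icc_of_le (by linarith [hh ρ hρ])]
    ring
  rw [e]
  refine setIntegral_mono_on (integrable_finsetSum _ hint)
    ((hP.pow 2).integrableOn_Icc) measurableSet_Icc fun t ht => ?_
  have hsum : ∑ ρ ∈ Z, Set.indicator (Set.Icc (ρ.im - h ρ) (ρ.im + h ρ))
      (fun _ => m ρ * v ρ ^ 2) t = ∑ ρ ∈ Z with |t - ρ.im| ≤ h ρ, m ρ * v ρ ^ 2 := by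
    rw [sum_filter]
    refine sum_congr rfl fun ρ _ => ?_
    rw [Set.indicator_apply]
    refine if_congr ?_ rfl rfl
    rw [Set.mem_Icc, abs_le]
    constructor <;> rintro ⟨h1, h2⟩ <;> constructor <;> linarith
  rw [hsum]
  rcases (Z.filter fun ρ => |t - ρ.im| ≤ h ρ).eq_empty_or_nonempty with h0 | h0
  · rw [h0, sum_empty]; positivity
  have h1 := H t (abs_le.mpr ht) _ (filter_subset _ _) h0 fun ρ hρ =>
    (mem_filter.mp hρ).2
  refine (sum_mul_sq_le_sq_sum _ m v (fun i hi => hm i (mem_filter.mp hi).1)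
    fun i hi => hv i (mem_filter.mp hi).1).trans ?_
  refine pow_le_pow_left₀ (sum_nonneg fun i hi => mul_nonneg ?_ ?_) h1 2
  · linarith [hm i (mem_filter.mp hi).1]
  · exact hv i (mem_filter.mp hi).1

/-- The weight comparison behind the zero-density step: for zeros at distance `lam / L` from the
line `Re s = 1`. -/
lemma exp_neg_le_weight {lam : ℝ} (h1 : 0.0416 ≤ lam) (h2 : lam ≤ 0.17) :
    0 ≤ 0.8852 / (1 / 24 + lam) - 4.005 ∧
    260 * Real.exp (-159.9 * lam)
      ≤ 0.13 * ((0.8852 / (1 / 24 + lam) - 4.005) ^ 2 * (0.72 * (1 / 24 + lam))) := by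
  have hr : 0 < 1 / 24 + lam := by linarith
  constructor
  · rw [sub_nonneg, le_div_iff₀ hr]; linarith
  have e1 : (0.8852 / (1 / 24 + lam) - 4.005) ^ 2 * (0.72 * (1 / 24 + lam))
      = 0.72 * (0.8852 - 4.005 * (1 / 24 + lam)) ^ 2 / (1 / 24 + lam) := by
    field_simp
  rw [e1, mul_div_assoc', le_div_iff₀ hr, show -159.9 * lam = -(159.9 * lam) by ring, Real.exp_neg]
  rw [mul_assoc, inv_mul_eq_div, mul_div_assoc', div_le_iff₀ (Real.exp_pos _)]
  obtain ⟨u, rfl⟩ : ∃ u, lam = 0.0416 + u := ⟨lam - 0.0416, by ring⟩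
  have hu : 0 ≤ u := by linarith
  have hu2 : u ≤ 0.1284 := by linarith
  have hA : (765 : ℝ) ≤ Real.exp (159.9 * 0.0416) := by
    have hb : Real.exp 1 ^ 6 * Real.exp 0.325 ^ 2 ≤ Real.exp (159.9 * 0.0416) := by
      rw [← Real.exp_nat_mul, ← Real.exp_nat_mul, ← Real.exp_add]
      exact Real.exp_le_exp.mpr (by norm_num)
    have h3 := Real.exp_one_gt_d9
    have h4 := Real.quadratic_le_exp_of_nonneg (x := 0.325) (by norm_num)
    refine le_trans ?_ hb
    calc (765 : ℝ) ≤ 2.718 ^ 6 * (1 + 0.325 + 0.325 ^ 2 / 2) ^ 2 := by norm_num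
      _ ≤ _ := by gcongr; linarith
  have hB : ((1 + 39.975 * u) ^ 2) ^ 2 ≤ Real.exp (159.9 * u) := by
    have h5 := Real.add_one_le_exp (39.975 * u)
    calc ((1 + 39.975 * u) ^ 2) ^ 2 = (39.975 * u + 1) ^ 4 := by ring
      _ ≤ Real.exp (39.975 * u) ^ 4 := by gcongr
      _ = Real.exp (159.9 * u) := by rw [← Real.exp_nat_mul]; congr 1; push_cast; ring
  rw [show Real.exp (159.9 * (0.0416 + u)) = Real.exp (159.9 * 0.0416) * Real.exp (159.9 * u) by
    rw [mul_add, Real.exp_add]]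
  have hP : 0.5517 * (1 + 6.005 * u) ≤ (1 + 39.975 * u) ^ 2
      * (0.8852 - 4.005 * (1 / 24 + (0.0416 + u))) := by
    nlinarith [mul_nonneg hu hu, mul_nonneg (mul_nonneg hu hu) (sub_nonneg.mpr hu2),
      mul_nonneg hu (sub_nonneg.mpr hu2)]
  have hP2 : 0.5517 ^ 2 * (1 + 12.01 * u) ≤ ((1 + 39.975 * u) ^ 2) ^ 2
      * (0.8852 - 4.005 * (1 / 24 + (0.0416 + u))) ^ 2 := by
    rw [← mul_pow]
    refine le_trans ?_ (pow_le_pow_left₀ (by positivity) hP 2)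
    nlinarith
  have hQ : ((1 + 39.975 * u) ^ 2) ^ 2 * (0.8852 - 4.005 * (1 / 24 + (0.0416 + u))) ^ 2
      ≤ Real.exp (159.9 * u) * (0.8852 - 4.005 * (1 / 24 + (0.0416 + u))) ^ 2 := by gcongr
  have hR : 765 * (0.5517 ^ 2 * (1 + 12.01 * u)) ≤ Real.exp (159.9 * 0.0416) *
      (Real.exp (159.9 * u) * (0.8852 - 4.005 * (1 / 24 + (0.0416 + u))) ^ 2) := by
    exact mul_le_mul hA (hP2.trans hQ) (by positivity) (by positivity)
  have : 260 * (1 / 24 + (0.0416 + u)) ≤ 0.13 * 0.72 * (765 * (0.5517 ^ 2 * (1 + 12.01 * u))) := by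
    nlinarith
  nlinarith

lemma exists_exp_neg_le_weight {lam : ℝ} (h1 : 0.0416 ≤ lam) (h2 : lam ≤ 0.2) :
    ∃ A θ : ℝ, 0 < A ∧ 0 < θ ∧ θ ≤ 0.36 ∧ A * (1 + θ ^ 2) ≤ 0.99995 ∧
      0 ≤ A / (1 / 24 + lam) - 4.005 ∧
      260 * Real.exp (-159.9 * lam)
        ≤ 0.13 * ((A / (1 / 24 + lam) - 4.005) ^ 2 * (2 * θ * (1 / 24 + lam))) := by
  rcases le_total lam 0.17 with h | h
  · obtain ⟨h3, h4⟩ := exp_neg_le_weight h1 h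
    refine ⟨0.8852, 0.36, by norm_num, by norm_num, le_rfl, by norm_num, h3, h4.trans ?_⟩
    norm_num
  · have hr : 0 < 1 / 24 + lam := by linarith
    have h3 : 0.09 ≤ 0.99 / (1 / 24 + lam) - 4.005 := by
      rw [le_sub_iff_add_le, le_div_iff₀ hr]; linarith
    refine ⟨0.99, 0.1, by norm_num, by norm_num, by norm_num, by norm_num, by linarith, ?_⟩
    have h4 : Real.exp (-159.9 * lam) ≤ (2 ^ 27)⁻¹ := by
      rw [neg_mul, Real.exp_neg]
      refine inv_anti₀ (by norm_num) ?_
      have e5 : Real.exp 1 ^ 27 ≤ Real.exp (159.9 * lam) := by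
        rw [← Real.exp_nat_mul]
        exact Real.exp_le_exp.mpr (by norm_num; linarith)
      refine le_trans ?_ e5
      have e6 := Real.exp_one_gt_d9
      gcongr
      linarith
    have h5 : (0.09 : ℝ) ^ 2 * (2 * 0.1 * 0.2)
        ≤ (0.99 / (1 / 24 + lam) - 4.005) ^ 2 * (2 * 0.1 * (1 / 24 + lam)) := by
      refine mul_le_mul (pow_le_pow_left₀ (by norm_num) h3 2) (by linarith) (by norm_num)
        (sq_nonneg _)
    norm_num at h4 h5 ⊢
    linarith

end LinnikAP

namespace LinnikAP

open MeasureTheory Complex Finset Filter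
open ArithmeticFunction (vonMangoldt)

/-- The square-summed divisor sums of the Selberg weights. -/
noncomputable def sieveDivisorSum (q R n : ℕ) : ℝ := ∑ d ∈ n.divisors, sieveWeight q R d

lemma sieveDivisorSum_prime (q : ℕ) {R p : ℕ} (hR : 1 ≤ R) (hp : p.Prime) (h : R < p) :
    sieveDivisorSum q R p = 1 := by
  rw [sieveDivisorSum, hp.divisors, sum_pair hp.one_lt.ne, sieveWeight_one hR,
    sieveWeight_eq_zero, add_zero]
  rw [mem_sieveSupport]
  rintro ⟨⟨-, h2⟩, -⟩
  omega

lemma sum_sq_sieveDivisorSum_window_le {q : ℕ} [NeZero q] {R : ℕ} (hR : 2 ≤ R) {y δ : ℝ}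
    (hy : 0 ≤ y) (hδ : 0 < δ) (hδ1 : δ ≤ 1)
    (h : q * (R : ℝ) ^ 2 * Real.log R + 1 ≤ Real.exp y * δ ^ 2) (S : Finset ℕ) (b : ZMod q) :
    q.totient * ∑ n ∈ S.filter (fun n : ℕ => (y < Real.log n ∧ Real.log n ≤ y + δ) ∧
        (n : ZMod q) = b), sieveDivisorSum q R n ^ 2
      ≤ Real.exp y * (δ + 2 * δ ^ 2) / Real.log R := by
  have hq0 : q ≠ 0 := NeZero.ne q
  have hφ : (0 : ℝ) < q.totient := by exact_mod_cast Nat.totient_pos.mpr (Nat.pos_of_ne_zero hq0)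
  have hlog : 0 < Real.log R := Real.log_pos (by exact_mod_cast (by omega : 1 < R))
  have hAB : ⌊Real.exp y⌋₊ ≤ ⌊Real.exp (y + δ)⌋₊ :=
    Nat.floor_le_floor (Real.exp_le_exp.mpr (by linarith))
  have h1 := sum_sq_sieveWeight_le hq0 hR hAB b.val
  have h2 : ∑ n ∈ S.filter (fun n : ℕ => (y < Real.log n ∧ Real.log n ≤ y + δ) ∧
        (n : ZMod q) = b), sieveDivisorSum q R n ^ 2
      ≤ ∑ n ∈ Ioc ⌊Real.exp y⌋₊ ⌊Real.exp (y + δ)⌋₊ with n ≡ b.val [MOD q],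
          (∑ d ∈ n.divisors, sieveWeight q R d) ^ 2 := by
    refine sum_le_sum_of_subset_of_nonneg (fun n hn => ?_) fun n _ _ => sq_nonneg _
    obtain ⟨-, ⟨h3, h4⟩, h5⟩ := mem_filter.mp hn
    have hn0 : (0 : ℝ) < n := by
      rcases Nat.eq_zero_or_pos n with rfl | h0
      · simp at h3; linarith
      · exact_mod_cast h0
    rw [mem_filter, mem_Ioc]
    refine ⟨⟨?_, ?_⟩, ?_⟩
    · rw [Nat.floor_lt (Real.exp_pos _).le]
      exact (Real.lt_log_iff_exp_lt hn0).mp h3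
    · exact Nat.le_floor ((Real.log_le_iff_le_exp hn0).mp h4)
    · rw [← ZMod.natCast_eq_natCast_iff, h5, ZMod.natCast_zmod_val]
  have h3 : ((⌊Real.exp (y + δ)⌋₊ : ℝ) - ⌊Real.exp y⌋₊) ≤ Real.exp y * (δ + δ ^ 2) + 1 := by
    have e1 := Nat.floor_le (Real.exp_pos (y + δ)).le
    have e2 := Nat.lt_floor_add_one (Real.exp y)
    have e3 : Real.exp δ ≤ 1 + (δ + δ ^ 2) := by
      have := Real.abs_exp_sub_one_sub_id_le (x := δ) (by rw [abs_of_pos hδ]; exact hδ1)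
      linarith [le_abs_self (Real.exp δ - 1 - δ)]
    have e4 : Real.exp (y + δ) ≤ Real.exp y * (1 + (δ + δ ^ 2)) := by
      rw [Real.exp_add]; gcongr
    linarith
  have hφq : (q.totient : ℝ) ≤ q := by exact_mod_cast Nat.totient_le q
  have h4 := mul_le_mul_of_nonneg_left (h2.trans h1) hφ.le
  refine h4.trans ?_
  rw [mul_add, ← mul_div_assoc, mul_div_mul_left _ _ hφ.ne', div_add' _ _ _ hlog.ne']
  gcongr
  have : (q.totient : ℝ) * (R : ℝ) ^ 2 * Real.log R ≤ q * (R : ℝ) ^ 2 * Real.log R := by gcongr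
  nlinarith

lemma continuous_primePoly_line {q : ℕ} (χ : DirichletCharacter ℂ q) (L K : ℝ) (σ : ℝ) :
    Continuous fun t : ℝ => primePoly χ L K (σ + t * I) := by
  unfold primePoly
  refine continuous_finsetSum _ fun n hn => ?_
  have hn0 : n ≠ 0 := (mem_filter.mp hn).2.ne_zero
  simp only [LSeries.term_of_ne_zero hn0]
  have : (n : ℂ) ≠ 0 := by exact_mod_cast hn0
  refine continuous_const.div (Continuous.const_cpow (by fun_prop) (Or.inl this)) fun t => ?_
  simp [cpow_eq_zero_iff, this]

lemma natCast_cpow_neg_line {n : ℕ} (hn : n ≠ 0) (σ t : ℝ) :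
    (n : ℂ) ^ (-((σ : ℂ) + t * I)) = (((n : ℝ) ^ (-σ) : ℝ) : ℂ) * cexp (-(I * t * Real.log n)) := by
  have hn' : (n : ℂ) ≠ 0 := by exact_mod_cast hn
  rw [neg_add, cpow_add _ _ hn', ← ofReal_neg, ← ofReal_natCast,
    ← ofReal_cpow (Nat.cast_nonneg n), cpow_def_of_ne_zero
    (by exact_mod_cast hn'), ← ofReal_log (Nat.cast_nonneg n)]
  congr 2
  ring

lemma primePoly_line {q : ℕ} (χ : DirichletCharacter ℂ q) (L K : ℝ) (σ t : ℝ) :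
    primePoly χ L K (σ + t * I) = ∑ n ∈ primeRange L K,
      ((vonMangoldt n * (n : ℝ) ^ (-σ) : ℝ) : ℂ) * χ (n : ZMod q) *
        cexp (-(I * t * Real.log n)) := by
  refine sum_congr rfl fun n hn => ?_
  have hn0 : n ≠ 0 := (mem_filter.mp hn).2.ne_zero
  rw [LSeries.term_of_ne_zero hn0, div_eq_mul_inv, ← cpow_neg,
    natCast_cpow_neg_line hn0, Pi.mul_apply]
  push_cast
  ring

lemma log_of_mem_primeRange {L K : ℝ} {n : ℕ} (hn : n ∈ primeRange L K) :
    n.Prime ∧ 2 * L < Real.log n ∧ Real.log n ≤ K * L := by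
  obtain ⟨h1, h2⟩ := mem_filter.mp hn
  rw [mem_Ioc, Nat.floor_lt (Real.exp_pos _).le] at h1
  have hn0 : (0 : ℝ) < n := by exact_mod_cast h2.pos
  refine ⟨h2, (Real.lt_log_iff_exp_lt hn0).mpr h1.1, (Real.log_le_iff_le_exp hn0).mpr ?_⟩
  exact (Nat.le_floor_iff (Real.exp_pos _).le).mp h1.2

lemma eventually_pow_mul_le_exp (k : ℕ) {C c : ℝ} (hc : 0 < c) :
    ∀ᶠ L : ℝ in atTop, C * L ^ k ≤ Real.exp (c * L) := by
  have h := (isLittleO_pow_exp_pos_mul_atTop k hc).const_mul_left C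
  filter_upwards [h.bound one_pos] with L hL
  rw [one_mul, Real.norm_eq_abs, Real.norm_of_nonneg (Real.exp_pos _).le] at hL
  exact (le_abs_self _).trans hL

lemma sieve_level_le {q R y L : ℝ} (hL : 10000 ≤ L) (hL2 : 1200 * L ^ 7 ≤ Real.exp (0.001 * L))
    (hR0 : 0 ≤ R) (hq : q ≤ Real.exp (0.5 * y + 0.0001)) (hR : R ≤ Real.exp (0.2497 * y))
    (hlog0 : 0 ≤ Real.log R) (h3 : Real.log R ≤ 100 * L) (hy : 2 * L - 0.0001 ≤ y) :
    q * R ^ 2 * Real.log R + 1 ≤ Real.exp y * (1 / L ^ 3) ^ 2 := by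
  have h2 : R ^ 2 ≤ Real.exp (0.4994 * y) := by
    calc R ^ 2 ≤ Real.exp (0.2497 * y) ^ 2 := by gcongr
      _ = _ := by rw [← Real.exp_nat_mul]; congr 1; push_cast; ring
  have h5 : Real.exp (0.5 * y + 0.0001) * Real.exp (0.4994 * y)
      = Real.exp y * Real.exp (0.0001 - 0.0006 * y) := by
    rw [← Real.exp_add, ← Real.exp_add]; congr 1; ring
  have h4 : q * R ^ 2 * Real.log R ≤ Real.exp y * Real.exp (0.0001 - 0.0006 * y) * (100 * L) := by
    rw [← h5]
    have : q * R ^ 2 ≤ Real.exp (0.5 * y + 0.0001) * Real.exp (0.4994 * y) :=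
      mul_le_mul hq h2 (sq_nonneg _) (Real.exp_pos _).le
    exact mul_le_mul this h3 hlog0 (by positivity)
  have h6 : Real.exp (0.0001 - 0.0006 * y) ≤ Real.exp (-(0.001 * L)) :=
    Real.exp_le_exp.mpr (by linarith)
  set X := 1 / (1200 * L ^ 7) with hX
  have h7 : Real.exp (-(0.001 * L)) ≤ X := by
    rw [Real.exp_neg, ← one_div]
    exact one_div_le_one_div_of_le (by positivity) hL2
  have h8 : 1 ≤ Real.exp y * X := by
    refine le_trans (Real.one_le_exp (by linarith : (0 : ℝ) ≤ y - 0.001 * L)) ?_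
    rw [sub_eq_add_neg, Real.exp_add]
    exact mul_le_mul_of_nonneg_left h7 (Real.exp_pos _).le
  have h9 : Real.exp y * (1 / L ^ 3) ^ 2 = Real.exp y * X * (1200 * L) := by
    rw [hX]; field_simp
  rw [h9]
  have h10 : Real.exp y * Real.exp (0.0001 - 0.0006 * y) * (100 * L)
      ≤ Real.exp y * X * (100 * L) :=
    mul_le_mul_of_nonneg_right (mul_le_mul_of_nonneg_left (h6.trans h7) (Real.exp_pos _).le)
      (by positivity)
  have h11 : 1 ≤ Real.exp y * X * (1100 * L) := by nlinarith
  linarith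

set_option maxHeartbeats 1000000 in
/-- The mean-square bound for the prime polynomials on the line `Re s = 1 + 1/(24 L)`. -/
theorem eventually_primePoly_mean_square_le :
    ∀ᶠ L : ℝ in atTop, ∀ (q : ℕ) [NeZero q], (q : ℝ) ≤ Real.exp L →
      ∑ χ : DirichletCharacter ℂ q, ∫ t in -(2 * L ^ 2)..(2 * L ^ 2),
        ‖primePoly χ L 400 ((1 + 1 / (24 * L) : ℝ) + t * I)‖ ^ 2 ≤ 258 * L := by
  filter_upwards [eventually_ge_atTop 10000, eventually_pow_mul_le_exp 7 (C := 1200)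
    (c := 0.001) (by norm_num)] with L hL hL2 q _ hq
  have hL0 : 0 < L := by linarith
  set δ : ℝ := 1 / L ^ 3 with hδdef
  set α : ℝ := 1 / (24 * L) with hα
  have hδ : 0 < δ := by positivity
  have hδ1 : δ ≤ 0.0001 := by
    rw [hδdef, div_le_iff₀ (by positivity)]
    nlinarith [pow_le_pow_left₀ (by norm_num) hL 3]
  simp_rw [primePoly_line]
  set w : ℕ → ℝ := fun n => 4.01 * (vonMangoldt n / n * Real.exp (-(2 * α) * Real.log n)) with hw
  have hw0 : ∀ n, 0 ≤ w n := fun n => by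
    have := ArithmeticFunction.vonMangoldt_nonneg (n := n)
    simp only [hw]; positivity
  have hδT : δ * (2 * L ^ 2) = 2 / L := by rw [hδdef]; field_simp
  have hδT2 : 2 / L ≤ 0.0002 := by rw [div_le_iff₀ hL0]; linarith
  have main := sum_char_mean_square_le (q := q) (primeRange L 400)
    (fun n => ((vonMangoldt n * (n : ℝ) ^ (-(1 + α)) : ℝ) : ℂ)) w hw0 hδ (T := 2 * L ^ 2)
    (by positivity) (by rw [hδT]; linarith) ?_
  · refine main.trans ?_
    have h1 : ∑ n ∈ primeRange L 400, w n ≤ 4.01 * (Real.exp (-(2 * α) * (2 * L)) *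
        (1 / (2 * α) + 8)) := by
      rw [hw, ← mul_sum]
      gcongr
      exact sum_vonMangoldt_exp_le _ (by positivity) (by positivity)
        fun n hn => (log_of_mem_primeRange hn).2.1
    have h2 : -(2 * α) * (2 * L) = -(1 / 6) := by rw [hα]; field_simp; norm_num
    have h3 : 1 / (2 * α) = 12 * L := by rw [hα]; field_simp; norm_num
    rw [h2, h3] at h1
    have h4 : Real.exp (-(1 / 6)) ≤ 0.84664 := by
      rw [Real.exp_neg]
      have h5 := Real.quadratic_le_exp_of_nonneg (x := 1 / 12) (by norm_num)
      have h6 : (1 + 1 / 12 + (1 / 12) ^ 2 / 2) ^ 2 ≤ Real.exp (1 / 12) ^ 2 := by gcongr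
      rw [← Real.exp_nat_mul] at h6
      rw [show ((2 : ℕ) : ℝ) * (1 / 12) = 1 / 6 by norm_num] at h6
      rw [inv_le_comm₀ (Real.exp_pos _) (by norm_num)]
      refine le_trans ?_ h6
      norm_num
    have h7 : ∑ n ∈ primeRange L 400, w n ≤ 40.775 * L := by
      refine h1.trans ?_
      have : Real.exp (-(1 / 6)) * (12 * L + 8) ≤ 0.84664 * (12 * L + 8) := by gcongr
      nlinarith
    have h8 : 2 * Real.pi / (1 - (δ * (2 * L ^ 2)) ^ 2 / 2) ^ 2 ≤ 6.2833 := by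
      have hp := Real.pi_lt_d6
      rw [hδT]
      have h9 : (2 / L) ^ 2 ≤ 0.0002 ^ 2 := by gcongr
      have h10 : (0.99999997 : ℝ) ^ 2 ≤ (1 - (2 / L) ^ 2 / 2) ^ 2 := by
        refine pow_le_pow_left₀ (by norm_num) ?_ 2
        norm_num at h9 ⊢; linarith
      rw [div_le_iff₀ (lt_of_lt_of_le (by norm_num) h10)]
      nlinarith
    calc _ ≤ 6.2833 * (40.775 * L) := by
          refine mul_le_mul h8 h7 (sum_nonneg fun n _ => hw0 n) (by norm_num)
      _ ≤ 258 * L := by nlinarith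
  intro y b
  set F := (primeRange L 400).filter (fun n : ℕ => (y < Real.log n ∧ Real.log n ≤ y + δ) ∧
    (n : ZMod q) = b)
  rcases F.eq_empty_or_nonempty with h0 | ⟨n0, hn0⟩
  · rw [h0]; simp
  have hy1 : 2 * L < y + δ := by
    obtain ⟨h1, ⟨-, h2⟩, -⟩ := mem_filter.mp hn0
    exact (log_of_mem_primeRange h1).2.1.trans_le h2
  have hy2 : y ≤ 400 * L := by
    obtain ⟨h1, ⟨h2, -⟩, -⟩ := mem_filter.mp hn0
    exact h2.le.trans (log_of_mem_primeRange h1).2.2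
  have hy3 : 10000 ≤ y := by linarith
  set R := ⌊Real.exp (0.2497 * y)⌋₊
  have hRle : (R : ℝ) ≤ Real.exp (0.2497 * y) := Nat.floor_le (Real.exp_pos _).le
  have hRge : Real.exp (0.2496 * y) ≤ R := by
    have h1 : Real.exp (0.2497 * y) - 1 ≤ R := (Nat.sub_one_lt_floor _).le
    have h2 : Real.exp (0.2497 * y) = Real.exp (0.2496 * y) * Real.exp (0.0001 * y) := by
      rw [← Real.exp_add]; congr 1; ring
    have h3 : 2 ≤ Real.exp (0.0001 * y) := by
      have := Real.add_one_le_exp (0.0001 * y); linarith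
    have h4 : 1 ≤ Real.exp (0.2496 * y) := Real.one_le_exp (by linarith)
    nlinarith
  have hR2 : 2 ≤ R := by
    have h1 : (2 : ℝ) ≤ R := by
      have := Real.add_one_le_exp (0.2496 * y); linarith
    exact_mod_cast h1
  have hR0 : (0 : ℝ) < R := by exact_mod_cast (by omega : 0 < R)
  have hlogR : 0.2496 * y ≤ Real.log R := (Real.le_log_iff_exp_le hR0).mpr hRge
  have hlogR2 : Real.log R ≤ 0.2497 * y := (Real.log_le_iff_le_exp hR0).mpr hRle
  have hwin := sum_sq_sieveDivisorSum_window_le (q := q) hR2 (y := y) (by linarith) hδ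
    (by linarith) ?_ (primeRange L 400) b
  · have hB1 : ∀ n ∈ F, sieveDivisorSum q R n = 1 := by
      intro n hn
      obtain ⟨h1, ⟨h2, -⟩, -⟩ := mem_filter.mp hn
      have hp := (log_of_mem_primeRange h1).1
      refine sieveDivisorSum_prime q (by omega) hp ?_
      have : (R : ℝ) < n := by
        refine hRle.trans_lt (lt_of_le_of_lt (Real.exp_le_exp.mpr (by linarith))
          ((Real.lt_log_iff_exp_lt (by exact_mod_cast hp.pos)).mp h2))
      exact_mod_cast this
    have hLam : ∀ n ∈ F, vonMangoldt n = Real.log n ∧ (0 : ℝ) < n ∧ 0 < Real.log n ∧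
        y < Real.log n ∧ Real.log n ≤ y + δ := by
      intro n hn
      obtain ⟨h1, ⟨h2, h3⟩, -⟩ := mem_filter.mp hn
      have hp := (log_of_mem_primeRange h1).1
      exact ⟨ArithmeticFunction.vonMangoldt_apply_prime hp, by exact_mod_cast hp.pos,
        by linarith, h2, h3⟩
    have hsum : q.totient * ∑ n ∈ F, vonMangoldt n / n ≤ 4.01 * δ := by
      have h1 : ∑ n ∈ F, vonMangoldt n / n
          ≤ (y + δ) * Real.exp (-y) * ∑ n ∈ F, sieveDivisorSum q R n ^ 2 := by
        rw [mul_sum]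
        refine sum_le_sum fun n hn => ?_
        obtain ⟨e1, e2, e3, e4, e5⟩ := hLam n hn
        rw [hB1 n hn, e1, one_pow, mul_one, div_eq_mul_inv]
        refine mul_le_mul e5 ?_ (by positivity) (by linarith)
        rw [Real.exp_neg]
        exact inv_anti₀ (Real.exp_pos _) ((Real.lt_log_iff_exp_lt e2).mp e4).le
      have h2 : (y + δ) * Real.exp (-y) * (Real.exp y * (δ + 2 * δ ^ 2) / Real.log R)
          ≤ 4.01 * δ := by
        have : (y + δ) * Real.exp (-y) * (Real.exp y * (δ + 2 * δ ^ 2) / Real.log R)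
            = (y + δ) * (δ + 2 * δ ^ 2) / Real.log R := by
          rw [Real.exp_neg]; field_simp
        rw [this, div_le_iff₀ (by linarith)]
        have h5 : (y + δ) * (1 + 2 * δ) ≤ 4.01 * (0.2496 * y) := by nlinarith
        have h6 : 4.01 * δ * (0.2496 * y) ≤ 4.01 * δ * Real.log R := by gcongr
        nlinarith
      calc q.totient * ∑ n ∈ F, vonMangoldt n / n
          ≤ q.totient * ((y + δ) * Real.exp (-y) * ∑ n ∈ F, sieveDivisorSum q R n ^ 2) := by
            gcongr
        _ = (y + δ) * Real.exp (-y) * (q.totient * ∑ n ∈ F, sieveDivisorSum q R n ^ 2) := by ring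
        _ ≤ (y + δ) * Real.exp (-y) * (Real.exp y * (δ + 2 * δ ^ 2) / Real.log R) := by
            refine mul_le_mul_of_nonneg_left hwin (mul_nonneg (by linarith) (Real.exp_pos _).le)
        _ ≤ 4.01 * δ := h2
    have hCS : (∑ n ∈ F, vonMangoldt n * (n : ℝ) ^ (-(1 + α))) ^ 2
        ≤ (∑ n ∈ F, vonMangoldt n / n) *
          ∑ n ∈ F, vonMangoldt n / n * Real.exp (-(2 * α) * Real.log n) := by
      refine sum_sq_le_sum_mul_sum_of_sq_le_mul F (fun n hn => ?_) (fun n hn => ?_)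
        fun n hn => ?_
      · obtain ⟨e1, e2, e3, -⟩ := hLam n hn
        rw [e1]; positivity
      · obtain ⟨e1, e2, e3, -⟩ := hLam n hn
        rw [e1]; positivity
      · obtain ⟨e1, e2, e3, -⟩ := hLam n hn
        refine le_of_eq ?_
        rw [rpow_neg_one_sub_eq (by exact_mod_cast e2.ne')]
        rw [show -(2 * α) * Real.log n = -α * Real.log n + -α * Real.log n by ring, Real.exp_add]
        ring
    rw [← ofReal_sum, norm_real, Real.norm_eq_abs, sq_abs]
    calc _ ≤ q.totient * ((∑ n ∈ F, vonMangoldt n / n) *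
          ∑ n ∈ F, vonMangoldt n / n * Real.exp (-(2 * α) * Real.log n)) := by gcongr
      _ = (q.totient * ∑ n ∈ F, vonMangoldt n / n) *
          ∑ n ∈ F, vonMangoldt n / n * Real.exp (-(2 * α) * Real.log n) := by ring
      _ ≤ 4.01 * δ * ∑ n ∈ F, vonMangoldt n / n * Real.exp (-(2 * α) * Real.log n) := by
          gcongr
      _ = _ := by rw [hw, ← mul_sum]; ring
  · exact sieve_level_le hL hL2 (Nat.cast_nonneg R) (hq.trans (Real.exp_le_exp.mpr (by linarith)))
      hRle (by linarith) (by linarith) (by linarith)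

lemma eventually_log_le_mul {c : ℝ} (hc : 0 < c) : ∀ᶠ L : ℝ in atTop, Real.log L ≤ c * L := by
  filter_upwards [Real.isLittleO_log_id_atTop.bound hc, eventually_ge_atTop 1] with L h1 h2
  rw [id, Real.norm_eq_abs, Real.norm_of_nonneg (by linarith)] at h1
  exact (le_abs_self _).trans h1

/-- A Dirichlet-polynomial detector for zeros near the line `Re s = 1`. -/
theorem eventually_sum_zeros_le_primePoly :
    ∀ᶠ L : ℝ in atTop, ∀ (q : ℕ) [NeZero q], (q : ℝ) ≤ Real.exp L →
      ∀ χ : DirichletCharacter ℂ q, χ ≠ 1 → ∀ t : ℝ, |t| ≤ 2 * L ^ 2 → ∀ S : Finset ℂ,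
      (∀ ρ ∈ S, χ.LFunction ρ = 0 ∧ dist ρ ((1 + 1 / (24 * L) : ℝ) + t * I) ≤ 1 / 2) →
      ∑ ρ ∈ S, (analyticOrderNatAt χ.LFunction ρ : ℝ) *
        ((1 + 1 / (24 * L) - ρ.re) / dist ((1 + 1 / (24 * L) : ℝ) + t * I) ρ ^ 2
          - 4 * (1 + 1 / (24 * L) - ρ.re))
      ≤ ‖primePoly χ L 400 ((1 + 1 / (24 * L) : ℝ) + t * I)‖ + 4.005 * L := by
  obtain ⟨C, hC, hCP⟩ := exists_norm_logDeriv_add_primePoly_le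
  filter_upwards [eventually_log_le_mul (c := 0.0001) (by norm_num), eventually_ge_atTop 1000,
    eventually_ge_atTop (1000 * C)] with L hlog hL hLC q _ hq χ hχ t ht S hS
  have hL0 : 0 < L := by linarith
  set δ : ℝ := 1 / (24 * L) with hδ
  have hδ0 : 0 < δ := by positivity
  have hδ1 : δ ≤ 1 := by rw [hδ, div_le_one (by positivity)]; linarith
  set c : ℂ := (1 + δ : ℝ) + t * I with hc
  have hcre : c.re = 1 + δ := by simp [hc]
  have hcim : c.im = t := by simp [hc]
  have h1 := sum_zeros_LFunction_le hχ hq hδ0 hδ1 hcre hS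
  rw [hcim] at h1
  simp_rw [hcre] at h1
  have h2 := hCP q χ L 400 δ c hL0.le (by norm_num) hδ0 hcre
  have h3 : (logDeriv χ.LFunction c).re ≤ ‖logDeriv χ.LFunction c + primePoly χ L 400 c‖
      + ‖primePoly χ L 400 c‖ := by
    have e1 := re_le_norm (logDeriv χ.LFunction c)
    have e2 := norm_sub_le (logDeriv χ.LFunction c + primePoly χ L 400 c) (primePoly χ L 400 c)
    rw [add_sub_cancel_right] at e2
    linarith
  have h4 : Real.exp (-δ * (400 * L)) * (1 / δ + 8) ≤ 0.001 * L := by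
    have e1 : -δ * (400 * L) = -(50 / 3) := by rw [hδ]; field_simp; norm_num
    have e2 : 1 / δ = 24 * L := by rw [hδ]; field_simp
    rw [e1, e2, Real.exp_neg]
    have e3 : (40000 : ℝ) ≤ Real.exp (50 / 3) := by
      have e5 : Real.exp 1 ^ 16 ≤ Real.exp (50 / 3) := by
        rw [← Real.exp_nat_mul]
        exact Real.exp_le_exp.mpr (by norm_num)
      have e6 := Real.exp_one_gt_d9
      calc (40000 : ℝ) ≤ 2 ^ 16 := by norm_num
        _ ≤ Real.exp 1 ^ 16 := by gcongr; linarith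
        _ ≤ _ := e5
    calc (Real.exp (50 / 3))⁻¹ * (24 * L + 8) ≤ (40000)⁻¹ * (24 * L + 8) := by gcongr
      _ ≤ _ := by linarith
  have h5 : 2 * Real.log (|t| + 5) + 4 * Real.log (14 / δ) ≤ 0.0014 * L := by
    have e1 : Real.log (|t| + 5) ≤ 3 * Real.log L := by
      rw [← Real.log_rpow hL0]
      refine Real.log_le_log (by positivity) ?_
      norm_num
      nlinarith [pow_pos hL0 2]
    have e2 : Real.log (14 / δ) ≤ 2 * Real.log L := by
      rw [← Real.log_rpow hL0]
      refine Real.log_le_log (by positivity) ?_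
      have : 14 / δ = 336 * L := by rw [hδ]; field_simp; norm_num
      rw [this]
      norm_num
      nlinarith
    linarith
  linarith

set_option maxHeartbeats 1000000 in
/-- Weighted count of the zeros lying very near the line `Re s = 1`. -/
theorem eventually_sum_near_zeros_le :
    ∀ᶠ L : ℝ in atTop, ∀ (q : ℕ) [NeZero q], (q : ℝ) ≤ Real.exp L →
      ∀ Z : DirichletCharacter ℂ q → Finset ℂ,
      (∀ χ, ∀ ρ ∈ Z χ, χ ≠ 1 ∧ χ.LFunction ρ = 0 ∧ ρ.re ≤ 1 - 0.0416 / L ∧ 1 - 0.2 / L ≤ ρ.re ∧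
        |ρ.im| ≤ L ^ 2 + 1) →
      ∑ χ, ∑ ρ ∈ Z χ, (analyticOrderNatAt χ.LFunction ρ : ℝ) *
        Real.exp (-159.9 * (L * (1 - ρ.re))) ≤ 0.13 := by
  filter_upwards [eventually_sum_zeros_le_primePoly, eventually_primePoly_mean_square_le,
    eventually_ge_atTop 1000] with L hA hB hL q _ hq Z hZ
  have hL0 : 0 < L := by linarith
  set r : ℂ → ℝ := fun ρ => 1 / 24 + L * (1 - ρ.re) with hr
  set m : DirichletCharacter ℂ q → ℂ → ℝ := fun χ ρ => analyticOrderNatAt χ.LFunction ρ with hm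
  have hlam : ∀ χ, ∀ ρ ∈ Z χ, 0.0416 ≤ L * (1 - ρ.re) ∧ L * (1 - ρ.re) ≤ 0.2 := by
    intro χ ρ hρ
    obtain ⟨-, -, h1, h2, -⟩ := hZ χ ρ hρ
    have e1 : 0.0416 / L ≤ 1 - ρ.re := by linarith
    have e2 : 1 - ρ.re ≤ 0.2 / L := by linarith
    rw [div_le_iff₀ hL0] at e1
    rw [le_div_iff₀ hL0] at e2
    constructor <;> linarith
  have hm1 : ∀ χ, ∀ ρ ∈ Z χ, 1 ≤ m χ ρ := by
    intro χ ρ hρ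
    obtain ⟨h0, h1, -⟩ := hZ χ ρ hρ
    have := one_le_analyticOrderNatAt (DirichletCharacter.differentiable_LFunction h0)
      (z := 1) (DirichletCharacter.LFunction_apply_one_ne_zero h0) h1
    simp only [hm]; exact_mod_cast this
  have hw : ∀ lam : ℝ, ∃ A θ : ℝ, 0.0416 ≤ lam ∧ lam ≤ 0.2 →
      0 < A ∧ 0 < θ ∧ θ ≤ 0.36 ∧ A * (1 + θ ^ 2) ≤ 0.99995 ∧
      0 ≤ A / (1 / 24 + lam) - 4.005 ∧
      260 * Real.exp (-159.9 * lam)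
        ≤ 0.13 * ((A / (1 / 24 + lam) - 4.005) ^ 2 * (2 * θ * (1 / 24 + lam))) := by
    intro lam
    by_cases h : 0.0416 ≤ lam ∧ lam ≤ 0.2
    · obtain ⟨A, θ, h'⟩ := exists_exp_neg_le_weight h.1 h.2
      exact ⟨A, θ, fun _ => h'⟩
    · exact ⟨0, 0, fun h' => absurd h' h⟩
  choose A' θ' hAθ using hw
  set A : ℂ → ℝ := fun ρ => A' (L * (1 - ρ.re))
  set θ : ℂ → ℝ := fun ρ => θ' (L * (1 - ρ.re))
  have hAθ' : ∀ χ, ∀ ρ ∈ Z χ, 0 < A ρ ∧ 0 < θ ρ ∧ θ ρ ≤ 0.36 ∧ A ρ * (1 + θ ρ ^ 2) ≤ 0.99995 ∧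
      0 ≤ A ρ / r ρ - 4.005 ∧
      260 * Real.exp (-159.9 * (L * (1 - ρ.re)))
        ≤ 0.13 * ((A ρ / r ρ - 4.005) ^ 2 * (2 * θ ρ * r ρ)) :=
    fun χ ρ hρ => hAθ _ (hlam χ ρ hρ)
  have key : ∀ χ, ∑ ρ ∈ Z χ, m χ ρ * ((A ρ / r ρ - 4.005) ^ 2 * (2 * θ ρ * r ρ)) ≤
      (∫ t in -(2 * L ^ 2)..(2 * L ^ 2),
        ‖primePoly χ L 400 ((1 + 1 / (24 * L) : ℝ) + t * I)‖ ^ 2) / L := by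
    intro χ
    have h1 := sum_mul_sq_le_integral (Z := Z χ) (m := m χ) (v := fun ρ => A ρ / r ρ - 4.005)
      (h := fun ρ => θ ρ * r ρ / L)
      (P := fun t : ℝ => ‖primePoly χ L 400 ((1 + 1 / (24 * L) : ℝ) + t * I)‖ / L)
      ((continuous_primePoly_line χ L 400 _).norm.div_const L) (T := 2 * L ^ 2) (by positivity)
      (hm1 χ) (fun ρ hρ => (hAθ' χ ρ hρ).2.2.2.2.1)
      (fun ρ hρ => by
        have := (hlam χ ρ hρ).1
        have h2 := (hAθ' χ ρ hρ).2.1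
        have h3 : 0 < r ρ := by simp only [hr]; linarith
        positivity)
      (fun ρ hρ => by
        obtain ⟨-, -, -, -, h5⟩ := hZ χ ρ hρ
        have h6 : θ ρ * r ρ / L ≤ 1 := by
          rw [div_le_one hL0]
          have h7 := hlam χ ρ hρ
          have h8 := hAθ' χ ρ hρ
          have h9 : r ρ ≤ 1 := by simp only [hr]; linarith
          have h10 : 0 ≤ r ρ := by simp only [hr]; linarith
          nlinarith
        nlinarith)
      (fun t ht S hS hne hSh => by
        rw [le_div_iff₀ hL0]
        have hχ : χ ≠ 1 := (hZ χ _ (hS hne.choose_spec)).1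
        have hdist : ∀ ρ ∈ S, dist ((1 + 1 / (24 * L) : ℝ) + t * I) ρ ^ 2
            ≤ (r ρ / L) ^ 2 * (1 + θ ρ ^ 2) := by
          intro ρ hρ
          have h3 := hSh ρ hρ
          have e : 1 + 1 / (24 * L) - ρ.re = r ρ / L := by simp only [hr]; field_simp; ring
          rw [Complex.dist_eq, Complex.sq_norm, Complex.normSq_apply]
          have e2 : (((1 + 1 / (24 * L) : ℝ) : ℂ) + t * I - ρ).re = r ρ / L := by
            simp [← e]
          have e3 : (((1 + 1 / (24 * L) : ℝ) : ℂ) + t * I - ρ).im = t - ρ.im := by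
            simp
          rw [e2, e3]
          have h4 := pow_le_pow_left₀ (abs_nonneg _) h3 2
          rw [sq_abs, mul_div_assoc, mul_pow] at h4
          nlinarith
        have h2 := hA q hq χ hχ t ht S (fun ρ hρ => by
          refine ⟨(hZ χ ρ (hS hρ)).2.1, ?_⟩
          have h4 := hdist ρ hρ
          have h5 := hlam χ ρ (hS hρ)
          obtain ⟨hA0, hθ0, hθ1, hAθ1, -⟩ := hAθ' χ ρ (hS hρ)
          rw [dist_comm]
          refine le_of_sq_le_sq ?_ (by norm_num)
          refine h4.trans ?_
          have h6 : r ρ / L ≤ 0.001 := by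
            rw [div_le_iff₀ hL0]; simp only [hr]; linarith
          have h7 : 0 ≤ r ρ / L := div_nonneg (by simp only [hr]; linarith) hL0.le
          have h8 : (r ρ / L) ^ 2 ≤ 0.001 ^ 2 := pow_le_pow_left₀ h7 h6 2
          have h9 : θ ρ ^ 2 ≤ 1 := by nlinarith
          nlinarith [sq_nonneg (r ρ / L)])
        have h3 : ∑ ρ ∈ S, m χ ρ * (A ρ / r ρ) * L ≤ ∑ ρ ∈ S, m χ ρ *
            ((1 + 1 / (24 * L) - ρ.re) / dist ((1 + 1 / (24 * L) : ℝ) + t * I) ρ ^ 2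
              - 4 * (1 + 1 / (24 * L) - ρ.re)) := by
          refine sum_le_sum fun ρ hρ => ?_
          rw [mul_assoc]
          refine mul_le_mul_of_nonneg_left ?_ (by linarith [hm1 χ ρ (hS hρ)])
          have h4 := hdist ρ hρ
          have h5 := hlam χ ρ (hS hρ)
          obtain ⟨hA0, hθ0, hθ1, hAθ1, -⟩ := hAθ' χ ρ (hS hρ)
          have hr0 : 0 < r ρ := by simp only [hr]; linarith
          have hr1 : r ρ ≤ 0.25 := by simp only [hr]; linarith
          have e : 1 + 1 / (24 * L) - ρ.re = r ρ / L := by simp only [hr]; field_simp; ring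
          rw [e]
          have hpos : 0 < dist (((1 + 1 / (24 * L) : ℝ) : ℂ) + t * I) ρ ^ 2 := by
            refine pow_pos (dist_pos.mpr fun hc => ?_) 2
            have := congrArg re hc
            simp at this
            rw [← this] at e
            have : r ρ / L = 0 := by rw [← e]; simp
            have := div_pos hr0 hL0
            linarith
          have h6 : (r ρ / L) / ((r ρ / L) ^ 2 * (1 + θ ρ ^ 2))
              ≤ (r ρ / L) / dist (((1 + 1 / (24 * L) : ℝ) : ℂ) + t * I) ρ ^ 2 := by gcongr
          have h7 : (r ρ / L) / ((r ρ / L) ^ 2 * (1 + θ ρ ^ 2)) = L / ((1 + θ ρ ^ 2) * r ρ) := by field_simp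
          have h8 : A ρ / r ρ * L + 4 * (r ρ / L) ≤ L / ((1 + θ ρ ^ 2) * r ρ) := by
            have e9 : A ρ / r ρ * L + 4 * (r ρ / L)
              = (A ρ * L ^ 2 + 4 * r ρ ^ 2) / (r ρ * L) := by field_simp
            rw [e9, div_le_div_iff₀ (by positivity) (by positivity)]
            have h10 : r ρ ^ 2 ≤ 0.000001 * L ^ 2 := by nlinarith
            have h12 : (1 + θ ρ ^ 2) * (4 * r ρ ^ 2) ≤ 2 * (4 * (0.000001 * L ^ 2)) := by
              have h13 : 1 + θ ρ ^ 2 ≤ 2 := by nlinarith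
              gcongr
            have h14 : A ρ * (1 + θ ρ ^ 2) * L ^ 2 ≤ 0.99995 * L ^ 2 := by gcongr
            have h11 : (1 + θ ρ ^ 2) * (A ρ * L ^ 2 + 4 * r ρ ^ 2) ≤ L ^ 2 := by
              have e16 : (1 + θ ρ ^ 2) * (A ρ * L ^ 2 + 4 * r ρ ^ 2) = A ρ * (1 + θ ρ ^ 2) * L ^ 2
                + (1 + θ ρ ^ 2) * (4 * r ρ ^ 2) := by ring
              rw [e16]
              norm_num at h12 h14
              have := sq_nonneg L
              linarith
            have h15 := mul_le_mul_of_nonneg_left h11 hr0.le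
            calc _ = r ρ * ((1 + θ ρ ^ 2) * (A ρ * L ^ 2 + 4 * r ρ ^ 2)) := by ring
              _ ≤ r ρ * L ^ 2 := h15
              _ = _ := by ring
          linarith
        have h4 : 1 ≤ ∑ ρ ∈ S, m χ ρ := by
          obtain ⟨ρ, hρ⟩ := hne
          exact (hm1 χ ρ (hS hρ)).trans (single_le_sum (f := m χ)
            (fun i hi => by linarith [hm1 χ i (hS hi)]) hρ)
        have h5 : (∑ ρ ∈ S, m χ ρ * (A ρ / r ρ - 4.005)) * L
            = ∑ ρ ∈ S, m χ ρ * (A ρ / r ρ) * L - 4.005 * L * ∑ ρ ∈ S, m χ ρ := by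
          rw [sum_mul, mul_sum, ← sum_sub_distrib]
          exact sum_congr rfl fun ρ _ => by ring
        rw [h5]
        have h6 : 4.005 * L * 1 ≤ 4.005 * L * ∑ ρ ∈ S, m χ ρ := by gcongr
        linarith)
    simp_rw [div_pow] at h1
    rw [intervalIntegral.integral_div] at h1
    rw [le_div_iff₀ hL0, sum_mul]
    rw [le_div_iff₀ (by positivity), sum_mul] at h1
    refine le_trans (le_of_eq (sum_congr rfl fun ρ _ => ?_)) h1
    field_simp
  have hfin : ∀ χ, ∑ ρ ∈ Z χ, m χ ρ * Real.exp (-159.9 * (L * (1 - ρ.re)))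
      ≤ (0.13 / 260) * ∑ ρ ∈ Z χ, m χ ρ * ((A ρ / r ρ - 4.005) ^ 2 * (2 * θ ρ * r ρ)) := by
    intro χ
    rw [mul_sum]
    refine sum_le_sum fun ρ hρ => ?_
    have h1 := (hAθ' χ ρ hρ).2.2.2.2.2
    have h2 := hm1 χ ρ hρ
    have h3 : Real.exp (-159.9 * (L * (1 - ρ.re)))
        ≤ (0.13 / 260) * ((A ρ / r ρ - 4.005) ^ 2 * (2 * θ ρ * r ρ)) := by
      linarith
    calc _ ≤ m χ ρ * ((0.13 / 260) * ((A ρ / r ρ - 4.005) ^ 2 * (2 * θ ρ * r ρ))) := by gcongr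
      _ = _ := by ring
  calc _ ≤ ∑ χ, (0.13 / 260) * ((∫ t in -(2 * L ^ 2)..(2 * L ^ 2),
        ‖primePoly χ L 400 ((1 + 1 / (24 * L) : ℝ) + t * I)‖ ^ 2) / L) :=
        sum_le_sum fun χ _ => (hfin χ).trans (by gcongr; exact key χ)
    _ = (0.13 / 260) * ((∑ χ : DirichletCharacter ℂ q, ∫ t in -(2 * L ^ 2)..(2 * L ^ 2),
        ‖primePoly χ L 400 ((1 + 1 / (24 * L) : ℝ) + t * I)‖ ^ 2) / L) := by
        rw [← mul_sum, sum_div]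
    _ ≤ (0.13 / 260) * (258 * L / L) := by
        have := hB q hq
        gcongr
    _ ≤ 0.13 := by
        rw [mul_div_assoc, div_self hL0.ne']; norm_num

end LinnikAP

namespace LinnikAP

open Finset
open ArithmeticFunction (moebius abs_moebius_le_one moebius_eq_zero_of_not_squarefree)

lemma sum_divisors_coprime_moebius {g n : ℕ} (hg : g ≠ 0) (hn : n ≠ 0) :
    ∑ d ∈ n.divisors, (if d.Coprime g then (moebius d : ℝ) else 0)
      = if n.primeFactors ⊆ g.primeFactors then 1 else 0 := by
  set P := n.primeFactors \ g.primeFactors with hP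
  have hPp : ∀ p ∈ P, p.Prime := fun p hp =>
    Nat.prime_of_mem_primeFactors (mem_sdiff.mp hp).1
  set n' := ∏ p ∈ P, p with hn'
  have hn'0 : n' ≠ 0 := prod_ne_zero_iff.mpr fun p hp => (hPp p hp).ne_zero
  have hpf : n'.primeFactors = P := Nat.primeFactors_prod hPp
  have hdvd : n' ∣ n := (prod_dvd_prod_of_subset _ _ _ sdiff_subset).trans
    (Nat.prod_primeFactors_dvd n)
  have h1 : ∑ d ∈ n.divisors, (if d.Coprime g then (moebius d : ℝ) else 0)
      = ∑ d ∈ n'.divisors, (moebius d : ℝ) := by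
    rw [← sum_filter]
    symm
    refine sum_subset (fun d hd => ?_) fun d hd hd' => ?_
    · rw [Nat.mem_divisors] at hd
      rw [mem_filter, Nat.mem_divisors]
      refine ⟨⟨hd.1.trans hdvd, hn⟩, ?_⟩
      refine Nat.Coprime.coprime_dvd_left hd.1 ?_
      refine Nat.Coprime.prod_left fun p hp => ?_
      rw [(hPp p hp).coprime_iff_not_dvd]
      intro hc
      exact (mem_sdiff.mp hp).2 (Nat.mem_primeFactors.mpr ⟨hPp p hp, hc, hg⟩)
    · rw [mem_filter, Nat.mem_divisors] at hd
      obtain ⟨⟨h1, -⟩, h2⟩ := hd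
      have : ¬ Squarefree d := by
        intro hs
        apply hd'
        rw [Nat.mem_divisors]
        refine ⟨?_, hn'0⟩
        rw [← Nat.prod_primeFactors_of_squarefree hs]
        refine prod_dvd_prod_of_subset _ _ _ fun p hp => ?_
        rw [hP, mem_sdiff]
        have hp' := Nat.mem_primeFactors.mp hp
        refine ⟨Nat.mem_primeFactors.mpr ⟨hp'.1, hp'.2.1.trans h1, hn⟩, fun hc => ?_⟩
        have h3 := Nat.dvd_gcd hp'.2.1 (Nat.mem_primeFactors.mp hc).2.1
        rw [h2] at h3
        exact hp'.1.one_lt.ne' (Nat.dvd_one.mp h3)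
      rw [moebius_eq_zero_of_not_squarefree this, Int.cast_zero]
  rw [h1, sum_divisors_moebius]
  refine if_congr ?_ rfl rfl
  rw [← sdiff_eq_empty_iff_subset, ← hP]
  constructor
  · intro h
    rw [← hpf, h, Nat.primeFactors_one]
  · intro h
    rw [hn', h, prod_empty]

/-- The Möbius function restricted to integers coprime to `g`, weighted by `d ^ (-s)`. -/
noncomputable def coprimeMoebius (g : ℕ) (s : ℝ) : ArithmeticFunction ℝ :=
  ⟨fun d => if d.Coprime g ∧ d ≠ 0 then (moebius d : ℝ) * (d : ℝ) ^ (-s) else 0, by simp⟩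

/-- The power function `n ^ (-s)` as an arithmetic function. -/
noncomputable def rpowNeg (s : ℝ) : ArithmeticFunction ℝ :=
  ⟨fun d => if d ≠ 0 then (d : ℝ) ^ (-s) else 0, by simp⟩

lemma coprimeMoebius_apply {g d : ℕ} (s : ℝ) (hd : d ≠ 0) :
    coprimeMoebius g s d = if d.Coprime g then (moebius d : ℝ) * (d : ℝ) ^ (-s) else 0 := by
  simp [coprimeMoebius, hd]

lemma rpowNeg_apply {d : ℕ} (s : ℝ) (hd : d ≠ 0) : rpowNeg s d = (d : ℝ) ^ (-s) := by
  simp [rpowNeg, hd]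

lemma coprimeMoebius_mul_rpowNeg {g n : ℕ} (s : ℝ) (hg : g ≠ 0) (hn : n ≠ 0) :
    (coprimeMoebius g s * rpowNeg s) n
      = if n.primeFactors ⊆ g.primeFactors then (n : ℝ) ^ (-s) else 0 := by
  rw [ArithmeticFunction.mul_apply, Nat.sum_divisorsAntidiagonal
    (f := fun a b => coprimeMoebius g s a * rpowNeg s b)]
  have h1 : ∀ d ∈ n.divisors, coprimeMoebius g s d * rpowNeg s (n / d)
      = (n : ℝ) ^ (-s) * (if d.Coprime g then (moebius d : ℝ) else 0) := by
    intro d hd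
    have hd' := Nat.mem_divisors.mp hd
    have hd0 : d ≠ 0 := fun h => hn (Nat.eq_zero_of_zero_dvd (h ▸ hd'.1))
    have hq : n / d ≠ 0 := by
      rw [Nat.div_ne_zero_iff]
      exact ⟨hd0, Nat.le_of_dvd (Nat.pos_of_ne_zero hn) hd'.1⟩
    rw [coprimeMoebius_apply s hd0, rpowNeg_apply s hq]
    split_ifs with h
    · have e : (n : ℝ) = d * (n / d : ℕ) := by
        rw [← Nat.cast_mul, Nat.mul_div_cancel' hd'.1]
      rw [e, Real.mul_rpow (by positivity) (by positivity)]
      ring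
    · simp
  rw [sum_congr rfl h1, ← mul_sum, sum_divisors_coprime_moebius hg hn]
  split_ifs <;> simp

/-- The classical bound for the partial sums of `μ(m) / m` over integers coprime to `g`. -/
lemma abs_sum_coprimeMoebius_one_le {g : ℕ} (hg : g ≠ 0) (N : ℕ) :
    |∑ m ∈ Ioc 0 N, coprimeMoebius g 1 m| ≤ 1 := by
  rcases Nat.eq_zero_or_pos N with rfl | hN
  · simp
  set f : ArithmeticFunction ℝ := coprimeMoebius g 0 with hf
  have hfm : ∀ m ∈ Ioc 0 N, coprimeMoebius g 1 m = f m * (m : ℝ)⁻¹ := by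
    intro m hm
    have hm0 : m ≠ 0 := (mem_Ioc.mp hm).1.ne'
    rw [hf, coprimeMoebius_apply _ hm0, coprimeMoebius_apply _ hm0, Real.rpow_neg_one]
    split_ifs <;> simp
  have hf1 : ∀ m, |f m| ≤ if m.Coprime g then 1 else 0 := by
    intro m
    by_cases hm0 : m = 0
    · subst hm0; simp; split_ifs <;> norm_num
    rw [hf, coprimeMoebius_apply _ hm0]
    split_ifs
    · simp only [neg_zero, Real.rpow_zero, mul_one]
      exact_mod_cast abs_moebius_le_one
    · simp
  have h1 : ∑ m ∈ Ioc 0 N, f m * ((N / m : ℕ) : ℝ)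
      = #{n ∈ Ioc 0 N | n.primeFactors ⊆ g.primeFactors} := by
    rw [← ArithmeticFunction.sum_Ioc_mul_zeta_eq_sum]
    rw [card_filter, Nat.cast_sum]
    refine sum_congr rfl fun n hn => ?_
    have hn0 : n ≠ 0 := (mem_Ioc.mp hn).1.ne'
    have h2 := coprimeMoebius_mul_rpowNeg (g := g) 0 hg hn0
    have h3 : (rpowNeg 0 : ArithmeticFunction ℝ) = (ArithmeticFunction.zeta : ArithmeticFunction ℝ) := by
      ext k
      by_cases hk : k = 0
      · simp [hk]
      · rw [rpowNeg_apply _ hk]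
        simp [ArithmeticFunction.natCoe_apply, ArithmeticFunction.zeta_apply, hk]
    rw [h3] at h2
    rw [h2]
    simp
  have hN0 : (0 : ℝ) < N := by exact_mod_cast hN
  have h2 : (N : ℝ) * ∑ m ∈ Ioc 0 N, coprimeMoebius g 1 m
      = ∑ m ∈ Ioc 0 N, f m * ((N / m : ℕ) : ℝ)
        + ∑ m ∈ Ioc 0 N, f m * ((N : ℝ) / m - (N / m : ℕ)) := by
    rw [← sum_add_distrib, mul_sum]
    refine sum_congr rfl fun m hm => ?_
    rw [hfm m hm]
    ring
  have h3 : |∑ m ∈ Ioc 0 N, f m * ((N : ℝ) / m - (N / m : ℕ))|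
      ≤ #{m ∈ Ioc 0 N | m.Coprime g ∧ m ≠ 1} := by
    refine (abs_sum_le_sum_abs _ _).trans ?_
    rw [card_filter, Nat.cast_sum]
    refine sum_le_sum fun m hm => ?_
    have hm0 : 0 < m := (mem_Ioc.mp hm).1
    rw [abs_mul]
    by_cases hm1 : m = 1
    · subst hm1; simp
    have h4 : |(N : ℝ) / m - (N / m : ℕ)| ≤ 1 := by
      rw [← Nat.floor_div_eq_div (K := ℝ)]
      have h5 := Nat.floor_le (a := (N : ℝ) / m) (by positivity)
      have h6 := Nat.lt_floor_add_one ((N : ℝ) / m)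
      rw [abs_le]; constructor <;> linarith
    calc |f m| * _ ≤ (if m.Coprime g then 1 else 0) * 1 :=
          mul_le_mul (hf1 m) h4 (abs_nonneg _) (by split_ifs <;> norm_num)
      _ = _ := by simp [hm1]
  have h4 : #{n ∈ Ioc 0 N | n.primeFactors ⊆ g.primeFactors}
      + #{m ∈ Ioc 0 N | m.Coprime g ∧ m ≠ 1} ≤ N := by
    rw [← card_union_of_disjoint]
    · refine (card_le_card (union_subset (filter_subset _ _)
        (filter_subset _ _))).trans ?_
      simp
    · rw [disjoint_filter]
      rintro m hm h5 ⟨h6, h7⟩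
      obtain ⟨p, hp, hpm⟩ := Nat.exists_prime_and_dvd h7
      have h8 : p ∈ g.primeFactors :=
        h5 (Nat.mem_primeFactors.mpr ⟨hp, hpm, (mem_Ioc.mp hm).1.ne'⟩)
      have h9 := Nat.dvd_gcd hpm (Nat.mem_primeFactors.mp h8).2.1
      rw [h6] at h9
      exact hp.one_lt.ne' (Nat.dvd_one.mp h9)
  have h4' : ((#{n ∈ Ioc 0 N | n.primeFactors ⊆ g.primeFactors} : ℕ) : ℝ)
      + (#{m ∈ Ioc 0 N | m.Coprime g ∧ m ≠ 1} : ℕ) ≤ N := by exact_mod_cast h4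
  have h5 : |(N : ℝ) * ∑ m ∈ Ioc 0 N, coprimeMoebius g 1 m| ≤ N := by
    rw [h2, h1]
    refine (abs_add_le _ _).trans ?_
    rw [abs_of_nonneg (by positivity)]
    linarith
  rw [abs_mul, abs_of_pos hN0] at h5
  exact le_of_mul_le_mul_left (by linarith) hN0

/-- Partial summation against a decreasing weight. -/
lemma abs_sum_mul_le_of_antitone {a b : ℕ → ℝ} (ha : ∀ N, |∑ m ∈ Ioc 0 N, a m| ≤ 1)
    (hb : ∀ m, 1 ≤ m → b (m + 1) ≤ b m) (hb0 : ∀ m, 1 ≤ m → 0 ≤ b m) (N : ℕ) :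
    |∑ m ∈ Ioc 0 N, a m * b m| ≤ b 1 := by
  rcases Nat.eq_zero_or_pos N with rfl | hN
  · simpa using hb0 1 le_rfl
  have key : ∀ n, 1 ≤ n → |∑ m ∈ Ioc 0 n, a m * b m - (∑ m ∈ Ioc 0 n, a m) * b n|
      ≤ b 1 - b n := by
    intro n hn
    induction n, hn using Nat.le_induction with
    | base => simp
    | succ n hn ih =>
      rw [sum_Ioc_succ_top (by omega), sum_Ioc_succ_top (by omega)]
      have e : ∑ m ∈ Ioc 0 n, a m * b m + a (n + 1) * b (n + 1)
          - (∑ m ∈ Ioc 0 n, a m + a (n + 1)) * b (n + 1)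
          = (∑ m ∈ Ioc 0 n, a m * b m - (∑ m ∈ Ioc 0 n, a m) * b n)
            + (∑ m ∈ Ioc 0 n, a m) * (b n - b (n + 1)) := by ring
      rw [e]
      refine (abs_add_le _ _).trans ?_
      have h1 : |(∑ m ∈ Ioc 0 n, a m) * (b n - b (n + 1))| ≤ 1 * (b n - b (n + 1)) := by
        rw [abs_mul, abs_of_nonneg (sub_nonneg.mpr (hb n hn))]
        exact mul_le_mul_of_nonneg_right (ha n) (sub_nonneg.mpr (hb n hn))
      linarith
  have h1 := key N hN
  have h2 : |(∑ m ∈ Ioc 0 N, a m) * b N| ≤ 1 * b N := by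
    rw [abs_mul, abs_of_nonneg (hb0 N hN)]
    exact mul_le_mul_of_nonneg_right (ha N) (hb0 N hN)
  have h3 := abs_add_le (∑ m ∈ Ioc 0 N, a m * b m - (∑ m ∈ Ioc 0 N, a m) * b N)
    ((∑ m ∈ Ioc 0 N, a m) * b N)
  rw [sub_add_cancel] at h3
  linarith

lemma abs_sum_coprimeMoebius_le {g : ℕ} (hg : g ≠ 0) {δ : ℝ} (hδ : 0 ≤ δ) (N : ℕ) :
    |∑ m ∈ Ioc 0 N, coprimeMoebius g (1 + δ) m| ≤ 1 := by
  have h := abs_sum_mul_le_of_antitone (a := coprimeMoebius g 1) (b := fun m => (m : ℝ) ^ (-δ))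
    (abs_sum_coprimeMoebius_one_le hg) (fun m hm => by
      refine Real.rpow_le_rpow_of_nonpos (by positivity) (by push_cast; linarith) (by linarith))
    (fun m hm => by positivity) N
  simp only [Nat.cast_one, Real.one_rpow] at h
  refine le_trans (le_of_eq ?_) h
  congr 1
  refine sum_congr rfl fun m hm => ?_
  have hm0 := (mem_Ioc.mp hm).1
  rw [coprimeMoebius_apply _ hm0.ne', coprimeMoebius_apply _ hm0.ne']
  split_ifs
  · rw [neg_add, Real.rpow_add (by positivity)]; ring
  · simp

lemma rpow_neg_step {δ : ℝ} (hδ : 0 < δ) {x y : ℝ} (hx : 0 < x) (hxy : x ≤ y) (hyx : y ≤ x + 1) :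
    (x ^ (-δ) - y ^ (-δ)) / δ ≤ x ^ (-(1 + δ)) := by
  rw [div_le_iff₀ hδ]
  have hy : 0 < y := by linarith
  have h1 : 1 - δ * (1 / x) ≤ (y / x) ^ (-δ) := by
    have h2 : 1 - δ * (y / x - 1) ≤ (y / x) ^ (-δ) := by
      rw [Real.rpow_def_of_pos (by positivity)]
      have h3 := Real.add_one_le_exp (Real.log (y / x) * -δ)
      have h4 := Real.log_le_sub_one_of_pos (show 0 < y / x by positivity)
      nlinarith
    have h5 : y / x - 1 ≤ 1 / x := by
      rw [sub_le_iff_le_add, div_add_one hx.ne', div_le_div_iff_of_pos_right hx]; linarith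
    nlinarith
  have h2 : y ^ (-δ) = x ^ (-δ) * (y / x) ^ (-δ) := by
    rw [← Real.mul_rpow hx.le (by positivity), mul_div_cancel₀ _ hx.ne']
  have h3 : x ^ (-(1 + δ)) = x ^ (-δ) * (1 / x) := by
    rw [neg_add, Real.rpow_add hx, Real.rpow_neg_one]; ring
  rw [h2, h3]
  have h4 : 0 < x ^ (-δ) := by positivity
  nlinarith

lemma le_rpow_neg_step {δ : ℝ} (hδ : 0 < δ) {x : ℝ} (hx : 0 < x) :
    (x + 1) ^ (-(1 + δ)) ≤ (x ^ (-δ) - (x + 1) ^ (-δ)) / δ := by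
  rw [le_div_iff₀ hδ]
  have hy : 0 < x + 1 := by linarith
  have h1 : 1 + δ * (1 / (x + 1)) ≤ (x / (x + 1)) ^ (-δ) := by
    rw [Real.rpow_def_of_pos (by positivity)]
    have h3 := Real.add_one_le_exp (Real.log (x / (x + 1)) * -δ)
    have h4 := Real.log_le_sub_one_of_pos (show 0 < x / (x + 1) by positivity)
    have h5 : x / (x + 1) - 1 = - (1 / (x + 1)) := by field_simp; ring
    nlinarith
  have h2 : x ^ (-δ) = (x + 1) ^ (-δ) * (x / (x + 1)) ^ (-δ) := by
    rw [← Real.mul_rpow hy.le (by positivity), mul_div_cancel₀ _ hy.ne']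
  have h3 : (x + 1) ^ (-(1 + δ)) = (x + 1) ^ (-δ) * (1 / (x + 1)) := by
    rw [neg_add, Real.rpow_add hy, Real.rpow_neg_one]; ring
  rw [h2, h3]
  have h4 : 0 < (x + 1) ^ (-δ) := by positivity
  nlinarith

/-- Partial sums of `k ^ (-1-δ)` approximate `(1 - y ^ (-δ)) / δ` up to a common constant. -/
lemma exists_abs_sum_rpowNeg_sub_le {δ : ℝ} (hδ : 0 < δ) (X : ℕ) :
    ∃ c : ℝ, 0 ≤ c ∧ c ≤ 1 ∧ ∀ y : ℝ, 1 ≤ y → y ≤ X →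
      |∑ k ∈ Ioc 0 ⌊y⌋₊, rpowNeg (1 + δ) k - (1 - y ^ (-δ)) / δ - c|
        ≤ (⌊y⌋₊ : ℝ) ^ (-(1 + δ)) := by
  set G : ℕ → ℝ := fun N => ∑ k ∈ Ioc 0 N, rpowNeg (1 + δ) k - (1 - (N : ℝ) ^ (-δ)) / δ with hG
  have hsucc : ∀ N : ℕ, G (N + 1) = G N + ((N : ℝ) + 1) ^ (-(1 + δ))
      - ((N : ℝ) ^ (-δ) - ((N : ℝ) + 1) ^ (-δ)) / δ := by
    intro N
    simp only [hG]
    rw [sum_Ioc_succ_top (by omega), rpowNeg_apply _ (by omega)]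
    push_cast
    ring
  have hanti : ∀ M N : ℕ, 1 ≤ M → M ≤ N → G N ≤ G M ∧
      G M - (M : ℝ) ^ (-(1 + δ)) ≤ G N - (N : ℝ) ^ (-(1 + δ)) := by
    intro M N hM hMN
    induction N, hMN using Nat.le_induction with
    | base => simp
    | succ N hN ih =>
      have hN0 : (0 : ℝ) < N := by exact_mod_cast (by omega : 0 < N)
      have h1 := rpow_neg_step hδ hN0 (by linarith : (N : ℝ) ≤ N + 1) le_rfl
      have h2 := le_rpow_neg_step hδ hN0
      have h3 := hsucc N
      push_cast
      constructor <;> linarith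
  have hG1 : G 1 = 1 := by simp [hG, rpowNeg_apply]
  refine ⟨G (X + 1), ?_, ?_, fun y hy1 hyX => ?_⟩
  · have h1 := (hanti 1 (X + 1) le_rfl (by omega)).2
    rw [hG1] at h1
    simp only [Nat.cast_one, Real.one_rpow] at h1
    have : 0 ≤ ((X + 1 : ℕ) : ℝ) ^ (-(1 + δ)) := by positivity
    linarith
  · rw [← hG1]
    exact (hanti 1 (X + 1) le_rfl (by omega)).1
  · set N := ⌊y⌋₊
    have hN1 : 1 ≤ N := (Nat.one_le_floor_iff y).mpr hy1
    have hNX : N ≤ X := by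
      have := Nat.floor_le_floor hyX
      rwa [Nat.floor_natCast] at this
    have hNy : (N : ℝ) ≤ y := Nat.floor_le (by linarith)
    have hyN : y ≤ N + 1 := (Nat.lt_floor_add_one y).le
    have hN0 : (0 : ℝ) < N := by exact_mod_cast hN1
    have hy0 : 0 < y := by linarith
    have h1 := hanti N (X + 1) hN1 (by omega)
    have h2 := hanti (N + 1) (X + 1) (by omega) (by omega)
    have e : ∑ k ∈ Ioc 0 N, rpowNeg (1 + δ) k = G N + (1 - (N : ℝ) ^ (-δ)) / δ := by
      simp only [hG]; ring
    have hu : (1 - (N : ℝ) ^ (-δ)) / δ ≤ (1 - y ^ (-δ)) / δ := by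
      have := Real.rpow_le_rpow_of_nonpos hN0 hNy (by linarith : -δ ≤ 0)
      gcongr
    have hl : (1 - y ^ (-δ)) / δ ≤ (1 - ((N : ℝ) + 1) ^ (-δ)) / δ := by
      have := Real.rpow_le_rpow_of_nonpos hy0 hyN (by linarith : -δ ≤ 0)
      gcongr
    have h3 := hsucc N
    have h4 : ((N : ℝ) + 1) ^ (-(1 + δ)) ≤ (N : ℝ) ^ (-(1 + δ)) :=
      Real.rpow_le_rpow_of_nonpos hN0 (by linarith) (by linarith)
    have e2 : (1 - (N : ℝ) ^ (-δ)) / δ = (1 - ((N : ℝ) + 1) ^ (-δ)) / δ -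
      ((N : ℝ) ^ (-δ) - ((N : ℝ) + 1) ^ (-δ)) / δ := by ring
    have h5 : 0 ≤ ((X + 1 : ℕ) : ℝ) ^ (-(1 + δ)) := by positivity
    rw [e, abs_le]
    constructor <;> linarith [h1.1, h1.2, h2.1]

/-- The truncated Möbius sum with a linear-type smoothing. -/
noncomputable def smoothMoebiusSum (δ x : ℝ) (g : ℕ) : ℝ :=
  ∑ m ∈ Ioc 0 ⌊x⌋₊, coprimeMoebius g (1 + δ) m * ((x ^ δ - (m : ℝ) ^ δ) / δ)

lemma abs_smoothMoebiusSum_le {δ x : ℝ} (hδ : 0 < δ) (hδ1 : δ ≤ 0.1) (hx : 1 ≤ x) {g : ℕ}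
    (hg : g ≠ 0) : |smoothMoebiusSum δ x g| ≤ 4.2 * x ^ δ * (g / g.totient) := by
  have hx0 : 0 < x := by linarith
  set N := ⌊x⌋₊
  have hNx : (N : ℝ) ≤ x := Nat.floor_le hx0.le
  have hgt : 1 ≤ (g : ℝ) / g.totient := by
    rw [le_div_iff₀ (by exact_mod_cast Nat.totient_pos.mpr (Nat.pos_of_ne_zero hg)), one_mul]
    exact_mod_cast Nat.totient_le g
  obtain ⟨c, hc0, hc1, hc⟩ := exists_abs_sum_rpowNeg_sub_le hδ (N + 1)
  set F : ArithmeticFunction ℝ := coprimeMoebius g (1 + δ) with hF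
  set K : ArithmeticFunction ℝ := rpowNeg (1 + δ)
  set e : ℕ → ℝ := fun m => ∑ k ∈ Ioc 0 (N / m), K k - (1 - (x / m) ^ (-δ)) / δ - c with he
  have hmem : ∀ m ∈ Ioc 0 N, (0 : ℝ) < m ∧ (m : ℝ) ≤ x ∧ m ≠ 0 := by
    intro m hm
    have := mem_Ioc.mp hm
    refine ⟨by exact_mod_cast this.1, ?_, this.1.ne'⟩
    exact le_trans (by exact_mod_cast this.2) hNx
  have hFabs : ∀ m ∈ Ioc 0 N, |F m| ≤ (m : ℝ) ^ (-(1 + δ)) := by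
    intro m hm
    obtain ⟨h0, -, hm0⟩ := hmem m hm
    rw [hF, coprimeMoebius_apply _ hm0]
    split_ifs
    · rw [abs_mul, abs_of_nonneg (a := (m : ℝ) ^ _) (by positivity)]
      have : |(moebius m : ℝ)| ≤ 1 := by exact_mod_cast abs_moebius_le_one
      exact mul_le_of_le_one_left (by positivity) this
    · rw [abs_zero]; positivity
  have he1 : ∀ m ∈ Ioc 0 N, |e m| ≤ (2 * m / x) ^ (1 + δ) := by
    intro m hm
    obtain ⟨h0, h1, hm0⟩ := hmem m hm
    have hy : 1 ≤ x / m := by rw [le_div_iff₀ h0]; linarith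
    have h2 := hc (x / m) hy (by
      refine (div_le_self hx0.le (by exact_mod_cast Nat.one_le_iff_ne_zero.mpr hm0)).trans ?_
      push_cast
      exact (Nat.lt_floor_add_one x).le)
    rw [Nat.floor_div_natCast] at h2
    refine h2.trans ?_
    rw [← Nat.floor_div_natCast]
    have h3 : x / m / 2 ≤ (⌊x / m⌋₊ : ℝ) := by
      have h4 := Nat.lt_floor_add_one (x / m)
      have h5 : (1 : ℝ) ≤ ⌊x / m⌋₊ := by exact_mod_cast (Nat.one_le_floor_iff _).mpr hy
      linarith
    rw [show 2 * m / x = (x / m / 2)⁻¹ by field_simp, Real.inv_rpow (by positivity),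
      ← Real.rpow_neg (by positivity)]
    exact Real.rpow_le_rpow_of_nonpos (by positivity) h3 (by linarith)
  have hmain : smoothMoebiusSum δ x g = x ^ δ * (∑ m ∈ Ioc 0 N, F m * ∑ k ∈ Ioc 0 (N / m), K k
      - c * ∑ m ∈ Ioc 0 N, F m - ∑ m ∈ Ioc 0 N, F m * e m) := by
    rw [mul_sum, ← sum_sub_distrib, ← sum_sub_distrib, mul_sum,
      smoothMoebiusSum]
    refine sum_congr rfl fun m hm => ?_
    obtain ⟨h0, h1, hm0⟩ := hmem m hm
    have h2 : (x / m) ^ (-δ) = (m : ℝ) ^ δ / x ^ δ := by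
      rw [Real.rpow_neg (by positivity), Real.div_rpow hx0.le h0.le, inv_div]
    have h3 : 0 < x ^ δ := by positivity
    simp only [he]
    rw [h2]
    field_simp
    ring
  have hA : |∑ m ∈ Ioc 0 N, F m * ∑ k ∈ Ioc 0 (N / m), K k| ≤ g / g.totient := by
    rw [← ArithmeticFunction.sum_Ioc_mul_eq_sum_sum]
    have h1 : ∑ n ∈ Ioc 0 N, (F * K) n
        = ∑ n ∈ Ioc 0 N with n.primeFactors ⊆ g.primeFactors, (n : ℝ) ^ (-(1 + δ)) := by
      rw [sum_filter]
      exact sum_congr rfl fun n hn => coprimeMoebius_mul_rpowNeg _ hg (hmem n hn).2.2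
    rw [h1, abs_of_nonneg (sum_nonneg fun n _ => by positivity)]
    refine le_trans (sum_le_sum fun n hn => ?_) (sum_inv_le_div_totient hg
      (T := {n ∈ Ioc 0 N | n.primeFactors ⊆ g.primeFactors}) fun k hk =>
        ⟨(hmem k (mem_filter.mp hk).1).2.2, (mem_filter.mp hk).2⟩)
    have h2 : (1 : ℝ) ≤ n := by
      exact_mod_cast Nat.one_le_iff_ne_zero.mpr (hmem n (mem_filter.mp hn).1).2.2
    rw [← Real.rpow_neg_one]
    exact Real.rpow_le_rpow_of_exponent_le h2 (by linarith)
  have hB : |c * ∑ m ∈ Ioc 0 N, F m| ≤ 1 := by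
    rw [abs_mul, abs_of_nonneg hc0]
    have := abs_sum_coprimeMoebius_le hg hδ.le N
    exact mul_le_one₀ hc1 (abs_nonneg _) this
  have hC : |∑ m ∈ Ioc 0 N, F m * e m| ≤ 2.2 := by
    refine (abs_sum_le_sum_abs _ _).trans ?_
    have h1 : ∀ m ∈ Ioc 0 N, |F m * e m| ≤ (2 / x) ^ (1 + δ) := by
      intro m hm
      obtain ⟨h0, h1, hm0⟩ := hmem m hm
      rw [abs_mul]
      calc |F m| * |e m| ≤ (m : ℝ) ^ (-(1 + δ)) * (2 * m / x) ^ (1 + δ) :=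
            mul_le_mul (hFabs m hm) (he1 m hm) (abs_nonneg _) (by positivity)
        _ = _ := by
          rw [show 2 * (m : ℝ) / x = m * (2 / x) by ring, Real.mul_rpow h0.le (by positivity),
            ← mul_assoc, ← Real.rpow_add h0]
          simp
    refine (sum_le_sum h1).trans ?_
    rw [sum_const, Nat.card_Ioc, nsmul_eq_mul, Nat.sub_zero]
    have h2 : (2 : ℝ) ^ (1 + δ) ≤ 2.2 := by
      have h3 : (2 : ℝ) ^ (1 + δ) ≤ 2 ^ (1.1 : ℝ) :=
        Real.rpow_le_rpow_of_exponent_le (by norm_num) (by linarith)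
      refine h3.trans ?_
      rw [show (1.1 : ℝ) = ((11 : ℕ) : ℝ) * (((10 : ℕ) : ℝ))⁻¹ by norm_num, Real.rpow_natCast_mul (by norm_num)]
      refine le_of_pow_le_pow_left₀ (n := 10) (by norm_num) (by norm_num) ?_
      rw [Real.rpow_inv_natCast_pow (by norm_num) (by norm_num)]
      norm_num
    have h4 : (N : ℝ) * (2 / x) ^ (1 + δ) ≤ x * (2 / x) ^ (1 + δ) := by gcongr
    refine h4.trans ?_
    rw [Real.div_rpow (by norm_num) hx0.le]
    have h5 : x ≤ x ^ (1 + δ) := by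
      conv_lhs => rw [← Real.rpow_one x]
      exact Real.rpow_le_rpow_of_exponent_le hx (by linarith)
    rw [mul_div_assoc', div_le_iff₀ (by positivity), mul_comm]
    exact mul_le_mul h2 h5 hx0.le (by norm_num)
  rw [hmain, abs_mul, abs_of_pos (by positivity : 0 < x ^ δ)]
  have h6 := abs_sub (∑ m ∈ Ioc 0 N, F m * ∑ k ∈ Ioc 0 (N / m), K k - c * ∑ m ∈ Ioc 0 N, F m)
    (∑ m ∈ Ioc 0 N, F m * e m)
  have h7 := abs_sub (∑ m ∈ Ioc 0 N, F m * ∑ k ∈ Ioc 0 (N / m), K k) (c * ∑ m ∈ Ioc 0 N, F m)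
  calc _ ≤ x ^ δ * (4.2 * (g / g.totient)) := by
        refine mul_le_mul_of_nonneg_left ?_ (by positivity)
        linarith
    _ = _ := by ring

lemma prod_sq_div_le (N : ℕ) (hN : 2 ≤ N) :
    ∏ k ∈ Ioc 2 N, (((k : ℝ) - 1) ^ 2 / ((k - 2) * k)) = 2 * ((N : ℝ) - 1) / N := by
  induction N, hN using Nat.le_induction with
  | base => norm_num
  | succ n hn ih =>
    rw [prod_Ioc_succ_top (by omega), ih]
    have h1 : (2 : ℝ) ≤ n := by exact_mod_cast hn
    have h2 : (n : ℝ) - 1 ≠ 0 := by linarith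
    push_cast
    have h3 : (n : ℝ) + 1 - 2 = n - 1 := by ring
    rw [h3]
    field_simp
    ring

/-- An Euler product bound used for mean values of `(n / φ(n)) ^ 2`. -/
lemma prod_primes_le (N : ℕ) :
    ∏ p ∈ Ioc 0 N with p.Prime, (1 + ((2 * p - 1) / ((p : ℝ) - 1) ^ 2) / p) ≤ 10 := by
  have h0 : ∏ p ∈ Ioc 2 (max N 2), ((((p : ℝ) - 1) ^ 2 / ((p - 2) * p)) ^ 2) ≤ 4 := by
    rw [prod_pow, prod_sq_div_le _ (le_max_right _ _)]
    have h1 : (2 : ℝ) ≤ (max N 2 : ℕ) := by exact_mod_cast le_max_right N 2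
    have h2 : 2 * (((max N 2 : ℕ) : ℝ) - 1) / (max N 2 : ℕ) ≤ 2 := by
      rw [div_le_iff₀ (by linarith)]; linarith
    have h3 : 0 ≤ 2 * (((max N 2 : ℕ) : ℝ) - 1) / (max N 2 : ℕ) :=
      div_nonneg (by linarith) (by linarith)
    nlinarith
  have hge : ∀ p ∈ Ioc 2 (max N 2), 1 + ((2 * p - 1) / ((p : ℝ) - 1) ^ 2) / p
      ≤ (((p : ℝ) - 1) ^ 2 / ((p - 2) * p)) ^ 2 := by
    intro p hp
    have h1 : (3 : ℝ) ≤ p := by exact_mod_cast (mem_Ioc.mp hp).1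
    have h2 : 0 < (p : ℝ) - 2 := by linarith
    have h3 : 0 < (p : ℝ) - 1 := by linarith
    have e : ((p : ℝ) - 1) ^ 2 / ((p - 2) * p) = 1 + 1 / ((p - 2) * p) := by
      field_simp; ring
    have h5 : ((2 * p - 1) / ((p : ℝ) - 1) ^ 2) / p ≤ 2 * (1 / ((p - 2) * p)) := by
      rw [div_div, mul_one_div, div_le_div_iff₀ (by positivity) (by positivity)]
      have : (2 * (p : ℝ) - 1) * (p - 2) ≤ 2 * (p - 1) ^ 2 := by nlinarith
      nlinarith
    rw [e]
    nlinarith [sq_nonneg (1 / (((p : ℝ) - 2) * p))]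
  have hone : ∀ p ∈ Ioc 2 (max N 2), 1 ≤ (((p : ℝ) - 1) ^ 2 / ((p - 2) * p)) ^ 2 := by
    intro p hp
    refine le_trans ?_ (hge p hp)
    have h1 : (3 : ℝ) ≤ p := by exact_mod_cast (mem_Ioc.mp hp).1
    have : 0 ≤ ((2 * p - 1) / ((p : ℝ) - 1) ^ 2) / p := by
      refine div_nonneg (div_nonneg ?_ (sq_nonneg _)) ?_ <;> linarith
    linarith
  have hpos : ∀ p ∈ ({p ∈ Ioc 0 N | p.Prime} : Finset ℕ),
      0 ≤ 1 + ((2 * p - 1) / ((p : ℝ) - 1) ^ 2) / p := by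
    intro p hp
    have h1 : (2 : ℝ) ≤ p := by exact_mod_cast (mem_filter.mp hp).2.two_le
    have : 0 ≤ ((2 * p - 1) / ((p : ℝ) - 1) ^ 2) / p := by
      refine div_nonneg (div_nonneg ?_ (sq_nonneg _)) ?_ <;> linarith
    linarith
  set f : ℕ → ℝ := fun p => if p = 2 then 5 / 2 else (((p : ℝ) - 1) ^ 2 / ((p - 2) * p)) ^ 2
    with hf
  calc _ ≤ ∏ p ∈ Ioc 0 N with p.Prime, f p := by
        refine prod_le_prod hpos fun p hp => ?_
        obtain ⟨h1, h2⟩ := mem_filter.mp hp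
        simp only [hf]
        split_ifs with h
        · subst h; norm_num
        · refine hge p (mem_Ioc.mpr ⟨lt_of_le_of_ne h2.two_le (Ne.symm h), ?_⟩)
          exact (mem_Ioc.mp h1).2.trans (le_max_left _ _)
    _ ≤ ∏ p ∈ Ioc 1 (max N 2), f p := by
        have hsub : ({p ∈ Ioc 0 N | p.Prime} : Finset ℕ) ⊆ Ioc 1 (max N 2) := by
          intro p hp
          obtain ⟨h1, h2⟩ := mem_filter.mp hp
          exact mem_Ioc.mpr ⟨h2.one_lt, (mem_Ioc.mp h1).2.trans (le_max_left _ _)⟩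
        have hf1 : ∀ p ∈ Ioc 1 (max N 2), 1 ≤ f p := by
          intro p hp
          simp only [hf]
          split_ifs with h
          · norm_num
          · have := mem_Ioc.mp hp
            exact hone p (mem_Ioc.mpr ⟨by omega, this.2⟩)
        rw [← prod_sdiff hsub]
        refine le_mul_of_one_le_left (prod_nonneg fun p hp => ?_) ?_
        · linarith [hf1 p (hsub hp)]
        · have h5 := prod_le_prod (s := Ioc 1 (max N 2) \ {p ∈ Ioc 0 N | p.Prime})
            (f := fun _ => (1 : ℝ)) (g := f) (fun _ _ => zero_le_one)
            fun p hp => hf1 p (mem_sdiff.mp hp).1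
          rwa [prod_const_one] at h5
    _ = 5 / 2 * ∏ p ∈ Ioc 2 (max N 2), ((((p : ℝ) - 1) ^ 2 / ((p - 2) * p)) ^ 2) := by
        rw [← prod_Ioc_consecutive f (by norm_num : 1 ≤ 2) (le_max_right N 2)]
        congr 1
        · simp [hf, show Ioc 1 2 = {2} from rfl]
        · refine prod_congr rfl fun p hp => ?_
          simp [hf, (mem_Ioc.mp hp).1.ne']
    _ ≤ 10 := by linarith

lemma sq_div_totient_eq {g : ℕ} (hg : g ≠ 0) : ((g : ℝ) / g.totient) ^ 2
    = ∑ t ∈ g.primeFactors.powerset, ∏ p ∈ t, ((2 * p - 1) / ((p : ℝ) - 1) ^ 2) := by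
  rw [← prod_one_add]
  have h1 : (g.totient : ℝ) = g * ∏ p ∈ g.primeFactors, (1 - (p : ℝ)⁻¹) := by
    have := Nat.totient_eq_mul_prod_factors g
    have h2 := congrArg (fun x : ℚ => (x : ℝ)) this
    push_cast at h2
    exact h2
  have hg0 : (g : ℝ) ≠ 0 := by exact_mod_cast hg
  rw [h1, div_mul_cancel_left₀ hg0, ← prod_inv_distrib, ← prod_pow]
  refine prod_congr rfl fun p hp => ?_
  have h2 : (2 : ℝ) ≤ p := by exact_mod_cast (Nat.prime_of_mem_primeFactors hp).two_le
  have h3 : (p : ℝ) - 1 ≠ 0 := by linarith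
  have h4 : (p : ℝ) ≠ 0 := by linarith
  field_simp
  ring

lemma sum_inv_mul_sq_div_totient_le (N : ℕ) :
    ∑ g ∈ Ioc 0 N with Squarefree g, (g : ℝ)⁻¹ * ((g : ℝ) / g.totient) ^ 2
      ≤ 10 * (1 + Real.log N) := by
  set f : ℕ → ℝ := fun p => (2 * p - 1) / ((p : ℝ) - 1) ^ 2
  set P : Finset ℕ := {p ∈ Ioc 0 N | p.Prime}
  have hf0 : ∀ p ∈ P, 0 ≤ f p := by
    intro p hp
    have h1 : (2 : ℝ) ≤ p := by exact_mod_cast (mem_filter.mp hp).2.two_le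
    exact div_nonneg (by linarith) (sq_nonneg _)
  have hH : ∑ m ∈ Ioc 0 N, (m : ℝ)⁻¹ ≤ 1 + Real.log N := by
    have h1 := harmonic_le_one_add_log N
    rw [harmonic_eq_sum_Icc] at h1
    push_cast at h1
    exact h1
  have hsub : ∀ g ∈ ({g ∈ Ioc 0 N | Squarefree g} : Finset ℕ), g.primeFactors ⊆ P := by
    intro g hg p hp
    have h1 := mem_Ioc.mp (mem_filter.mp hg).1
    have h2 := Nat.prime_of_mem_primeFactors hp
    exact mem_filter.mpr ⟨mem_Ioc.mpr ⟨h2.pos,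
      (Nat.le_of_mem_primeFactors hp).trans h1.2⟩, h2⟩
  have e1 : ∑ g ∈ Ioc 0 N with Squarefree g, (g : ℝ)⁻¹ * ((g : ℝ) / g.totient) ^ 2
      = ∑ t ∈ P.powerset, ∑ g ∈ Ioc 0 N with Squarefree g,
        if t ⊆ g.primeFactors then (g : ℝ)⁻¹ * ∏ p ∈ t, f p else 0 := by
    rw [sum_comm]
    refine sum_congr rfl fun g hg => ?_
    have hg0 : g ≠ 0 := (mem_Ioc.mp (mem_filter.mp hg).1).1.ne'
    rw [sq_div_totient_eq hg0, mul_sum, ← sum_filter]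
    refine sum_congr ?_ fun _ _ => rfl
    ext t
    rw [mem_powerset, mem_filter, mem_powerset]
    exact ⟨fun h => ⟨h.trans (hsub g hg), h⟩, fun h => h.2⟩
  have e2 : ∀ t ∈ P.powerset, ∑ g ∈ Ioc 0 N with Squarefree g,
        (if t ⊆ g.primeFactors then (g : ℝ)⁻¹ * ∏ p ∈ t, f p else 0)
        ≤ (∏ p ∈ t, f p / p) * (1 + Real.log N) := by
    intro t ht
    rw [mem_powerset] at ht
    have hft : 0 ≤ ∏ p ∈ t, f p := prod_nonneg fun p hp => hf0 p (ht hp)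
    have htpf : ∀ p ∈ t, p.Prime := fun p hp => (mem_filter.mp (ht hp)).2
    set D := ∏ p ∈ t, p
    have hD0 : 0 < D := prod_pos fun p hp => (htpf p hp).pos
    have hdvd : ∀ g, t ⊆ g.primeFactors → D ∣ g := fun g hg =>
      (prod_dvd_prod_of_subset _ _ _ hg).trans (Nat.prod_primeFactors_dvd g)
    have hDf : ∏ p ∈ t, f p / (p : ℝ) = (∏ p ∈ t, f p) / D := by
      rw [prod_div_distrib (f := f) (g := fun p : ℕ => (p : ℝ)), ← Nat.cast_prod]
    rw [← sum_filter, ← sum_mul, hDf]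
    have h1 : ∑ g ∈ ({g ∈ ({g ∈ Ioc 0 N | Squarefree g} : Finset ℕ) | t ⊆ g.primeFactors} : Finset ℕ),
        (g : ℝ)⁻¹ ≤ (D : ℝ)⁻¹ * ∑ m ∈ Ioc 0 N, (m : ℝ)⁻¹ := by
      rw [mul_sum]
      have h2 : ∀ g ∈ ({g ∈ ({g ∈ Ioc 0 N | Squarefree g} : Finset ℕ) | t ⊆ g.primeFactors} : Finset ℕ),
          (g : ℝ)⁻¹ = (D : ℝ)⁻¹ * ((g / D : ℕ) : ℝ)⁻¹ := by
        intro g hg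
        rw [← mul_inv, ← Nat.cast_mul, Nat.mul_div_cancel' (hdvd g (mem_filter.mp hg).2)]
      rw [sum_congr rfl h2]
      rw [← sum_image (f := fun m : ℕ => (D : ℝ)⁻¹ * (m : ℝ)⁻¹) (g := fun g => g / D)]
      · refine sum_le_sum_of_subset_of_nonneg ?_ fun m _ _ => by positivity
        intro m hm
        obtain ⟨g, hg, rfl⟩ := mem_image.mp hm
        have h3 := hdvd g (mem_filter.mp hg).2
        have h4 := mem_Ioc.mp (mem_filter.mp (mem_filter.mp hg).1).1
        exact mem_Ioc.mpr ⟨Nat.div_pos (Nat.le_of_dvd h4.1 h3) hD0,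
          (Nat.div_le_self _ _).trans h4.2⟩
      · intro g hg g' hg' h
        have h3 := hdvd g (mem_filter.mp hg).2
        have h4 := hdvd g' (mem_filter.mp hg').2
        rw [← Nat.mul_div_cancel' h3, ← Nat.mul_div_cancel' h4]
        simp only at h
        rw [h]
    calc _ ≤ ((D : ℝ)⁻¹ * (1 + Real.log N)) * ∏ p ∈ t, f p := by
          refine mul_le_mul_of_nonneg_right (h1.trans ?_) hft
          gcongr
      _ = _ := by ring
  rw [e1]
  refine (sum_le_sum e2).trans ?_
  rw [← sum_mul, ← prod_one_add]
  refine mul_le_mul_of_nonneg_right (prod_primes_le N) ?_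
  refine le_trans ?_ hH
  positivity

/-- The multiplicative function with `∑_{g ∣ m} J(g) = m ^ s` for squarefree `m`. -/
noncomputable def jordanFun (s : ℝ) : ArithmeticFunction ℝ :=
  ArithmeticFunction.prodPrimeFactors fun p => (p : ℝ) ^ s - 1

lemma sum_divisors_jordanFun (s : ℝ) {m : ℕ} (hm : Squarefree m) :
    ∑ g ∈ m.divisors, jordanFun s g = (m : ℝ) ^ s := by
  rw [← ArithmeticFunction.IsMultiplicative.prodPrimeFactors_one_add_of_squarefree
    (ArithmeticFunction.IsMultiplicative.prodPrimeFactors _) hm]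
  have h1 : ∀ p ∈ m.primeFactors, 1 + jordanFun s p = (p : ℝ) ^ s := by
    intro p hp
    have hp' := Nat.prime_of_mem_primeFactors hp
    rw [jordanFun, ArithmeticFunction.prodPrimeFactors_apply hp'.ne_zero, hp'.primeFactors,
      prod_singleton]
    ring
  rw [prod_congr rfl h1, Real.finsetProd_rpow _ _ (fun _ _ => by positivity),
    ← Nat.cast_prod, Nat.prod_primeFactors_of_squarefree hm]

lemma jordanFun_le {s : ℝ} (hs : 0 ≤ s) {g : ℕ} (hg : Squarefree g) :
    jordanFun s g ≤ (g : ℝ) ^ s := by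
  rw [jordanFun, ArithmeticFunction.prodPrimeFactors_apply hg.ne_zero]
  have h1 : ∏ p ∈ g.primeFactors, ((p : ℝ) ^ s - 1) ≤ ∏ p ∈ g.primeFactors, (p : ℝ) ^ s := by
    refine prod_le_prod (fun p hp => ?_) fun p hp => by linarith
    rw [sub_nonneg]
    refine Real.one_le_rpow ?_ hs
    exact_mod_cast (Nat.prime_of_mem_primeFactors hp).one_le
  refine h1.trans (le_of_eq ?_)
  rw [Real.finsetProd_rpow _ _ (fun _ _ => by positivity), ← Nat.cast_prod,
    Nat.prod_primeFactors_of_squarefree hg]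

/-- The Barban–Vehov weights. -/
noncomputable def bvWeight (δ R : ℝ) (d : ℕ) : ℝ :=
  if d ∈ Ioc 0 ⌊R⌋₊ then (moebius d : ℝ) * ((R ^ δ - (d : ℝ) ^ δ) / δ) else 0

/-- The divisor sums of the Barban–Vehov weights. -/
noncomputable def bvSum (δ R : ℝ) (n : ℕ) : ℝ := ∑ d ∈ n.divisors, bvWeight δ R d

lemma bvWeight_of_not_squarefree {δ R : ℝ} {d : ℕ} (hd : ¬ Squarefree d) :
    bvWeight δ R d = 0 := by
  rw [bvWeight, moebius_eq_zero_of_not_squarefree hd]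
  simp

lemma bvSum_eq {δ R : ℝ} {n : ℕ} (hn : n ≠ 0) :
    bvSum δ R n = ∑ d ∈ Ioc 0 ⌊R⌋₊, bvWeight δ R d * if d ∣ n then 1 else 0 := by
  simp_rw [mul_ite, mul_one, mul_zero]
  rw [← sum_filter, bvSum]
  symm
  refine sum_subset (fun d hd => ?_) fun d hd hd' => ?_
  · exact Nat.mem_divisors.mpr ⟨(mem_filter.mp hd).2, hn⟩
  · rw [bvWeight, if_neg]
    intro hc
    exact hd' (mem_filter.mpr ⟨hc, (Nat.mem_divisors.mp hd).1⟩)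

lemma hasSum_rpow_neg_dvd {s : ℝ} (hs : 1 < s) {D : ℕ} (hD : D ≠ 0) :
    HasSum (fun n : ℕ => (if D ∣ n then 1 else 0) * (n : ℝ) ^ (-s))
      ((D : ℝ) ^ (-s) * ∑' n : ℕ, (n : ℝ) ^ (-s)) := by
  have hinj : Function.Injective fun n : ℕ => D * n := fun a b h =>
    Nat.eq_of_mul_eq_mul_left (Nat.pos_of_ne_zero hD) h
  rw [← hinj.hasSum_iff]
  · have h1 := (summable_rpow_neg hs).hasSum.mul_left ((D : ℝ) ^ (-s))
    refine h1.congr_fun ?_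
    intro n
    simp only [Function.comp_apply, dvd_mul_right, if_true, one_mul]
    rw [Nat.cast_mul, Real.mul_rpow (by positivity) (by positivity)]
  · intro n hn
    rw [if_neg, zero_mul]
    rintro ⟨k, rfl⟩
    exact hn ⟨k, rfl⟩

lemma hasSum_sq_bvSum (δ R : ℝ) {s : ℝ} (hs : 1 < s) :
    HasSum (fun n : ℕ => bvSum δ R n ^ 2 * (n : ℝ) ^ (-s))
      ((∑ d ∈ Ioc 0 ⌊R⌋₊, ∑ e ∈ Ioc 0 ⌊R⌋₊, bvWeight δ R d * bvWeight δ R e *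
        ((Nat.lcm d e : ℕ) : ℝ) ^ (-s)) * ∑' n : ℕ, (n : ℝ) ^ (-s)) := by
  have h1 : HasSum (fun n : ℕ => ∑ d ∈ Ioc 0 ⌊R⌋₊, ∑ e ∈ Ioc 0 ⌊R⌋₊,
      bvWeight δ R d * bvWeight δ R e * ((if Nat.lcm d e ∣ n then 1 else 0) * (n : ℝ) ^ (-s)))
      (∑ d ∈ Ioc 0 ⌊R⌋₊, ∑ e ∈ Ioc 0 ⌊R⌋₊, bvWeight δ R d * bvWeight δ R e *
        (((Nat.lcm d e : ℕ) : ℝ) ^ (-s) * ∑' n : ℕ, (n : ℝ) ^ (-s))) := by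
    refine hasSum_sum fun d hd => hasSum_sum fun e he => (hasSum_rpow_neg_dvd hs ?_).mul_left _
    exact Nat.lcm_ne_zero (mem_Ioc.mp hd).1.ne' (mem_Ioc.mp he).1.ne'
  have e1 : (∑ d ∈ Ioc 0 ⌊R⌋₊, ∑ e ∈ Ioc 0 ⌊R⌋₊, bvWeight δ R d * bvWeight δ R e *
        ((Nat.lcm d e : ℕ) : ℝ) ^ (-s)) * ∑' n : ℕ, (n : ℝ) ^ (-s)
      = ∑ d ∈ Ioc 0 ⌊R⌋₊, ∑ e ∈ Ioc 0 ⌊R⌋₊, bvWeight δ R d * bvWeight δ R e *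
        (((Nat.lcm d e : ℕ) : ℝ) ^ (-s) * ∑' n : ℕ, (n : ℝ) ^ (-s)) := by
    simp_rw [sum_mul, mul_assoc]
  rw [e1]
  refine h1.congr_fun ?_
  intro n
  by_cases hn : n = 0
  · subst hn
    simp [Real.zero_rpow (by linarith : -s ≠ 0)]
  · rw [bvSum_eq hn, sq, sum_mul_sum, sum_mul]
    refine sum_congr rfl fun d _ => ?_
    rw [sum_mul]
    refine sum_congr rfl fun e _ => ?_
    by_cases h1 : d ∣ n <;> by_cases h2 : e ∣ n <;> simp [Nat.lcm_dvd_iff, h1, h2]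

lemma sum_bvWeight_multiples {δ R : ℝ} (hδ : 0 < δ) (hR : 0 < R) {g : ℕ} (hg : g ≠ 0) :
    ∑ d ∈ Ioc 0 ⌊R⌋₊ with g ∣ d, bvWeight δ R d * (d : ℝ) ^ (-(1 + δ))
      = (moebius g : ℝ) * (g : ℝ)⁻¹ * smoothMoebiusSum δ (R / g) g := by
  have hg0 : (0 : ℝ) < g := by exact_mod_cast Nat.pos_of_ne_zero hg
  rw [smoothMoebiusSum, mul_sum, Nat.floor_div_natCast]
  refine sum_nbij' (fun d => d / g) (fun m => g * m) ?_ ?_ ?_ ?_ ?_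
  · intro d hd
    obtain ⟨h1, h2⟩ := mem_filter.mp hd
    have h3 := mem_Ioc.mp h1
    exact mem_Ioc.mpr ⟨Nat.div_pos (Nat.le_of_dvd h3.1 h2) (Nat.pos_of_ne_zero hg),
      Nat.div_le_div_right h3.2⟩
  · intro m hm
    have h3 := mem_Ioc.mp hm
    refine mem_filter.mpr ⟨mem_Ioc.mpr ⟨Nat.mul_pos (Nat.pos_of_ne_zero hg) h3.1, ?_⟩,
      dvd_mul_right _ _⟩
    exact (Nat.mul_le_mul_left g h3.2).trans (Nat.mul_div_le _ _)
  · intro d hd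
    exact Nat.mul_div_cancel' (mem_filter.mp hd).2
  · intro m hm
    exact Nat.mul_div_cancel_left _ (Nat.pos_of_ne_zero hg)
  · intro d hd
    obtain ⟨h1, m, rfl⟩ := mem_filter.mp hd
    rw [Nat.mul_div_cancel_left _ (Nat.pos_of_ne_zero hg), bvWeight, if_pos h1]
    have hm : m ≠ 0 := by
      rintro rfl
      simp at h1
    have hm0 : (0 : ℝ) < m := by exact_mod_cast Nat.pos_of_ne_zero hm
    rw [coprimeMoebius_apply _ hm]
    split_ifs with h
    · rw [ArithmeticFunction.isMultiplicative_moebius.map_mul_of_coprime h.symm]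
      push_cast
      rw [Real.mul_rpow hg0.le hm0.le, Real.mul_rpow hg0.le hm0.le, Real.div_rpow hR.le hg0.le,
        neg_add, Real.rpow_add hg0, Real.rpow_neg_one, Real.rpow_neg hg0.le]
      field_simp
    · have : ¬ Squarefree (g * m) := fun hc => h (Nat.squarefree_mul_iff.mp hc).1.symm
      rw [moebius_eq_zero_of_not_squarefree this]
      simp

lemma quadratic_form_eq (δ R s : ℝ) :
    ∑ d ∈ Ioc 0 ⌊R⌋₊, ∑ e ∈ Ioc 0 ⌊R⌋₊, bvWeight δ R d * bvWeight δ R e *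
        ((Nat.lcm d e : ℕ) : ℝ) ^ (-s)
      = ∑ g ∈ Ioc 0 ⌊R⌋₊, jordanFun s g *
        (∑ d ∈ Ioc 0 ⌊R⌋₊ with g ∣ d, bvWeight δ R d * (d : ℝ) ^ (-s)) ^ 2 := by
  have h1 : ∀ g ∈ Ioc 0 ⌊R⌋₊, jordanFun s g *
        (∑ d ∈ Ioc 0 ⌊R⌋₊ with g ∣ d, bvWeight δ R d * (d : ℝ) ^ (-s)) ^ 2
      = ∑ d ∈ Ioc 0 ⌊R⌋₊, ∑ e ∈ Ioc 0 ⌊R⌋₊, (bvWeight δ R d * (d : ℝ) ^ (-s)) *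
        (bvWeight δ R e * (e : ℝ) ^ (-s)) * if g ∣ d ∧ g ∣ e then jordanFun s g else 0 := by
    intro g _
    rw [sum_filter, sq, sum_mul_sum, mul_sum]
    refine sum_congr rfl fun d _ => ?_
    rw [mul_sum]
    refine sum_congr rfl fun e _ => ?_
    by_cases h1 : g ∣ d <;> by_cases h2 : g ∣ e <;> simp [h1, h2]
    ring
  rw [sum_congr rfl h1]
  symm
  rw [sum_comm]
  refine sum_congr rfl fun d hd => ?_
  rw [sum_comm]
  refine sum_congr rfl fun e he => ?_
  symm
  rw [← mul_sum, ← sum_filter]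
  by_cases hsq : Squarefree d
  swap
  · simp [bvWeight_of_not_squarefree hsq]
  have hd' := mem_Ioc.mp hd
  have hgcd : Squarefree (Nat.gcd d e) := hsq.squarefree_of_dvd (Nat.gcd_dvd_left d e)
  have h2 : ∑ g ∈ Ioc 0 ⌊R⌋₊ with g ∣ d ∧ g ∣ e, jordanFun s g = ((Nat.gcd d e : ℕ) : ℝ) ^ s := by
    rw [← sum_divisors_jordanFun s hgcd]
    refine sum_congr ?_ fun _ _ => rfl
    ext g
    rw [mem_filter, Nat.mem_divisors, Nat.dvd_gcd_iff, mem_Ioc]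
    refine ⟨fun h => ⟨h.2, hgcd.ne_zero⟩, fun h => ⟨⟨Nat.pos_of_dvd_of_pos h.1.1 hd'.1, ?_⟩, h.1⟩⟩
    exact (Nat.le_of_dvd hd'.1 h.1.1).trans hd'.2
  rw [h2]
  have h3 : ((Nat.gcd d e : ℕ) : ℝ) * (Nat.lcm d e : ℕ) = d * e := by
    exact_mod_cast Nat.gcd_mul_lcm d e
  have h4 : ((Nat.gcd d e : ℕ) : ℝ) ^ (-s) * ((Nat.lcm d e : ℕ) : ℝ) ^ (-s)
      = (d : ℝ) ^ (-s) * (e : ℝ) ^ (-s) := by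
    rw [← Real.mul_rpow (by positivity) (by positivity), h3,
      Real.mul_rpow (by positivity) (by positivity)]
  have h5 : (0 : ℝ) < (Nat.gcd d e : ℕ) := by exact_mod_cast Nat.pos_of_ne_zero hgcd.ne_zero
  have h6 : ((Nat.gcd d e : ℕ) : ℝ) ^ (-s) * ((Nat.gcd d e : ℕ) : ℝ) ^ s = 1 := by
    rw [← Real.rpow_add h5]; simp
  calc _ = bvWeight δ R d * bvWeight δ R e * (((Nat.gcd d e : ℕ) : ℝ) ^ (-s) *
        ((Nat.lcm d e : ℕ) : ℝ) ^ (-s)) * ((Nat.gcd d e : ℕ) : ℝ) ^ s := by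
        rw [mul_assoc, mul_assoc, mul_right_comm (((Nat.gcd d e : ℕ) : ℝ) ^ (-s)), h6, one_mul]
        ring
    _ = _ := by rw [h4]; ring

/-- Barban–Vehov mean square bound. -/
theorem sum_sq_bvSum_le {δ R : ℝ} (hδ : 0 < δ) (hδ1 : δ ≤ 0.1) (hR : 1 ≤ R) (S : Finset ℕ) :
    ∑ n ∈ S, bvSum δ R n ^ 2 * (n : ℝ) ^ (-(1 + δ))
      ≤ 176.4 * R ^ (2 * δ) * (1 + Real.log R) * ((1 + δ) / δ) := by
  have hR0 : 0 < R := by linarith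
  have h1 := sum_le_hasSum S (fun n _ => by positivity)
    (hasSum_sq_bvSum δ R (s := 1 + δ) (by linarith))
  refine h1.trans ?_
  have hZ := tsum_rpow_neg_le (σ := 1 + δ) (by linarith)
  rw [add_sub_cancel_left] at hZ
  have hZ0 : 0 ≤ ∑' n : ℕ, (n : ℝ) ^ (-(1 + δ)) := tsum_nonneg fun n => by positivity
  rw [quadratic_form_eq]
  have h2 : ∀ g ∈ Ioc 0 ⌊R⌋₊, jordanFun (1 + δ) g *
        (∑ d ∈ Ioc 0 ⌊R⌋₊ with g ∣ d, bvWeight δ R d * (d : ℝ) ^ (-(1 + δ))) ^ 2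
      ≤ if Squarefree g then 17.64 * R ^ (2 * δ) * ((g : ℝ)⁻¹ * ((g : ℝ) / g.totient) ^ 2)
        else 0 := by
    intro g hg
    have hg' := mem_Ioc.mp hg
    have hg0 : (0 : ℝ) < g := by exact_mod_cast hg'.1
    have hg1 : (1 : ℝ) ≤ g := by exact_mod_cast hg'.1
    have hgR : (g : ℝ) ≤ R := le_trans (by exact_mod_cast hg'.2) (Nat.floor_le hR0.le)
    rw [sum_bvWeight_multiples hδ hR0 hg'.1.ne']
    split_ifs with hsq
    swap
    · rw [moebius_eq_zero_of_not_squarefree hsq]; simp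
    have h3 := abs_smoothMoebiusSum_le hδ hδ1 (x := R / g) (by rwa [le_div_iff₀ hg0, one_mul])
      hg'.1.ne'
    have h4 : smoothMoebiusSum δ (R / g) g ^ 2 ≤ (4.2 * (R / g) ^ δ * (g / g.totient)) ^ 2 := by
      rw [← sq_abs]
      exact pow_le_pow_left₀ (abs_nonneg _) h3 2
    have h5 : ((moebius g : ℤ) : ℝ) ^ 2 ≤ 1 := by
      have : |(moebius g : ℝ)| ≤ 1 := by exact_mod_cast abs_moebius_le_one
      rw [← sq_abs]
      nlinarith [abs_nonneg (moebius g : ℝ)]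
    have h6 : (R / g) ^ δ = R ^ δ * (g : ℝ) ^ (-δ) := by
      rw [Real.div_rpow hR0.le hg0.le, Real.rpow_neg hg0.le]; rfl
    have h7 : R ^ (2 * δ) = (R ^ δ) ^ 2 := by
      rw [mul_comm, Real.rpow_mul hR0.le]; norm_num
    have h8 : (g : ℝ) ^ (1 + δ) * (g : ℝ) ^ (-δ) = g := by
      rw [← Real.rpow_add hg0]; simp
    have h9 : (g : ℝ) ^ (-δ) ≤ 1 := Real.rpow_le_one_of_one_le_of_nonpos hg1 (by linarith)
    calc _ ≤ (g : ℝ) ^ (1 + δ) * (1 * ((g : ℝ)⁻¹ ^ 2 *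
          (4.2 * (R / g) ^ δ * (g / g.totient)) ^ 2)) := by
          refine mul_le_mul (jordanFun_le (by linarith) hsq) ?_ (sq_nonneg _) (by positivity)
          rw [mul_pow, mul_pow, mul_assoc]
          refine mul_le_mul h5 ?_ (by positivity) zero_le_one
          exact mul_le_mul_of_nonneg_left h4 (by positivity)
      _ = 17.64 * R ^ (2 * δ) * ((g : ℝ) / g.totient) ^ 2 * (g : ℝ)⁻¹ ^ 2 *
          (((g : ℝ) ^ (1 + δ) * (g : ℝ) ^ (-δ)) * (g : ℝ) ^ (-δ)) := by
          rw [h6, h7]; ring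
      _ = 17.64 * R ^ (2 * δ) * ((g : ℝ) / g.totient) ^ 2 * (g : ℝ)⁻¹ * (g : ℝ) ^ (-δ) := by
          rw [h8]; field_simp
      _ ≤ 17.64 * R ^ (2 * δ) * ((g : ℝ) / g.totient) ^ 2 * (g : ℝ)⁻¹ * 1 := by gcongr
      _ = _ := by ring
  have h3 : ∑ g ∈ Ioc 0 ⌊R⌋₊, jordanFun (1 + δ) g *
        (∑ d ∈ Ioc 0 ⌊R⌋₊ with g ∣ d, bvWeight δ R d * (d : ℝ) ^ (-(1 + δ))) ^ 2
      ≤ 17.64 * R ^ (2 * δ) * (10 * (1 + Real.log R)) := by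
    refine (sum_le_sum h2).trans ?_
    rw [← sum_filter, ← mul_sum]
    refine mul_le_mul_of_nonneg_left ?_ (by positivity)
    refine (sum_inv_mul_sq_div_totient_le ⌊R⌋₊).trans ?_
    have h4 : Real.log ⌊R⌋₊ ≤ Real.log R := by
      refine Real.log_le_log ?_ (Nat.floor_le hR0.le)
      exact_mod_cast (Nat.floor_pos.mpr hR)
    linarith
  calc _ ≤ 17.64 * R ^ (2 * δ) * (10 * (1 + Real.log R)) * ((1 + δ) / δ) := by
        refine mul_le_mul h3 hZ hZ0 ?_
        have := Real.log_nonneg hR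
        positivity
    _ = _ := by ring

end LinnikAP

namespace LinnikAP

open Finset Complex
open ArithmeticFunction (moebius)

/-- Weights equal to the Möbius function up to `U` and decaying to zero at `V`. -/
noncomputable def mollWeight (δ U V : ℝ) (d : ℕ) : ℝ :=
  (bvWeight δ V d - bvWeight δ U d) / ((V ^ δ - U ^ δ) / δ)

/-- The divisor sums of `mollWeight`. -/
noncomputable def mollSum (δ U V : ℝ) (n : ℕ) : ℝ := ∑ d ∈ n.divisors, mollWeight δ U V d

section weights

variable {δ U V : ℝ}

lemma mollSum_eq (δ U V : ℝ) (n : ℕ) :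
    mollSum δ U V n = (bvSum δ V n - bvSum δ U n) / ((V ^ δ - U ^ δ) / δ) := by
  simp only [mollSum, mollWeight, bvSum, ← sum_div, sum_sub_distrib]

lemma mollWeight_denom_pos (hδ : 0 < δ) (hU : 1 ≤ U) (hUV : U < V) : 0 < (V ^ δ - U ^ δ) / δ := by
  have := Real.rpow_lt_rpow (by linarith) hUV hδ
  have : 0 < V ^ δ - U ^ δ := by linarith
  positivity

lemma mollWeight_of_le (hδ : 0 < δ) (hU : 1 ≤ U) (hUV : U < V) {d : ℕ} (hd0 : d ≠ 0)
    (hd : (d : ℝ) ≤ U) : mollWeight δ U V d = moebius d := by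
  have h1 := mollWeight_denom_pos hδ hU hUV
  have h2 : d ∈ Ioc 0 ⌊U⌋₊ := mem_Ioc.mpr ⟨Nat.pos_of_ne_zero hd0, Nat.le_floor hd⟩
  have h3 : d ∈ Ioc 0 ⌊V⌋₊ := mem_Ioc.mpr
    ⟨Nat.pos_of_ne_zero hd0, Nat.le_floor (hd.trans hUV.le)⟩
  rw [mollWeight, bvWeight, bvWeight, if_pos h2, if_pos h3, div_eq_iff h1.ne']
  ring

lemma mollWeight_of_gt (hUV : U < V) {d : ℕ} (hd : d ∉ Ioc 0 ⌊V⌋₊) :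
    mollWeight δ U V d = 0 := by
  have h2 : d ∉ Ioc 0 ⌊U⌋₊ := fun h => hd <| by
    rw [mem_Ioc] at *
    exact ⟨h.1, h.2.trans (Nat.floor_mono hUV.le)⟩
  rw [mollWeight, bvWeight, bvWeight, if_neg h2, if_neg hd]
  simp

lemma abs_mollWeight_le (hδ : 0 < δ) (hU : 1 ≤ U) (hUV : U < V) (d : ℕ) :
    |mollWeight δ U V d| ≤ 1 := by
  have hμ : |(moebius d : ℝ)| ≤ 1 := by exact_mod_cast ArithmeticFunction.abs_moebius_le_one
  by_cases hd : d ∈ Ioc 0 ⌊V⌋₊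
  swap
  · rw [mollWeight_of_gt hUV hd]; simp
  have hd' := mem_Ioc.mp hd
  rcases le_or_gt (d : ℝ) U with h | h
  · rwa [mollWeight_of_le hδ hU hUV hd'.1.ne' h]
  have h1 := mollWeight_denom_pos hδ hU hUV
  have h2 : d ∉ Ioc 0 ⌊U⌋₊ := fun h' => by
    have := (Nat.le_floor_iff (by linarith)).mp (mem_Ioc.mp h').2
    linarith
  have hdV : (d : ℝ) ≤ V := (Nat.le_floor_iff (by linarith)).mp hd'.2
  have h3 := Real.rpow_le_rpow (by positivity) hdV hδ.le
  have h4 := Real.rpow_le_rpow (by linarith) h.le hδ.le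
  rw [mollWeight, bvWeight, bvWeight, if_neg h2, if_pos hd, sub_zero, abs_div, abs_mul,
    abs_of_pos h1, div_le_one h1, abs_of_nonneg (div_nonneg (by linarith) hδ.le)]
  calc _ ≤ 1 * ((V ^ δ - (d : ℝ) ^ δ) / δ) :=
        mul_le_mul_of_nonneg_right hμ (div_nonneg (by linarith) hδ.le)
    _ ≤ _ := by rw [one_mul]; gcongr

lemma mollSum_of_le (hδ : 0 < δ) (hU : 1 ≤ U) (hUV : U < V) {n : ℕ}
    (hn : (n : ℝ) ≤ U) : mollSum δ U V n = if n = 1 then 1 else 0 := by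
  rw [mollSum, ← sum_divisors_moebius]
  refine sum_congr rfl fun d hd => ?_
  have hd0 := (Nat.pos_of_mem_divisors hd).ne'
  refine mollWeight_of_le hδ hU hUV hd0 (le_trans ?_ hn)
  exact_mod_cast Nat.divisor_le hd

lemma sum_sq_mollSum_le (hδ : 0 < δ) (hδ1 : δ ≤ 0.1) (hU : 1 ≤ U) (hUV : U < V) (S : Finset ℕ) :
    ∑ n ∈ S, mollSum δ U V n ^ 2 * (n : ℝ) ^ (-(1 + δ))
      ≤ 352.8 * (V ^ (2 * δ) * (1 + Real.log V) + U ^ (2 * δ) * (1 + Real.log U)) *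
        ((1 + δ) / δ) / ((V ^ δ - U ^ δ) / δ) ^ 2 := by
  have h0 := mollWeight_denom_pos hδ hU hUV
  have hV := sum_sq_bvSum_le hδ hδ1 (hU.trans hUV.le) S
  have hU' := sum_sq_bvSum_le hδ hδ1 hU S
  rw [le_div_iff₀ (by positivity), sum_mul]
  calc _ ≤ ∑ n ∈ S, (2 * (bvSum δ V n ^ 2 * (n : ℝ) ^ (-(1 + δ))) +
        2 * (bvSum δ U n ^ 2 * (n : ℝ) ^ (-(1 + δ)))) := by
        refine sum_le_sum fun n _ => ?_
        have h1 : 0 ≤ (n : ℝ) ^ (-(1 + δ)) := by positivity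
        have h2 : mollSum δ U V n * ((V ^ δ - U ^ δ) / δ) = bvSum δ V n - bvSum δ U n := by
          rw [mollSum_eq, div_mul_cancel₀ _ h0.ne']
        calc _ = (mollSum δ U V n * ((V ^ δ - U ^ δ) / δ)) ^ 2 * (n : ℝ) ^ (-(1 + δ)) := by ring
          _ ≤ (2 * bvSum δ V n ^ 2 + 2 * bvSum δ U n ^ 2) * (n : ℝ) ^ (-(1 + δ)) := by
            rw [h2]
            refine mul_le_mul_of_nonneg_right ?_ h1
            nlinarith [sq_nonneg (bvSum δ V n + bvSum δ U n)]
          _ = _ := by ring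
    _ ≤ _ := by
        rw [sum_add_distrib, ← mul_sum, ← mul_sum]
        linarith

end weights

section truncation

variable {q : ℕ} [NeZero q]

/-- Partial sums over multiples of `l` at a zero. -/
lemma norm_sum_multiples_le {χ : DirichletCharacter ℂ q} (hχ : χ ≠ 1) {ρ : ℂ}
    (hρ : χ.LFunction ρ = 0) (h0 : 1 / 2 ≤ ρ.re) (h1 : ρ.re ≤ 1) {l N : ℕ} (hl : 0 < l)
    (hlN : l ≤ N) :
    ‖∑ n ∈ Ioc 0 N, (if l ∣ n then 1 else 0) * (χ (n : ZMod q) * (n : ℂ) ^ (-ρ))‖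
      ≤ 8 * q * ‖ρ‖ * (N : ℝ) ^ (-ρ.re) := by
  have hN : 0 < N := hl.trans_le hlN
  set M := N / l with hM
  have hM1 : 1 ≤ M := (Nat.one_le_div_iff hl).mpr hlN
  have h2 : ∑ n ∈ Ioc 0 N, (if l ∣ n then 1 else 0) * (χ (n : ZMod q) * (n : ℂ) ^ (-ρ))
      = χ (l : ZMod q) * (l : ℂ) ^ (-ρ) * ∑ m ∈ Icc 1 M, χ (m : ZMod q) * (m : ℂ) ^ (-ρ) := by
    simp_rw [ite_mul, one_mul, zero_mul]
    rw [← sum_filter, mul_sum]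
    refine sum_nbij' (fun d => d / l) (fun m => l * m) ?_ ?_ ?_ ?_ ?_
    · intro n hn
      obtain ⟨hn1, m, rfl⟩ := mem_filter.mp hn
      rw [mem_Ioc] at hn1
      rw [Nat.mul_div_cancel_left _ hl, mem_Icc, hM, Nat.le_div_iff_mul_le hl]
      exact ⟨Nat.pos_of_mul_pos_left hn1.1, by linarith [hn1.2, mul_comm l m]⟩
    · intro m hm
      rw [mem_Icc, hM, Nat.le_div_iff_mul_le hl] at hm
      rw [mem_filter, mem_Ioc]
      exact ⟨⟨Nat.mul_pos hl hm.1, by linarith [hm.2, mul_comm l m]⟩, dvd_mul_right _ _⟩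
    · intro n hn
      exact Nat.mul_div_cancel' (mem_filter.mp hn).2
    · intro m hm
      exact Nat.mul_div_cancel_left _ hl
    · intro n hn
      obtain ⟨hn1, m, rfl⟩ := mem_filter.mp hn
      rw [Nat.mul_div_cancel_left _ hl]
      push_cast
      rw [map_mul, natCast_mul_natCast_cpow]
      ring
  rw [h2, norm_mul, norm_mul]
  have h3 := norm_LFunction_sub_sum_le hχ hM1 (s := ρ) (by linarith)
  rw [hρ, zero_sub, norm_neg] at h3
  have h4 : ‖(l : ℂ) ^ (-ρ)‖ = (l : ℝ) ^ (-ρ.re) := by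
    rw [norm_natCast_cpow_of_pos hl]; simp
  have h5 : (l : ℝ) ^ (-ρ.re) * (M : ℝ) ^ (-ρ.re) ≤ 2 * (N : ℝ) ^ (-ρ.re) := by
    rw [← Real.mul_rpow (by positivity) (by positivity)]
    have hNR : (0 : ℝ) < N := by exact_mod_cast hN
    have h6 : (N : ℝ) / 2 ≤ l * M := by
      have h7 : N < l * (M + 1) := Nat.lt_mul_div_succ N hl
      have h8 : N ≤ 2 * (l * M) := by nlinarith
      have h9 : (N : ℝ) ≤ 2 * (l * M) := by exact_mod_cast h8
      linarith
    calc _ ≤ ((N : ℝ) / 2) ^ (-ρ.re) :=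
          Real.rpow_le_rpow_of_nonpos (by positivity) h6 (by linarith)
      _ = (N : ℝ) ^ (-ρ.re) * 2 ^ ρ.re := by
          rw [Real.div_rpow hNR.le (by norm_num), Real.rpow_neg (by norm_num : (0 : ℝ) ≤ 2),
            div_inv_eq_mul]
      _ ≤ (N : ℝ) ^ (-ρ.re) * 2 := by
          refine mul_le_mul_of_nonneg_left ?_ (by positivity)
          calc (2 : ℝ) ^ ρ.re ≤ 2 ^ (1 : ℝ) := Real.rpow_le_rpow_of_exponent_le (by norm_num) h1
            _ = 2 := Real.rpow_one 2
      _ = _ := mul_comm _ _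
  have h6 : 2 * (q : ℝ) * ‖ρ‖ / ρ.re ≤ 4 * q * ‖ρ‖ := by
    rw [div_le_iff₀ (by linarith)]
    have : 0 ≤ (q : ℝ) * ‖ρ‖ := by positivity
    nlinarith
  calc _ ≤ 1 * (l : ℝ) ^ (-ρ.re) * (4 * q * ‖ρ‖ * (M : ℝ) ^ (-ρ.re)) := by
        rw [h4]
        refine mul_le_mul ?_ (h3.trans ?_) (norm_nonneg _) (by positivity)
        · exact mul_le_mul_of_nonneg_right (χ.norm_le_one _) (by positivity)
        · exact mul_le_mul_of_nonneg_right h6 (by positivity)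
    _ = 4 * q * ‖ρ‖ * ((l : ℝ) ^ (-ρ.re) * (M : ℝ) ^ (-ρ.re)) := by ring
    _ ≤ 4 * q * ‖ρ‖ * (2 * (N : ℝ) ^ (-ρ.re)) := by gcongr
    _ = _ := by ring

/-- A doubly mollified Dirichlet polynomial is small at a zero of the `L`-function. -/
lemma norm_sum_mollified_le {χ : DirichletCharacter ℂ q} (hχ : χ ≠ 1) {ρ : ℂ}
    (hρ : χ.LFunction ρ = 0) (h0 : 1 / 2 ≤ ρ.re) (h1 : ρ.re ≤ 1) {a b : ℕ → ℝ} {V R N : ℕ}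
    (ha : ∀ d, |a d| ≤ 1) (hb : ∀ d, |b d| ≤ 1) (ha0 : ∀ d ∉ Ioc 0 V, a d = 0)
    (hb0 : ∀ d ∉ Ioc 0 R, b d = 0) (hN : V * R ≤ N) :
    ‖∑ n ∈ Ioc 0 N, ((((∑ d ∈ n.divisors, a d) * ∑ e ∈ n.divisors, b e : ℝ)) : ℂ) *
        (χ (n : ZMod q) * (n : ℂ) ^ (-ρ))‖
      ≤ V * R * (8 * q * ‖ρ‖ * (N : ℝ) ^ (-ρ.re)) := by
  have key : ∀ (f : ℕ → ℝ) (W : ℕ), (∀ d ∉ Ioc 0 W, f d = 0) → ∀ n : ℕ, n ≠ 0 →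
      ∑ d ∈ n.divisors, f d = ∑ d ∈ Ioc 0 W, f d * if d ∣ n then 1 else 0 := by
    intro f W hf n hn
    simp_rw [mul_ite, mul_one, mul_zero]
    rw [← sum_filter]
    symm
    refine sum_subset (fun d hd => ?_) fun d hd hd' => ?_
    · exact Nat.mem_divisors.mpr ⟨(mem_filter.mp hd).2, hn⟩
    · exact hf d fun h => hd' (mem_filter.mpr ⟨h, Nat.dvd_of_mem_divisors hd⟩)
  have h2 : ∑ n ∈ Ioc 0 N, ((((∑ d ∈ n.divisors, a d) * ∑ e ∈ n.divisors, b e : ℝ)) : ℂ) *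
        (χ (n : ZMod q) * (n : ℂ) ^ (-ρ))
      = ∑ d ∈ Ioc 0 V, ∑ e ∈ Ioc 0 R, ((a d * b e : ℝ) : ℂ) *
        ∑ n ∈ Ioc 0 N, (if Nat.lcm d e ∣ n then 1 else 0) *
          (χ (n : ZMod q) * (n : ℂ) ^ (-ρ)) := by
    have h3 : ∀ n ∈ Ioc 0 N, ((((∑ d ∈ n.divisors, a d) * ∑ e ∈ n.divisors, b e : ℝ)) : ℂ) *
        (χ (n : ZMod q) * (n : ℂ) ^ (-ρ))
        = ∑ d ∈ Ioc 0 V, ∑ e ∈ Ioc 0 R, ((a d * b e : ℝ) : ℂ) *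
          ((if Nat.lcm d e ∣ n then 1 else 0) * (χ (n : ZMod q) * (n : ℂ) ^ (-ρ))) := by
      intro n hn
      have hn0 := (mem_Ioc.mp hn).1.ne'
      rw [key a V ha0 n hn0, key b R hb0 n hn0, sum_mul_sum]
      push_cast
      rw [sum_mul]
      refine sum_congr rfl fun d _ => ?_
      rw [sum_mul]
      refine sum_congr rfl fun e _ => ?_
      simp only [Nat.lcm_dvd_iff]
      by_cases hd : d ∣ n <;> by_cases he : e ∣ n <;> simp [hd, he]
    rw [sum_congr rfl h3, sum_comm]
    refine sum_congr rfl fun d _ => ?_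
    rw [sum_comm]
    exact sum_congr rfl fun e _ => (mul_sum _ _ _).symm
  rw [h2]
  have h4 : ∀ d ∈ Ioc 0 V, ‖∑ e ∈ Ioc 0 R, ((a d * b e : ℝ) : ℂ) *
        ∑ n ∈ Ioc 0 N, (if Nat.lcm d e ∣ n then 1 else 0) *
          (χ (n : ZMod q) * (n : ℂ) ^ (-ρ))‖ ≤ R * (8 * q * ‖ρ‖ * (N : ℝ) ^ (-ρ.re)) := by
    intro d hd
    refine (norm_sum_le_of_le _ (n := fun _ => 8 * q * ‖ρ‖ * (N : ℝ) ^ (-ρ.re)) fun e he => ?_).trans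
      (le_of_eq ?_)
    · rw [norm_mul, norm_real, Real.norm_eq_abs, abs_mul]
      have hd' := mem_Ioc.mp hd
      have he' := mem_Ioc.mp he
      have h5 := norm_sum_multiples_le hχ hρ h0 h1 (l := Nat.lcm d e) (N := N)
        (Nat.lcm_pos hd'.1 he'.1) ?_
      · calc _ ≤ 1 * (8 * q * ‖ρ‖ * (N : ℝ) ^ (-ρ.re)) :=
            mul_le_mul (mul_le_one₀ (ha d) (abs_nonneg _) (hb e)) h5 (norm_nonneg _) zero_le_one
          _ = _ := one_mul _
      · exact ((Nat.le_of_dvd (Nat.mul_pos hd'.1 he'.1) (Nat.lcm_dvd_mul d e)).trans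
          (Nat.mul_le_mul hd'.2 he'.2)).trans hN
    · simp
  refine (norm_sum_le_of_le _ h4).trans (le_of_eq ?_)
  simp
  ring

end truncation

end LinnikAP

namespace LinnikAP

open Finset Complex Filter
open scoped Real

/-- The range of summation of the doubly mollified polynomial. -/
noncomputable def mollRange (L : ℝ) : Finset ℕ :=
  Ioc ⌊Real.exp (2.1 * L)⌋₊ ⌊Real.exp (7 * L)⌋₊

/-- The coefficients of the doubly mollified polynomial. -/
noncomputable def mollCoeff (q : ℕ) (L : ℝ) (n : ℕ) : ℝ :=
  mollSum (0.1 / L) (Real.exp (2.1 * L)) (Real.exp (4.2 * L)) n *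
    sieveDivisorSum q ⌊Real.exp (0.5 * L)⌋₊ n

/-- The doubly mollified polynomial detecting zeros far from the line `re s = 1`. -/
noncomputable def mollPoly {q : ℕ} (χ : DirichletCharacter ℂ q) (L : ℝ) (s : ℂ) : ℂ :=
  ∑ n ∈ mollRange L, (mollCoeff q L n : ℂ) * (χ (n : ZMod q) * (n : ℂ) ^ (-s))

lemma log_of_mem_mollRange {L : ℝ} {n : ℕ} (hn : n ∈ mollRange L) :
    n ≠ 0 ∧ 2.1 * L < Real.log n ∧ Real.log n ≤ 7 * L := by
  rw [mollRange, mem_Ioc, Nat.floor_lt (Real.exp_pos _).le] at hn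
  have hn0 : (0 : ℝ) < n := (Real.exp_pos _).trans hn.1
  refine ⟨by exact_mod_cast hn0.ne', (Real.lt_log_iff_exp_lt hn0).mpr hn.1,
    (Real.log_le_iff_le_exp hn0).mpr ?_⟩
  exact (Nat.le_floor_iff (Real.exp_pos _).le).mp hn.2

lemma differentiable_mollPoly {q : ℕ} (χ : DirichletCharacter ℂ q) (L : ℝ) :
    Differentiable ℂ (mollPoly χ L) := by
  unfold mollPoly
  refine Differentiable.fun_sum fun n hn => ?_
  have hn0 : (n : ℂ) ≠ 0 := by exact_mod_cast (log_of_mem_mollRange hn).1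
  exact (((differentiable_id.neg).const_cpow (Or.inl hn0)).const_mul _).const_mul _

lemma mollPoly_line {q : ℕ} (χ : DirichletCharacter ℂ q) (L : ℝ) (σ t : ℝ) :
    mollPoly χ L (σ + t * I) = ∑ n ∈ mollRange L,
      ((mollCoeff q L n * (n : ℝ) ^ (-σ) : ℝ) : ℂ) * χ (n : ZMod q) *
        cexp (-(I * t * Real.log n)) := by
  refine sum_congr rfl fun n hn => ?_
  rw [natCast_cpow_neg_line (log_of_mem_mollRange hn).1]
  push_cast
  ring

lemma exp_bounds_moll : Real.exp 0.84 ≤ 2.4 ∧ Real.exp 0.42 ≤ 1.6 ∧ Real.exp 0.7 ≤ 2.1 ∧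
    0.254 ≤ Real.exp 0.42 - Real.exp 0.21 := by
  have h21 : Real.exp 0.21 ≤ 1.2345 := by
    have := Real.exp_bound_div_one_sub_of_interval (x := 0.07) (by norm_num) (by norm_num)
    have h2 := Real.exp_bound' (x := 0.21) (by norm_num) (by norm_num) (n := 4) (by norm_num)
    norm_num [sum_range_succ, Nat.factorial] at h2
    linarith
  have h21' : 1.21 ≤ Real.exp 0.21 := by
    have := Real.add_one_le_exp (0.21 : ℝ); linarith
  have h42 : Real.exp 0.42 = Real.exp 0.21 ^ 2 := by
    rw [← Real.exp_nat_mul]; norm_num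
  have h84 : Real.exp 0.84 = Real.exp 0.21 ^ 4 := by
    rw [← Real.exp_nat_mul]; norm_num
  have h70 : Real.exp 0.7 ≤ 2.1 := by
    have h2 := Real.exp_bound' (x := 0.7) (by norm_num) (by norm_num) (n := 4) (by norm_num)
    norm_num [sum_range_succ, Nat.factorial] at h2
    linarith
  refine ⟨?_, ?_, h70, ?_⟩
  · rw [h84]
    calc _ ≤ (1.2345 : ℝ) ^ 4 := by gcongr
      _ ≤ _ := by norm_num
  · rw [h42]
    calc _ ≤ (1.2345 : ℝ) ^ 2 := by gcongr
      _ ≤ _ := by norm_num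
  · rw [h42]; nlinarith

lemma sum_sq_mollSum_exp_le {L : ℝ} (hL : 100 ≤ L) (S : Finset ℕ) :
    ∑ n ∈ S, mollSum (0.1 / L) (Real.exp (2.1 * L)) (Real.exp (4.2 * L)) n ^ 2 *
      (n : ℝ) ^ (-(1 + 0.1 / L)) ≤ 8000 := by
  have hL0 : 0 < L := by linarith
  obtain ⟨h84, h42, h70, hd⟩ := exp_bounds_moll
  have h := sum_sq_mollSum_le (δ := 0.1 / L) (U := Real.exp (2.1 * L)) (V := Real.exp (4.2 * L))
    (by positivity) (by rw [div_le_iff₀ hL0]; nlinarith)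
    (Real.one_le_exp (by positivity)) (Real.exp_lt_exp.mpr (by linarith)) S
  refine h.trans ?_
  rw [Real.log_exp, Real.log_exp]
  simp_rw [← Real.exp_mul]
  rw [show 4.2 * L * (2 * (0.1 / L)) = 0.84 by field_simp; norm_num,
    show 2.1 * L * (2 * (0.1 / L)) = 0.42 by field_simp; norm_num,
    show 4.2 * L * (0.1 / L) = 0.42 by field_simp; norm_num,
    show 2.1 * L * (0.1 / L) = 0.21 by field_simp; norm_num,
    show (1 + 0.1 / L) / (0.1 / L) = 10 * L + 1 by field_simp; norm_num; ring,
    show (Real.exp 0.42 - Real.exp 0.21) / (0.1 / L)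
      = 10 * L * (Real.exp 0.42 - Real.exp 0.21) by field_simp; norm_num]
  have h1 : 2.54 * L ≤ 10 * L * (Real.exp 0.42 - Real.exp 0.21) := by nlinarith
  rw [div_le_iff₀ (by positivity)]
  have h2 : (2.54 * L) ^ 2 ≤ (10 * L * (Real.exp 0.42 - Real.exp 0.21)) ^ 2 := by gcongr
  have h3 : Real.exp 0.84 * (1 + 4.2 * L) + Real.exp 0.42 * (1 + 2.1 * L) ≤ 13.9 * L := by
    have : Real.exp 0.84 * (1 + 4.2 * L) ≤ 2.4 * (4.21 * L) :=
      mul_le_mul h84 (by linarith) (by positivity) (by norm_num)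
    have : Real.exp 0.42 * (1 + 2.1 * L) ≤ 1.6 * (2.11 * L) :=
      mul_le_mul h42 (by linarith) (by positivity) (by norm_num)
    linarith
  calc _ ≤ 352.8 * (13.9 * L) * (10.1 * L) :=
        mul_le_mul (by linarith) (by linarith) (by positivity) (by positivity)
    _ ≤ 8000 * (2.54 * L) ^ 2 := by nlinarith
    _ ≤ _ := by linarith

theorem eventually_mollPoly_mean_square_le :
    ∀ᶠ L : ℝ in atTop, ∀ (q : ℕ) [NeZero q], (q : ℝ) ≤ Real.exp L → ∀ σ : ℝ, σ ≤ 1 →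
      ∑ χ : DirichletCharacter ℂ q, ∫ t in -(2 * L ^ 2)..(2 * L ^ 2),
        ‖mollPoly χ L (σ + t * I)‖ ^ 2 ≤ 230000 / L * Real.exp (14 * (L * (1 - σ))) := by
  filter_upwards [eventually_ge_atTop 10000, eventually_pow_mul_le_exp 7 (C := 3)
    (c := 0.1) (by norm_num)] with L hL hL2 q _ hq σ hσ
  have hL0 : 0 < L := by linarith
  set δ : ℝ := 1 / L ^ 3 with hδdef
  have hδ : 0 < δ := by positivity
  have hδ1 : δ ≤ 0.0001 := by
    rw [hδdef, div_le_iff₀ (by positivity)]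
    nlinarith [pow_le_pow_left₀ (by norm_num) hL 3]
  simp_rw [mollPoly_line]
  set A : ℕ → ℝ := mollSum (0.1 / L) (Real.exp (2.1 * L)) (Real.exp (4.2 * L))
  set R := ⌊Real.exp (0.5 * L)⌋₊
  set w : ℕ → ℝ := fun n => 2.1 / L * (A n ^ 2 * (n : ℝ) ^ (1 - 2 * σ)) with hw
  have hw0 : ∀ n, 0 ≤ w n := fun n => by simp only [hw]; positivity
  have hδT : δ * (2 * L ^ 2) = 2 / L := by rw [hδdef]; field_simp
  have hδT2 : 2 / L ≤ 0.0002 := by rw [div_le_iff₀ hL0]; linarith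
  have main := sum_char_mean_square_le (q := q) (mollRange L)
    (fun n => ((mollCoeff q L n * (n : ℝ) ^ (-σ) : ℝ) : ℂ)) w hw0 hδ (T := 2 * L ^ 2)
    (by positivity) (by rw [hδT]; linarith) ?_
  · refine main.trans ?_
    have h1 : ∑ n ∈ mollRange L, w n ≤ 2.1 / L * (8000 * (2.1 * Real.exp (14 * (L * (1 - σ))))) := by
      rw [hw, ← mul_sum]
      refine mul_le_mul_of_nonneg_left ?_ (by positivity)
      calc _ ≤ ∑ n ∈ mollRange L, A n ^ 2 * (n : ℝ) ^ (-(1 + 0.1 / L)) *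
            (2.1 * Real.exp (14 * (L * (1 - σ)))) := by
            refine sum_le_sum fun n hn => ?_
            obtain ⟨hn0, -, hn2⟩ := log_of_mem_mollRange hn
            have hn1 : (0 : ℝ) < n := by exact_mod_cast Nat.pos_of_ne_zero hn0
            rw [mul_assoc]
            refine mul_le_mul_of_nonneg_left ?_ (sq_nonneg _)
            rw [show 1 - 2 * σ = -(1 + 0.1 / L) + (2 * (1 - σ) + 0.1 / L) by ring,
              Real.rpow_add hn1]
            refine mul_le_mul_of_nonneg_left ?_ (by positivity)
            rw [Real.rpow_def_of_pos hn1]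
            calc _ ≤ Real.exp (7 * L * (2 * (1 - σ) + 0.1 / L)) := by gcongr
              _ = Real.exp 0.7 * Real.exp (14 * (L * (1 - σ))) := by
                rw [← Real.exp_add]; congr 1; field_simp; norm_num; ring
              _ ≤ _ := mul_le_mul_of_nonneg_right exp_bounds_moll.2.2.1 (Real.exp_pos _).le
        _ ≤ _ := by
          rw [← sum_mul]
          exact mul_le_mul_of_nonneg_right (sum_sq_mollSum_exp_le (by linarith) _) (by positivity)
    have h8 : 2 * Real.pi / (1 - (δ * (2 * L ^ 2)) ^ 2 / 2) ^ 2 ≤ 6.2833 := by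
      have hp := Real.pi_lt_d6
      rw [hδT]
      have h9 : (2 / L) ^ 2 ≤ 0.0002 ^ 2 := by gcongr
      have h10 : (0.99999997 : ℝ) ^ 2 ≤ (1 - (2 / L) ^ 2 / 2) ^ 2 := by
        refine pow_le_pow_left₀ (by norm_num) ?_ 2
        norm_num at h9 ⊢; linarith
      rw [div_le_iff₀ (lt_of_lt_of_le (by norm_num) h10)]
      nlinarith
    calc _ ≤ 6.2833 * (2.1 / L * (8000 * (2.1 * Real.exp (14 * (L * (1 - σ)))))) :=
          mul_le_mul h8 h1 (sum_nonneg fun n _ => hw0 n) (by norm_num)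
      _ = 221674.824 / L * Real.exp (14 * (L * (1 - σ))) := by ring
      _ ≤ _ := by gcongr; norm_num
  intro y b
  set F := (mollRange L).filter (fun n : ℕ => (y < Real.log n ∧ Real.log n ≤ y + δ) ∧
    (n : ZMod q) = b)
  rcases F.eq_empty_or_nonempty with h0 | ⟨n0, hn0⟩
  · rw [h0]; simp
  have hy1 : 2.1 * L < y + δ := by
    obtain ⟨h1, ⟨-, h2⟩, -⟩ := mem_filter.mp hn0
    exact (log_of_mem_mollRange h1).2.1.trans_le h2
  have hRle : (R : ℝ) ≤ Real.exp (0.5 * L) := Nat.floor_le (Real.exp_pos _).le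
  have hRge : Real.exp (0.49 * L) ≤ R := by
    have h1 : Real.exp (0.5 * L) - 1 ≤ R := (Nat.sub_one_lt_floor _).le
    have h2 : Real.exp (0.5 * L) = Real.exp (0.49 * L) * Real.exp (0.01 * L) := by
      rw [← Real.exp_add]; congr 1; ring
    have h3 : 2 ≤ Real.exp (0.01 * L) := by
      have := Real.add_one_le_exp (0.01 * L); linarith
    have h4 : 1 ≤ Real.exp (0.49 * L) := Real.one_le_exp (by linarith)
    nlinarith
  have hR2 : 2 ≤ R := by
    have h1 : (2 : ℝ) ≤ R := by
      have := Real.add_one_le_exp (0.49 * L); linarith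
    exact_mod_cast h1
  have hR0 : (0 : ℝ) < R := by exact_mod_cast (by omega : 0 < R)
  have hlogR : 0.49 * L ≤ Real.log R := (Real.le_log_iff_exp_le hR0).mpr hRge
  have hlogR2 : Real.log R ≤ 0.5 * L := (Real.log_le_iff_le_exp hR0).mpr hRle
  have hwin := sum_sq_sieveDivisorSum_window_le (q := q) hR2 (y := y) (by linarith) hδ
    (by linarith) ?_ (mollRange L) b
  · have hCS : (∑ n ∈ F, mollCoeff q L n * (n : ℝ) ^ (-σ)) ^ 2
        ≤ (∑ n ∈ F, A n ^ 2 * (n : ℝ) ^ (-(2 * σ))) * ∑ n ∈ F, sieveDivisorSum q R n ^ 2 := by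
      refine sum_sq_le_sum_mul_sum_of_sq_le_mul F (fun n hn => by positivity)
        (fun n hn => by positivity) fun n hn => le_of_eq ?_
      have h1 : (n : ℝ) ^ (-(2 * σ)) = ((n : ℝ) ^ (-σ)) ^ 2 := by
        rw [← Real.rpow_natCast, ← Real.rpow_mul (Nat.cast_nonneg n)]
        congr 1; push_cast; ring
      rw [h1, mollCoeff]
      ring
    have hW : Real.exp y * ∑ n ∈ F, A n ^ 2 * (n : ℝ) ^ (-(2 * σ))
        ≤ ∑ n ∈ F, A n ^ 2 * (n : ℝ) ^ (1 - 2 * σ) := by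
      rw [mul_sum]
      refine sum_le_sum fun n hn => ?_
      obtain ⟨h1, ⟨h2, -⟩, -⟩ := mem_filter.mp hn
      have hn1 : (0 : ℝ) < n := by
        exact_mod_cast Nat.pos_of_ne_zero (log_of_mem_mollRange h1).1
      have h3 : Real.exp y ≤ n := ((Real.lt_log_iff_exp_lt hn1).mp h2).le
      rw [sub_eq_add_neg, Real.rpow_add hn1, Real.rpow_one]
      calc _ ≤ (n : ℝ) * (A n ^ 2 * (n : ℝ) ^ (-(2 * σ))) := by gcongr
        _ = _ := by ring
    have hW0 : 0 ≤ ∑ n ∈ F, A n ^ 2 * (n : ℝ) ^ (-(2 * σ)) :=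
      sum_nonneg fun n _ => by positivity
    have hW1 : 0 ≤ ∑ n ∈ F, A n ^ 2 * (n : ℝ) ^ (1 - 2 * σ) :=
      sum_nonneg fun n _ => by positivity
    rw [← ofReal_sum, norm_real, Real.norm_eq_abs, sq_abs]
    calc _ ≤ q.totient * ((∑ n ∈ F, A n ^ 2 * (n : ℝ) ^ (-(2 * σ))) *
          ∑ n ∈ F, sieveDivisorSum q R n ^ 2) := by gcongr
      _ = (∑ n ∈ F, A n ^ 2 * (n : ℝ) ^ (-(2 * σ))) *
          (q.totient * ∑ n ∈ F, sieveDivisorSum q R n ^ 2) := by ring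
      _ ≤ (∑ n ∈ F, A n ^ 2 * (n : ℝ) ^ (-(2 * σ))) *
          (Real.exp y * (δ + 2 * δ ^ 2) / Real.log R) := mul_le_mul_of_nonneg_left hwin hW0
      _ = (Real.exp y * ∑ n ∈ F, A n ^ 2 * (n : ℝ) ^ (-(2 * σ))) *
          (δ * (1 + 2 * δ) / Real.log R) := by ring
      _ ≤ (∑ n ∈ F, A n ^ 2 * (n : ℝ) ^ (1 - 2 * σ)) * (δ * (2.1 / L)) := by
          refine mul_le_mul hW ?_ (by positivity) hW1
          rw [mul_div_assoc]
          refine mul_le_mul_of_nonneg_left ?_ hδ.le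
          rw [div_le_div_iff₀ (by linarith) hL0]
          nlinarith
      _ = _ := by rw [hw, ← mul_sum]; ring
  · have h1 : Real.exp (2.1 * L) ≤ 3 * Real.exp y := by
      have h2 : Real.exp 0.0001 ≤ 3 := by
        have := Real.exp_one_lt_d9
        have h3 : Real.exp 0.0001 ≤ Real.exp 1 := Real.exp_le_exp.mpr (by norm_num)
        linarith
      calc _ ≤ Real.exp (0.0001 + y) := Real.exp_le_exp.mpr (by linarith)
        _ = Real.exp 0.0001 * Real.exp y := Real.exp_add _ _
        _ ≤ _ := mul_le_mul_of_nonneg_right h2 (Real.exp_pos _).le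
    have h2 : Real.exp (2.1 * L) = Real.exp (0.1 * L) * Real.exp (2 * L) := by
      rw [← Real.exp_add]; congr 1; ring
    have h3 : (q : ℝ) * (R : ℝ) ^ 2 * Real.log R ≤ Real.exp (2 * L) * (0.5 * L) := by
      have h4 : Real.exp (2 * L) = Real.exp L * Real.exp (0.5 * L) ^ 2 := by
        rw [← Real.exp_nat_mul, ← Real.exp_add]; congr 1; push_cast; ring
      rw [h4]
      refine mul_le_mul (mul_le_mul hq ?_ (by positivity) (Real.exp_pos _).le) hlogR2
        (by linarith) (by positivity)
      gcongr
    have h4 : 1 ≤ Real.exp (2 * L) := Real.one_le_exp (by linarith)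
    rw [hδdef, div_pow, one_pow, ← pow_mul, mul_one_div, le_div_iff₀ (by positivity)]
    norm_num only
    calc _ ≤ (Real.exp (2 * L) * L) * L ^ 6 := by
          refine mul_le_mul_of_nonneg_right ?_ (by positivity)
          nlinarith
      _ = (3 * L ^ 7) * Real.exp (2 * L) / 3 := by ring
      _ ≤ Real.exp (0.1 * L) * Real.exp (2 * L) / 3 := by gcongr
      _ ≤ _ := by rw [← h2]; linarith

lemma eventually_one_half_le_mollPoly :
    ∀ᶠ L : ℝ in atTop, ∀ (q : ℕ) [NeZero q], (q : ℝ) ≤ Real.exp L →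
      ∀ (χ : DirichletCharacter ℂ q), χ ≠ 1 → ∀ ρ : ℂ, χ.LFunction ρ = 0 → 9 / 10 ≤ ρ.re →
        ρ.re ≤ 1 → |ρ.im| ≤ L ^ 2 + 1 → 0.9 ≤ ‖mollPoly χ L ρ‖ ^ 2 := by
  filter_upwards [eventually_ge_atTop 1000, eventually_pow_mul_le_exp 2 (C := 320)
    (c := 0.5) (by norm_num)] with L hL hL2 q _ hq χ hχ ρ hρ h0 h1 him
  set U := Real.exp (2.1 * L)
  set V := Real.exp (4.2 * L)
  set R := ⌊Real.exp (0.5 * L)⌋₊ with hR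
  set N := ⌊Real.exp (7 * L)⌋₊
  have hU1 : 1 ≤ U := Real.one_le_exp (by positivity)
  have hUV : U < V := Real.exp_lt_exp.mpr (by linarith)
  have hδ : 0 < 0.1 / L := by positivity
  have hR1 : 1 ≤ R := Nat.le_floor (by rw [Nat.cast_one]; exact Real.one_le_exp (by positivity))
  have hRle : (R : ℝ) ≤ Real.exp (0.5 * L) := Nat.floor_le (Real.exp_pos _).le
  have hVle : (⌊V⌋₊ : ℝ) ≤ Real.exp (4.2 * L) := Nat.floor_le (Real.exp_pos _).le
  have hNge : Real.exp (6.99 * L) ≤ N := by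
    have h1 : Real.exp (7 * L) - 1 ≤ N := (Nat.sub_one_lt_floor _).le
    have h2 : Real.exp (7 * L) = Real.exp (6.99 * L) * Real.exp (0.01 * L) := by
      rw [← Real.exp_add]; congr 1; ring
    have h3 : 2 ≤ Real.exp (0.01 * L) := by
      have := Real.add_one_le_exp (0.01 * L); linarith
    have h4 : 1 ≤ Real.exp (6.99 * L) := Real.one_le_exp (by linarith)
    nlinarith
  have hVR : ⌊V⌋₊ * R ≤ N := by
    refine Nat.le_floor ?_
    push_cast
    calc (⌊V⌋₊ : ℝ) * R ≤ Real.exp (4.2 * L) * Real.exp (0.5 * L) := by gcongr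
      _ = Real.exp (4.7 * L) := by rw [← Real.exp_add]; congr 1; ring
      _ ≤ _ := Real.exp_le_exp.mpr (by linarith)
  have main := norm_sum_mollified_le hχ hρ (by linarith) h1 (a := mollWeight (0.1 / L) U V)
    (b := sieveWeight q R) (V := ⌊V⌋₊) (R := R) (N := N) (abs_mollWeight_le hδ hU1 hUV)
    (abs_sieveWeight_le hR1) (fun d hd => mollWeight_of_gt hUV hd) (fun d hd => by
      refine sieveWeight_eq_zero fun h => hd ?_
      have := (mem_sieveSupport.mp h).1
      exact mem_Ioc.mpr ⟨this.1, this.2⟩) hVR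
  change ‖∑ n ∈ Ioc 0 N, (mollCoeff q L n : ℂ) * (χ (n : ZMod q) * (n : ℂ) ^ (-ρ))‖ ≤ _ at main
  have hUN : ⌊U⌋₊ ≤ N := Nat.floor_mono (Real.exp_le_exp.mpr (by linarith))
  have hUf : 1 ≤ ⌊U⌋₊ := Nat.le_floor (by rwa [Nat.cast_one])
  have hsplit : ∑ n ∈ Ioc 0 N, (mollCoeff q L n : ℂ) * (χ (n : ZMod q) * (n : ℂ) ^ (-ρ))
      = 1 + mollPoly χ L ρ := by
    rw [mollPoly, mollRange, ← sum_Ioc_consecutive _ (Nat.zero_le ⌊U⌋₊) hUN]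
    congr 1
    rw [sum_eq_single_of_mem 1 (mem_Ioc.mpr ⟨one_pos, hUf⟩)]
    · rw [mollCoeff, mollSum_of_le hδ hU1 hUV (by rwa [Nat.cast_one]), sieveDivisorSum]
      simp [← hR, sieveWeight_one hR1]
    · intro n hn hn1
      rw [mollCoeff, mollSum_of_le hδ hU1 hUV
        ((Nat.le_floor_iff (by linarith)).mp (mem_Ioc.mp hn).2), if_neg hn1]
      simp
  rw [hsplit] at main
  have hρn : ‖ρ‖ ≤ 2 * L ^ 2 := by
    refine (norm_le_abs_re_add_abs_im ρ).trans ?_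
    rw [abs_of_nonneg (by linarith)]
    nlinarith
  have hNσ : (N : ℝ) ^ (-ρ.re) ≤ Real.exp (-(6.2 * L)) := by
    calc _ ≤ Real.exp (6.99 * L) ^ (-ρ.re) :=
          Real.rpow_le_rpow_of_nonpos (Real.exp_pos _) hNge (by linarith)
      _ = Real.exp (6.99 * L * (-ρ.re)) := by rw [← Real.exp_mul]
      _ ≤ _ := Real.exp_le_exp.mpr (by nlinarith)
  have hsmall : ‖1 + mollPoly χ L ρ‖ ≤ 0.05 := by
    refine main.trans ?_
    calc _ ≤ Real.exp (4.2 * L) * Real.exp (0.5 * L) *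
          (8 * Real.exp L * (2 * L ^ 2) * Real.exp (-(6.2 * L))) := by gcongr
      _ = 16 * L ^ 2 * (Real.exp (4.2 * L) * Real.exp (0.5 * L) * Real.exp L *
          Real.exp (-(6.2 * L))) := by ring
      _ = 16 * L ^ 2 * Real.exp (-(0.5 * L)) := by
          rw [← Real.exp_add, ← Real.exp_add, ← Real.exp_add]; congr 2; ring
      _ ≤ 0.05 := by
          rw [Real.exp_neg, ← div_eq_mul_inv, div_le_iff₀ (Real.exp_pos _)]
          linarith
  have h5 : 0.95 ≤ ‖mollPoly χ L ρ‖ := by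
    have h6 := norm_sub_norm_le (1 : ℂ) (-mollPoly χ L ρ)
    rw [norm_one, norm_neg, sub_neg_eq_add] at h6
    linarith
  nlinarith

/-- Sub-mean value property over a disc for the square of the modulus. -/
lemma norm_sq_mul_le_setIntegral_ball {f : ℂ → ℂ} (hf : Differentiable ℂ f) (z : ℂ) {r : ℝ}
    (hr : 0 < r) :
    π * r ^ 2 * ‖f z‖ ^ 2 ≤ ∫ w in Metric.ball z r, ‖f w‖ ^ 2 := by
  have hmean : ∀ s : ℝ, ∫ θ in Set.Ioo (-π) π,
      f (z + s * (Real.cos θ + Real.sin θ * I)) ^ 2 = 2 * π * f z ^ 2 := by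
    intro s
    have h1 : Real.circleAverage (fun w => f w ^ 2) z s = f z ^ 2 :=
      DiffContOnCl.circleAverage (hf.pow 2).diffContOnCl
    rw [Real.circleAverage_eq_integral_add (-π),
      intervalIntegral.integral_comp_add_right (fun θ => f (circleMap z s θ) ^ 2),
      show (0 : ℝ) + -π = -π by ring, show 2 * π + -π = π by ring,
      intervalIntegral.integral_of_le (by linarith [Real.pi_pos]),
      MeasureTheory.integral_Ioc_eq_integral_Ioo, real_smul] at h1
    have h2 : ∀ θ : ℝ, f (z + s * (Real.cos θ + Real.sin θ * I)) ^ 2 = f (circleMap z s θ) ^ 2 := by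
      intro θ
      rw [circleMap, exp_mul_I]
      push_cast
      rfl
    simp_rw [h2]
    rw [← h1, ← mul_assoc]
    push_cast
    rw [mul_inv_cancel₀, one_mul]
    exact mul_ne_zero two_ne_zero (by exact_mod_cast Real.pi_pos.ne')
  have hcont : Continuous fun p : ℝ × ℝ =>
      (p.1 : ℝ) • f (z + p.1 * (Real.cos p.2 + Real.sin p.2 * I)) ^ 2 := by
    have := hf.continuous
    fun_prop
  have key : ∫ w in Metric.ball z r, f w ^ 2 = π * r ^ 2 * f z ^ 2 := by
    have h1 : ∫ w in Metric.ball z r, f w ^ 2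
        = ∫ w, (Metric.ball (0 : ℂ) r).indicator (fun w => f (z + w) ^ 2) w := by
      rw [← MeasureTheory.integral_indicator Metric.isOpen_ball.measurableSet,
        ← MeasureTheory.integral_add_left_eq_self _ z]
      refine MeasureTheory.integral_congr_ae (Eventually.of_forall fun w => ?_)
      by_cases hw : ‖w‖ < r <;> simp [Set.indicator, hw]
    rw [h1, ← Complex.integral_comp_polarCoord_symm]
    have h2 : ∀ p ∈ polarCoord.target,
        p.1 • (Metric.ball (0 : ℂ) r).indicator (fun w => f (z + w) ^ 2) (Complex.polarCoord.symm p)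
        = (Set.Ioo 0 r ×ˢ Set.Ioo (-π) π).indicator (fun p : ℝ × ℝ =>
          (p.1 : ℝ) • f (z + p.1 * (Real.cos p.2 + Real.sin p.2 * I)) ^ 2) p := by
      rintro ⟨s, θ⟩ hp
      rw [polarCoord_target] at hp
      obtain ⟨hs, hθ⟩ := hp
      simp only [Set.mem_Ioi] at hs
      simp only at hθ
      by_cases hsr : s < r
      · rw [Set.indicator_of_mem, Set.indicator_of_mem, Complex.polarCoord_symm_apply]
        · exact ⟨⟨hs, hsr⟩, hθ⟩
        · rw [mem_ball_zero_iff, Complex.norm_polarCoord_symm, abs_of_pos hs]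
          exact hsr
      · rw [Set.indicator_of_notMem, Set.indicator_of_notMem, smul_zero]
        · exact fun h => hsr h.1.2
        · rw [mem_ball_zero_iff, Complex.norm_polarCoord_symm, abs_of_pos hs]
          exact hsr
    rw [MeasureTheory.setIntegral_congr_fun
      (by rw [polarCoord_target]; measurability) h2,
      MeasureTheory.setIntegral_indicator (by measurability)]
    have h3 : polarCoord.target ∩ Set.Ioo 0 r ×ˢ Set.Ioo (-π) π
        = Set.Ioo 0 r ×ˢ Set.Ioo (-π) π := by
      rw [Set.inter_eq_right, polarCoord_target]
      exact fun p hp => ⟨hp.1.1, hp.2⟩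
    rw [h3, MeasureTheory.Measure.volume_eq_prod, MeasureTheory.setIntegral_prod]
    · simp only [MeasureTheory.integral_smul]
      simp_rw [hmean]
      rw [integral_smul_const, ← MeasureTheory.integral_Ioc_eq_integral_Ioo,
        ← intervalIntegral.integral_of_le hr.le, integral_id, real_smul]
      push_cast
      ring
    · refine (hcont.continuousOn.integrableOn_compact (K := Set.Icc 0 r ×ˢ
        Set.Icc (-π) π) (isCompact_Icc.prod isCompact_Icc)).mono_set ?_
      exact Set.prod_mono Set.Ioo_subset_Icc_self Set.Ioo_subset_Icc_self
  have h1 : ‖∫ w in Metric.ball z r, f w ^ 2‖ = π * r ^ 2 * ‖f z‖ ^ 2 := by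
    rw [key]
    simp [abs_of_pos Real.pi_pos]
  rw [← h1]
  refine (MeasureTheory.norm_integral_le_integral_norm _).trans (le_of_eq ?_)
  simp

set_option maxHeartbeats 1000000 in
/-- The number of zeros in a small disc is controlled by the distance to the line `re s = 1`. -/
lemma eventually_sum_order_disc_le :
    ∀ᶠ L : ℝ in atTop, ∀ (q : ℕ) [NeZero q], (q : ℝ) ≤ Real.exp L →
      ∀ (χ : DirichletCharacter ℂ q), χ ≠ 1 → ∀ z : ℂ, 0.88 ≤ z.re → z.re ≤ 1 →
        |z.im| ≤ 2 * L ^ 2 → ∀ S : Finset ℂ,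
        (∀ ρ ∈ S, χ.LFunction ρ = 0 ∧ dist ρ z ≤ 0.01 / L) →
        ∑ ρ ∈ S, (analyticOrderNatAt χ.LFunction ρ : ℝ) ≤ 3.5 * (1 + L * (1 - z.re)) := by
  filter_upwards [eventually_ge_atTop 10000, eventually_log_le_mul (c := 0.001) (by norm_num)]
    with L hL hlog q _ hq χ hχ z hz0 hz1 him S hS
  have hL0 : 0 < L := by linarith
  set c : ℂ := ⟨1 + 1 / L, z.im⟩
  have hcre : c.re = 1 + 1 / L := rfl
  have hcim : c.im = z.im := rfl
  have hLi : 1 / L ≤ 0.0001 := by rw [div_le_iff₀ hL0]; linarith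
  have hLi0 : 0 < 1 / L := by positivity
  have hr : 0.01 / L = 0.01 * (1 / L) := by ring
  have hgeom : ∀ ρ ∈ S, ρ.re ≤ 1 ∧ |ρ.re - z.re| ≤ 0.01 / L ∧ |ρ.im - z.im| ≤ 0.01 / L := by
    intro ρ hρ
    obtain ⟨h1, h2⟩ := hS ρ hρ
    rw [Complex.dist_eq] at h2
    refine ⟨?_, (abs_re_le_norm (ρ - z)).trans h2, (abs_im_le_norm (ρ - z)).trans h2⟩
    by_contra! h
    exact DirichletCharacter.LFunction_ne_zero_of_one_le_re χ (Or.inl hχ) h.le h1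
  have main := sum_zeros_LFunction_le hχ hq hLi0 (by linarith) hcre (S := S) (by
    intro ρ hρ
    refine ⟨(hS ρ hρ).1, ?_⟩
    obtain ⟨h1, h2, h3⟩ := hgeom ρ hρ
    have h4 : dist z c ≤ 0.13 := by
      rw [dist_of_im_eq hcim.symm, Real.dist_eq, hcre, abs_le]
      constructor <;> linarith
    have := dist_triangle ρ z c
    have := (hS ρ hρ).2
    rw [hr] at this
    linarith)
  have hre : (logDeriv χ.LFunction c).re ≤ L + 8 := by
    have h1 := norm_logDeriv_LFunction_le χ hLi0 hcre
    rw [one_div_one_div] at h1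
    exact (re_le_norm _).trans h1
  have hlog1 : Real.log (|c.im| + 5) ≤ 3 * Real.log L := by
    rw [← Real.log_rpow hL0, hcim]
    refine Real.log_le_log (by positivity) ?_
    norm_num
    nlinarith [sq_nonneg L]
  have hlog2 : Real.log (14 / (1 / L)) ≤ 2 * Real.log L := by
    rw [← Real.log_rpow hL0]
    refine Real.log_le_log (by positivity) ?_
    rw [div_div_eq_mul_div, div_one]
    norm_num
    nlinarith
  set lam := L * (1 - z.re) with hlam
  have hlam0 : 0 ≤ lam := mul_nonneg hL0.le (by linarith)
  have hterm : ∀ ρ ∈ S, (analyticOrderNatAt χ.LFunction ρ : ℝ) * (0.91 * L / (1.01 + lam))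
      ≤ (analyticOrderNatAt χ.LFunction ρ : ℝ) *
        ((c.re - ρ.re) / dist c ρ ^ 2 - 4 * (c.re - ρ.re)) := by
    intro ρ hρ
    refine mul_le_mul_of_nonneg_left ?_ (Nat.cast_nonneg _)
    obtain ⟨h1, h2, h3⟩ := hgeom ρ hρ
    set u := c.re - ρ.re with hu
    rw [abs_le, hr] at h2 h3
    have hu0 : 1 / L ≤ u := by rw [hu, hcre]; linarith
    have hu1 : u ≤ 0.14 := by rw [hu, hcre]; linarith
    have hu2 : L * u ≤ 1.01 + lam := by
      have h4 : u ≤ 1 / L + (1 - z.re) + 0.01 * (1 / L) := by rw [hu, hcre]; linarith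
      calc L * u ≤ L * (1 / L + (1 - z.re) + 0.01 * (1 / L)) := by gcongr
        _ = _ := by rw [hlam]; field_simp; ring
    have hd : dist c ρ ^ 2 ≤ 1.0001 * u ^ 2 := by
      rw [Complex.dist_eq, Complex.sq_norm, Complex.normSq_apply, Complex.sub_re, Complex.sub_im,
        ← hu, hcim]
      have h5 : (z.im - ρ.im) ^ 2 ≤ (0.01 * (1 / L)) ^ 2 := sq_le_sq' (by linarith) (by linarith)
      have h6 : (1 / L) ^ 2 ≤ u ^ 2 := by gcongr
      nlinarith
    have hd0 : 0 < dist c ρ ^ 2 := by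
      have : dist c ρ ≠ 0 := by
        rw [dist_ne_zero]
        intro h
        have : u = 0 := by rw [hu, h]; ring
        linarith
      positivity
    have hu00 : 0 < u := by linarith
    calc 0.91 * L / (1.01 + lam) ≤ 0.91 / u := by
          rw [div_le_div_iff₀ (by linarith) hu00]; nlinarith
      _ ≤ u / (1.0001 * u ^ 2) - 4 * u := by
          rw [le_sub_iff_add_le, div_add' _ _ _ hu00.ne', div_le_div_iff₀ hu00 (by positivity)]
          have : u ^ 2 ≤ 0.14 ^ 2 := by gcongr
          have h7 : 1.0001 * (0.91 + 4 * u * u) ≤ 1 := by nlinarith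
          nlinarith [mul_le_mul_of_nonneg_right h7 (sq_nonneg u)]
      _ ≤ _ := by gcongr
  have h1 := (sum_le_sum hterm).trans main
  rw [← sum_mul, ← mul_div_assoc, div_le_iff₀ (by linarith)] at h1
  have h2 : (logDeriv χ.LFunction c).re +
      (2 * L + 2 * Real.log (|c.im| + 5) + 4 * Real.log (14 / (1 / L))) ≤ 3.1 * L := by
    linarith
  have h3 : (∑ ρ ∈ S, (analyticOrderNatAt χ.LFunction ρ : ℝ)) * (0.91 * L)
      ≤ 3.1 * L * (1.01 + lam) :=
    h1.trans (mul_le_mul_of_nonneg_right h2 (by linarith))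
  have h4 : (∑ ρ ∈ S, (analyticOrderNatAt χ.LFunction ρ : ℝ)) * (0.91 * L)
      ≤ (3.1 / 0.91 * (1.01 + lam)) * (0.91 * L) := by
    refine h3.trans (le_of_eq ?_); ring
  have h5 := le_of_mul_le_mul_right h4 (by positivity)
  refine h5.trans ?_
  norm_num
  nlinarith

lemma setIntegral_reProdIm {F : ℂ → ℝ} (hF : Continuous F) {a b c d : ℝ} (hab : a ≤ b)
    (hcd : c ≤ d) :
    ∫ z in Set.Icc a b ×ℂ Set.Icc c d, F z = ∫ σ in a..b, ∫ t in c..d, F (σ + t * I) := by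
  have h1 : Set.Icc a b ×ℂ Set.Icc c d
      = measurableEquivRealProd ⁻¹' (Set.Icc a b ×ˢ Set.Icc c d) := by
    ext z
    simp [mem_reProdIm, measurableEquivRealProd_apply]
    tauto
  have h2 : ∀ z : ℂ, F z = (fun p : ℝ × ℝ => F (p.1 + p.2 * I)) (measurableEquivRealProd z) := by
    intro z
    simp [measurableEquivRealProd_apply, re_add_im]
  rw [h1, MeasureTheory.integral_congr_ae (Eventually.of_forall h2),
    volume_preserving_equiv_real_prod.setIntegral_preimage_emb
    measurableEquivRealProd.measurableEmbedding (fun p : ℝ × ℝ => F (p.1 + p.2 * I)),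
    MeasureTheory.Measure.volume_eq_prod, MeasureTheory.setIntegral_prod]
  · rw [intervalIntegral.integral_of_le hab, MeasureTheory.integral_Icc_eq_integral_Ioc]
    refine MeasureTheory.integral_congr_ae (Eventually.of_forall fun σ => ?_)
    simp only
    rw [intervalIntegral.integral_of_le hcd, MeasureTheory.integral_Icc_eq_integral_Ioc]
  · exact (Continuous.continuousOn (by fun_prop)).integrableOn_compact
      (isCompact_Icc.prod isCompact_Icc)

lemma exp_neg_moll_le : Real.exp (-(144.9 * 0.19)) ≤ 0.000000000004 := by
  have h1 := Real.exp_one_gt_d9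
  have h2 : (2.7 : ℝ) ^ 27 ≤ Real.exp 1 ^ 27 := by gcongr; linarith
  rw [← Real.exp_nat_mul] at h2
  rw [Real.exp_neg, inv_le_comm₀ (Real.exp_pos _) (by norm_num)]
  refine le_trans (by norm_num) (h2.trans (Real.exp_le_exp.mpr (by norm_num)))

lemma exp_moll_le : Real.exp 1.599 ≤ 5 := by
  have h1 := Real.exp_one_lt_d9
  have h2 : Real.exp 1.599 ^ 5 ≤ 5 ^ 5 := by
    rw [← Real.exp_nat_mul]
    calc _ ≤ Real.exp ((8 : ℕ) * 1) := Real.exp_le_exp.mpr (by norm_num)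
      _ = Real.exp 1 ^ 8 := by rw [Real.exp_nat_mul]
      _ ≤ 2.7182818286 ^ 8 := by gcongr
      _ ≤ _ := by norm_num
  exact le_of_pow_le_pow_left₀ (by norm_num) (by norm_num) h2

lemma integral_exp_line_le {L a b : ℝ} (hL : 0 < L) :
    ∫ σ in a..b, Real.exp (-(144.9 * (L * (1 - σ))))
      ≤ Real.exp (-(144.9 * (L * (1 - b)))) / (144.9 * L) := by
  have h : ∀ σ ∈ Set.uIcc a b, HasDerivAt
      (fun σ => Real.exp (-(144.9 * (L * (1 - σ)))) / (144.9 * L))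
      (Real.exp (-(144.9 * (L * (1 - σ))))) σ := by
    intro σ _
    have h1 : HasDerivAt (fun σ : ℝ => -(144.9 * (L * (1 - σ)))) (144.9 * L) σ := by
      exact ((((hasDerivAt_id σ).const_sub 1).const_mul L).const_mul (144.9 : ℝ)).neg.congr_deriv
        (by ring)
    exact (h1.exp.div_const (144.9 * L)).congr_deriv (by field_simp)
  rw [intervalIntegral.integral_eq_sub_of_hasDerivAt h
    ((by fun_prop : Continuous fun σ : ℝ => Real.exp (-(144.9 * (L * (1 - σ))))).intervalIntegrable _ _)]
  have : 0 ≤ Real.exp (-(144.9 * (L * (1 - a)))) / (144.9 * L) := by positivity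
  linarith

/-- Zeros at distance at least `0.2 / L` from the line `re s = 1`, for all characters together. -/
theorem eventually_sum_far_zeros_le :
    ∀ᶠ L : ℝ in atTop, ∀ (q : ℕ) [NeZero q], (q : ℝ) ≤ Real.exp L →
      ∀ Z : DirichletCharacter ℂ q → Finset ℂ,
        (∀ χ, ∀ ρ ∈ Z χ, χ ≠ 1 ∧ χ.LFunction ρ = 0 ∧ ρ.re ≤ 1 - 0.2 / L ∧ 9 / 10 ≤ ρ.re ∧
          |ρ.im| ≤ L ^ 2 + 1) →
        ∑ χ, ∑ ρ ∈ Z χ, (analyticOrderNatAt χ.LFunction ρ : ℝ) *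
          Real.exp (-(159.9 * (L * (1 - ρ.re)))) ≤ 0.004 := by
  filter_upwards [eventually_ge_atTop 1000, eventually_mollPoly_mean_square_le,
    eventually_one_half_le_mollPoly, eventually_sum_order_disc_le] with L hL hMS hlow hdisc q _ hq Z hZ
  classical
  have hL0 : 0 < L := by linarith
  set r := 0.01 / L with hr
  have hr0 : 0 < r := by positivity
  have hr1 : r ≤ 0.00001 := by rw [hr, div_le_iff₀ hL0]; linarith
  have hLr : L * r = 0.01 := by rw [hr]; field_simp
  set b := 1 - 0.19 / L with hb
  have hb' : b = 1 - 19 * r := by rw [hb, hr]; ring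
  have hab : (0.89 : ℝ) ≤ b := by rw [hb']; norm_num at hr1 ⊢; linarith
  have hT : -(2 * L ^ 2) ≤ 2 * L ^ 2 := by nlinarith
  set Q := Set.Icc (0.89 : ℝ) b ×ℂ Set.Icc (-(2 * L ^ 2)) (2 * L ^ 2) with hQ
  have hQc : IsCompact Q := isCompact_Icc.reProdIm isCompact_Icc
  have hQm : MeasurableSet Q := hQc.measurableSet
  set Ω : ℝ → ℝ := fun σ => 17.5 * Real.exp (-(158.9 * (L * (1 - σ)))) with hΩ
  have hone : ∀ χ : DirichletCharacter ℂ q,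
      (∑ ρ ∈ Z χ, (analyticOrderNatAt χ.LFunction ρ : ℝ) *
        Real.exp (-(159.9 * (L * (1 - ρ.re))))) * (0.9 * (Real.pi * r ^ 2))
        ≤ ∫ σ in (0.89 : ℝ)..b, ∫ t in -(2 * L ^ 2)..(2 * L ^ 2),
          Ω σ * ‖mollPoly χ L (σ + t * I)‖ ^ 2 := by
    intro χ
    set h := mollPoly χ L
    have hd : Differentiable ℂ h := differentiable_mollPoly χ L
    have hcont : Continuous fun z : ℂ => ‖h z‖ ^ 2 := by
      have := hd.continuous
      fun_prop
    have hFc : Continuous fun z : ℂ => Ω z.re * ‖h z‖ ^ 2 := by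
      have := hd.continuous
      simp only [hΩ]
      fun_prop
    have hint : ∀ ρ : ℂ, MeasureTheory.IntegrableOn
        ((Metric.ball ρ r).indicator fun z => ‖h z‖ ^ 2) Q := fun ρ =>
      (hcont.continuousOn.integrableOn_compact hQc).indicator Metric.isOpen_ball.measurableSet
    have hsub : ∀ ρ ∈ Z χ, Metric.ball ρ r ⊆ Q := by
      intro ρ hρ z hz
      obtain ⟨-, -, h1, h2, h3⟩ := hZ χ ρ hρ
      have hz' : ‖z - ρ‖ < r := by rw [← dist_eq]; exact hz
      have e1 := abs_lt.mp ((abs_re_le_norm (z - ρ)).trans_lt hz')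
      have e2 := abs_lt.mp ((abs_im_le_norm (z - ρ)).trans_lt hz')
      have e3 := abs_le.mp h3
      rw [sub_re] at e1
      rw [sub_im] at e2
      have h4 : 0.2 / L = 20 * r := by rw [hr]; ring
      rw [h4] at h1
      rw [hQ, mem_reProdIm]
      refine ⟨⟨?_, ?_⟩, ?_, ?_⟩
      · norm_num at h2 hr1 e1 ⊢; linarith
      · rw [hb']; linarith
      · nlinarith
      · nlinarith
    have hmean : ∀ ρ ∈ Z χ, 0.9 * (Real.pi * r ^ 2)
        ≤ ∫ z in Q, (Metric.ball ρ r).indicator (fun z => ‖h z‖ ^ 2) z := by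
      intro ρ hρ
      obtain ⟨g0, g1, g2, g3, g4⟩ := hZ χ ρ hρ
      rw [MeasureTheory.setIntegral_indicator Metric.isOpen_ball.measurableSet,
        Set.inter_eq_right.mpr (hsub ρ hρ)]
      have h1 := norm_sq_mul_le_setIntegral_ball hd ρ hr0
      have h2 := hlow q hq χ g0 ρ g1 g3 (by
        have : 0 < 0.2 / L := by positivity
        linarith) g4
      refine le_trans ?_ h1
      rw [mul_comm]
      exact mul_le_mul_of_nonneg_left h2 (by positivity)
    rcases (Z χ).eq_empty_or_nonempty with h0 | ⟨ρ0, hρ0⟩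
    · rw [h0, sum_empty, zero_mul]
      refine intervalIntegral.integral_nonneg hab fun σ _ =>
        intervalIntegral.integral_nonneg hT fun t _ => ?_
      simp only [hΩ]
      positivity
    have hχ : χ ≠ 1 := (hZ χ ρ0 hρ0).1
    have hpt : ∀ z ∈ Q, ∑ ρ ∈ Z χ, (analyticOrderNatAt χ.LFunction ρ : ℝ) *
        Real.exp (-(159.9 * (L * (1 - ρ.re)))) *
          (Metric.ball ρ r).indicator (fun z => ‖h z‖ ^ 2) z ≤ Ω z.re * ‖h z‖ ^ 2 := by
      intro z hz
      rw [hQ, mem_reProdIm] at hz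
      obtain ⟨⟨z1, z2⟩, z3⟩ := hz
      have z4 : z.re ≤ 1 := by
        have : 0 < 0.19 / L := by positivity
        linarith
      have hS := hdisc q hq χ hχ z (by norm_num at z1 ⊢; linarith) z4 (abs_le.mpr z3)
        ((Z χ).filter fun ρ => z ∈ Metric.ball ρ r) (by
          intro ρ hρ
          obtain ⟨h1, h2⟩ := mem_filter.mp hρ
          refine ⟨(hZ χ ρ h1).2.1, ?_⟩
          rw [dist_comm]
          exact (Metric.mem_ball.mp h2).le)
      calc _ = ∑ ρ ∈ (Z χ).filter fun ρ => z ∈ Metric.ball ρ r,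
            (analyticOrderNatAt χ.LFunction ρ : ℝ) *
            Real.exp (-(159.9 * (L * (1 - ρ.re)))) * ‖h z‖ ^ 2 := by
            rw [sum_filter]
            refine sum_congr rfl fun ρ _ => ?_
            by_cases hzρ : z ∈ Metric.ball ρ r
            · rw [if_pos hzρ, Set.indicator_of_mem hzρ]
            · rw [if_neg hzρ, Set.indicator_of_notMem hzρ, mul_zero]
        _ ≤ ∑ ρ ∈ (Z χ).filter fun ρ => z ∈ Metric.ball ρ r,
            (analyticOrderNatAt χ.LFunction ρ : ℝ) *
            (5 * Real.exp (-(159.9 * (L * (1 - z.re)))) * ‖h z‖ ^ 2) := by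
            refine sum_le_sum fun ρ hρ => ?_
            obtain ⟨h1, h2⟩ := mem_filter.mp hρ
            rw [mul_assoc]
            refine mul_le_mul_of_nonneg_left (mul_le_mul_of_nonneg_right ?_ (sq_nonneg _))
              (Nat.cast_nonneg _)
            have h3 : L * (1 - z.re) - 0.01 ≤ L * (1 - ρ.re) := by
              have h4 : |z.re - ρ.re| < r := (abs_re_le_norm (z - ρ)).trans_lt
                (by rw [← dist_eq]; exact h2)
              have h5 := (abs_lt.mp h4).1
              nlinarith
            calc _ ≤ Real.exp (1.599 + -(159.9 * (L * (1 - z.re)))) := by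
                  refine Real.exp_le_exp.mpr ?_
                  norm_num at h3 ⊢
                  linarith
              _ ≤ _ := by
                  rw [Real.exp_add]
                  exact mul_le_mul_of_nonneg_right exp_moll_le (Real.exp_pos _).le
        _ = (∑ ρ ∈ (Z χ).filter fun ρ => z ∈ Metric.ball ρ r,
            (analyticOrderNatAt χ.LFunction ρ : ℝ)) *
            (5 * Real.exp (-(159.9 * (L * (1 - z.re)))) * ‖h z‖ ^ 2) := by rw [sum_mul]
        _ ≤ (3.5 * Real.exp (L * (1 - z.re))) *
            (5 * Real.exp (-(159.9 * (L * (1 - z.re)))) * ‖h z‖ ^ 2) := by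
            refine mul_le_mul_of_nonneg_right (hS.trans ?_) (by positivity)
            have := Real.add_one_le_exp (L * (1 - z.re))
            linarith
        _ = Ω z.re * ‖h z‖ ^ 2 := by
            simp only [hΩ]
            rw [show -(158.9 * (L * (1 - z.re))) = L * (1 - z.re) + -(159.9 * (L * (1 - z.re))) by
              ring, Real.exp_add]
            ring
    calc _ ≤ ∑ ρ ∈ Z χ, (analyticOrderNatAt χ.LFunction ρ : ℝ) *
          Real.exp (-(159.9 * (L * (1 - ρ.re)))) *
          ∫ z in Q, (Metric.ball ρ r).indicator (fun z => ‖h z‖ ^ 2) z := by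
          rw [sum_mul]
          exact sum_le_sum fun ρ hρ => mul_le_mul_of_nonneg_left (hmean ρ hρ) (by positivity)
      _ = ∫ z in Q, ∑ ρ ∈ Z χ, (analyticOrderNatAt χ.LFunction ρ : ℝ) *
          Real.exp (-(159.9 * (L * (1 - ρ.re)))) *
          (Metric.ball ρ r).indicator (fun z => ‖h z‖ ^ 2) z := by
          rw [MeasureTheory.integral_finsetSum _ fun ρ _ => (hint ρ).const_mul _]
          exact sum_congr rfl fun ρ _ => (MeasureTheory.integral_const_mul _ _).symm
      _ ≤ ∫ z in Q, Ω z.re * ‖h z‖ ^ 2 := by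
          refine MeasureTheory.setIntegral_mono_on
            (MeasureTheory.integrable_finsetSum _ fun ρ _ => (hint ρ).const_mul _)
            (hFc.continuousOn.integrableOn_compact hQc) hQm hpt
      _ = _ := by
          rw [hQ, setIntegral_reProdIm hFc hab hT]
          simp
  have hΩc : Continuous Ω := by simp only [hΩ]; fun_prop
  have hcχ : ∀ χ : DirichletCharacter ℂ q, Continuous fun σ : ℝ =>
      ∫ t in -(2 * L ^ 2)..(2 * L ^ 2), Ω σ * ‖mollPoly χ L (σ + t * I)‖ ^ 2 := by
    intro χ
    have := (differentiable_mollPoly χ L).continuous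
    refine intervalIntegral.continuous_parametric_intervalIntegral_of_continuous' ?_ _ _
    fun_prop
  have htotal : (∑ χ, ∑ ρ ∈ Z χ, (analyticOrderNatAt χ.LFunction ρ : ℝ) *
        Real.exp (-(159.9 * (L * (1 - ρ.re))))) * (0.9 * (Real.pi * r ^ 2))
      ≤ 4025000 / L * (Real.exp (-(144.9 * (L * (1 - b)))) / (144.9 * L)) := by
    rw [sum_mul]
    refine (sum_le_sum fun χ _ => hone χ).trans ?_
    rw [← intervalIntegral.integral_finsetSum fun χ _ => (hcχ χ).intervalIntegrable _ _]
    calc _ ≤ ∫ σ in (0.89 : ℝ)..b, 4025000 / L * Real.exp (-(144.9 * (L * (1 - σ)))) := by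
          refine intervalIntegral.integral_mono_on hab
            ((continuous_finsetSum _ fun χ _ => hcχ χ).intervalIntegrable _ _)
            ((by fun_prop : Continuous fun σ : ℝ =>
              4025000 / L * Real.exp (-(144.9 * (L * (1 - σ))))).intervalIntegrable _ _) ?_
          intro σ hσ
          have hσ1 : σ ≤ 1 := by
            have : 0 < 0.19 / L := by positivity
            linarith [hσ.2]
          have h1 := hMS q hq σ hσ1
          simp_rw [intervalIntegral.integral_const_mul]
          rw [← mul_sum]
          calc _ ≤ Ω σ * (230000 / L * Real.exp (14 * (L * (1 - σ)))) :=
                mul_le_mul_of_nonneg_left h1 (by simp only [hΩ]; positivity)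
            _ = 4025000 / L * (Real.exp (-(158.9 * (L * (1 - σ)))) *
                Real.exp (14 * (L * (1 - σ)))) := by simp only [hΩ]; ring
            _ = _ := by rw [← Real.exp_add]; congr 2; ring
      _ ≤ _ := by
          rw [intervalIntegral.integral_const_mul]
          exact mul_le_mul_of_nonneg_left (integral_exp_line_le hL0) (by positivity)
  have hLb : L * (1 - b) = 0.19 := by rw [hb]; field_simp; ring
  rw [hLb] at htotal
  have hpi := Real.pi_gt_three
  have hX : 0 < 0.9 * (Real.pi * r ^ 2) := by positivity
  refine le_of_mul_le_mul_right (htotal.trans ?_) hX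
  calc _ ≤ 4025000 / L * (0.000000000004 / (144.9 * L)) := by
        have := exp_neg_moll_le
        gcongr
    _ = (4025000 * 0.000000000004 / 144.9 * 10000) * r ^ 2 := by rw [hr]; field_simp; norm_num
    _ ≤ 0.004 * (0.9 * (3 * r ^ 2)) := by
        rw [show 0.004 * (0.9 * (3 * r ^ 2)) = 0.0108 * r ^ 2 by ring]
        exact mul_le_mul_of_nonneg_right (by norm_num) (sq_nonneg _)
    _ ≤ _ := by gcongr

end LinnikAP

namespace LinnikAP

open Finset Complex Filter MeasureTheory
open scoped Real

/-- A Gaussian in `log n` centred at `ℓ` of width `1 / L`. -/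
noncomputable def bump (L ℓ : ℝ) (n : ℕ) : ℝ := Real.exp (-(L ^ 2 / 2) * (Real.log n - ℓ) ^ 2)

lemma bump_pos (L ℓ : ℝ) (n : ℕ) : 0 < bump L ℓ n := Real.exp_pos _

lemma hasSum_mul_bump {a : ℕ → ℂ} (ha : a 0 = 0) {L c : ℝ} (hL : 0 < L) (ℓ : ℝ)
    (hs : Summable fun n => ‖LSeries.term a c n‖) :
    HasSum (fun n => a n * bump L ℓ n) (((1 / (L * √(2 * π)) : ℝ) : ℂ) *
      ∫ t : ℝ, LSeries a (c + t * I) * gaussWeight (1 / L) ℓ (c + t * I)) := by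
  have hη : 0 < 1 / L := by positivity
  set F : ℕ → ℝ → ℂ := fun n t => LSeries.term a (c + t * I) n * gaussWeight (1 / L) ℓ (c + t * I)
    with hF
  have hterm : ∀ n : ℕ, n ≠ 0 → ∀ t : ℝ, F n t
      = a n * gaussWeight (1 / L) (ℓ - Real.log n) (c + t * I) := by
    intro n hn t
    have hn' : (n : ℂ) ≠ 0 := by exact_mod_cast hn
    simp only [hF]
    rw [LSeries.term_of_ne_zero hn, div_eq_mul_inv, ← cpow_neg, ← gaussWeight_mul_cexp,
      cpow_def_of_ne_zero hn', ← natCast_log]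
    rw [show (Real.log n : ℂ) * -(c + t * I) = -((c + t * I) * Real.log n) by ring]
    ring
  have hF0 : ∀ t, F 0 t = 0 := fun t => by simp [hF]
  have hFi : ∀ n, Integrable (F n) := by
    intro n
    rcases eq_or_ne n 0 with rfl | hn
    · simp only [funext hF0]; exact integrable_zero _ _ _
    · simp only [funext (hterm n hn)]
      exact (integrable_gaussWeight_line hη _ c).const_mul _
  have hnorm : ∀ n, ∫ t, ‖F n t‖ = ‖LSeries.term a c n‖ * ∫ t : ℝ, ‖gaussWeight (1 / L) ℓ (c + t * I)‖ := by
    intro n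
    rw [← integral_const_mul]
    refine integral_congr_ae (Eventually.of_forall fun t => ?_)
    simp only [hF]
    rw [norm_mul, LSeries.norm_term_eq, LSeries.norm_term_eq]
    simp
  have h := hasSum_integral_of_summable_integral_norm hFi (by
    simp only [hnorm]; exact hs.mul_right _)
  have h2 := h.mul_left ((1 / (L * √(2 * π)) : ℝ) : ℂ)
  have e1 : (fun n => a n * (bump L ℓ n : ℂ))
      = fun n => ((1 / (L * √(2 * π)) : ℝ) : ℂ) * ∫ t, F n t := by
    funext n
    rcases eq_or_ne n 0 with rfl | hn
    · simp [ha, hF0]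
    · simp only [hterm n hn]
      rw [integral_const_mul, integral_gaussWeight_line hη, bump]
      rw [mul_left_comm, ← ofReal_mul]
      congr 2
      have hpi : √(2 * π) ≠ 0 := by positivity
      rw [show -(ℓ - Real.log n) ^ 2 / (2 * (1 / L) ^ 2)
        = -(L ^ 2 / 2) * (Real.log n - ℓ) ^ 2 by field_simp; ring]
      field_simp
  have e2 : ∀ t : ℝ, LSeries a (c + t * I) * gaussWeight (1 / L) ℓ (c + t * I) = ∑' n, F n t := by
    intro t
    simp only [hF]
    rw [LSeries, tsum_mul_right]
  rw [e1]
  simp only [e2]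
  exact h2

/-- The explicit formula with its error term made explicit in the range that is used. -/
lemma eventually_norm_integral_logDeriv_le :
    ∀ᶠ L : ℝ in atTop, ∀ f : ℂ → ℂ, Differentiable ℂ f →
      LocalGrowth f (Real.exp L) (L ^ 2 + 2) → (∀ s : ℂ, 1 ≤ s.re → f s ≠ 0) →
      (∀ t : ℝ, ‖logDeriv f ((1 + 1 / L : ℝ) + t * I)‖ ≤ 4 * L) →
      ∀ Z : Finset ℂ, (∀ ρ, ρ ∈ Z ↔ f ρ = 0 ∧ 9 / 10 ≤ ρ.re ∧ |ρ.im| ≤ L ^ 2 + 1) →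
      ∀ ℓ : ℝ, 159.9 * L ≤ ℓ → ℓ ≤ 160 * L →
      ‖∫ t : ℝ, logDeriv f ((1 + 1 / L : ℝ) + t * I) *
          gaussWeight (1 / L) ℓ ((1 + 1 / L : ℝ) + t * I)‖
        ≤ 2 * π * Real.exp ℓ * ((1 + 1 / L) * ∑ ρ ∈ Z, (analyticOrderNatAt f ρ : ℝ) *
            Real.exp (-(159.9 * (L * (1 - ρ.re)))) + Real.exp (-8 * L)) := by
  filter_upwards [eventually_ge_atTop 100000, eventually_pow_mul_le_exp 5 (C := 4000) (c := 0.1)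
    (by norm_num)] with L hL hpoly f hf hgr hnz hB' Z hZ ℓ hℓ hℓ'
  have hL0 : 0 < L := by linarith
  have hre : ∀ ρ ∈ Z, ρ.re ≤ 1 := by
    intro ρ hρ
    by_contra h
    exact hnz ρ (not_le.mp h).le ((hZ ρ).mp hρ).1
  have hcdef : 1 < 1 + 1 / L := by have : 0 < 1 / L := by positivity
                                   linarith
  have hinv : 1 / L ≤ 0.00001 := by rw [div_le_iff₀ hL0]; linarith
  have hinv0 : 0 < 1 / L := by positivity
  have hmain := explicit_formula hf (by rw [Real.one_lt_exp_iff]; exact hL0) (sq_nonneg L) hgr hZ hre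
    hcdef (by norm_num at hinv ⊢; linarith) (fun t => hnz _ (by simp; positivity)) hB'
    (η := 1 / L) hinv0 (ℓ := ℓ) (by linarith) (B := (80 * L ^ 2 + 400) * L) (by rw [Real.log_exp])
  refine hmain.trans ?_
  have hpi := Real.pi_gt_three
  have hm : ∀ ρ, (0 : ℝ) ≤ (analyticOrderNatAt f ρ : ℝ) := fun ρ => Nat.cast_nonneg _
  have hη2 : (1 / L) ^ 2 ≤ 1 / L * 0.1 := by rw [sq]; gcongr; norm_num at hinv ⊢; linarith
  have h1 : ∑ ρ ∈ Z, (analyticOrderNatAt f ρ : ℝ) *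
        Real.exp (ρ.re * ℓ + (1 / L) ^ 2 * ρ.re ^ 2 / 2)
      ≤ Real.exp ℓ * ((1 + 1 / L) * ∑ ρ ∈ Z, (analyticOrderNatAt f ρ : ℝ) *
            Real.exp (-(159.9 * (L * (1 - ρ.re))))) := by
    rw [mul_sum, mul_sum]
    refine sum_le_sum fun ρ hρ => ?_
    have hr1 := hre ρ hρ
    have hr0 := ((hZ ρ).mp hρ).2.1
    have e1 : Real.exp ((1 / L) ^ 2) ≤ 1 + 1 / L := by
      have h3 := Real.abs_exp_sub_one_le (x := (1 / L) ^ 2) (by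
        rw [abs_of_nonneg (sq_nonneg _)]; norm_num at hinv hη2 ⊢; linarith)
      rw [abs_of_nonneg (sq_nonneg (1 / L))] at h3
      have h4 := (abs_le.mp h3).2
      generalize (1 / L) ^ 2 = d at h4 hη2 ⊢
      generalize 1 / L = e at hη2 hinv0 ⊢
      linarith
    calc _ ≤ (analyticOrderNatAt f ρ : ℝ) * Real.exp (ℓ + (-(159.9 * (L * (1 - ρ.re))) + (1 / L) ^ 2)) := by
          refine mul_le_mul_of_nonneg_left (Real.exp_le_exp.mpr ?_) (hm ρ)
          have h5 : 159.9 * L * (1 - ρ.re) ≤ ℓ * (1 - ρ.re) :=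
            mul_le_mul_of_nonneg_right hℓ (by linarith)
          have h6 : (1 / L) ^ 2 * ρ.re ^ 2 ≤ (1 / L) ^ 2 * 1 :=
            mul_le_mul_of_nonneg_left (by nlinarith) (sq_nonneg _)
          have := sq_nonneg (1 / L)
          nlinarith
      _ = Real.exp ((1 / L) ^ 2) * (Real.exp ℓ * ((analyticOrderNatAt f ρ : ℝ) *
            Real.exp (-(159.9 * (L * (1 - ρ.re)))))) := by
          rw [Real.exp_add, Real.exp_add]; ring
      _ ≤ (1 + 1 / L) * (Real.exp ℓ * ((analyticOrderNatAt f ρ : ℝ) *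
            Real.exp (-(159.9 * (L * (1 - ρ.re)))))) :=
          mul_le_mul_of_nonneg_right e1 (by have := hm ρ; positivity)
      _ = _ := by ring
  set B := (80 * L ^ 2 + 400) * L with hB
  have hBle : B ≤ 100 * L ^ 3 := by rw [hB]; nlinarith [sq_nonneg L]
  have hB0 : 0 ≤ B := by positivity
  have hone : (1 : ℝ) ≤ L := by linarith
  have hE : Real.exp (47 / 50 * ℓ + (1 / L) ^ 2) ≤ Real.exp (ℓ + -9 * L) := by
    refine Real.exp_le_exp.mpr ?_
    norm_num at hη2 hinv hℓ ⊢
    linarith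
  have hE2 : Real.exp ((1 + 1 / L) * ℓ + (1 / L) ^ 2 - (1 / L) ^ 2 / 4 * (L ^ 2) ^ 2)
      ≤ Real.exp (ℓ + -9 * L) := by
    refine Real.exp_le_exp.mpr ?_
    have e1 : 1 / L * ℓ ≤ 160 := by rw [div_mul_eq_mul_div, div_le_iff₀ hL0]; linarith
    have e2 : (1 / L) ^ 2 / 4 * (L ^ 2) ^ 2 = L ^ 2 / 4 := by field_simp
    rw [e2, add_mul, one_mul]
    norm_num at hη2 hinv e1 ⊢
    nlinarith
  have hE3 : 2 * L ^ 2 * B + B + (4 * L + B / (1 + 1 / L - 1)) * (4 / (1 / L)) ≤ 4000 * L ^ 5 := by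
    rw [show 1 + 1 / L - 1 = 1 / L by ring, div_div_eq_mul_div, div_div_eq_mul_div, div_one, div_one]
    have e1 : L ^ 3 ≤ L ^ 5 := pow_le_pow_right₀ hone (by norm_num)
    have e2 : L ^ 2 ≤ L ^ 5 := pow_le_pow_right₀ hone (by norm_num)
    have e3 : L ^ 2 * B ≤ L ^ 2 * (100 * L ^ 3) := by gcongr
    nlinarith
  have hX : 4000 * L ^ 5 * Real.exp (ℓ + -9 * L) ≤ Real.exp ℓ * Real.exp (-8 * L) := by
    rw [← Real.exp_add]
    calc _ ≤ Real.exp (0.1 * L) * Real.exp (ℓ + -9 * L) := by gcongr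
      _ ≤ _ := by
        rw [← Real.exp_add]
        refine Real.exp_le_exp.mpr ?_
        norm_num
        linarith
  have h2 : 2 * L ^ 2 * B * Real.exp (47 / 50 * ℓ + (1 / L) ^ 2)
          + B * Real.exp ((1 + 1 / L) * ℓ + (1 / L) ^ 2 - (1 / L) ^ 2 / 4 * (L ^ 2) ^ 2)
          + (4 * L + B / (1 + 1 / L - 1)) *
            Real.exp ((1 + 1 / L) * ℓ + (1 / L) ^ 2 - (1 / L) ^ 2 / 4 * (L ^ 2) ^ 2) * (4 / (1 / L))
      ≤ Real.exp ℓ * Real.exp (-8 * L) := by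
    have e0 : 0 ≤ 4 * L + B / (1 + 1 / L - 1) := by
      rw [show 1 + 1 / L - 1 = 1 / L by ring]; positivity
    calc _ ≤ 2 * L ^ 2 * B * Real.exp (ℓ + -9 * L) + B * Real.exp (ℓ + -9 * L)
          + (4 * L + B / (1 + 1 / L - 1)) * Real.exp (ℓ + -9 * L) * (4 / (1 / L)) := by
          refine add_le_add (add_le_add (mul_le_mul_of_nonneg_left hE (by positivity))
            (mul_le_mul_of_nonneg_left hE2 hB0)) ?_
          exact mul_le_mul_of_nonneg_right (mul_le_mul_of_nonneg_left hE2 e0) (by positivity)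
      _ = (2 * L ^ 2 * B + B + (4 * L + B / (1 + 1 / L - 1)) * (4 / (1 / L))) *
          Real.exp (ℓ + -9 * L) := by ring
      _ ≤ 4000 * L ^ 5 * Real.exp (ℓ + -9 * L) :=
          mul_le_mul_of_nonneg_right hE3 (Real.exp_pos _).le
      _ ≤ _ := hX
  have h3 := mul_le_mul_of_nonneg_left h1 (by positivity : 0 ≤ 2 * π)
  have h4 : Real.exp ℓ * Real.exp (-8 * L) ≤ 2 * π * (Real.exp ℓ * Real.exp (-8 * L)) :=
    le_mul_of_one_le_left (by positivity) (by linarith)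
  linarith

lemma exists_zeros_box {f : ℂ → ℂ} (hf : Differentiable ℂ f) (hnz : ∀ s : ℂ, 1 ≤ s.re → f s ≠ 0)
    (T : ℝ) : ∃ Z : Finset ℂ, ∀ ρ, ρ ∈ Z ↔ f ρ = 0 ∧ 9 / 10 ≤ ρ.re ∧ |ρ.im| ≤ T := by
  classical
  obtain ⟨Z, hZ⟩ := exists_zeros_finset hf (hnz 1 (by simp)) 1 (1 + T)
  refine ⟨Z.filter fun ρ => 9 / 10 ≤ ρ.re ∧ |ρ.im| ≤ T, fun ρ => ?_⟩
  rw [mem_filter, hZ]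
  refine ⟨fun h => ⟨h.1.1, h.2⟩, fun h => ⟨⟨h.1, ?_⟩, h.2⟩⟩
  have hre : ρ.re < 1 := by
    by_contra h1
    exact hnz ρ (not_lt.mp h1) h.1
  rw [dist_eq]
  refine (norm_le_abs_re_add_abs_im _).trans ?_
  rw [sub_re, sub_im, one_re, one_im, sub_zero]
  have : |ρ.re - 1| ≤ 1 := by rw [abs_le]; constructor <;> linarith [h.2.1]
  linarith [h.2.2]

end LinnikAP

namespace LinnikAP

open Finset Complex Filter
open ArithmeticFunction (vonMangoldt)
open scoped Real

lemma eventually_localGrowth_LFunction :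
    ∀ᶠ L : ℝ in atTop, ∀ (q : ℕ) [NeZero q], (q : ℝ) ≤ Real.exp L →
      ∀ χ : DirichletCharacter ℂ q, χ ≠ 1 → LocalGrowth χ.LFunction (Real.exp L) (L ^ 2 + 2) := by
  filter_upwards [eventually_ge_atTop 10, eventually_pow_mul_le_exp 2 (C := 100000) (c := 1)
    (by norm_num)] with L hL hpoly q _ hq χ hχ t ht
  have hre : ((21 / 20 : ℝ) + t * I : ℂ).re = 21 / 20 := by
    rw [add_re, ofReal_re]; simp
  have him : ((21 / 20 : ℝ) + t * I : ℂ).im = t := by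
    rw [add_im, ofReal_im]; simp
  have hlow := le_norm_LFunction χ (s := (21 / 20 : ℝ) + t * I) (by rw [hre]; norm_num)
  rw [hre] at hlow
  norm_num at hlow
  refine ⟨by norm_num; intro h; norm_num [h] at hlow, fun s hs => ?_⟩
  have e1 := (abs_re_le_norm (s - ((21 / 20 : ℝ) + t * I))).trans
    ((dist_eq s _).symm.le.trans hs)
  have e2 := (abs_im_le_norm (s - ((21 / 20 : ℝ) + t * I))).trans
    ((dist_eq s _).symm.le.trans hs)
  rw [sub_re, hre, abs_le] at e1
  rw [sub_im, him] at e2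
  have h1 := norm_LFunction_le hχ (s := s) (by linarith) (by linarith)
  have h2 : |s.im| ≤ L ^ 2 + 3 := by
    have := abs_add_le (s.im - t) t
    rw [sub_add_cancel] at this; linarith
  have h3 : 7 * √(q * (|s.im| + 4)) ≤ Real.exp L * (1 / 21) := by
    have : √(q * (|s.im| + 4)) ≤ Real.exp L * (1 / 147) := by
      rw [Real.sqrt_le_left (by positivity)]
      calc _ ≤ Real.exp L * (L ^ 2 + 3 + 4) := by gcongr
        _ ≤ Real.exp L * (1 / 147 ^ 2 * Real.exp L) := by
            refine mul_le_mul_of_nonneg_left ?_ (Real.exp_pos _).le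
            rw [one_mul] at hpoly
            nlinarith
        _ = _ := by ring
    linarith
  refine h1.trans (h3.trans (mul_le_mul_of_nonneg_left ?_ (Real.exp_pos _).le))
  norm_num
  exact hlow

lemma riemannZeta₁_eq_sub_mul {s : ℂ} (hs : s ≠ 1) :
    riemannZeta₁ s = (s - 1) * riemannZeta s := by
  have h : s - 1 ≠ 0 := sub_ne_zero.mpr hs
  rw [riemannZeta_eq_inv_sub_mul hs]
  field_simp

lemma eventually_localGrowth_riemannZeta₁ :
    ∀ᶠ L : ℝ in atTop, LocalGrowth riemannZeta₁ (Real.exp L) (L ^ 2 + 2) := by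
  filter_upwards [eventually_ge_atTop 10, eventually_pow_mul_le_exp 4 (C := 100000) (c := 1)
    (by norm_num)] with L hL hpoly t ht
  have hre : ((21 / 20 : ℝ) + t * I : ℂ).re = 21 / 20 := by
    rw [add_re, ofReal_re]; simp
  have him : ((21 / 20 : ℝ) + t * I : ℂ).im = t := by
    rw [add_im, ofReal_im]; simp
  have hlow : 1 / 420 ≤ ‖riemannZeta₁ ((21 / 20 : ℝ) + t * I)‖ := by
    have h1 := le_norm_LFunction (1 : DirichletCharacter ℂ 1) (s := (21 / 20 : ℝ) + t * I)
      (by rw [hre]; norm_num)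
    rw [hre, DirichletCharacter.LFunction_modOne_eq] at h1
    have h2 : 1 / 20 ≤ ‖((21 / 20 : ℝ) + t * I : ℂ) - 1‖ := by
      refine le_trans ?_ ((le_abs_self _).trans (abs_re_le_norm _))
      rw [sub_re, hre, one_re]; norm_num
    have h3 : ((21 / 20 : ℝ) + t * I : ℂ) ≠ 1 := by
      intro h
      rw [h] at hre
      norm_num at hre
    rw [riemannZeta₁_eq_sub_mul h3, norm_mul]
    calc (1 : ℝ) / 420 = 1 / 20 * ((21 / 20 - 1) / (21 / 20)) := by norm_num
      _ ≤ _ := by gcongr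
  refine ⟨by intro h; rw [h] at hlow; norm_num at hlow, fun s hs => ?_⟩
  have e1 := (abs_re_le_norm (s - ((21 / 20 : ℝ) + t * I))).trans
    ((dist_eq s _).symm.le.trans hs)
  have e2 := (abs_im_le_norm (s - ((21 / 20 : ℝ) + t * I))).trans
    ((dist_eq s _).symm.le.trans hs)
  rw [sub_re, hre, abs_le] at e1
  rw [sub_im, him] at e2
  have h1 := norm_riemannZeta₁_le (s := s) (by linarith) (by linarith)
  have h2 : |s.im| ≤ L ^ 2 + 3 := by
    have := abs_add_le (s.im - t) t
    rw [sub_add_cancel] at this; linarith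
  have h3 : 3 * (|s.im| + 4) ^ 2 ≤ Real.exp L * (1 / 420) := by
    calc _ ≤ 3 * (L ^ 2 + 3 + 4) ^ 2 := by gcongr
      _ ≤ 3 * (2 * L ^ 2) ^ 2 := by gcongr; nlinarith
      _ = 12 * L ^ 4 := by ring
      _ ≤ _ := by rw [one_mul] at hpoly; linarith [show (0:ℝ) ≤ L ^ 4 by positivity]
  exact h1.trans (h3.trans (mul_le_mul_of_nonneg_left hlow (Real.exp_pos _).le))

/-- The sums over primes twisted by the nonprincipal characters. -/
theorem eventually_sum_norm_charSum_le :
    ∀ᶠ L : ℝ in atTop, ∀ (q : ℕ) [NeZero q], (q : ℝ) ≤ Real.exp L →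
      (∀ χ : DirichletCharacter ℂ q, χ ≠ 1 → ∀ ρ : ℂ, χ.LFunction ρ = 0 → |ρ.im| ≤ L ^ 2 + 1 →
        ρ.re ≤ 1 - 0.0416 / L) →
      ∀ ℓ : ℝ, 159.9 * L ≤ ℓ → ℓ ≤ 160 * L →
        ∑ χ ∈ (univ : Finset (DirichletCharacter ℂ q)).erase 1,
          ‖∑' n : ℕ, χ n * (vonMangoldt n : ℂ) * (bump L ℓ n : ℂ)‖
            ≤ 0.1345 * (√(2 * π) / L * Real.exp ℓ) := by
  filter_upwards [eventually_ge_atTop 100000, eventually_localGrowth_LFunction,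
    eventually_norm_integral_logDeriv_le, eventually_sum_near_zeros_le,
    eventually_sum_far_zeros_le] with L hL hgr hEF hnear hfar q _ hq hzf ℓ hℓ hℓ'
  classical
  have hL0 : 0 < L := by linarith
  have hinv : 1 / L ≤ 0.00001 := by rw [div_le_iff₀ hL0]; linarith
  have hinv0 : 0 < 1 / L := by positivity
  have hnz : ∀ χ : DirichletCharacter ℂ q, χ ≠ 1 → ∀ s : ℂ, 1 ≤ s.re → χ.LFunction s ≠ 0 :=
    fun χ hχ s hs => DirichletCharacter.LFunction_ne_zero_of_one_le_re χ (Or.inl hχ) hs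
  have hex : ∀ χ : DirichletCharacter ℂ q, ∃ Z : Finset ℂ, χ ≠ 1 →
      ∀ ρ, ρ ∈ Z ↔ χ.LFunction ρ = 0 ∧ 9 / 10 ≤ ρ.re ∧ |ρ.im| ≤ L ^ 2 + 1 := by
    intro χ
    by_cases hχ : χ = 1
    · exact ⟨∅, fun h => absurd hχ h⟩
    · obtain ⟨Z, hZ⟩ := exists_zeros_box (DirichletCharacter.differentiable_LFunction hχ)
        (hnz χ hχ) (L ^ 2 + 1)
      exact ⟨Z, fun _ => hZ⟩
  choose Z hZ using hex
  set w : DirichletCharacter ℂ q → ℂ → ℝ := fun χ ρ => (analyticOrderNatAt χ.LFunction ρ : ℝ) *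
    Real.exp (-(159.9 * (L * (1 - ρ.re))))
  set A := √(2 * π) / L * Real.exp ℓ with hA
  have hA0 : 0 ≤ A := by positivity
  have hone : ∀ χ ∈ (univ : Finset (DirichletCharacter ℂ q)).erase 1,
      ‖∑' n : ℕ, χ n * (vonMangoldt n : ℂ) * (bump L ℓ n : ℂ)‖
        ≤ A * ((1 + 1 / L) * ∑ ρ ∈ Z χ, w χ ρ + Real.exp (-8 * L)) := by
    intro χ hχ'
    have hχ : χ ≠ 1 := ne_of_mem_erase hχ'
    have hline : ∀ t : ℝ, ((1 + 1 / L : ℝ) + t * I : ℂ).re = 1 + 1 / L := by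
      intro t; simp
    have hS := hasSum_mul_bump (a := (fun n : ℕ => χ (n : ZMod q)) *
      fun n : ℕ => ((vonMangoldt n : ℝ) : ℂ)) (by simp) (c := 1 + 1 / L) hL0 ℓ
      (summable_term_vonMangoldt χ (by rw [ofReal_re]; linarith)).norm
    simp only [Pi.mul_apply] at hS
    rw [hS.tsum_eq]
    have he := hEF χ.LFunction (DirichletCharacter.differentiable_LFunction hχ)
      (hgr q hq χ hχ) (hnz χ hχ) (fun t => by
        have := norm_logDeriv_LFunction_le χ hinv0 (hline t)
        rw [one_div_one_div] at this
        linarith) (Z χ) (hZ χ hχ) ℓ hℓ hℓ'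
    rw [norm_mul, norm_real, Real.norm_of_nonneg (by positivity)]
    have hneg : ∫ t : ℝ, LSeries ((fun n : ℕ => χ (n : ZMod q)) *
        fun n : ℕ => ((vonMangoldt n : ℝ) : ℂ)) ((1 + 1 / L : ℝ) + t * I) *
          gaussWeight (1 / L) ℓ ((1 + 1 / L : ℝ) + t * I)
        = -∫ t : ℝ, logDeriv χ.LFunction ((1 + 1 / L : ℝ) + t * I) *
          gaussWeight (1 / L) ℓ ((1 + 1 / L : ℝ) + t * I) := by
      rw [← MeasureTheory.integral_neg]
      congr 1
      funext t
      rw [logDeriv_LFunction_eq χ (by rw [hline]; linarith)]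
      ring
    rw [hneg, norm_neg]
    change _ ≤ 2 * π * Real.exp ℓ * ((1 + 1 / L) * ∑ ρ ∈ Z χ, w χ ρ + Real.exp (-8 * L)) at he
    refine (mul_le_mul_of_nonneg_left he (by positivity)).trans (le_of_eq ?_)
    have hpi : √(2 * π) * √(2 * π) = 2 * π := Real.mul_self_sqrt (by positivity)
    have hpi0 : √(2 * π) ≠ 0 := by positivity
    rw [hA]
    generalize √(2 * π) = r at hpi hpi0 ⊢
    rw [← hpi]
    field_simp
  refine (sum_le_sum hone).trans ?_
  rw [← mul_sum, mul_comm 0.1345]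
  refine mul_le_mul_of_nonneg_left ?_ hA0
  rw [sum_add_distrib, ← mul_sum, sum_const, nsmul_eq_mul]
  have h1 := hnear q hq (fun χ => if χ = 1 then ∅ else (Z χ).filter fun ρ => 1 - 0.2 / L ≤ ρ.re) (by
    intro χ ρ hρ
    by_cases hχ : χ = 1
    · rw [if_pos hχ] at hρ; simp at hρ
    · rw [if_neg hχ, mem_filter, hZ χ hχ] at hρ
      obtain ⟨⟨a1, a2, a3⟩, a4⟩ := hρ
      exact ⟨hχ, a1, hzf χ hχ ρ a1 a3, a4, a3⟩)
  have h2 := hfar q hq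
    (fun χ => if χ = 1 then ∅ else (Z χ).filter fun ρ => ¬ (1 - 0.2 / L ≤ ρ.re)) (by
    intro χ ρ hρ
    by_cases hχ : χ = 1
    · rw [if_pos hχ] at hρ; simp at hρ
    · rw [if_neg hχ, mem_filter, hZ χ hχ] at hρ
      obtain ⟨⟨a1, a2, a3⟩, a4⟩ := hρ
      exact ⟨hχ, a1, (not_le.mp a4).le, a2, a3⟩)
  have hsum : ∑ χ ∈ (univ : Finset (DirichletCharacter ℂ q)).erase 1, ∑ ρ ∈ Z χ, w χ ρ ≤ 0.134 := by
    simp only [neg_mul] at h1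
    have hsplit : ∀ p : ℂ → Prop, ∀ [DecidablePred p],
        ∑ χ : DirichletCharacter ℂ q, ∑ ρ ∈ (if χ = 1 then ∅ else (Z χ).filter p), w χ ρ
        = ∑ χ ∈ (univ : Finset (DirichletCharacter ℂ q)).erase 1, ∑ ρ ∈ (Z χ).filter p, w χ ρ := by
      intro p _
      rw [← add_sum_erase univ _ (mem_univ (1 : DirichletCharacter ℂ q)), if_pos rfl,
        sum_empty, zero_add]
      exact sum_congr rfl fun χ hχ => by rw [if_neg (ne_of_mem_erase hχ)]
    rw [hsplit] at h1 h2
    have h3 := add_le_add h1 h2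
    rw [← sum_add_distrib] at h3
    simp only [sum_filter_add_sum_filter_not] at h3
    norm_num at h3 ⊢
    exact h3
  have hcard : ((univ : Finset (DirichletCharacter ℂ q)).erase 1).card * Real.exp (-8 * L)
      ≤ 0.0001 := by
    have hc : (((univ : Finset (DirichletCharacter ℂ q)).erase 1).card : ℝ) ≤ Real.exp L := by
      refine le_trans ?_ hq
      have h3 : Fintype.card (DirichletCharacter ℂ q) ≤ q := by
        rw [← Nat.card_eq_fintype_card,
          DirichletCharacter.card_eq_totient_of_hasEnoughRootsOfUnity]
        exact Nat.totient_le q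
      exact_mod_cast (card_erase_le).trans h3
    calc _ ≤ Real.exp L * Real.exp (-8 * L) := by gcongr
      _ = Real.exp (-(7 * L)) := by rw [← Real.exp_add]; congr 1; ring
      _ ≤ 0.0001 := by
        rw [Real.exp_neg, inv_le_comm₀ (Real.exp_pos _) (by norm_num)]
        have := Real.add_one_le_exp (7 * L)
        norm_num
        linarith
  calc _ ≤ (1 + 0.00001 : ℝ) * 0.134 + 0.0001 := by
        refine add_le_add (mul_le_mul (add_le_add le_rfl hinv) hsum ?_ (by norm_num)) hcard
        · exact sum_nonneg fun χ _ => sum_nonneg fun ρ _ => by positivity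
    _ ≤ _ := by norm_num

end LinnikAP

namespace LinnikAP

open Finset Complex Filter Topology
open ArithmeticFunction (vonMangoldt)
open scoped Real

lemma riemannZeta₁_ne_zero {s : ℂ} (hs : 1 ≤ s.re) : riemannZeta₁ s ≠ 0 := by
  rcases eq_or_ne s 1 with rfl | h
  · simp
  · rw [riemannZeta₁_eq_sub_mul h]
    exact mul_ne_zero (sub_ne_zero.mpr h) (riemannZeta_ne_zero_of_one_le_re hs)

lemma logDeriv_riemannZeta₁ {s : ℂ} (hs : 1 < s.re) :
    logDeriv riemannZeta₁ s = 1 / (s - 1) + logDeriv riemannZeta s := by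
  have h1 : s ≠ 1 := by rintro rfl; simp at hs
  have he : riemannZeta₁ =ᶠ[𝓝 s] fun z => (z - 1) * riemannZeta z := by
    filter_upwards [isOpen_ne.mem_nhds h1] with z hz using riemannZeta₁_eq_sub_mul hz
  rw [logDeriv_apply, he.deriv_eq, he.eq_of_nhds, ← logDeriv_apply,
    logDeriv_mul (f := fun z => z - 1) (g := riemannZeta) s (sub_ne_zero.mpr h1)
      (riemannZeta_ne_zero_of_one_lt_re hs) (by fun_prop) (differentiableAt_riemannZeta h1),
    logDeriv_apply]
  simp

lemma logDeriv_riemannZeta_eq {s : ℂ} (hs : 1 < s.re) :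
    logDeriv riemannZeta s = -LSeries (fun n : ℕ => ((vonMangoldt n : ℝ) : ℂ)) s := by
  have h := logDeriv_LFunction_eq (1 : DirichletCharacter ℂ 1) hs
  rw [DirichletCharacter.LFunction_modOne_eq] at h
  rw [h]
  congr 2
  funext n
  rw [Pi.mul_apply, MulChar.one_apply (isUnit_of_subsingleton _), one_mul]

lemma summable_term_vonMangoldt_one {s : ℂ} (hs : 1 < s.re) :
    Summable (LSeries.term (fun n : ℕ => ((vonMangoldt n : ℝ) : ℂ)) s) := by
  have h := summable_term_vonMangoldt (1 : DirichletCharacter ℂ 1) hs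
  convert h using 2
  funext n
  rw [Pi.mul_apply, MulChar.one_apply (isUnit_of_subsingleton _), one_mul]

lemma norm_logDeriv_riemannZeta_le {δ : ℝ} (hδ : 0 < δ) {s : ℂ} (hs : s.re = 1 + δ) :
    ‖logDeriv riemannZeta s‖ ≤ 1 / δ + 8 := by
  have h := norm_logDeriv_LFunction_le (1 : DirichletCharacter ℂ 1) hδ hs
  rwa [DirichletCharacter.LFunction_modOne_eq] at h

lemma re_logDeriv_comb_nonpos {σ : ℝ} (hσ : 1 < σ) (t : ℝ) :
    3 * (logDeriv riemannZeta σ).re + 4 * (logDeriv riemannZeta (σ + t * I)).re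
      + (logDeriv riemannZeta (σ + (2 * t : ℝ) * I)).re ≤ 0 := by
  have hre : ∀ u : ℝ, 1 < ((σ : ℂ) + u * I).re := by intro u; simpa using hσ
  have key : ∀ u : ℝ, HasSum (fun n : ℕ => vonMangoldt n * (n : ℝ) ^ (-σ) * Real.cos (u * Real.log n))
      (-(logDeriv riemannZeta (σ + u * I)).re) := by
    intro u
    rw [logDeriv_riemannZeta_eq (hre u), neg_re, neg_neg]
    have h := hasSum_re (summable_term_vonMangoldt_one (hre u)).hasSum
    convert h using 1
    swap
    · rfl
    funext n
    rcases eq_or_ne n 0 with rfl | hn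
    · simp
    · rw [LSeries.term_of_ne_zero hn, div_eq_mul_inv, ← cpow_neg,
        natCast_cpow_neg_line hn, ← mul_assoc, ← ofReal_mul, re_ofReal_mul,
        show -(I * u * (Real.log n : ℂ)) = ((-(u * Real.log n) : ℝ) : ℂ) * I by push_cast; ring,
        exp_ofReal_mul_I_re, Real.cos_neg]
  have h0 := key 0
  simp only [ofReal_zero, zero_mul, add_zero] at h0
  have h := ((h0.mul_left 3).add ((key t).mul_left 4)).add (key (2 * t))
  have := h.nonneg fun n => by
    have h1 : Real.cos (2 * t * Real.log n) = 2 * Real.cos (t * Real.log n) ^ 2 - 1 := by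
      rw [mul_assoc, Real.cos_two_mul]
    have h2 : 0 ≤ vonMangoldt n * (n : ℝ) ^ (-σ) :=
      mul_nonneg ArithmeticFunction.vonMangoldt_nonneg (Real.rpow_nonneg (Nat.cast_nonneg n) _)
    rw [h1, Real.cos_zero]
    have := mul_nonneg h2 (sq_nonneg (1 + Real.cos (t * Real.log n)))
    nlinarith
  linarith

lemma sum_zeros_riemannZeta₁_le {a t : ℝ} (ha : 0 < a) (ha1 : a ≤ 0.05) (ht : 1 ≤ |t|)
    {S : Finset ℂ} (hS : ∀ ρ ∈ S, riemannZeta₁ ρ = 0 ∧ dist ρ ((1 + a : ℝ) + t * I) ≤ 1 / 2) :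
    ∑ ρ ∈ S, (analyticOrderNatAt riemannZeta₁ ρ : ℝ) *
        ((1 + a - ρ.re) / dist ((1 + a : ℝ) + t * I : ℂ) ρ ^ 2 - 4 * (1 + a - ρ.re))
      ≤ (logDeriv riemannZeta ((1 + a : ℝ) + t * I)).re + 1
        + 4 * Real.log (6 * (|t| + 5) ^ 2 / a) := by
  set c : ℂ := (1 + a : ℝ) + t * I with hc
  have hcre : c.re = 1 + a := by simp [hc]
  have hcim : c.im = t := by simp [hc]
  have hcn : 1 ≤ ‖c - 1‖ := by
    refine ht.trans ?_
    have := abs_im_le_norm (c - 1)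
    rwa [sub_im, hcim, one_im, sub_zero] at this
  have hne : c ≠ 1 := by
    intro h; rw [h] at hcn; norm_num at hcn
  have hlow : a / 2 ≤ ‖riemannZeta₁ c‖ := by
    have h1 := le_norm_LFunction (1 : DirichletCharacter ℂ 1) (s := c) (by rw [hcre]; linarith)
    rw [hcre, DirichletCharacter.LFunction_modOne_eq] at h1
    rw [riemannZeta₁_eq_sub_mul hne, norm_mul]
    have h2 : a / 2 ≤ (1 + a - 1) / (1 + a) := by
      rw [show 1 + a - 1 = a by ring]
      gcongr
      norm_num at ha1 ⊢
      linarith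
    nlinarith [norm_nonneg (riemannZeta c)]
  set M := 6 * (|t| + 5) ^ 2 / a with hM
  have hM1 : 1 < M := by
    rw [hM, lt_div_iff₀ ha]
    norm_num at ha1
    nlinarith
  have hb : ∀ s, dist s c ≤ 1 / 2 → ‖riemannZeta₁ s‖ ≤ M * ‖riemannZeta₁ c‖ := by
    intro s hs
    have e1 := (abs_re_le_norm (s - c)).trans ((dist_eq s _).symm.le.trans hs)
    have e2 := (abs_im_le_norm (s - c)).trans ((dist_eq s _).symm.le.trans hs)
    rw [sub_re, hcre, abs_le] at e1
    rw [sub_im, hcim] at e2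
    norm_num at ha1
    have h1 := norm_riemannZeta₁_le (s := s) (by linarith) (by linarith)
    have h2 : |s.im| ≤ |t| + 1 := by
      have := abs_add_le (s.im - t) t
      rw [sub_add_cancel] at this; linarith
    calc _ ≤ _ := h1
      _ ≤ 3 * (|t| + 5) ^ 2 := mul_le_mul_of_nonneg_left
          (pow_le_pow_left₀ (by positivity) (by linarith) 2) (by norm_num)
      _ = M * (a / 2) := by rw [hM]; field_simp; norm_num
      _ ≤ _ := by gcongr
  have h := sum_zeros_le differentiable_riemannZeta₁ (R := 1 / 2) (by norm_num)
    (riemannZeta₁_ne_zero (by rw [hcre]; linarith)) hM1 hb (fun ρ hρ _ => by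
      rw [hcre]
      by_contra h
      exact riemannZeta₁_ne_zero (by linarith) hρ) hS
  rw [logDeriv_riemannZeta₁ (by rw [hcre]; linarith), add_re (1 / (c - 1)), hcre] at h
  have h3 : (1 / (c - 1)).re ≤ 1 := by
    refine (re_le_norm _).trans ?_
    rw [norm_div, norm_one]
    exact div_le_one_of_le₀ hcn (norm_nonneg _)
  have h4 : ∀ u : ℝ, u / (1 / 2) ^ 2 = 4 * u := by intro u; ring
  simp only [h4] at h
  rw [show 2 * Real.log M / (1 / 2) = 4 * Real.log M by ring] at h
  linarith

/-- The classical zero-free region, away from the real axis. -/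
lemma re_le_of_riemannZeta₁_eq_zero {ρ : ℂ} (hρ : riemannZeta₁ ρ = 0) (hγ : 1 ≤ |ρ.im|) :
    ρ.re ≤ 1 - 0.0002 / Real.log (|ρ.im| + 5) := by
  set X := |ρ.im| + 5
  set l := Real.log X with hl
  have hX6 : 6 ≤ X := by linarith
  have hl1 : 1.7 ≤ l := by
    rw [hl, Real.le_log_iff_exp_le (by linarith)]
    refine le_trans ?_ hX6
    have h1 := Real.exp_one_lt_d9
    have h2 : Real.exp 1.7 ^ 10 ≤ 6 ^ 10 := by
      rw [← Real.exp_nat_mul]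
      calc _ = Real.exp ((17 : ℕ) * 1) := by norm_num
        _ = Real.exp 1 ^ 17 := by rw [Real.exp_nat_mul]
        _ ≤ 2.7182818286 ^ 17 := by gcongr
        _ ≤ _ := by norm_num
    exact le_of_pow_le_pow_left₀ (by norm_num) (by norm_num) h2
  have hl0 : 0 < l := by norm_num at hl1; linarith
  set a := 0.001 / l with ha
  have ha0 : 0 < a := by positivity
  have ha1 : a ≤ 0.001 := by
    rw [ha, div_le_iff₀ hl0]; norm_num at hl1 ⊢; linarith
  by_contra hcon
  rw [not_le] at hcon
  have h02 : 0.0002 / l = 0.2 * a := by rw [ha]; ring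
  rw [h02] at hcon
  have hlt : ρ.re < 1 := by
    by_contra h; exact riemannZeta₁_ne_zero (not_lt.mp h) hρ
  have hlogM : ∀ t : ℝ, |t| ≤ 2 * |ρ.im| → Real.log (6 * (|t| + 5) ^ 2 / a) ≤ 15 * l := by
    intro t ht
    have h1 : 6 * (|t| + 5) ^ 2 / a ≤ 24 * X ^ 2 * (1000 * X) := by
      rw [ha, div_div_eq_mul_div, div_le_iff₀ (by norm_num)]
      have h2 : l ≤ X := (Real.log_le_sub_one_of_pos (by linarith)).trans (by linarith)
      have h3 : (|t| + 5) ^ 2 ≤ (2 * X) ^ 2 := by gcongr; linarith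
      calc 6 * (|t| + 5) ^ 2 * l ≤ 6 * (2 * X) ^ 2 * X := by gcongr
        _ = _ := by norm_num; ring
    have h4 : 24 * X ^ 2 * (1000 * X) ≤ X ^ 15 := by
      have h5 : (24000 : ℝ) ≤ X ^ 12 := by
        calc (24000 : ℝ) ≤ 6 ^ 12 := by norm_num
          _ ≤ _ := by gcongr
      calc _ = 24000 * X ^ 3 := by ring
        _ ≤ X ^ 12 * X ^ 3 := by gcongr
        _ = _ := by ring
    have h6 := Real.log_le_log (by positivity) (h1.trans h4)
    rw [Real.log_pow] at h6
    exact_mod_cast h6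
  have hdist : dist ((1 + a : ℝ) + ρ.im * I : ℂ) ρ = 1 + a - ρ.re := by
    rw [dist_eq]
    have : ((1 + a : ℝ) + ρ.im * I : ℂ) - ρ = ((1 + a - ρ.re : ℝ) : ℂ) := by
      apply Complex.ext <;> simp
    rw [this, norm_real, Real.norm_of_nonneg (by linarith)]
  have hdle : 1 + a - ρ.re ≤ 0.002 := by
    norm_num at ha1 hcon ⊢; linarith
  have hd0 : 0 < 1 + a - ρ.re := by linarith
  have hA := sum_zeros_riemannZeta₁_le (a := a) (t := ρ.im) ha0 (ha1.trans (by norm_num)) hγ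
    (S := {ρ}) (by
      intro z hz
      rw [mem_singleton] at hz
      rw [hz, dist_comm, hdist]
      exact ⟨hρ, hdle.trans (by norm_num)⟩)
  have hB := sum_zeros_riemannZeta₁_le (a := a) (t := 2 * ρ.im) ha0 (ha1.trans (by norm_num))
    (by rw [abs_mul, abs_two]; linarith) (S := ∅) (by simp)
  rw [sum_empty] at hB
  rw [sum_singleton, hdist] at hA
  have h341 := re_logDeriv_comb_nonpos (σ := 1 + a) (by linarith) ρ.im
  have hC := norm_logDeriv_riemannZeta_le ha0 (s := ((1 + a : ℝ) : ℂ)) (by rw [ofReal_re])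
  have hC' := (abs_le.mp ((abs_re_le_norm _).trans hC)).1
  have hm : (1 : ℝ) ≤ analyticOrderNatAt riemannZeta₁ ρ := by
    exact_mod_cast one_le_analyticOrderNatAt differentiable_riemannZeta₁
      (z := 1) (riemannZeta₁_ne_zero (by simp)) hρ
  set d := 1 + a - ρ.re with hd
  have hdd : d / d ^ 2 = 1 / d := by field_simp
  rw [hdd] at hA
  have hbig : 500 ≤ 1 / d := by
    rw [le_div_iff₀ hd0]; norm_num at hdle ⊢; linarith
  have hA2 : 1 / d - 4 * d ≤ (analyticOrderNatAt riemannZeta₁ ρ : ℝ) * (1 / d - 4 * d) := by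
    refine le_mul_of_one_le_left ?_ hm
    norm_num at hdle hbig ⊢; linarith
  have hl2 := hlogM (2 * ρ.im) (by rw [abs_mul, abs_two])
  have hl3 := hlogM ρ.im (by linarith [abs_nonneg ρ.im])
  have hla : l = 0.001 * (1 / a) := by rw [ha]; field_simp
  have hfin : 4 * (1 / d) ≤ 3.32 * (1 / a) := by
    clear_value d
    generalize (logDeriv riemannZeta (((1 + a : ℝ) : ℂ) + ((ρ.im : ℝ) : ℂ) * I)).re = x₁ at hA h341
    generalize (logDeriv riemannZeta (((1 + a : ℝ) : ℂ) + ((2 * ρ.im : ℝ) : ℂ) * I)).re = x₂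
      at hB h341
    generalize (logDeriv riemannZeta ((1 + a : ℝ) : ℂ)).re = x₀ at hC' h341
    generalize Real.log (6 * (|2 * ρ.im| + 5) ^ 2 / a) = y₂ at hB hl2
    generalize Real.log (6 * (|ρ.im| + 5) ^ 2 / a) = y₁ at hA hl3
    generalize (analyticOrderNatAt riemannZeta₁ ρ : ℝ) * (1 / d - 4 * d) = z at hA hA2
    generalize 1 / d = d' at *
    generalize 1 / a = a' at *
    norm_num at hdle hl1 hla ⊢
    linarith
  have h5 : 4 * a ≤ 3.32 * d := by
    have := mul_le_mul_of_nonneg_right hfin (by positivity : 0 ≤ a * d)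
    have e1 : 4 * (1 / d) * (a * d) = 4 * a := by field_simp
    have e2 : 3.32 * (1 / a) * (a * d) = 3.32 * d := by field_simp
    rwa [e1, e2] at this
  norm_num at h5 hcon hd
  linarith

lemma exists_re_le_of_riemannZeta₁_eq_zero : ∃ c : ℝ, 0 < c ∧ ∀ ρ : ℂ, riemannZeta₁ ρ = 0 →
    9 / 10 ≤ ρ.re → ρ.re ≤ 1 - c / Real.log (|ρ.im| + 5) := by
  obtain ⟨Z, hZ⟩ := exists_zeros_box differentiable_riemannZeta₁ (fun s hs => riemannZeta₁_ne_zero hs) 1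
  have h1 : ∀ᶠ δ : ℝ in 𝓝[>] 0, ∀ ρ ∈ Z, δ < 1 - ρ.re := by
    rw [Finset.eventually_all]
    intro ρ hρ
    have : 0 < 1 - ρ.re := by
      by_contra h
      exact riemannZeta₁_ne_zero (by linarith) ((hZ ρ).mp hρ).1
    exact (eventually_lt_nhds this).filter_mono nhdsWithin_le_nhds
  obtain ⟨δ, hδ, hδ0⟩ := (h1.and self_mem_nhdsWithin).exists
  refine ⟨min δ 0.0002, lt_min hδ0 (by norm_num), fun ρ hρ hre => ?_⟩
  have hlog : 1 ≤ Real.log (|ρ.im| + 5) := by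
    rw [Real.le_log_iff_exp_le (by positivity)]
    have := Real.exp_one_lt_d9
    linarith [abs_nonneg ρ.im]
  rcases le_total |ρ.im| 1 with h | h
  · have h2 := hδ ρ ((hZ ρ).mpr ⟨hρ, hre, h⟩)
    have h3 : min δ 0.0002 / Real.log (|ρ.im| + 5) ≤ δ :=
      (div_le_self (le_min (le_of_lt hδ0) (by norm_num)) hlog).trans (min_le_left _ _)
    linarith
  · refine (re_le_of_riemannZeta₁_eq_zero hρ h).trans ?_
    have : min δ 0.0002 / Real.log (|ρ.im| + 5) ≤ 0.0002 / Real.log (|ρ.im| + 5) :=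
      div_le_div_of_nonneg_right (min_le_right _ _) (by linarith)
    linarith

lemma eventually_sum_zeros_riemannZeta₁_le :
    ∀ᶠ L : ℝ in atTop, ∀ Z : Finset ℂ,
      (∀ ρ ∈ Z, riemannZeta₁ ρ = 0 ∧ 9 / 10 ≤ ρ.re ∧ |ρ.im| ≤ L ^ 2 + 1) →
      ∑ ρ ∈ Z, (analyticOrderNatAt riemannZeta₁ ρ : ℝ) *
        Real.exp (-(159.9 * (L * (1 - ρ.re)))) ≤ 0.0001 := by
  obtain ⟨c, hc, hzf⟩ := exists_re_le_of_riemannZeta₁_eq_zero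
  have hsqrt : Tendsto Real.sqrt atTop atTop := Real.tendsto_sqrt_atTop
  filter_upwards [eventually_ge_atTop 100, eventually_localGrowth_riemannZeta₁,
    hsqrt.eventually (eventually_pow_mul_le_exp 6 (C := 1000000) hc),
    hsqrt.eventually (eventually_log_le_mul (c := 0.1) (by norm_num))] with L hL hgr hpoly hlog Z hZ
  have hL0 : 0 < L := by linarith
  have hs := Real.sq_sqrt hL0.le
  set u := √L with hu
  have hu10 : 10 ≤ u := by rw [hu]; exact Real.le_sqrt_of_sq_le (by linarith)
  have hcount := sum_order_strip_le differentiable_riemannZeta₁ (Real.one_le_exp hL0.le)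
    (T := L ^ 2 + 1) (by positivity) (by rw [show L ^ 2 + 1 + 1 = L ^ 2 + 2 by ring]; exact hgr)
    (S := Z) (fun ρ hρ => ⟨(hZ ρ hρ).1, (hZ ρ hρ).2.1, by
      by_contra h
      exact riemannZeta₁_ne_zero (not_le.mp h).le (hZ ρ hρ).1, (hZ ρ hρ).2.2⟩)
  rw [Real.log_exp] at hcount
  have hlogu : Real.log (L ^ 2 + 6) ≤ u := by
    have h1 : Real.log (L ^ 2 + 6) ≤ Real.log (u ^ 5) := by
      refine Real.log_le_log (by positivity) ?_
      rw [← hs]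
      have : 10 * u ^ 4 ≤ u * u ^ 4 := mul_le_mul_of_nonneg_right hu10 (by positivity)
      nlinarith [sq_nonneg (u ^ 2)]
    rw [Real.log_pow] at h1
    push_cast at h1
    norm_num at hlog
    linarith
  have hterm : ∀ ρ ∈ Z, Real.exp (-(159.9 * (L * (1 - ρ.re)))) ≤ Real.exp (-(c * u)) := by
    intro ρ hρ
    obtain ⟨h1, h2, h3⟩ := hZ ρ hρ
    refine Real.exp_le_exp.mpr (neg_le_neg ?_)
    have h4 := hzf ρ h1 h2
    have h5 : Real.log (|ρ.im| + 5) ≤ u :=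
      (Real.log_le_log (by positivity) (by linarith)).trans hlogu
    have h6 : 0 < Real.log (|ρ.im| + 5) := Real.log_pos (by linarith [abs_nonneg ρ.im])
    have h7 : c / u ≤ 1 - ρ.re := by
      have : c / u ≤ c / Real.log (|ρ.im| + 5) := div_le_div_of_nonneg_left hc.le h6 h5
      linarith
    have h8 : L * (c / u) ≤ L * (1 - ρ.re) := mul_le_mul_of_nonneg_left h7 hL0.le
    have h9 : L * (c / u) = c * u := by rw [← hs]; field_simp
    have h10 : 0 ≤ c * u := by positivity
    norm_num
    linarith
  calc _ ≤ ∑ ρ ∈ Z, (analyticOrderNatAt riemannZeta₁ ρ : ℝ) * Real.exp (-(c * u)) :=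
        sum_le_sum fun ρ hρ => mul_le_mul_of_nonneg_left (hterm ρ hρ) (Nat.cast_nonneg _)
    _ ≤ ((4 * (L ^ 2 + 1) + 3) * (5 * L)) * Real.exp (-(c * u)) := by
        rw [← sum_mul]
        exact mul_le_mul_of_nonneg_right hcount (Real.exp_pos _).le
    _ ≤ 100 * u ^ 6 * Real.exp (-(c * u)) := by
        refine mul_le_mul_of_nonneg_right ?_ (Real.exp_pos _).le
        rw [show u ^ 6 = L ^ 3 by rw [← hs]; ring]
        nlinarith
    _ ≤ 0.0001 * Real.exp (c * u) * Real.exp (-(c * u)) := by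
        refine mul_le_mul_of_nonneg_right ?_ (Real.exp_pos _).le
        norm_num
        linarith
    _ = _ := by rw [mul_assoc, ← Real.exp_add, add_neg_cancel, Real.exp_zero, mul_one]

end LinnikAP

namespace LinnikAP

open Filter Topology Finset Complex ArithmeticFunction
open scoped Real

lemma summable_vonMangoldt_mul_bump {L : ℝ} (hL : 0 < L) (ℓ : ℝ) :
    Summable fun n : ℕ => vonMangoldt n * bump L ℓ n := by
  have h := hasSum_mul_bump (a := fun n : ℕ => ((vonMangoldt n : ℝ) : ℂ)) (by simp) (c := 2) hL ℓ
    (summable_term_vonMangoldt_one (by norm_num)).norm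
  exact summable_ofReal.mp (by simpa using h.summable)

lemma le_integral_Ioi_exp_mul_gaussian {L ℓ : ℝ} (hL : 0 < L) :
    √(2 * π) / L * Real.exp ℓ - 1
      ≤ ∫ v : ℝ in Set.Ioi 0, Real.exp v * Real.exp (-(ℓ - v) ^ 2 / (2 * (1 / L) ^ 2)) := by
  have hη : 0 < 1 / L := by positivity
  have hint := integrable_exp_mul_gaussian hη ℓ 1
  have htot := integral_exp_mul_gaussian hη (ℓ := ℓ) (β := 1)
  simp only [one_mul] at hint htot
  rw [← MeasureTheory.integral_add_compl (measurableSet_Ioi (a := (0 : ℝ))) hint,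
    Set.compl_Ioi] at htot
  have h1 : ∫ v : ℝ in Set.Iic 0, Real.exp v * Real.exp (-(ℓ - v) ^ 2 / (2 * (1 / L) ^ 2))
      ≤ 1 := by
    refine le_trans ?_ integral_exp_Iic_zero.le
    refine MeasureTheory.integral_mono hint.integrableOn (integrableOn_exp_Iic 0) fun v => ?_
    refine mul_le_of_le_one_right (Real.exp_pos _).le (Real.exp_le_one_iff.mpr ?_)
    rw [neg_div]
    exact neg_nonpos.mpr (by positivity)
  have h2 : √(2 * π) / L * Real.exp ℓ
      ≤ √(2 * π) * (1 / L) * Real.exp (ℓ + (1 / L) ^ 2 / 2) := by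
    rw [mul_one_div]
    gcongr
    linarith [show 0 ≤ (1 / L) ^ 2 / 2 by positivity]
  simp only [one_pow, mul_one] at htot
  linarith

lemma eventually_le_tsum_vonMangoldt_mul_bump :
    ∀ᶠ L : ℝ in atTop, ∀ ℓ : ℝ, 159.9 * L ≤ ℓ → ℓ ≤ 160 * L →
      0.9997 * (√(2 * π) / L * Real.exp ℓ) ≤ ∑' n : ℕ, vonMangoldt n * bump L ℓ n := by
  filter_upwards [eventually_norm_integral_logDeriv_le, eventually_localGrowth_riemannZeta₁,
    eventually_sum_zeros_riemannZeta₁_le, eventually_ge_atTop (100000 : ℝ)]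
    with L hEF hgr hZs hL ℓ hℓ hℓ'
  have hL0 : 0 < L := by linarith
  have hinv : 1 / L ≤ 0.00001 := by rw [div_le_iff₀ hL0]; linarith
  have hinv0 : 0 < 1 / L := by positivity
  have hline : ∀ t : ℝ, ((1 + 1 / L : ℝ) + t * I : ℂ).re = 1 + 1 / L := by intro t; simp
  have hsub : ∀ t : ℝ, 1 / L ≤ ‖((1 + 1 / L : ℝ) + t * I : ℂ) - 1‖ := by
    intro t
    refine le_trans (le_of_eq ?_) (re_le_norm _)
    rw [sub_re, hline, one_re]; ring
  have hne : ∀ t : ℝ, ((1 + 1 / L : ℝ) + t * I : ℂ) - 1 ≠ 0 := fun t =>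
    norm_pos_iff.mp (hinv0.trans_le (hsub t))
  have hb1 : ∀ t : ℝ, ‖1 / (((1 + 1 / L : ℝ) + t * I : ℂ) - 1)‖ ≤ L := by
    intro t
    rw [norm_div, norm_one, div_le_comm₀ (hinv0.trans_le (hsub t)) hL0]
    exact hsub t
  have hb2 : ∀ t : ℝ, ‖logDeriv riemannZeta₁ ((1 + 1 / L : ℝ) + t * I)‖ ≤ 4 * L := by
    intro t
    rw [logDeriv_riemannZeta₁ (by rw [hline]; linarith)]
    have := norm_logDeriv_riemannZeta_le hinv0 (hline t)
    rw [one_div_one_div] at this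
    refine (norm_add_le _ _).trans ?_
    linarith [hb1 t]
  have hcl : Continuous fun t : ℝ => ((1 + 1 / L : ℝ) + t * I : ℂ) := by fun_prop
  have hi1 : MeasureTheory.Integrable fun t : ℝ => 1 / (((1 + 1 / L : ℝ) + t * I : ℂ) - 1) *
      gaussWeight (1 / L) ℓ ((1 + 1 / L : ℝ) + t * I) :=
    (integrable_gaussWeight_line hinv0 ℓ _).bdd_mul
      (continuous_const.div (hcl.sub continuous_const) hne).aestronglyMeasurable
      (Eventually.of_forall hb1)
  have hi2 : MeasureTheory.Integrable fun t : ℝ => logDeriv riemannZeta₁ ((1 + 1 / L : ℝ) + t * I) *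
      gaussWeight (1 / L) ℓ ((1 + 1 / L : ℝ) + t * I) := by
    refine (integrable_gaussWeight_line hinv0 ℓ _).bdd_mul (Continuous.aestronglyMeasurable ?_)
      (Eventually.of_forall hb2)
    refine Continuous.div ?_ (differentiable_riemannZeta₁.continuous.comp hcl)
      fun t => riemannZeta₁_ne_zero (by rw [hline]; linarith)
    exact (differentiable_riemannZeta₁.contDiff (n := 1)).continuous_deriv_one.comp hcl
  have hS := hasSum_mul_bump (a := fun n : ℕ => ((vonMangoldt n : ℝ) : ℂ)) (by simp)
    (c := 1 + 1 / L) hL0 ℓ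
    (summable_term_vonMangoldt_one (by rw [ofReal_re]; linarith)).norm
  have hsplit : ∫ t : ℝ, LSeries (fun n : ℕ => ((vonMangoldt n : ℝ) : ℂ)) ((1 + 1 / L : ℝ) + t * I) *
      gaussWeight (1 / L) ℓ ((1 + 1 / L : ℝ) + t * I)
      = (∫ t : ℝ, 1 / (((1 + 1 / L : ℝ) + t * I : ℂ) - 1) *
          gaussWeight (1 / L) ℓ ((1 + 1 / L : ℝ) + t * I))
        - ∫ t : ℝ, logDeriv riemannZeta₁ ((1 + 1 / L : ℝ) + t * I) *
          gaussWeight (1 / L) ℓ ((1 + 1 / L : ℝ) + t * I) := by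
    rw [← MeasureTheory.integral_sub hi1 hi2]
    congr 1
    funext t
    have h1 : 1 < ((1 + 1 / L : ℝ) + t * I : ℂ).re := by rw [hline]; linarith
    rw [logDeriv_riemannZeta₁ h1, logDeriv_riemannZeta_eq h1]
    ring
  obtain ⟨Z, hZ⟩ := exists_zeros_box differentiable_riemannZeta₁
    (fun s hs => riemannZeta₁_ne_zero hs) (L ^ 2 + 1)
  have he := hEF riemannZeta₁ differentiable_riemannZeta₁ hgr (fun s hs => riemannZeta₁_ne_zero hs)
    hb2 Z hZ ℓ hℓ hℓ'
  have hz := hZs Z fun ρ hρ => (hZ ρ).mp hρ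
  rw [hsplit, integral_gaussWeight_div hinv0 ℓ (by rw [one_re]; linarith)] at hS
  set J := ∫ v : ℝ in Set.Ioi 0, Real.exp v * Real.exp (-(ℓ - v) ^ 2 / (2 * (1 / L) ^ 2)) with hJ
  have hJc : ∫ v : ℝ in Set.Ioi 0, cexp (1 * v) *
      ((Real.exp (-(ℓ - v) ^ 2 / (2 * (1 / L) ^ 2)) : ℝ) : ℂ) = (J : ℂ) := by
    rw [hJ, ← integral_complex_ofReal]
    congr 1
    funext v
    push_cast
    rw [one_mul]
  rw [hJc] at hS
  set E := ∫ t : ℝ, logDeriv riemannZeta₁ ((1 + 1 / L : ℝ) + t * I) *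
    gaussWeight (1 / L) ℓ ((1 + 1 / L : ℝ) + t * I)
  have hre := (hasSum_re hS).tsum_eq
  simp only [← ofReal_mul, ofReal_re, re_ofReal_mul, sub_re] at hre
  rw [hre]
  have hEre : E.re ≤ 2 * π * Real.exp ℓ * 0.0002 := by
    refine ((re_le_norm _).trans he).trans ?_
    refine mul_le_mul_of_nonneg_left ?_ (by positivity)
    have h8 : Real.exp (-8 * L) ≤ 0.00001 := by
      rw [neg_mul, Real.exp_neg, inv_le_comm₀ (Real.exp_pos _) (by norm_num)]
      have := Real.add_one_le_exp (8 * L)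
      norm_num
      linarith
    refine (add_le_add (mul_le_mul (add_le_add le_rfl hinv) hz ?_ (by norm_num)) h8).trans
      (by norm_num)
    exact sum_nonneg fun ρ _ => by positivity
  have hJl := le_integral_Ioi_exp_mul_gaussian (ℓ := ℓ) hL0
  rw [← hJ] at hJl
  have hpi : √(2 * π) * √(2 * π) = 2 * π := Real.mul_self_sqrt (by positivity)
  have hpi0 : 1 ≤ √(2 * π) := by
    rw [Real.one_le_sqrt]; linarith [Real.pi_gt_three]
  have hone : 1 ≤ 0.0001 * (√(2 * π) / L * Real.exp ℓ) := by
    have h1 : L * L ≤ Real.exp ℓ := by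
      calc L * L ≤ Real.exp L * Real.exp L := by
            gcongr <;> linarith [Real.add_one_le_exp L]
        _ = Real.exp (L + L) := (Real.exp_add _ _).symm
        _ ≤ _ := Real.exp_le_exp.mpr (by norm_num at hℓ; linarith)
    have h2 : L ≤ √(2 * π) / L * Real.exp ℓ := by
      rw [div_mul_eq_mul_div, le_div_iff₀ hL0]
      exact h1.trans (le_mul_of_one_le_left (Real.exp_pos _).le hpi0)
    linarith
  rw [← hpi] at hEre
  generalize √(2 * π) = r at *
  have e1 : 1 / (L * r) * (r / (1 / L) * J - E.re) = J - E.re / (L * r) := by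
    field_simp
  have e2 : E.re / (L * r) ≤ 0.0002 * (r / L * Real.exp ℓ) := by
    rw [div_le_iff₀ (by positivity)]
    refine hEre.trans (le_of_eq ?_)
    field_simp
  rw [e1]
  linarith

lemma bump_le_one (L ℓ : ℝ) (n : ℕ) : bump L ℓ n ≤ 1 := by
  rw [bump, Real.exp_le_one_iff, neg_mul]
  exact neg_nonpos.mpr (by positivity)

lemma bump_le_of_lt {L ℓ : ℝ} (hL : 2 ≤ L) (hℓ : ℓ ≤ 160 * L - 4 / √L) {n : ℕ}
    (hn : 160 * L < Real.log n) :
    bump L ℓ n ≤ Real.exp (-4 * L + ℓ + 160) * (n : ℝ) ^ (-(1 + 1 / L)) := by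
  have hL0 : 0 < L := by linarith
  have hs0 : 0 < √L := Real.sqrt_pos.mpr hL0
  have hss : √L * √L = L := Real.mul_self_sqrt hL0.le
  have hn0 : (0 : ℝ) < n := by
    rcases Nat.eq_zero_or_pos n with rfl | h
    · simp at hn; linarith
    · exact_mod_cast h
  rw [bump, Real.rpow_def_of_pos hn0, ← Real.exp_add, Real.exp_le_exp]
  set u := Real.log n - ℓ with hu
  have hu4 : 4 / √L ≤ u := by linarith
  have hu0 : 0 < u := lt_of_lt_of_le (by positivity) hu4
  have hw : 4 ≤ √L * u := by rw [div_le_iff₀ hs0] at hu4; linarith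
  have h1 : 16 ≤ L * u ^ 2 := by
    calc (16 : ℝ) ≤ (√L * u) * (√L * u) := by nlinarith
      _ = (√L * √L) * u ^ 2 := by ring
      _ = L * u ^ 2 := by rw [hss]
  have h3 : 8 * u ≤ L ^ 2 * u ^ 2 := by
    have hs1 : 1 ≤ √L := Real.one_le_sqrt.mpr (by linarith)
    calc 8 * u = 2 * 1 * 4 * u := by ring
      _ ≤ L * √L * (√L * u) * u := by gcongr
      _ = L * (√L * √L) * u ^ 2 := by ring
      _ = _ := by rw [hss]; ring
  have h4 : 16 * L ≤ L ^ 2 * u ^ 2 := by nlinarith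
  have hlog : Real.log n = u + ℓ := by rw [hu]; ring
  have h5 : 1 / L * (u + ℓ) ≤ u + 160 := by
    have : 1 / L * ℓ ≤ 160 := by
      rw [one_div_mul_eq_div, div_le_iff₀ hL0]
      have : 0 < 4 / √L := by positivity
      linarith
    have : 1 / L * u ≤ u := mul_le_of_le_one_left hu0.le ((div_le_one hL0).mpr (by linarith))
    linarith
  have h6 : Real.log n * -(1 + 1 / L) = -(u + ℓ) - 1 / L * (u + ℓ) := by rw [hlog]; ring
  rw [h6]
  linarith

lemma tsum_le_sum_range_add {L ℓ : ℝ} (hL : 2 ≤ L) (hℓ : ℓ ≤ 160 * L - 4 / √L) {g : ℕ → ℝ}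
    (hg0 : ∀ n, 0 ≤ g n) (hg : ∀ n, g n ≤ vonMangoldt n * bump L ℓ n) :
    ∑' n, g n ≤ ∑ n ∈ range (⌊Real.exp (160 * L)⌋₊ + 1), g n
      + Real.exp (-4 * L + ℓ + 160) * (L + 8) := by
  have hL0 : 0 < L := by linarith
  have hs := Summable.of_nonneg_of_le hg0 hg (summable_vonMangoldt_mul_bump hL0 ℓ)
  have hm := (summable_vonMangoldt_rpow (δ := 1 / L) (by positivity)).hasSum
  have hm' := tsum_vonMangoldt_rpow_le (δ := 1 / L) (X := 0) (by positivity) le_rfl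
    (fun _ => True) fun n _ => by
      rcases Nat.lt_or_ge n 2 with h | h
      · left; interval_cases n <;> simp
      · right; exact Real.log_pos (by exact_mod_cast h)
  simp only [if_true, mul_zero, Real.exp_zero, one_mul, one_div_one_div] at hm'
  set R := range (⌊Real.exp (160 * L)⌋₊ + 1) with hR
  have h1 : HasSum (fun n => if n ∈ R then g n else 0) (∑ n ∈ R, g n) := by
    rw [← sum_congr rfl fun n hn => if_pos hn]
    exact hasSum_sum_of_ne_finset_zero fun n hn => if_neg hn
  refine (hasSum_le (fun n => ?_) hs.hasSum
    (h1.add (hm.mul_left (Real.exp (-4 * L + ℓ + 160))))).trans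
    (add_le_add le_rfl (mul_le_mul_of_nonneg_left hm' (Real.exp_pos _).le))
  have hpos : 0 ≤ vonMangoldt n * (n : ℝ) ^ (-(1 + 1 / L)) :=
    mul_nonneg vonMangoldt_nonneg (Real.rpow_nonneg (Nat.cast_nonneg n) _)
  by_cases hn : n ∈ R
  · rw [if_pos hn]
    exact le_add_of_nonneg_right (mul_nonneg (Real.exp_pos _).le hpos)
  · rw [if_neg hn, zero_add]
    rw [hR, mem_range, not_lt, Nat.add_one_le_iff, Nat.floor_lt (Real.exp_pos _).le] at hn
    have := bump_le_of_lt hL hℓ ((Real.lt_log_iff_exp_lt ((Real.exp_pos _).trans hn)).mpr hn)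
    calc g n ≤ vonMangoldt n * bump L ℓ n := hg n
      _ ≤ vonMangoldt n * (Real.exp (-4 * L + ℓ + 160) * (n : ℝ) ^ (-(1 + 1 / L))) :=
        mul_le_mul_of_nonneg_left this vonMangoldt_nonneg
      _ = _ := by ring

lemma sum_range_not_prime_le {L : ℝ} (hL : 0 ≤ L) :
    ∑ n ∈ range (⌊Real.exp (160 * L)⌋₊ + 1), (if n.Prime then 0 else vonMangoldt n)
      ≤ 320 * L * Real.exp (80 * L) := by
  have h := Chebyshev.psi_sub_theta_le (x := Real.exp (160 * L)) (Real.one_le_exp (by positivity))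
  rw [Chebyshev.psi_sub_theta_eq_sum_not_prime, Real.log_exp, ← Real.exp_half,
    sum_filter] at h
  calc _ = ∑ n ∈ Ioc 0 ⌊Real.exp (160 * L)⌋₊, (if ¬n.Prime then vonMangoldt n else 0) := by
        simp only [ite_not]
        refine (sum_subset (fun n hn => ?_) fun n hn hn' => ?_).symm
        · rw [mem_Ioc] at hn; rw [mem_range]; lia
        · rw [mem_Ioc] at hn'; rw [mem_range] at hn
          rw [show n = 0 by lia]; simp
    _ ≤ _ := h
    _ = _ := by rw [show 160 * L / 2 = 80 * L by ring]; ring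

lemma sum_range_not_coprime_le {L ℓ : ℝ} (hL : 0 ≤ L) {q : ℕ} (hq : q ≠ 0) :
    ∑ n ∈ range (⌊Real.exp (160 * L)⌋₊ + 1),
        (if n.Coprime q then 0 else vonMangoldt n * bump L ℓ n)
      ≤ 320 * L * Real.exp (80 * L) + Real.log q := by
  classical
  have h2 : ∑ n ∈ range (⌊Real.exp (160 * L)⌋₊ + 1), (if n ∈ q.divisors then vonMangoldt n else 0)
      ≤ Real.log q := by
    rw [← vonMangoldt_sum, ← sum_filter, filter_mem_eq_inter]
    exact sum_le_sum_of_subset_of_nonneg inter_subset_right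
      fun _ _ _ => vonMangoldt_nonneg
  refine le_trans ?_ (add_le_add (sum_range_not_prime_le hL) h2)
  rw [← sum_add_distrib]
  refine sum_le_sum fun n _ => ?_
  have h0 : 0 ≤ vonMangoldt n := vonMangoldt_nonneg
  have hb : vonMangoldt n * bump L ℓ n ≤ vonMangoldt n := mul_le_of_le_one_right h0 (bump_le_one _ _ _)
  by_cases hc : n.Coprime q
  · rw [if_pos hc]; split_ifs <;> positivity
  · rw [if_neg hc]
    by_cases hp : n.Prime
    · have hd : n ∈ q.divisors := Nat.mem_divisors.mpr
        ⟨by by_contra h; exact hc ((Nat.Prime.coprime_iff_not_dvd hp).mpr h), hq⟩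
      rw [if_pos hp, if_pos hd]; linarith
    · rw [if_neg hp]; split_ifs <;> linarith

lemma le_totient_mul_tsum {L ℓ : ℝ} (hL : 0 < L) {q : ℕ} [NeZero q] {a : ZMod q} (ha : IsUnit a) :
    (∑' n : ℕ, if n.Coprime q then vonMangoldt n * bump L ℓ n else 0)
      - ∑ χ ∈ (univ : Finset (DirichletCharacter ℂ q)).erase 1,
        ‖∑' n : ℕ, χ n * (vonMangoldt n : ℂ) * (bump L ℓ n : ℂ)‖
      ≤ q.totient * ∑' n : ℕ, if (n : ZMod q) = a then vonMangoldt n * bump L ℓ n else 0 := by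
  have hs := summable_vonMangoldt_mul_bump hL ℓ
  have hsum : ∀ χ : DirichletCharacter ℂ q,
      Summable fun n : ℕ => χ n * (vonMangoldt n : ℂ) * (bump L ℓ n : ℂ) := by
    intro χ
    refine Summable.of_norm_bounded hs fun n => ?_
    rw [mul_assoc, norm_mul, ← ofReal_mul, norm_real, Real.norm_of_nonneg
      (mul_nonneg vonMangoldt_nonneg (bump_pos _ _ _).le)]
    exact mul_le_of_le_one_left (mul_nonneg vonMangoldt_nonneg (bump_pos _ _ _).le)
      (χ.norm_le_one _)
  have h1 := hasSum_sum (s := univ) fun (χ : DirichletCharacter ℂ q) _ =>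
    (hsum χ).hasSum.mul_left (χ a⁻¹)
  have e1 : ∀ n : ℕ, ∑ χ : DirichletCharacter ℂ q,
      χ a⁻¹ * (χ n * (vonMangoldt n : ℂ) * (bump L ℓ n : ℂ))
      = (((q.totient : ℝ) * if (n : ZMod q) = a then vonMangoldt n * bump L ℓ n else 0 : ℝ) : ℂ) := by
    intro n
    simp only [← mul_assoc, ← sum_mul]
    rw [DirichletCharacter.sum_char_inv_mul_char_eq ℂ ha (n : ZMod q)]
    by_cases h : a = (n : ZMod q)
    · rw [if_pos h, if_pos h.symm]; push_cast; ring
    · rw [if_neg h, if_neg (Ne.symm h)]; simp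
  simp only [e1] at h1
  have h2 := (hasSum_re h1).tsum_eq
  simp only [ofReal_re] at h2
  rw [tsum_mul_left] at h2
  rw [h2, ← add_sum_erase univ _ (mem_univ (1 : DirichletCharacter ℂ q)),
    add_re]
  have h3 : ((1 : DirichletCharacter ℂ q) a⁻¹ *
      ∑' n : ℕ, (1 : DirichletCharacter ℂ q) n * (vonMangoldt n : ℂ) * (bump L ℓ n : ℂ)).re
      = ∑' n : ℕ, if n.Coprime q then vonMangoldt n * bump L ℓ n else 0 := by
    have hu : IsUnit a⁻¹ := by
      rw [isUnit_iff_exists_inv]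
      exact ⟨a, ZMod.inv_mul_of_unit a ha⟩
    rw [MulChar.one_apply hu, one_mul, re_tsum (hsum 1)]
    congr 1
    funext n
    by_cases h : n.Coprime q
    · rw [if_pos h, MulChar.one_apply ((ZMod.isUnit_iff_coprime n q).mpr h), one_mul,
        ← ofReal_mul, ofReal_re]
    · rw [if_neg h, MulChar.map_nonunit _ (mt (ZMod.isUnit_iff_coprime n q).mp h)]; simp
  rw [h3, sub_eq_add_neg]
  refine add_le_add le_rfl (neg_le.mp ?_)
  refine ((neg_le_abs _).trans (abs_re_le_norm _)).trans ((norm_sum_le _ _).trans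
    (sum_le_sum fun χ _ => ?_))
  rw [norm_mul]
  exact mul_le_of_le_one_left (norm_nonneg _) (χ.norm_le_one _)

lemma eventually_le_sum_prime_log_mul_bump :
    ∀ᶠ L : ℝ in atTop, ∀ (q : ℕ) [NeZero q], (q : ℝ) ≤ Real.exp L →
      (∀ χ : DirichletCharacter ℂ q, χ ≠ 1 → ∀ ρ : ℂ, χ.LFunction ρ = 0 →
        |ρ.im| ≤ L ^ 2 + 1 → ρ.re ≤ 1 - 0.0416 / L) →
      ∀ a : ℕ, a.Coprime q → ∀ ℓ : ℝ, 159.9 * L ≤ ℓ → ℓ ≤ 160 * L - 4 / √L →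
        0.865 * (√(2 * π) / L * Real.exp ℓ) ≤ q.totient *
          ∑ p ∈ (range (⌊Real.exp (160 * L)⌋₊ + 1)).filter (fun p => p.Prime ∧ p % q = a % q),
            Real.log p * bump L ℓ p := by
  filter_upwards [eventually_sum_norm_charSum_le, eventually_le_tsum_vonMangoldt_mul_bump,
    eventually_pow_mul_le_exp 2 (C := 10000 * (321 + 4 * Real.exp 160)) (c := 3) (by norm_num),
    eventually_ge_atTop (8 : ℝ)] with L hchar hzeta hexp hL q _ hq hzf a ha ℓ hℓ hℓ'
  have hL0 : 0 < L := by linarith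
  have hℓ2 : ℓ ≤ 160 * L := by
    have : 0 < 4 / √L := by positivity
    linarith
  have hc := hchar q hq hzf ℓ hℓ hℓ2
  have hz := hzeta ℓ hℓ hℓ2
  have hu : IsUnit (a : ZMod q) := (ZMod.isUnit_iff_coprime a q).mpr ha
  have hm := le_totient_mul_tsum (ℓ := ℓ) hL0 hu
  have hf0 : ∀ n : ℕ, 0 ≤ vonMangoldt n * bump L ℓ n := fun n =>
    mul_nonneg vonMangoldt_nonneg (bump_pos _ _ _).le
  have hs := summable_vonMangoldt_mul_bump hL0 ℓ
  set R := range (⌊Real.exp (160 * L)⌋₊ + 1)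
  set K := Real.exp (-4 * L + ℓ + 160) * (L + 8) with hK
  set A := √(2 * π) / L * Real.exp ℓ with hA
  set P := ∑ p ∈ R.filter (fun p => p.Prime ∧ p % q = a % q), Real.log p * bump L ℓ p with hP
  set B := 320 * L * Real.exp (80 * L) with hB
  have hnc : (∑' n : ℕ, vonMangoldt n * bump L ℓ n)
      ≤ (∑' n : ℕ, if n.Coprime q then vonMangoldt n * bump L ℓ n else 0) + (B + L + K) := by
    have h1 := tsum_le_sum_range_add (L := L) (ℓ := ℓ)
      (g := fun n => if n.Coprime q then 0 else vonMangoldt n * bump L ℓ n) (by linarith) hℓ'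
      (fun n => by split_ifs <;> simp [hf0]) (fun n => by split_ifs <;> simp [hf0])
    have h2 := sum_range_not_coprime_le (L := L) (ℓ := ℓ) hL0.le (NeZero.ne q)
    have h3 : Real.log q ≤ L := by
      rw [Real.log_le_iff_le_exp (by exact_mod_cast NeZero.pos q)]; exact hq
    have h4 : (∑' n : ℕ, vonMangoldt n * bump L ℓ n)
        = (∑' n : ℕ, if n.Coprime q then vonMangoldt n * bump L ℓ n else 0)
          + ∑' n : ℕ, if n.Coprime q then 0 else vonMangoldt n * bump L ℓ n := by
      rw [← Summable.tsum_add]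
      · congr 1; funext n; split_ifs <;> simp
      · exact Summable.of_nonneg_of_le (fun n => by split_ifs <;> simp [hf0])
          (fun n => by split_ifs <;> simp [hf0]) hs
      · exact Summable.of_nonneg_of_le (fun n => by split_ifs <;> simp [hf0])
          (fun n => by split_ifs <;> simp [hf0]) hs
    linarith
  have hN : (∑' n : ℕ, if (n : ZMod q) = (a : ZMod q) then vonMangoldt n * bump L ℓ n else 0)
      ≤ P + (B + K) := by
    have h1 := tsum_le_sum_range_add (L := L) (ℓ := ℓ)
      (g := fun n => if (n : ZMod q) = (a : ZMod q) then vonMangoldt n * bump L ℓ n else 0)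
      (by linarith) hℓ' (fun n => by split_ifs <;> simp [hf0])
      (fun n => by split_ifs <;> simp [hf0])
    have h2 : ∑ n ∈ R, (if (n : ZMod q) = (a : ZMod q) then vonMangoldt n * bump L ℓ n else 0)
        ≤ P + B := by
      refine le_trans ?_ (add_le_add le_rfl (sum_range_not_prime_le hL0.le))
      rw [hP, sum_filter, ← sum_add_distrib]
      refine sum_le_sum fun n _ => ?_
      simp only [ZMod.natCast_eq_natCast_iff']
      by_cases hp : n.Prime
      · simp [hp, vonMangoldt_apply_prime hp]
      · simp only [hp, false_and, if_false, zero_add]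
        split_ifs
        · exact mul_le_of_le_one_right vonMangoldt_nonneg (bump_le_one _ _ _)
        · exact vonMangoldt_nonneg
    linarith
  have hphi : (q.totient : ℝ) ≤ Real.exp L := le_trans (by exact_mod_cast Nat.totient_le q) hq
  have hK0 : 0 ≤ K := by positivity
  have hE : 2 * (Real.exp L * (B + L + K)) ≤ 0.0002 * A := by
    have hb : B + L ≤ 321 * L * Real.exp (ℓ - 4 * L) := by
      have h80 : Real.exp (80 * L) ≤ Real.exp (ℓ - 4 * L) :=
        Real.exp_le_exp.mpr (by norm_num at hℓ; linarith)
      have : 1 ≤ Real.exp (ℓ - 4 * L) := (Real.one_le_exp (by positivity)).trans h80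
      calc B + L ≤ 320 * L * Real.exp (ℓ - 4 * L) + L * Real.exp (ℓ - 4 * L) := by
            rw [hB]; gcongr; exact le_mul_of_one_le_right hL0.le this
        _ = _ := by ring
    have hk : K ≤ 2 * Real.exp 160 * L * Real.exp (ℓ - 4 * L) := by
      rw [hK, show -4 * L + ℓ + 160 = 160 + (ℓ - 4 * L) by ring, Real.exp_add]
      calc _ ≤ Real.exp 160 * Real.exp (ℓ - 4 * L) * (2 * L) := by gcongr; linarith
        _ = _ := by ring
    have hr : 1 ≤ √(2 * π) := by
      rw [Real.one_le_sqrt]; linarith [Real.pi_gt_three]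
    have hAl : 1 / L * Real.exp ℓ ≤ A := by rw [hA]; gcongr
    have hx : Real.exp L * Real.exp (ℓ - 4 * L) * Real.exp (3 * L) = Real.exp ℓ := by
      rw [← Real.exp_add, ← Real.exp_add]; congr 1; ring
    calc 2 * (Real.exp L * (B + L + K))
        ≤ 2 * (Real.exp L * ((321 + 4 * Real.exp 160) * L * Real.exp (ℓ - 4 * L))) := by
          gcongr
          have : 0 ≤ Real.exp 160 * L * Real.exp (ℓ - 4 * L) := by positivity
          linarith
      _ = 0.0002 * (1 / L * (Real.exp L * Real.exp (ℓ - 4 * L) *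
            (10000 * (321 + 4 * Real.exp 160) * L ^ 2))) := by
          generalize Real.exp 160 = b
          field_simp
          ring
      _ ≤ 0.0002 * (1 / L * (Real.exp L * Real.exp (ℓ - 4 * L) * Real.exp (3 * L))) := by gcongr
      _ ≤ 0.0002 * A := by rw [hx]; gcongr
  have hphi0 : (0 : ℝ) ≤ q.totient := Nat.cast_nonneg _
  have h1 := mul_le_mul_of_nonneg_left hN hphi0
  have h2 : (q.totient : ℝ) * (B + K) ≤ Real.exp L * (B + L + K) :=
    mul_le_mul hphi (by linarith) (by positivity) (Real.exp_pos _).le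
  have h3 : B + L + K ≤ Real.exp L * (B + L + K) :=
    le_mul_of_one_le_left (by positivity) (Real.one_le_exp hL0.le)
  rw [mul_add] at h1
  generalize (∑' n : ℕ, vonMangoldt n * bump L ℓ n) = z at *
  generalize (∑' n : ℕ, if n.Coprime q then vonMangoldt n * bump L ℓ n else 0) = c at *
  generalize (∑' n : ℕ, if (n : ZMod q) = (a : ZMod q) then vonMangoldt n * bump L ℓ n else 0) = N
    at *
  generalize Real.exp L * (B + L + K) = D at *
  have hm := hm.trans h1
  replace hm := (sub_le_sub_left hc c).trans hm
  clear hchar hzeta hc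
  norm_num at hE hm hz ⊢
  linarith

lemma intervalIntegral_bump_le {L : ℝ} (hL : 0 < L) {u v : ℝ} (huv : u ≤ v) (n : ℕ) :
    ∫ ℓ in u..v, bump L ℓ n ≤ √(2 * π) / L := by
  have hi : MeasureTheory.Integrable fun ℓ : ℝ => bump L ℓ n := by
    have := (integrable_exp_neg_mul_sq (b := L ^ 2 / 2) (by positivity)).comp_sub_left (Real.log n)
    exact this
  rw [intervalIntegral.integral_of_le huv]
  refine (MeasureTheory.setIntegral_le_integral hi
    (Eventually.of_forall fun ℓ => (bump_pos L ℓ n).le)).trans (le_of_eq ?_)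
  unfold bump
  rw [MeasureTheory.integral_sub_left_eq_self (fun y : ℝ => Real.exp (-(L ^ 2 / 2) * y ^ 2)),
    integral_gaussian, show π / (L ^ 2 / 2) = 2 * π / L ^ 2 by field_simp,
    Real.sqrt_div (by positivity), Real.sqrt_sq hL.le]

lemma eventually_le_sum_prime_log :
    ∀ᶠ L : ℝ in atTop, ∀ (q : ℕ) [NeZero q], (q : ℝ) ≤ Real.exp L →
      (∀ χ : DirichletCharacter ℂ q, χ ≠ 1 → ∀ ρ : ℂ, χ.LFunction ρ = 0 →
        |ρ.im| ≤ L ^ 2 + 1 → ρ.re ≤ 1 - 0.0416 / L) →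
      ∀ a : ℕ, a.Coprime q → (1 - Real.exp (-2)) * Real.exp (160 * L) ≤ q.totient *
          ∑ p ∈ (range (⌊Real.exp (160 * L)⌋₊ + 1)).filter (fun p => p.Prime ∧ p % q = a % q),
            Real.log p := by
  filter_upwards [eventually_le_sum_prime_log_mul_bump, eventually_log_le_mul (c := 0.1)
    (by norm_num), eventually_ge_atTop (10000000000 : ℝ)] with L h hlog hL q _ hq hzf a ha
  have hL0 : 0 < L := by linarith
  have hsq : 100000 ≤ √L := Real.le_sqrt_of_sq_le (by norm_num; exact hL)
  have h4 : 4 / √L ≤ 0.00004 := by rw [div_le_iff₀ (by linarith)]; norm_num; linarith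
  have hlogL : 1 ≤ Real.log L := by
    rw [Real.le_log_iff_exp_le hL0]
    linarith [Real.exp_one_lt_d9]
  set S := (range (⌊Real.exp (160 * L)⌋₊ + 1)).filter (fun p => p.Prime ∧ p % q = a % q)
  set u := 160 * L - Real.log L with hu
  set v := 160 * L - 4 / √L with hv
  have huv : u ≤ v := by norm_num at h4; linarith
  have hcb : ∀ n : ℕ, Continuous fun ℓ : ℝ => bump L ℓ n := by
    intro n; unfold bump; fun_prop
  have hr : 0 < √(2 * π) / L := by positivity
  have hint : ∫ ℓ in u..v, 0.865 * (√(2 * π) / L * Real.exp ℓ)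
      ≤ ∫ ℓ in u..v, q.totient * ∑ p ∈ S, Real.log p * bump L ℓ p := by
    refine intervalIntegral.integral_mono_on huv (Continuous.intervalIntegrable (by fun_prop) _ _)
      (Continuous.intervalIntegrable (by fun_prop) _ _) fun ℓ hℓ => ?_
    refine h q hq hzf a ha ℓ ?_ hℓ.2
    have := hℓ.1
    norm_num at hlog ⊢
    linarith
  rw [intervalIntegral.integral_const_mul, intervalIntegral.integral_const_mul, integral_exp,
    intervalIntegral.integral_const_mul, intervalIntegral.integral_finsetSum
    (fun p _ => Continuous.intervalIntegrable (by fun_prop) _ _)] at hint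
  simp only [intervalIntegral.integral_const_mul] at hint
  have hup : ∑ p ∈ S, Real.log p * ∫ ℓ in u..v, bump L ℓ p
      ≤ (∑ p ∈ S, Real.log p) * (√(2 * π) / L) := by
    rw [sum_mul]
    exact sum_le_sum fun p _ => mul_le_mul_of_nonneg_left
      (intervalIntegral_bump_le hL0 huv p) (Real.log_natCast_nonneg p)
  have h5 := hint.trans (mul_le_mul_of_nonneg_left hup (Nat.cast_nonneg q.totient))
  have h6 : 0.865 * (Real.exp v - Real.exp u) ≤ q.totient * ∑ p ∈ S, Real.log p := by
    refine le_of_mul_le_mul_right (le_trans (le_of_eq ?_) (h5.trans (le_of_eq ?_))) hr <;> ring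
  refine le_trans ?_ h6
  have hev : 0.99996 * Real.exp (160 * L) ≤ Real.exp v := by
    rw [hv, sub_eq_add_neg, Real.exp_add, mul_comm]
    gcongr
    have := Real.add_one_le_exp (-(4 / √L))
    norm_num at h4 ⊢
    linarith
  have heu : Real.exp u ≤ 0.00001 * Real.exp (160 * L) := by
    rw [hu, Real.exp_sub, Real.exp_log hL0, div_le_iff₀ hL0]
    have := Real.exp_pos (160 * L)
    norm_num
    nlinarith
  have he2 : 0.1353 ≤ Real.exp (-2) := by
    have h1 : Real.exp 2 ≤ 1 / 0.1353 := by
      have e : Real.exp 2 = Real.exp 1 * Real.exp 1 := by rw [← Real.exp_add]; norm_num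
      rw [e]
      refine (mul_le_mul Real.exp_one_lt_d9.le Real.exp_one_lt_d9.le (Real.exp_pos _).le
        (by norm_num)).trans (by norm_num)
    rw [Real.exp_neg, le_inv_comm₀ (by norm_num) (Real.exp_pos _)]
    norm_num at h1 ⊢
    linarith
  have := Real.exp_pos (160 * L)
  calc (1 - Real.exp (-2)) * Real.exp (160 * L) ≤ 0.8647 * Real.exp (160 * L) := by
        gcongr; norm_num at he2 ⊢; linarith
    _ ≤ _ := by norm_num at hev heu ⊢; linarith

theorem exists_primes_AP_lower_bound : ∃ x₀ : ℝ, 1 < x₀ ∧ ∀ (q : ℕ) [NeZero q],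
      (∀ χ : DirichletCharacter ℂ q, ∀ s : ℂ, DirichletCharacter.LFunction χ s = 0 →
          ¬(1 - s.re < 1 / (24 * Real.log ((q : ℝ) * (1 + |s.im|))))) →
      ∀ a : ℕ, Nat.Coprime a q → ∀ x : ℝ, x₀ ≤ x → (q : ℝ) ^ (160 : ℕ) ≤ x →
        (1 - Real.exp (-2)) * x / ((q.totient : ℝ) * Real.log x)
          ≤ (({p : ℕ | Nat.Prime p ∧ (p : ℝ) ≤ x ∧ p % q = a % q}.ncard : ℝ)) := by
  obtain ⟨L₀, hL₀⟩ := eventually_atTop.mp (eventually_le_sum_prime_log.and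
    ((eventually_log_le_mul (c := 0.0003) (by norm_num)).and (eventually_ge_atTop (2 : ℝ))))
  refine ⟨Real.exp (160 * max L₀ 1), Real.one_lt_exp_iff.mpr (by positivity),
    fun q _ hzf a ha x hx hqx => ?_⟩
  have hx0 : 0 < x := (Real.exp_pos _).trans_le hx
  obtain ⟨L, hLx⟩ : ∃ L, 160 * L = Real.log x := ⟨Real.log x / 160, by ring⟩
  have hLm : max L₀ 1 ≤ L := by
    have := (Real.le_log_iff_exp_le hx0).mpr hx
    linarith
  obtain ⟨hmain, hlog, hL2⟩ := hL₀ L ((le_max_left _ _).trans hLm)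
  have hL0 : 0 < L := by linarith
  have hq0 : (0 : ℝ) < q := by exact_mod_cast NeZero.pos q
  have hlq : Real.log q ≤ L := by
    have := Real.log_le_log (by positivity) hqx
    rw [Real.log_pow, ← hLx] at this
    push_cast at this
    linarith
  have hexp : Real.exp (160 * L) = x := by rw [hLx, Real.exp_log hx0]
  have h := hmain q ((Real.log_le_iff_le_exp hq0).mp hlq) (fun χ hχ ρ hρ him => by
    have hq2 : 2 ≤ q := by
      by_contra hlt
      have : q = 1 := by have := NeZero.pos q; lia
      subst this
      exact hχ (DirichletCharacter.level_one χ)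
    have h1 := not_lt.mp (hzf χ ρ hρ)
    have h2 : Real.log ((q : ℝ) * (1 + |ρ.im|)) ≤ 1.001 * L := by
      rw [Real.log_mul hq0.ne' (by positivity)]
      have h3 : Real.log (1 + |ρ.im|) ≤ Real.log (L ^ 3) :=
        Real.log_le_log (by positivity) (by nlinarith)
      rw [Real.log_pow] at h3
      push_cast at h3
      norm_num at hlog ⊢
      linarith
    have h4 : 0 < Real.log ((q : ℝ) * (1 + |ρ.im|)) := by
      refine Real.log_pos ?_
      have : (2 : ℝ) ≤ q := by exact_mod_cast hq2
      nlinarith [abs_nonneg ρ.im]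
    have h5 : 0.0416 / L ≤ 1 / (24 * Real.log ((q : ℝ) * (1 + |ρ.im|))) := by
      rw [div_le_div_iff₀ hL0 (by positivity)]
      norm_num at h2 ⊢
      linarith
    linarith) a ha
  rw [hexp] at h
  set S := (range (⌊x⌋₊ + 1)).filter (fun p => p.Prime ∧ p % q = a % q) with hS
  have hset : {p : ℕ | Nat.Prime p ∧ (p : ℝ) ≤ x ∧ p % q = a % q} = (S : Set ℕ) := by
    ext p
    simp only [hS, Set.mem_ofPred_eq, coe_filter, mem_range, Nat.lt_succ_iff,
      Nat.le_floor_iff hx0.le]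
    tauto
  rw [hset, Set.ncard_coe_finset]
  have hlx : 0 < Real.log x := by rw [← hLx]; positivity
  have hphi : (0 : ℝ) < q.totient := by exact_mod_cast Nat.totient_pos.mpr (NeZero.pos q)
  rw [div_le_iff₀ (by positivity)]
  refine h.trans ?_
  have hsum : ∑ p ∈ S, Real.log p ≤ S.card * Real.log x := by
    rw [← nsmul_eq_mul]
    refine sum_le_card_nsmul _ _ _ fun p hp => ?_
    rw [hS, mem_filter, mem_range, Nat.lt_succ_iff, Nat.le_floor_iff hx0.le] at hp
    exact Real.log_le_log (by exact_mod_cast hp.2.1.pos) hp.1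
  calc _ ≤ (q.totient : ℝ) * (S.card * Real.log x) := by gcongr
    _ = _ := by ring

end LinnikAP

open Real

/-- Primes in arithmetic progressions to moduli whose `L`-functions have no zero in the
explicit region: if no `L(s, χ)` for `χ` mod `q` vanishes at a point `s = σ + it` with
`1 − σ < 1/(24·log(q(1+|t|)))`, then for `(a, q) = 1` and `x ≥ q^160` (and `x` large),
the number of primes `p ≤ x` with `p ≡ a (mod q)` is at least
`(1 − e^{−2} − ε)·x/(φ(q)·log x)`. -/
theorem primes_in_AP_no_exceptional_zero :
    ∀ ε : ℝ, 0 < ε → ∃ x₀ : ℝ, ∀ q : ℕ, ∀ hq : 1 ≤ q,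
      haveI : NeZero q := ⟨by omega⟩
      (∀ χ : DirichletCharacter ℂ q, ∀ s : ℂ,
        DirichletCharacter.LFunction χ s = 0 →
          ¬(1 - s.re < 1 / (24 * Real.log ((q : ℝ) * (1 + |s.im|))))) →
      ∀ a : ℕ, Nat.Coprime a q →
      ∀ x : ℝ, x₀ ≤ x → (q : ℝ) ^ (160 : ℕ) ≤ x →
        (1 - Real.exp (-2) - ε) * x / ((q.totient : ℝ) * Real.log x)
          ≤ (({p : ℕ | Nat.Prime p ∧ (p : ℝ) ≤ x ∧ p % q = a % q}.ncard : ℝ)) := by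
  intro ε hε
  obtain ⟨x₀, hx₀, h⟩ := LinnikAP.exists_primes_AP_lower_bound
  refine ⟨x₀, fun q hq => ?_⟩
  have : NeZero q := ⟨by omega⟩
  intro hzf a ha x hx hqx
  refine le_trans ?_ (h q hzf a ha x hx hqx)
  have : 0 ≤ Real.log x := Real.log_nonneg (by linarith)
  have : 0 ≤ x := by linarith
  refine div_le_div_of_nonneg_right (mul_le_mul_of_nonneg_right ?_ this) (by positivity)
  linarith
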